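/- There exists a bounded normalized circle domain Ω ⊆ ℂ such that: (i) Ω is conformally rigid, i.e., every conformal map f from Ω onto a normalized circle domain is the restriction of a Möbius transformation; and (ii) the frontier ∂Ω of Ω in ℂ is not conformally removable, i.e., there exists a homeomorphism h : ℂ → ℂ which is complex-differentiable at every point of ℂ ∖ ∂Ω but is not the restriction of a Möbius transformation. (Rajala's counterexample to the rigidity conjecture of He and Schramm.) -/

import Mathlib

open Set Metric Complex Filter MeasureTheory Topology ENNReal NNReal

noncomputable section

/-- A conformal map from `U` onto `V`: an injective holomorphic function on `U` with image `V`. -/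
def ConformalMapOnto (f : ℂ → ℂ) (U V : Set ℂ) : Prop :=
  DifferentiableOn ℂ f U ∧ Set.InjOn f U ∧ f '' U = V

/-- `f` agrees on `U` with a Möbius transformation. -/
def IsMobiusOn (f : ℂ → ℂ) (U : Set ℂ) : Prop :=
  ∃ a b c d : ℂ, a * d - b * c ≠ 0 ∧ ∀ z ∈ U, c * z + d ≠ 0 ∧ f z = (a * z + b) / (c * z + d)

/-- The copy of a planar set in the Riemann sphere `ℂ̂ = OnePoint ℂ`. -/
def sph (S : Set ℂ) : Set (OnePoint ℂ) := (fun z : ℂ => (z : OnePoint ℂ)) '' S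

/-- A normalized circle domain: a domain in `ℂ` such that every connected component of its
frontier in the Riemann sphere is a single point or a Euclidean circle. -/
def IsNormalizedCircleDomain (D : Set ℂ) : Prop :=
  IsOpen D ∧ IsConnected D ∧
    ∀ x ∈ frontier (sph D),
      connectedComponentIn (frontier (sph D)) x = {x} ∨
        ∃ (c : ℂ) (r : ℝ), 0 < r ∧
          connectedComponentIn (frontier (sph D)) x = sph (Metric.sphere c r)

/-- The radial retraction of the plane onto a closed disc. -/
def discProj (c : ℂ) (R : ℝ) (z : ℂ) : ℂ := c + ((R / max R ‖z - c‖ : ℝ) : ℂ) * (z - c)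

lemma continuous_discProj (c : ℂ) {R : ℝ} (hR : 0 < R) : Continuous (discProj c R) := by
  unfold discProj
  refine continuous_const.add (Continuous.mul (continuous_ofReal.comp ?_) (by fun_prop))
  refine continuous_const.div (by fun_prop) fun z => ?_
  exact (lt_of_lt_of_le hR (le_max_left _ _)).ne'

lemma discProj_mem (c : ℂ) {R : ℝ} (hR : 0 < R) (z : ℂ) : discProj c R z ∈ closedBall c R := by
  have h : 0 < max R ‖z - c‖ := lt_of_lt_of_le hR (le_max_left _ _)
  rw [mem_closedBall, dist_eq_norm, discProj, add_sub_cancel_left, norm_mul, norm_real,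
    Real.norm_of_nonneg (by positivity), div_mul_eq_mul_div, div_le_iff₀ h]
  exact mul_le_mul_of_nonneg_left (le_max_right _ _) hR.le

lemma discProj_eq {c : ℂ} {R : ℝ} (hR : 0 < R) {z : ℂ} (hz : z ∈ closedBall c R) :
    discProj c R z = z := by
  rw [mem_closedBall, dist_eq_norm] at hz
  rw [discProj, max_eq_left hz, div_self hR.ne']; simp

/-- Tietze extension of complex functions. -/
lemma ContinuousOn.exists_tietze {s : Set ℂ} (hs : IsClosed s) {W : ℂ → ℂ}
    (hW : ContinuousOn W s) : ∃ Φ : ℂ → ℂ, Continuous Φ ∧ ∀ z ∈ s, Φ z = W z := by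
  obtain ⟨g, hg⟩ := ContinuousMap.exists_restrict_eq hs
    (⟨s.domRestrict W, continuousOn_iff_continuous_domRestrict.1 hW⟩ : C(s, ℂ))
  exact ⟨g, g.continuous, fun z hz => congrArg (fun F : C(s, ℂ) => F ⟨z, hz⟩) hg⟩

/-- Tietze extension with values in a closed disc. -/
lemma ContinuousOn.exists_tietze_closedBall {s : Set ℂ} (hs : IsClosed s) {W : ℂ → ℂ}
    (hW : ContinuousOn W s) {b : ℂ} {R : ℝ} (hR : 0 < R) (h : ∀ z ∈ s, W z ∈ closedBall b R) :
    ∃ Φ : ℂ → ℂ, Continuous Φ ∧ (∀ z ∈ s, Φ z = W z) ∧ ∀ z, Φ z ∈ closedBall b R := by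
  obtain ⟨Φ, h1, h2⟩ := hW.exists_tietze hs
  refine ⟨fun z => discProj b R (Φ z), (continuous_discProj b hR).comp h1, fun z hz => ?_,
    fun z => discProj_mem b hR _⟩
  simp only [h2 z hz]
  exact discProj_eq hR (h z hz)

/-- The loop `w` has a continuous logarithm that increases by `2πik` over each period. -/
def HasWind (w : ℝ → ℂ) (k : ℤ) : Prop :=
  ∃ L : ℝ → ℂ, Continuous L ∧ (∀ θ, exp (L θ) = w θ) ∧
    ∀ θ, L (θ + 2 * Real.pi) = L θ + k * (2 * Real.pi * I)

/-- The restriction of `W` to the circle of center `c` and radius `r`, as a loop. -/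
def circLoop (W : ℂ → ℂ) (c : ℂ) (r : ℝ) : ℝ → ℂ := fun θ => W (circleMap c r θ)

lemma const_of_exp_eq_one {φ : ℝ → ℂ} (hφ : Continuous φ)
    (h : ∀ θ, exp (φ θ) = 1) : ∃ n : ℤ, ∀ θ, φ θ = n * (2 * Real.pi * I) := by
  have h1 : ∀ θ, ∃ n : ℤ, φ θ = n * (2 * Real.pi * I) := fun θ => Complex.exp_eq_one_iff.1 (h θ)
  choose n hn using h1
  have hc : Continuous fun θ => (n θ : ℝ) := by
    have : (fun θ => (n θ : ℝ)) = fun θ => (φ θ / (2 * Real.pi * I)).re := by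
      funext θ
      rw [hn θ, mul_div_cancel_right₀]
      · simp
      · exact Complex.two_pi_I_ne_zero
    rw [this]; fun_prop
  have hc' : Continuous n := Int.isClosedEmbedding_coe_real.isInducing.continuous_iff.2 hc
  refine ⟨n 0, fun θ => ?_⟩
  have := PreconnectedSpace.constant (inferInstance : PreconnectedSpace ℝ) hc' (x := θ) (y := 0)
  rw [hn θ, this]

lemma exists_log_of_contractible {X : Type*} [TopologicalSpace X] [ContractibleSpace X]
    [LocallyPathConnectedSpace X] {w : X → ℂ} (hw : Continuous w) (h0 : ∀ θ, w θ ≠ 0) :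
    ∃ L : X → ℂ, Continuous L ∧ ∀ θ, exp (L θ) = w θ := by
  obtain ⟨x₀⟩ : Nonempty X := inferInstance
  obtain ⟨F, ⟨-, hF⟩, -⟩ := isCoveringMapOn_exp.existsUnique_continuousMap_lifts
    ⟨w, hw⟩ (a₀ := x₀) (exp_log (h0 x₀)) (fun x => h0 x)
  exact ⟨F, F.continuous, fun θ => congrFun hF θ⟩

lemma exists_log_ball {W : ℂ → ℂ} {c : ℂ} {R : ℝ} (hR : 0 < R)
    (hW : ContinuousOn W (closedBall c R)) (h0 : ∀ z ∈ closedBall c R, W z ≠ 0) :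
    ∃ L : ℂ → ℂ, Continuous L ∧ ∀ z ∈ closedBall c R, exp (L z) = W z := by
  obtain ⟨L, h1, h2⟩ := exists_log_of_contractible (w := fun z => W (discProj c R z))
    (hW.comp_continuous (continuous_discProj c hR) (discProj_mem c hR))
    (fun z => h0 _ (discProj_mem c hR z))
  exact ⟨L, h1, fun z hz => by rw [h2, discProj_eq hR hz]⟩

lemma HasWind.unique {w : ℝ → ℂ} {k l : ℤ} (hk : HasWind w k) (hl : HasWind w l) : k = l := by
  obtain ⟨L, h1, h2, h3⟩ := hk
  obtain ⟨M, g1, g2, g3⟩ := hl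
  obtain ⟨n, hn⟩ := const_of_exp_eq_one (φ := fun θ => L θ - M θ) (h1.sub g1) (fun θ => by
    rw [exp_sub, h2, g2, div_self]; rw [← g2]; exact exp_ne_zero _)
  have e0 := hn 0
  have e1 := hn (0 + 2 * Real.pi)
  simp only [h3, g3] at e1
  have : ((k : ℂ) - l) * (2 * Real.pi * I) = 0 := by linear_combination e1 - e0
  rcases mul_eq_zero.1 this with h | h
  · exact_mod_cast sub_eq_zero.1 h
  · exact absurd h Complex.two_pi_I_ne_zero

lemma HasWind.mul {w v : ℝ → ℂ} {k l : ℤ} (hk : HasWind w k) (hl : HasWind v l) :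
    HasWind (fun θ => w θ * v θ) (k + l) := by
  obtain ⟨L, h1, h2, h3⟩ := hk
  obtain ⟨M, g1, g2, g3⟩ := hl
  refine ⟨fun θ => L θ + M θ, h1.add g1, fun θ => by rw [exp_add, h2, g2], fun θ => ?_⟩
  simp only [h3, g3]; push_cast; ring

lemma HasWind.inv {w : ℝ → ℂ} {k : ℤ} (hk : HasWind w k) : HasWind (fun θ => (w θ)⁻¹) (-k) := by
  obtain ⟨L, h1, h2, h3⟩ := hk
  refine ⟨fun θ => -L θ, h1.neg, fun θ => by rw [exp_neg, h2], fun θ => ?_⟩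
  simp only [h3]; push_cast; ring

lemma HasWind.zpow {w : ℝ → ℂ} {k : ℤ} (hk : HasWind w k) (m : ℤ) :
    HasWind (fun θ => w θ ^ m) (m * k) := by
  obtain ⟨L, h1, h2, h3⟩ := hk
  refine ⟨fun θ => m * L θ, by fun_prop, fun θ => by rw [exp_int_mul, h2], fun θ => ?_⟩
  simp only [h3]; push_cast; ring

lemma HasWind.exists {w : ℝ → ℂ} (hw : Continuous w) (h0 : ∀ θ, w θ ≠ 0)
    (hp : ∀ θ, w (θ + 2 * Real.pi) = w θ) : ∃ k, HasWind w k := by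
  obtain ⟨L, h1, h2⟩ := exists_log_of_contractible hw h0
  obtain ⟨n, hn⟩ := const_of_exp_eq_one (φ := fun θ => L (θ + 2 * Real.pi) - L θ)
    (by fun_prop) (fun θ => by
      rw [exp_sub, h2, h2, hp, div_self (h0 θ)])
  exact ⟨n, L, h1, h2, fun θ => by rw [← hn θ]; ring⟩

lemma HasWind.zero_of_ball {W : ℂ → ℂ} {c : ℂ} {r : ℝ} (hr : 0 < r)
    (hW : ContinuousOn W (closedBall c r)) (h0 : ∀ z ∈ closedBall c r, W z ≠ 0) :
    HasWind (circLoop W c r) 0 := by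
  obtain ⟨L, h1, h2⟩ := exists_log_ball hr hW h0
  refine ⟨fun θ => L (circleMap c r θ), h1.comp (continuous_circleMap c r), fun θ => ?_,
    fun θ => ?_⟩
  · exact h2 _ (circleMap_mem_closedBall c hr.le θ)
  · simp [periodic_circleMap c r θ]

/-- A loop whose values lie in a convex set avoiding the origin: the case of a ball. -/
lemma HasWind.zero_of_near {w : ℝ → ℂ} (hw : Continuous w)
    (hp : ∀ θ, w (θ + 2 * Real.pi) = w θ) {b : ℂ} {R : ℝ}  (hb : R < ‖b‖)
    (h : ∀ θ, w θ ∈ closedBall b R) : HasWind w 0 := by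
  have hR0 : 0 ≤ R := le_trans dist_nonneg (h 0)
  obtain ⟨ρ, h1, h2⟩ := exists_between hb
  have hρ : 0 < ρ := hR0.trans_lt h1
  obtain ⟨L, hL1, hL2⟩ := exists_log_ball (W := fun z => z) (c := b) hρ (by fun_prop) (by
    rintro z hz rfl
    rw [mem_closedBall, dist_zero_left] at hz
    linarith)
  refine ⟨fun θ => L (w θ), hL1.comp hw, fun θ => ?_, fun θ => by simp [hp]⟩
  exact hL2 _ (closedBall_subset_closedBall h1.le (h θ))

lemma HasWind.sub_inside {c a : ℂ} {r : ℝ} (ha : ‖a - c‖ < r) :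
    HasWind (circLoop (fun z => z - a) c r) 1 := by
  have hr : 0 < r := (norm_nonneg _).trans_lt ha
  have h1 : HasWind (fun θ : ℝ => (r : ℂ) * exp (θ * I)) 1 := by
    refine ⟨fun θ => Real.log r + θ * I, by fun_prop, fun θ => ?_, fun θ => ?_⟩
    · rw [exp_add, ← ofReal_exp, Real.exp_log hr]
    · push_cast; ring
  have h2 : HasWind (fun θ : ℝ => 1 - (a - c) / ((r : ℂ) * exp (θ * I))) 0 := by
    refine HasWind.zero_of_near (b := 1) (R := ‖a - c‖ / r) ?_ ?_ ?_ ?_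
    · refine continuous_const.sub (continuous_const.div (by fun_prop) fun θ => ?_)
      exact mul_ne_zero (by exact_mod_cast hr.ne') (exp_ne_zero _)
    · intro θ
      congr 3
      rw [show ((θ + 2 * Real.pi : ℝ) : ℂ) * I = θ * I + 2 * Real.pi * I by push_cast; ring,
        exp_add, exp_two_pi_mul_I, mul_one]
    · rw [norm_one, div_lt_one hr]; exact ha
    · intro θ
      rw [mem_closedBall, dist_eq_norm, sub_sub_cancel_left, norm_neg, norm_div, norm_mul,
        norm_exp_ofReal_mul_I, mul_one, norm_real, Real.norm_of_nonneg hr.le]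
  have h3 := h1.mul h2
  rw [add_zero] at h3
  convert h3 using 2
  rename_i θ
  have : (r : ℂ) * exp (θ * I) ≠ 0 := mul_ne_zero (by exact_mod_cast hr.ne') (exp_ne_zero _)
  rw [mul_sub, mul_div_cancel₀ _ this]
  simp only [circLoop, circleMap]
  ring

lemma HasWind.sub_outside {c a : ℂ} {r : ℝ} (hr : 0 < r) (ha : r < ‖a - c‖) :
    HasWind (circLoop (fun z => z - a) c r) 0 := by
  refine HasWind.zero_of_ball hr (by fun_prop) ?_
  intro z hz h
  rw [sub_eq_zero] at h
  rw [mem_closedBall, dist_eq_norm, h] at hz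
  linarith

/-- A `2π`-periodic continuous function on the line is the restriction to the circle of a
continuous function on the plane. -/
lemma exists_continuous_of_periodic {φ : ℝ → ℂ} (hφ : Continuous φ)
    (hp : ∀ θ, φ (θ + 2 * Real.pi) = φ θ) (c : ℂ) {r : ℝ} (hr : 0 < r) :
    ∃ Φ : ℂ → ℂ, Continuous Φ ∧ ∀ θ, Φ (circleMap c r θ) = φ θ := by
  have hp' : Function.Periodic φ (2 * Real.pi) := hp
  have hc : Continuous (hp'.lift : Real.Angle → ℂ) := by
    exact continuous_quot_lift _ hφ
  have h1 : ContinuousOn (fun z : ℂ => hp'.lift ((arg (z - c) : ℝ) : Real.Angle))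
      (sphere c r) := by
    intro z hz
    refine ContinuousAt.continuousWithinAt ?_
    refine hc.continuousAt.comp (f := fun z : ℂ => ((arg (z - c) : ℝ) : Real.Angle)) ?_
    have hz' : z - c ≠ 0 := by
      rintro h
      rw [mem_sphere, dist_eq_norm, h, norm_zero] at hz
      linarith
    exact (Complex.continuousAt_arg_coe_angle hz').comp (f := fun z => z - c) (by fun_prop)
  obtain ⟨Φ, h2, h3⟩ := h1.exists_tietze isClosed_sphere
  refine ⟨Φ, h2, fun θ => ?_⟩
  rw [h3 _ (circleMap_mem_sphere c hr.le θ)]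
  have : ((arg (circleMap c r θ - c) : ℝ) : Real.Angle) = (θ : Real.Angle) := by
    rw [circleMap_sub_center, circleMap_zero, Complex.arg_mul_coe_angle]
    · rw [arg_ofReal_of_nonneg hr.le, arg_exp_mul_I]
      simp
    · exact_mod_cast hr.ne'
    · exact exp_ne_zero _
  rw [this]
  exact Function.Periodic.lift_coe hp' θ

lemma HasWind.exists_exp {W : ℂ → ℂ} {c : ℂ} {r : ℝ} (hr : 0 < r) {k : ℤ}
    (h : HasWind (circLoop W c r) k) :
    ∃ Φ : ℂ → ℂ, Continuous Φ ∧ ∀ z ∈ sphere c r, W z = (z - c) ^ k * exp (Φ z) := by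
  have h1 := h.mul (((HasWind.sub_inside (c := c) (a := c) (r := r) (by simpa using hr)).zpow
    k).inv)
  rw [mul_one, add_neg_cancel] at h1
  obtain ⟨L, g1, g2, g3⟩ := h1
  obtain ⟨Φ, e1, e2⟩ := exists_continuous_of_periodic g1 (fun θ => by rw [g3]; simp) c hr
  refine ⟨Φ, e1, fun z hz => ?_⟩
  obtain ⟨θ, rfl⟩ : ∃ θ, circleMap c r θ = z := by
    have := range_circleMap c r
    rw [abs_of_pos hr] at this
    rw [← this] at hz
    exact hz
  rw [e2, g2]
  have : circleMap c r θ - c ≠ 0 := by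
    rw [circleMap_sub_center]; exact circleMap_ne_center hr.ne'
  simp only [circLoop]
  have h3 := zpow_ne_zero k this
  field_simp

lemma HasWind.congr {w v : ℝ → ℂ} {k : ℤ} (h : HasWind w k) (e : ∀ θ, v θ = w θ) :
    HasWind v k := by
  rwa [show v = w from funext e]

lemma HasWind.sub_zpow_out {c a : ℂ} {r : ℝ} (hr : 0 < r) (ha : r < ‖a - c‖) (m : ℤ) :
    HasWind (circLoop (fun z => (z - a) ^ m) c r) 0 := by
  have := (HasWind.sub_outside hr ha).zpow m
  rwa [mul_zero] at this

lemma HasWind.sub_zpow_in {c a : ℂ} {r : ℝ} (ha : ‖a - c‖ < r) (m : ℤ) :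
    HasWind (circLoop (fun z => (z - a) ^ m) c r) m := by
  have := (HasWind.sub_inside ha).zpow m
  rwa [mul_one] at this

/-- The winding number along the outer circle of a disc with holes of a nonvanishing function is
the sum of the winding numbers along the boundaries of the holes. -/
lemma HasWind.sum_holes {ι : Type*} [DecidableEq ι] {c : ι → ℂ} {r : ι → ℝ} {a : ℂ} {R : ℝ}
    (hR : 0 < R) {k : ι → ℤ} (s : Finset ι) : ∀ {H : ℂ → ℂ}
    (_ : ∀ i ∈ s, 0 < r i)
    (_ : (s : Set ι).PairwiseDisjoint fun i => closedBall (c i) (r i))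
    (_ : ∀ i ∈ s, closedBall (c i) (r i) ⊆ ball a R)
    (_ : ContinuousOn H (closedBall a R \ ⋃ i ∈ s, ball (c i) (r i)))
    (_ : ∀ z ∈ closedBall a R \ ⋃ i ∈ s, ball (c i) (r i), H z ≠ 0)
    (_ : ∀ i ∈ s, HasWind (circLoop H (c i) (r i)) (k i)),
    HasWind (circLoop H a R) (∑ i ∈ s, k i) := by
  induction s using Finset.induction_on with
  | empty =>
    intro H _ _ _ hc h0 _
    simp only [Finset.notMem_empty, iUnion_of_empty, iUnion_empty, sdiff_empty] at hc h0
    simpa using HasWind.zero_of_ball hR hc h0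
  | insert j s hj ih =>
    intro H hr hd hin hc h0 hk
    have hjm : j ∈ insert j s := Finset.mem_insert_self j s
    have hsub : s ⊆ insert j s := Finset.subset_insert j s
    have hrj : 0 < r j := hr j hjm
    obtain ⟨Φ, hΦ, he⟩ := (hk j hjm).exists_exp hrj
    classical
    set H₁ : ℂ → ℂ := fun z => if z ∈ closedBall (c j) (r j) then exp (Φ z)
      else H z * (z - c j) ^ (-k j) with hH₁
    have hout : ∀ z, z ∉ ball (c j) (r j) → H₁ z = H z * (z - c j) ^ (-k j) := by
      intro z hz
      by_cases h : z ∈ closedBall (c j) (r j)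
      · have hs : z ∈ sphere (c j) (r j) := by
          rw [mem_sphere]; rw [mem_closedBall] at h; rw [mem_ball, not_lt] at hz
          exact le_antisymm h hz
        have hne : z - c j ≠ 0 := by
          intro h'
          rw [mem_sphere, dist_eq_norm, h', norm_zero] at hs
          exact hrj.ne hs
        simp only [hH₁, if_pos h]
        rw [he z hs, zpow_neg]
        have := zpow_ne_zero (k j) hne
        field_simp
      · simp only [hH₁, if_neg h]
    have hne : ∀ z, z ∉ ball (c j) (r j) → z - c j ≠ 0 := by
      intro z hz h'
      rw [mem_ball, not_lt, dist_eq_norm, h', norm_zero] at hz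
      exact absurd hz (not_le.2 hrj)
    set Y := closedBall a R \ ⋃ i ∈ s, ball (c i) (r i) with hY
    have hYc : IsClosed Y := by
      refine isClosed_closedBall.sdiff ?_
      exact isOpen_biUnion fun _ _ => isOpen_ball
    have hYj : Y \ ball (c j) (r j) ⊆ closedBall a R \ ⋃ i ∈ insert j s, ball (c i) (r i) := by
      rintro z ⟨⟨h1, h2⟩, h3⟩
      refine ⟨h1, ?_⟩
      simp only [mem_iUnion, not_exists, Finset.mem_insert] at h2 ⊢
      rintro i (rfl | hi)
      · exact h3
      · exact h2 i hi
    have hc₁ : ContinuousOn H₁ Y := by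
      have hu : Y ⊆ (Y \ ball (c j) (r j)) ∪ closedBall (c j) (r j) := by
        intro z hz
        by_cases h : z ∈ ball (c j) (r j)
        · exact Or.inr (ball_subset_closedBall h)
        · exact Or.inl ⟨hz, h⟩
      refine ContinuousOn.mono ?_ hu
      refine ContinuousOn.union_of_isClosed ?_ ?_ (hYc.sdiff isOpen_ball) isClosed_closedBall
      · have : ContinuousOn (fun z => H z * (z - c j) ^ (-k j)) (Y \ ball (c j) (r j)) := by
          refine (hc.mono hYj).mul ?_
          refine ContinuousOn.zpow₀ (by fun_prop) _ ?_
          exact fun z hz => Or.inl (hne z hz.2)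
        exact this.congr fun z hz => hout z hz.2
      · have : ContinuousOn (fun z => exp (Φ z)) (closedBall (c j) (r j)) := by fun_prop
        exact this.congr fun z hz => if_pos hz
    have h0₁ : ∀ z ∈ Y, H₁ z ≠ 0 := by
      intro z hz
      by_cases h : z ∈ ball (c j) (r j)
      · simp only [hH₁, if_pos (ball_subset_closedBall h)]
        exact exp_ne_zero _
      · rw [hout z h]
        exact mul_ne_zero (h0 z (hYj ⟨hz, h⟩)) (zpow_ne_zero _ (hne z h))
    have hk₁ : ∀ i ∈ s, HasWind (circLoop H₁ (c i) (r i)) (k i) := by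
      intro i hi
      have him : i ∈ insert j s := hsub hi
      have hdij := hd him hjm (fun h => hj (h ▸ hi))
      have h1 := (hk i him).mul (HasWind.sub_zpow_out (c := c i) (a := c j) (hr i him) (by
        by_contra hcon
        have h' : c j ∈ closedBall (c i) (r i) := by
          rw [mem_closedBall, dist_eq_norm]; exact not_lt.1 hcon
        exact Set.disjoint_left.1 hdij h' (mem_closedBall_self hrj.le)) (-k j))
      rw [add_zero] at h1
      refine h1.congr fun θ => ?_
      refine hout _ fun hb => ?_
      exact Set.disjoint_left.1 hdij (circleMap_mem_closedBall _ (hr i him).le θ)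
        (ball_subset_closedBall hb)
    have := ih (H := H₁) (fun i hi => hr i (hsub hi)) (hd.subset (by exact_mod_cast hsub))
      (fun i hi => hin i (hsub hi)) hc₁ h0₁ hk₁
    have h2 := this.mul (HasWind.sub_zpow_in (c := a) (a := c j) (r := R) (by
      rw [← dist_eq_norm]; exact hin j hjm (mem_closedBall_self hrj.le)) (k j))
    rw [Finset.sum_insert hj, add_comm]
    refine h2.congr fun θ => ?_
    have hz : circleMap a R θ ∉ ball (c j) (r j) := by
      intro hb
      have := hin j hjm (ball_subset_closedBall hb)
      have h3 := circleMap_mem_sphere a hR.le θ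
      rw [mem_ball] at this; rw [mem_sphere] at h3; linarith
    simp only [circLoop]
    rw [hout _ hz, mul_assoc, ← zpow_add₀ (hne _ hz), neg_add_cancel, zpow_zero, mul_one]

/-- Splitting off one zero of a function. -/
lemma exists_factor_zero {Y : Set ℂ} {W : ℂ → ℂ} (hc : ContinuousOn W Y) {a : ℂ}
    (hY : Y ∈ 𝓝 a) (ha : AnalyticAt ℂ W a) (hn : ¬ ∀ᶠ z in 𝓝 a, W z = 0) :
    ∃ (m : ℕ) (W₁ : ℂ → ℂ), ContinuousOn W₁ Y ∧ (∀ z, W z = (z - a) ^ m * W₁ z) ∧ W₁ a ≠ 0 ∧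
      (deriv W a ≠ 0 → m ≤ 1) := by
  obtain ⟨m, g, hg, hg0, he⟩ := ha.exists_eventuallyEq_pow_smul_nonzero_iff.2 hn
  classical
  set W₁ := Function.update (fun z => W z / (z - a) ^ m) a (g a) with hW₁
  have h1 : ∀ z, z ≠ a → W₁ z = W z / (z - a) ^ m := fun z hz => by
    rw [hW₁, Function.update_of_ne hz]
  have h2 : W₁ a = g a := by rw [hW₁, Function.update_self]
  have h3 : W₁ =ᶠ[𝓝 a] g := by
    filter_upwards [he] with z hz
    by_cases h : z = a
    · rw [h, h2]
    · rw [h1 z h, hz, smul_eq_mul, mul_div_cancel_left₀]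
      exact pow_ne_zero _ (sub_ne_zero.2 h)
  refine ⟨m, W₁, ?_, ?_, by rwa [h2], ?_⟩
  · intro z hz
    by_cases h : z = a
    · subst h
      exact (hg.continuousAt.congr h3.symm).continuousWithinAt
    · have h4 : ContinuousWithinAt (fun z => W z / (z - a) ^ m) Y z := by
        refine (hc z hz).div (by fun_prop) (pow_ne_zero _ (sub_ne_zero.2 h))
      refine h4.congr_of_eventuallyEq ?_ (h1 z h)
      refine eventually_nhdsWithin_of_eventually_nhds ?_
      filter_upwards [isOpen_ne.mem_nhds h] with w hw using h1 w hw
  · intro z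
    by_cases h : z = a
    · subst h
      have := he.self_of_nhds
      rw [this, h2, smul_eq_mul]
    · rw [h1 z h, mul_div_cancel₀]
      exact pow_ne_zero _ (sub_ne_zero.2 h)
  · intro hd
    by_contra hm
    apply hd
    rw [Filter.EventuallyEq.deriv_eq he]
    have h5 : HasDerivAt (fun z => (z - a) ^ m * g z)
        ((m * (a - a) ^ (m - 1) * 1) * g a + (a - a) ^ m * deriv g a) a :=
      (((hasDerivAt_id a).sub_const a).pow m).mul hg.differentiableAt.hasDerivAt
    have := h5.deriv
    simp only [smul_eq_mul]
    rw [this, sub_self, zero_pow (by omega), zero_pow (by omega)]; ring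

/-- Splitting off finitely many zeros of a function. -/
lemma exists_factor_zeros {Y : Set ℂ} (Z : Finset ℂ) : ∀ {W : ℂ → ℂ} (_ : ContinuousOn W Y)
    (_ : ∀ a ∈ Z, Y ∈ 𝓝 a ∧ AnalyticAt ℂ W a ∧ ¬ ∀ᶠ z in 𝓝 a, W z = 0),
    ∃ (m : ℂ → ℕ) (W₁ : ℂ → ℂ), ContinuousOn W₁ Y ∧
      (∀ z, W z = (∏ a ∈ Z, (z - a) ^ m a) * W₁ z) ∧ (∀ a ∈ Z, W₁ a ≠ 0) ∧
      ∀ a ∈ Z, W a = 0 → 1 ≤ m a ∧ (deriv W a ≠ 0 → m a = 1) := by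
  induction Z using Finset.induction_on with
  | empty =>
    intro W hc _
    exact ⟨fun _ => 0, W, hc, by simp, by simp, by simp⟩
  | insert b Z hb ih =>
    intro W hc h
    obtain ⟨hYb, hab, hnb⟩ := h b (Finset.mem_insert_self _ _)
    obtain ⟨m, W₁, h1, h2, h3, h4⟩ := exists_factor_zero hc hYb hab hnb
    have hne : ∀ a ∈ Z, a ≠ b := fun a ha hab => hb (hab ▸ ha)
    have hev : ∀ a ∈ Z, W₁ =ᶠ[𝓝 a] fun z => W z / (z - b) ^ m := by
      intro a ha
      filter_upwards [isOpen_ne.mem_nhds (hne a ha)] with z hz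
      rw [h2 z, mul_div_cancel_left₀]
      exact pow_ne_zero _ (sub_ne_zero.2 hz)
    have han : ∀ a ∈ Z, AnalyticAt ℂ W₁ a := by
      intro a ha
      refine AnalyticAt.congr ?_ (hev a ha).symm
      refine (h a (Finset.mem_insert_of_mem ha)).2.1.div ?_
        (pow_ne_zero _ (sub_ne_zero.2 (hne a ha)))
      exact (analyticAt_id.sub analyticAt_const).pow m
    obtain ⟨m', W₂, g1, g2, g3, g4⟩ := ih (W := W₁) h1 (fun a ha => by
      refine ⟨(h a (Finset.mem_insert_of_mem ha)).1, han a ha, fun hcon => ?_⟩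
      refine (h a (Finset.mem_insert_of_mem ha)).2.2 ?_
      filter_upwards [hcon] with z hz
      rw [h2, hz, mul_zero])
    classical
    have hm : ∀ z, ∏ a ∈ Z, (z - a) ^ (Function.update m' b m a) = ∏ a ∈ Z, (z - a) ^ m' a := by
      intro z
      refine Finset.prod_congr rfl fun a ha => ?_
      rw [Function.update_of_ne (hne a ha)]
    refine ⟨Function.update m' b m, W₂, g1, fun z => ?_, ?_, ?_⟩
    · rw [Finset.prod_insert hb, Function.update_self, hm, mul_assoc, ← g2, ← h2]
    · intro a ha
      rcases Finset.mem_insert.1 ha with rfl | ha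
      · intro h0
        apply h3
        rw [g2, h0, mul_zero]
      · exact g3 a ha
    · intro a ha hWa
      rcases Finset.mem_insert.1 ha with rfl | ha
      · rw [Function.update_self]
        have h5 : 1 ≤ m := by
          by_contra hm0
          have : m = 0 := by omega
          rw [h2, this, pow_zero, one_mul] at hWa
          exact h3 hWa
        exact ⟨h5, fun hd => le_antisymm (h4 hd) h5⟩
      · rw [Function.update_of_ne (hne a ha)]
        have hW₁a : W₁ a = 0 := by
          rw [h2] at hWa
          exact (mul_eq_zero.1 hWa).resolve_left (pow_ne_zero _ (sub_ne_zero.2 (hne a ha)))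
        obtain ⟨e1, e2⟩ := g4 a ha hW₁a
        refine ⟨e1, fun hd => e2 fun hd' => hd ?_⟩
        have h6 : HasDerivAt (fun z => (z - b) ^ m * W₁ z)
            ((m * (a - b) ^ (m - 1) * 1) * W₁ a + (a - b) ^ m * deriv W₁ a) a :=
          (((hasDerivAt_id a).sub_const b).pow m).mul (han a ha).differentiableAt.hasDerivAt
        rw [show W = fun z => (z - b) ^ m * W₁ z from funext h2, h6.deriv, hW₁a, hd']
        ring

lemma HasWind.prod {ι : Type*} (s : Finset ι) {w : ι → ℝ → ℂ} {k : ι → ℤ}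
    (h : ∀ i ∈ s, HasWind (w i) (k i)) : HasWind (fun θ => ∏ i ∈ s, w i θ) (∑ i ∈ s, k i) := by
  classical
  induction s using Finset.induction_on with
  | empty => exact ⟨fun _ => 0, continuous_const, by simp, by simp⟩
  | insert b s hb ih =>
    simp only [Finset.prod_insert hb, Finset.sum_insert hb]
    exact (h b (Finset.mem_insert_self _ _)).mul
      (ih fun i hi => h i (Finset.mem_insert_of_mem hi))

/-- The argument principle in a disc with holes. -/
lemma HasWind.argument_principle {ι : Type*} [DecidableEq ι] {c : ι → ℂ} {r : ι → ℝ} {a : ℂ}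
    {R : ℝ} (hR : 0 < R) {k : ι → ℤ} (s : Finset ι) {W : ℂ → ℂ} (Z : Finset ℂ)
    (hr : ∀ i ∈ s, 0 < r i)
    (hd : (s : Set ι).PairwiseDisjoint fun i => closedBall (c i) (r i))
    (hin : ∀ i ∈ s, closedBall (c i) (r i) ⊆ ball a R)
    (hc : ContinuousOn W (closedBall a R \ ⋃ i ∈ s, ball (c i) (r i)))
    (hk : ∀ i ∈ s, HasWind (circLoop W (c i) (r i)) (k i))
    (hZ : ∀ z ∈ Z, z ∈ ball a R ∧ (∀ i ∈ s, z ∉ closedBall (c i) (r i)) ∧ W z = 0 ∧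
      AnalyticAt ℂ W z ∧ ¬ ∀ᶠ w in 𝓝 z, W w = 0)
    (h0 : ∀ z ∈ closedBall a R \ ⋃ i ∈ s, ball (c i) (r i), W z = 0 → z ∈ Z) :
    ∃ m : ℂ → ℕ, HasWind (circLoop W a R) (∑ i ∈ s, k i + ∑ z ∈ Z, (m z : ℤ)) ∧
      ∀ z ∈ Z, 1 ≤ m z ∧ (deriv W z ≠ 0 → m z = 1) := by
  set Y := closedBall a R \ ⋃ i ∈ s, ball (c i) (r i) with hY
  have hYn : ∀ z ∈ Z, Y ∈ 𝓝 z := by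
    intro z hz
    obtain ⟨h1, h2, -⟩ := hZ z hz
    have : ball a R ∩ ⋂ i ∈ s, (closedBall (c i) (r i))ᶜ ∈ 𝓝 z := by
      refine inter_mem (isOpen_ball.mem_nhds h1) ?_
      refine (Filter.biInter_finset_mem s).2 fun i hi => ?_
      exact isClosed_closedBall.isOpen_compl.mem_nhds (h2 i hi)
    filter_upwards [this] with w hw
    refine ⟨ball_subset_closedBall hw.1, ?_⟩
    simp only [mem_iUnion, not_exists]
    intro i hi hwi
    exact mem_iInter₂.1 hw.2 i hi (ball_subset_closedBall hwi)
  obtain ⟨m, W₁, h1, h2, h3, h4⟩ := exists_factor_zeros Z hc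
    (fun z hz => ⟨hYn z hz, (hZ z hz).2.2.2⟩)
  have hne : ∀ z ∈ Y, W₁ z ≠ 0 := by
    intro z hz h
    exact h3 z (h0 z hz (by rw [h2, h, mul_zero])) h
  have hk₁ : ∀ i ∈ s, HasWind (circLoop W₁ (c i) (r i)) (k i) := by
    intro i hi
    have hp : HasWind (fun θ => ∏ z ∈ Z, circLoop (fun w => (w - z) ^ (m z : ℤ)) (c i) (r i) θ)
        (∑ z ∈ Z, 0) := by
      refine HasWind.prod Z fun z hz => HasWind.sub_zpow_out (hr i hi) ?_ _
      have := (hZ z hz).2.1 i hi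
      rwa [mem_closedBall, not_le, dist_eq_norm] at this
    have := (hk i hi).mul hp.inv
    simp only [Finset.sum_const_zero, neg_zero, add_zero] at this
    refine this.congr fun θ => ?_
    simp only [circLoop, zpow_natCast]
    rw [h2 (circleMap (c i) (r i) θ), mul_comm, ← mul_assoc, inv_mul_cancel₀, one_mul]
    refine Finset.prod_ne_zero_iff.2 fun z hz => pow_ne_zero _ (sub_ne_zero.2 ?_)
    rintro rfl
    exact (hZ _ hz).2.1 i hi (circleMap_mem_closedBall _ (hr i hi).le θ)
  have hs := HasWind.sum_holes hR s hr hd hin h1 hne hk₁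
  have hp : HasWind (fun θ => ∏ z ∈ Z, circLoop (fun w => (w - z) ^ (m z : ℤ)) a R θ)
      (∑ z ∈ Z, (m z : ℤ)) := by
    refine HasWind.prod Z fun z hz => HasWind.sub_zpow_in ?_ _
    have := (hZ z hz).1
    rwa [mem_ball, dist_eq_norm] at this
  refine ⟨m, (hs.mul hp).congr fun θ => ?_, fun z hz => h4 z hz (hZ z hz).2.2.1⟩
  simp only [circLoop, zpow_natCast]
  rw [h2 (circleMap a R θ), mul_comm]

lemma HasWind.zero_of_slit {w : ℝ → ℂ} (hw : Continuous w)
    (hp : ∀ θ, w (θ + 2 * Real.pi) = w θ) (h : ∀ θ, w θ ∈ slitPlane) : HasWind w 0 := by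
  refine ⟨fun θ => log (w θ), hw.clog h, fun θ => exp_log (slitPlane_ne_zero (h θ)),
    fun θ => by simp [hp]⟩

lemma one_sub_mem_slitPlane {u : ℂ} (h : ‖u‖ < 1) : 1 - u ∈ slitPlane := by
  left
  have := (abs_lt.1 ((abs_re_le_norm u).trans_lt h)).2
  simp; linarith

lemma neg_one_zpow_floor_mul_sin (x : ℝ) : 0 ≤ (-1 : ℝ) ^ ⌊x / Real.pi⌋ * Real.sin x := by
  have h := Real.sin_sub_int_mul_pi x ⌊x / Real.pi⌋
  rw [← h]
  apply Real.sin_nonneg_of_nonneg_of_le_pi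
  · have := Int.floor_le (x / Real.pi)
    rw [le_div_iff₀ Real.pi_pos] at this; linarith
  · have := (Int.lt_floor_add_one (x / Real.pi)).le
    rw [div_le_iff₀ Real.pi_pos] at this; linarith

lemma even_of_sign {b Y A u v : ℝ} {i : ℤ} (hb : 0 ≤ b) (hY : 0 < Y)
    (h : Y * Real.sin A = b * (Real.sin u * Real.sin v)) (hA : A = Real.pi / 2 - i * Real.pi) :
    Even (⌊u / Real.pi⌋ + ⌊v / Real.pi⌋ + i) := by
  rw [hA, Real.sin_sub_int_mul_pi, Real.sin_pi_div_two, mul_one] at h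
  by_contra hodd
  rw [Int.not_even_iff_odd] at hodd
  have h1 := mul_nonneg hb (mul_nonneg (neg_one_zpow_floor_mul_sin u)
    (neg_one_zpow_floor_mul_sin v))
  have h2 : b * ((-1 : ℝ) ^ ⌊u / Real.pi⌋ * Real.sin u * ((-1 : ℝ) ^ ⌊v / Real.pi⌋ * Real.sin v))
      = Y * (-1 : ℝ) ^ (⌊u / Real.pi⌋ + ⌊v / Real.pi⌋ + i) := by
    rw [zpow_add₀ (by norm_num), zpow_add₀ (by norm_num)]
    linear_combination (-(-1 : ℝ) ^ ⌊u / Real.pi⌋ * (-1 : ℝ) ^ ⌊v / Real.pi⌋) * h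
  rw [h2, hodd.neg_one_zpow] at h1
  linarith

/-- Each time the angle `A` drops by `π`, one of the angles `u`, `v` passes a multiple of `π`. -/
lemma floor_count {A u v Y : ℝ → ℝ} {b : ℝ} (hb : 0 ≤ b) (hA : Continuous A) (hu : Monotone u)
    (hv : Monotone v) (hY : ∀ t, 0 < Y t)
    (h : ∀ t, Y t * Real.sin (A t) = b * (Real.sin (u t) * Real.sin (v t))) (j : ℕ) :
    ∀ (i : ℤ) (a e : ℝ), a ≤ e → A a = Real.pi / 2 - i * Real.pi →
      A e ≤ Real.pi / 2 - (i + j : ℤ) * Real.pi →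
      ∃ t ∈ Icc a e, A t = Real.pi / 2 - (i + j : ℤ) * Real.pi ∧
        ⌊u a / Real.pi⌋ + ⌊v a / Real.pi⌋ + j ≤ ⌊u t / Real.pi⌋ + ⌊v t / Real.pi⌋ := by
  have hpi := Real.pi_pos
  induction j with
  | zero =>
    intro i a e hae h1 _
    exact ⟨a, ⟨le_rfl, hae⟩, by simpa using h1, by simp⟩
  | succ j ih =>
    intro i a e hae h1 h2
    obtain ⟨t, ht, h3, h4⟩ := ih i a e hae h1 (by
      refine h2.trans ?_
      push_cast
      nlinarith)
    have h5 : Real.pi / 2 - (i + (j + 1 : ℕ) : ℤ) * Real.pi ≤ A t := by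
      rw [h3]; push_cast; nlinarith
    obtain ⟨t', ht', h6⟩ := intermediate_value_Icc' ht.2 hA.continuousOn ⟨h2, h5⟩
    refine ⟨t', ⟨ht.1.trans ht'.1, ht'.2⟩, h6, ?_⟩
    have e1 := even_of_sign hb (hY t) (h t) h3
    have e2 := even_of_sign hb (hY t') (h t') h6
    have m1 : ⌊u t / Real.pi⌋ ≤ ⌊u t' / Real.pi⌋ :=
      Int.floor_le_floor (div_le_div_of_nonneg_right (hu ht'.1) hpi.le)
    have m2 : ⌊v t / Real.pi⌋ ≤ ⌊v t' / Real.pi⌋ :=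
      Int.floor_le_floor (div_le_div_of_nonneg_right (hv ht'.1) hpi.le)
    rw [Int.even_iff] at e1 e2
    push_cast at *
    omega

lemma iterate_period {φ : ℝ → ℝ} {d : ℝ} (h : ∀ θ, φ (θ + 2 * Real.pi) = φ θ + d) (n : ℕ)
    (θ : ℝ) : φ (θ + n * (2 * Real.pi)) = φ θ + n * d := by
  induction n with
  | zero => simp
  | succ n ih =>
    push_cast
    rw [show θ + ((n : ℝ) + 1) * (2 * Real.pi) = θ + n * (2 * Real.pi) + 2 * Real.pi by ring,
      h, ih]
    ring

lemma wind_core {A u v Y : ℝ → ℝ} {b : ℝ} (hb : 0 ≤ b) (hA : Continuous A) (hu : Monotone u)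
    (hv : Monotone v) (hY : ∀ t, 0 < Y t)
    (h : ∀ t, Y t * Real.sin (A t) = b * (Real.sin (u t) * Real.sin (v t))) {m k : ℤ}
    (hAp : ∀ θ, A (θ + 2 * Real.pi) = A θ + Real.pi * (2 * m - k - 1))
    (hup : ∀ θ, u (θ + 2 * Real.pi) = u θ + Real.pi * k)
    (hvp : ∀ θ, v (θ + 2 * Real.pi) = v θ + Real.pi) (hk : 0 ≤ k) : 0 ≤ m := by
  have hpi := Real.pi_pos
  by_contra hm
  have hm' : m ≤ -1 := by omega
  have hmR : (m : ℝ) ≤ -1 := by exact_mod_cast hm'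
  have hkR : (0 : ℝ) ≤ k := by exact_mod_cast hk
  have hA6 := iterate_period hAp 6 0
  have hu6 := iterate_period hup 6 0
  have hv6 := iterate_period hvp 6 0
  rw [zero_add] at hA6 hu6 hv6
  set e : ℝ := (6 : ℕ) * (2 * Real.pi) with he
  have he0 : 0 < e := by positivity
  -- first level at or below `A 0`
  set i : ℤ := ⌈(Real.pi / 2 - A 0) / Real.pi⌉ with hi
  have i1 : Real.pi / 2 - i * Real.pi ≤ A 0 := by
    have := Int.le_ceil ((Real.pi / 2 - A 0) / Real.pi)
    rw [div_le_iff₀ hpi] at this; linarith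
  have i2 : A 0 < Real.pi / 2 - i * Real.pi + Real.pi := by
    have := Int.ceil_lt_add_one ((Real.pi / 2 - A 0) / Real.pi)
    rw [← sub_lt_iff_lt_add, lt_div_iff₀ hpi] at this; linarith
  obtain ⟨j, hj⟩ : ∃ j : ℕ, (j : ℤ) = 6 * (k + 3) - 1 :=
    ⟨(6 * (k + 3) - 1).toNat, Int.toNat_of_nonneg (by omega)⟩
  have hjR : (j : ℝ) = 6 * (k + 3) - 1 := by exact_mod_cast hj
  have h6 : A e ≤ Real.pi / 2 - (i + j : ℤ) * Real.pi := by
    rw [hA6]; push_cast; rw [hjR]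
    nlinarith
  obtain ⟨t0, ht0, h7⟩ := intermediate_value_Icc' he0.le hA.continuousOn
    (show Real.pi / 2 - i * Real.pi ∈ Icc (A e) (A 0) from ⟨h6.trans (by
      push_cast
      have : (0 : ℝ) ≤ j * Real.pi := by positivity
      linarith), i1⟩)
  obtain ⟨t, ht, h8, h9⟩ := floor_count hb hA hu hv hY h j i t0 e ht0.2 h7 h6
  have hfl : ∀ {x y d : ℝ}, x - y ≤ Real.pi * d → (⌊x / Real.pi⌋ : ℝ) - ⌊y / Real.pi⌋ < d + 1 := by
    intro x y d hxy
    have f1 := Int.floor_le (x / Real.pi)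
    have f2 := Int.lt_floor_add_one (y / Real.pi)
    have : x / Real.pi - y / Real.pi ≤ d := by
      rw [← _root_.sub_div, div_le_iff₀ hpi]; linarith
    linarith
  have hu' : u t - u t0 ≤ Real.pi * (6 * k) := by
    have g1 := hu ht.2
    have g2 := hu ht0.1
    rw [hu6] at g1; push_cast at g1; linarith
  have hv' : v t - v t0 ≤ Real.pi * 6 := by
    have g1 := hv ht.2
    have g2 := hv ht0.1
    rw [hv6] at g1; push_cast at g1; linarith
  have f1 := hfl hu'
  have f2 := hfl hv'
  have h9' : ((⌊u t0 / Real.pi⌋ : ℝ) + ⌊v t0 / Real.pi⌋ + j) ≤ ⌊u t / Real.pi⌋ + ⌊v t / Real.pi⌋ := by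
    exact_mod_cast h9
  linarith

lemma re_im_of_exp {L Y : ℂ} (h : exp L = Y) : ‖Y‖ * Real.sin L.im = Y.im := by
  rw [← h, norm_exp, exp_im]

lemma circleMap_exp (c : ℂ) (r θ : ℝ) : circleMap c r θ = c + r * exp (θ * I) := rfl

lemma two_circle_identity (r r1 α β η θ : ℝ) :
    (((r1 * (exp (η * I) - exp (β * I)) - r * (exp (θ * I) - exp (α * I))) *
      exp (-((η + θ) / 2 + (α - β) / 2 + Real.pi / 2 : ℝ) * I))).im =
      2 * (Real.sin ((η - β) / 2) * (r1 * Real.sin (β - α / 2 - θ / 2) +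
        r * Real.sin (θ / 2 - α / 2))) := by
  set ψ : ℝ := (η + θ) / 2 + (α - β) / 2 + Real.pi / 2 with hψ
  have h1 : ∀ x : ℝ, exp (x * I) * exp (-(ψ : ℝ) * I) = exp ((x - ψ : ℝ) * I) := by
    intro x
    rw [← exp_add]; congr 1; push_cast; ring
  have h2 : (r1 * (exp (η * I) - exp (β * I)) - r * (exp (θ * I) - exp (α * I))) *
      exp (-(ψ : ℝ) * I) = r1 * (exp ((η - ψ : ℝ) * I) - exp ((β - ψ : ℝ) * I)) -
        r * (exp ((θ - ψ : ℝ) * I) - exp ((α - ψ : ℝ) * I)) := by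
    simp only [← h1]; ring
  have h3 : Real.sin (η - ψ) - Real.sin (β - ψ) =
      2 * Real.sin ((η - β) / 2) * Real.sin (β - α / 2 - θ / 2) := by
    rw [Real.sin_sub_sin, ← Real.cos_sub_pi_div_two (β - α / 2 - θ / 2)]
    rw [show (η - ψ - (β - ψ)) / 2 = (η - β) / 2 by ring,
      show (η - ψ + (β - ψ)) / 2 = β - α / 2 - θ / 2 - Real.pi / 2 by rw [hψ]; ring]
  have h4 : Real.sin (θ - ψ) - Real.sin (α - ψ) =
      - (2 * Real.sin (θ / 2 - α / 2) * Real.sin ((η - β) / 2)) := by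
    rw [Real.sin_sub_sin, ← Real.cos_sub_pi_div_two ((η - β) / 2)]
    rw [show (θ - ψ - (α - ψ)) / 2 = θ / 2 - α / 2 by ring,
      show (θ - ψ + (α - ψ)) / 2 = -((η - β) / 2 - Real.pi / 2) - Real.pi by rw [hψ]; ring,
      Real.cos_sub_pi, Real.cos_neg]
    ring
  rw [h2]
  simp only [sub_im, im_ofReal_mul, exp_ofReal_mul_I_im, h3, h4]
  ring

lemma amplitude (p q : ℝ) : ∃ b φ : ℝ, 0 ≤ b ∧
    ∀ x, p * Real.cos x + q * Real.sin x = b * Real.sin (x + φ) := by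
  refine ⟨‖(⟨q, p⟩ : ℂ)‖, arg ⟨q, p⟩, norm_nonneg _, fun x => ?_⟩
  have h1 := norm_mul_cos_arg (⟨q, p⟩ : ℂ)
  have h2 := norm_mul_sin_arg (⟨q, p⟩ : ℂ)
  simp only at h1 h2
  rw [Real.sin_add]
  linear_combination (-Real.sin x) * h1 - Real.cos x * h2

/-- Nonnegativity of the fixed point index of a monotone circle correspondence. -/
lemma HasWind.nonneg_of_circles {c c1 : ℂ} {r r1 : ℝ} (hr : 0 < r) (hr1 : 0 < r1)
    {η : ℝ → ℝ} (hη : Continuous η) (hm : Monotone η) {k m : ℤ}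
    (hk : ∀ θ, η (θ + 2 * Real.pi) = η θ + 2 * Real.pi * k)
    (h : HasWind (fun θ => circleMap c1 r1 (η θ) - circleMap c r θ) m) : 0 ≤ m := by
  have hpi := Real.pi_pos
  have hk0 : 0 ≤ k := by
    have := hm (show (0 : ℝ) ≤ 0 + 2 * Real.pi by linarith)
    rw [hk] at this
    have h1 : (0 : ℝ) ≤ k := by
      by_contra hc
      push Not at hc
      nlinarith
    exact_mod_cast h1
  have hWc : Continuous fun θ => circleMap c1 r1 (η θ) := (continuous_circleMap c1 r1).comp hη
  have hWp : ∀ θ, circleMap c1 r1 (η (θ + 2 * Real.pi)) = circleMap c1 r1 (η θ) := by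
    intro θ
    rw [hk, mul_comm]
    exact (periodic_circleMap c1 r1).int_mul k (η θ)
  have hγ : HasWind (fun θ => circleMap c1 r1 (η θ) - c1) k := by
    refine ⟨fun θ => Real.log r1 + η θ * I, by fun_prop, fun θ => ?_, fun θ => ?_⟩
    · simp only [exp_add, ← ofReal_exp, Real.exp_log hr1, circleMap_exp]; ring
    · simp only [hk]; push_cast; ring
  set d : ℝ → ℝ := fun α => ‖circleMap c r α - c1‖ - r1 with hd
  have hdc : Continuous d := by
    have := continuous_circleMap c r
    fun_prop
  have hn1 : ∀ θ, ‖circleMap c1 r1 (η θ) - c1‖ = r1 := by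
    intro θ; rw [circleMap_sub_center, norm_circleMap_zero, abs_of_pos hr1]
  have hne1 : ∀ θ, circleMap c1 r1 (η θ) - c1 ≠ 0 := fun θ => by
    rw [← norm_ne_zero_iff, hn1]; exact hr1.ne'
  by_cases hneg : ∀ α, d α < 0
  · have h2 : HasWind (fun θ => 1 - (circleMap c r θ - c1) / (circleMap c1 r1 (η θ) - c1)) 0 := by
      refine HasWind.zero_of_slit ?_ ?_ ?_
      · exact continuous_const.sub (((continuous_circleMap c r).sub continuous_const).div
          (hWc.sub continuous_const) hne1)
      · intro θ; simp only [hWp, periodic_circleMap c r θ]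
      · intro θ
        apply one_sub_mem_slitPlane
        rw [norm_div, hn1, div_lt_one hr1]
        have := hneg θ
        simp only [hd] at this; linarith
    have h3 := hγ.mul h2
    have h4 := h.unique (h3.congr fun θ => by
      have := hne1 θ
      rw [mul_sub, mul_div_cancel₀ _ this]; ring)
    rw [h4]; linarith
  by_cases hpos : ∀ α, 0 < d α
  · have hne : ∀ θ, circleMap c r θ - c1 ≠ 0 := by
      intro θ h0
      have := hpos θ
      simp only [hd, h0, norm_zero] at this; linarith
    have h2 : HasWind (fun θ => 1 - (circleMap c1 r1 (η θ) - c1) / (circleMap c r θ - c1)) 0 := by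
      refine HasWind.zero_of_slit ?_ ?_ ?_
      · exact continuous_const.sub ((hWc.sub continuous_const).div
          ((continuous_circleMap c r).sub continuous_const) hne)
      · intro θ; simp only [hWp, periodic_circleMap c r θ]
      · intro θ
        apply one_sub_mem_slitPlane
        have := hpos θ
        simp only [hd] at this
        rw [norm_div, hn1, div_lt_one (by linarith)]
        linarith
    have h1 : HasWind (fun _ => (-1 : ℂ)) 0 :=
      ⟨fun _ => Real.pi * I, continuous_const, fun _ => exp_pi_mul_I, by simp⟩
    have h5 : ∃ l : ℤ, 0 ≤ l ∧ HasWind (circLoop (fun z => z - c1) c r) l := by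
      rcases lt_trichotomy ‖c1 - c‖ r with hlt | heq | hgt
      · exact ⟨1, by norm_num, HasWind.sub_inside hlt⟩
      · exfalso
        have hs : c1 ∈ range (circleMap c r) := by
          rw [range_circleMap, mem_sphere, dist_eq_norm, abs_of_pos hr]; exact heq
        obtain ⟨θ, hθ⟩ := hs
        exact hne θ (sub_eq_zero.2 hθ)
      · exact ⟨0, le_rfl, HasWind.sub_outside hr hgt⟩
    obtain ⟨l, hl, h6⟩ := h5
    have h4 := h.unique (((h1.mul h6).mul h2).congr fun θ => by
      have := hne θ
      simp only [circLoop]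
      rw [mul_assoc, mul_sub, mul_div_cancel₀ _ this]; ring)
    rw [h4]; linarith
  push Not at hneg hpos
  obtain ⟨a1, ha1⟩ := hneg
  obtain ⟨a2, ha2⟩ := hpos
  obtain ⟨α, hα⟩ : ∃ α, d α = 0 := by
    have := intermediate_value_univ a2 a1 hdc (show (0 : ℝ) ∈ Icc (d a2) (d a1) from ⟨ha2, ha1⟩)
    exact this
  obtain ⟨β, hβ⟩ : circleMap c r α ∈ range (circleMap c1 r1) := by
    rw [range_circleMap, mem_sphere, dist_eq_norm, abs_of_pos hr1]
    simp only [hd] at hα; linarith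
  obtain ⟨L, hL1, hL2, hL3⟩ := h
  obtain ⟨b, φ, hb, hφ⟩ := amplitude (r1 * Real.sin (β - α / 2) - r * Real.sin (α / 2))
    (- r1 * Real.cos (β - α / 2) + r * Real.cos (α / 2))
  have hW : ∀ θ, circleMap c1 r1 (η θ) - circleMap c r θ =
      r1 * (exp (η θ * I) - exp (β * I)) - r * (exp (θ * I) - exp (α * I)) := by
    intro θ
    simp only [circleMap_exp] at hβ ⊢
    linear_combination hβ
  have hW0 : ∀ θ, circleMap c1 r1 (η θ) - circleMap c r θ ≠ 0 := fun θ h0 => by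
    have := hL2 θ
    simp only [h0] at this
    exact exp_ne_zero _ this
  refine wind_core (A := fun θ => (L θ).im - ((η θ + θ) / 2 + (α - β) / 2 + Real.pi / 2))
    (u := fun θ => (η θ - β) / 2) (v := fun θ => θ / 2 + φ)
    (Y := fun θ => ‖circleMap c1 r1 (η θ) - circleMap c r θ‖) (b := 2 * b) (k := k)
    (by positivity) (by fun_prop) ?_ ?_ (fun θ => norm_pos_iff.2 (hW0 θ)) ?_ ?_ ?_ ?_ hk0
  · intro x y hxy
    have := hm hxy
    simp only; linarith
  · intro x y hxy
    simp only; linarith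
  · intro θ
    have e1 := two_circle_identity r r1 α β (η θ) θ
    rw [← hW] at e1
    have e2 : exp (L θ + -((η θ + θ) / 2 + (α - β) / 2 + Real.pi / 2 : ℝ) * I) =
        (circleMap c1 r1 (η θ) - circleMap c r θ) *
        exp (-((η θ + θ) / 2 + (α - β) / 2 + Real.pi / 2 : ℝ) * I) := by
      rw [exp_add, hL2]
    have e3 := re_im_of_exp e2
    rw [e1] at e3
    have e4 : ‖(circleMap c1 r1 (η θ) - circleMap c r θ) *
        exp (-((η θ + θ) / 2 + (α - β) / 2 + Real.pi / 2 : ℝ) * I)‖ =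
        ‖circleMap c1 r1 (η θ) - circleMap c r θ‖ := by
      rw [norm_mul, ← ofReal_neg, norm_exp_ofReal_mul_I, mul_one]
    rw [e4] at e3
    have e5 : (L θ + -((η θ + θ) / 2 + (α - β) / 2 + Real.pi / 2 : ℝ) * I).im =
        (L θ).im - ((η θ + θ) / 2 + (α - β) / 2 + Real.pi / 2) := by
      rw [← ofReal_neg, add_im, im_ofReal_mul, I_im]; ring
    rw [e5] at e3
    rw [e3]
    have e6 := hφ (θ / 2)
    have e7 : r1 * Real.sin (β - α / 2 - θ / 2) + r * Real.sin (θ / 2 - α / 2) =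
        b * Real.sin (θ / 2 + φ) := by
      rw [← e6, Real.sin_sub, Real.sin_sub (θ / 2)]; ring
    rw [e7]; ring
  · intro θ
    simp only [hL3, hk]
    have : (L θ + m * (2 * Real.pi * I)).im = (L θ).im + 2 * Real.pi * m := by
      simp; ring
    rw [this]; ring
  · intro θ
    simp only [hk]; ring
  · intro θ
    ring

/-- A nonvanishing holomorphic function on a convex open set has a holomorphic logarithm. -/
lemma Convex.exists_holomorphic_log {S : Set ℂ} (hS : Convex ℝ S) (hSo : IsOpen S)
    (hne : S.Nonempty) {g : ℂ → ℂ} (hg : DifferentiableOn ℂ g S) (h0 : ∀ z ∈ S, g z ≠ 0) :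
    ∃ φ : ℂ → ℂ, DifferentiableOn ℂ φ S ∧ ∀ z ∈ S, exp (φ z) = g z := by
  have : ContractibleSpace S := hS.contractibleSpace hne
  have : LocallyPathConnectedSpace S := hSo.locallyPathConnectedSpace
  obtain ⟨L, hL, hLe⟩ := exists_log_of_contractible (X := S) (w := fun z => g z)
    (continuousOn_iff_continuous_domRestrict.1 hg.continuousOn) (fun z => h0 z z.2)
  classical
  let φ : ℂ → ℂ := fun z => if h : z ∈ S then L ⟨z, h⟩ else 0
  have hφ : ∀ z : S, φ z = L z := fun z => by simp [φ]
  have hφc : ContinuousOn φ S := by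
    rw [continuousOn_iff_continuous_domRestrict]
    convert hL using 1
    funext z
    exact hφ z
  have hφe : ∀ z ∈ S, exp (φ z) = g z := fun z hz => by rw [hφ ⟨z, hz⟩, hLe]
  refine ⟨φ, fun z hz => DifferentiableAt.differentiableWithinAt ?_, hφe⟩
  have hca : ContinuousAt φ z := hφc.continuousAt (hSo.mem_nhds hz)
  have hev : φ =ᶠ[𝓝 z] fun v => φ z + log (g v / g z) := by
    have h1 : ∀ᶠ v in 𝓝 z, ‖φ v - φ z‖ < 1 := by
      have := hca.sub_const (φ z) |>.norm
      exact this.eventually_lt_const (by simp)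
    filter_upwards [h1, hSo.mem_nhds hz] with v hv hvS
    have h2 := (abs_lt.1 ((abs_im_le_norm (φ v - φ z)).trans_lt hv))
    have := Real.pi_gt_three
    rw [← hφe z hz, ← hφe v hvS, ← exp_sub, log_exp (by linarith) (by linarith)]
    ring
  refine DifferentiableAt.congr_of_eventuallyEq ?_ hev
  have hgz : DifferentiableAt ℂ g z := hg.differentiableAt (hSo.mem_nhds hz)
  refine (differentiableAt_const _).add ((hgz.div_const _).clog ?_)
  rw [div_self (h0 z hz)]; exact one_mem_slitPlane

lemma convex_strip (a b : ℝ) : Convex ℝ {w : ℂ | a < w.re ∧ w.re < b} := by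
  have := (convex_Ioo a b).linear_preimage reLm
  exact this

lemma isOpen_strip (a b : ℝ) : IsOpen {w : ℂ | a < w.re ∧ w.re < b} :=
  isOpen_Ioo.preimage continuous_re

lemma closure_verticalStrip_subset (l u : ℝ) : closure (HadamardThreeLines.verticalStrip l u) ⊆
    HadamardThreeLines.verticalClosedStrip l u :=
  closure_minimal (fun _ hv => ⟨hv.1.le, hv.2.le⟩) (isClosed_Icc.preimage continuous_re)

lemma strip_norm_le {u : ℝ} {S : Set ℂ} (hu : 0 < u)
    (hS : {w : ℂ | 0 < w.re ∧ w.re ≤ u} ⊆ S) {G : ℂ → ℂ} (hG : DifferentiableOn ℂ G S)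
    (h2 : ∀ w : ℂ, 0 < w.re → w.re ≤ u → ‖G w‖ ≤ 2)
    (hlim : ∀ η > 0, ∃ δ > 0, ∀ w ∈ S, w.re < δ → ‖G w‖ ≤ 1 + η) {w : ℂ} (h0 : 0 < w.re)
    (hwu : w.re ≤ u) : ‖G w‖ ≤ 2 ^ (w.re / u) := by
  have key : ∀ η > 0, ‖G w‖ ≤ (1 + η) * 2 ^ (w.re / u) := by
    intro η hη
    obtain ⟨δ, hδ, h⟩ := hlim η hη
    set l := min (δ / 2) (w.re / 2)
    have hl0 : 0 < l := lt_min (by linarith) (by linarith)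
    have hlw : l < w.re := (min_le_right _ _).trans_lt (by linarith)
    have hlδ : l < δ := (min_le_left _ _).trans_lt (by linarith)
    have hlu : l < u := hlw.trans_le hwu
    have hsub : HadamardThreeLines.verticalClosedStrip l u ⊆ S := fun v hv =>
      hS ⟨hl0.trans_le hv.1, hv.2⟩
    have := HadamardThreeLines.norm_le_interp_of_mem_verticalClosedStrip' (f := G) (z := w)
      (a := 1 + η) (b := 2) hlu ⟨hlw.le, hwu⟩
      (DifferentiableOn.diffContOnCl (hG.mono ((closure_verticalStrip_subset l u).trans hsub))) (by
        refine ⟨2, ?_⟩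
        rintro _ ⟨v, hv, rfl⟩
        exact h2 v (hl0.trans_le hv.1) hv.2)
      (fun v hv => h v (hsub ⟨(show v.re = l from hv).ge, (show v.re = l from hv).le.trans hlu.le⟩)
        (by rw [show v.re = l from hv]; exact hlδ))
      (fun v hv => h2 v (by rw [show v.re = u from hv]; exact hu) (show v.re = u from hv).le)
    refine this.trans ?_
    have ht0 : 0 ≤ (w.re - l) / (u - l) := div_nonneg (by linarith) (by linarith)
    have ht : (w.re - l) / (u - l) ≤ w.re / u := by
      rw [div_le_div_iff₀ (by linarith) hu]; nlinarith
    have h1 : (1 + η) ^ (1 - (w.re - l) / (u - l)) ≤ 1 + η := by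
      calc _ ≤ (1 + η) ^ (1 : ℝ) := Real.rpow_le_rpow_of_exponent_le (by linarith) (by linarith)
        _ = _ := Real.rpow_one _
    have h2 : (2 : ℝ) ^ ((w.re - l) / (u - l)) ≤ 2 ^ (w.re / u) :=
      Real.rpow_le_rpow_of_exponent_le (by norm_num) ht
    gcongr
  have hc : Tendsto (fun η : ℝ => (1 + η) * (2 : ℝ) ^ (w.re / u)) (𝓝[>] 0)
      (𝓝 (2 ^ (w.re / u))) := by
    have : Tendsto (fun η : ℝ => (1 + η) * (2 : ℝ) ^ (w.re / u)) (𝓝 0)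
      (𝓝 ((1 + 0) * 2 ^ (w.re / u))) := by
      apply Continuous.tendsto; fun_prop
    simpa using this.mono_left nhdsWithin_le_nhds
  exact ge_of_tendsto hc (by filter_upwards [self_mem_nhdsWithin] with η hη using key η hη)

lemma strip_deriv_le {C u : ℝ} (hC : 0 < C) {φ : ℂ → ℂ}
    (hφ : DifferentiableOn ℂ φ {w | 0 < w.re ∧ w.re < u})
    (h0 : ∀ w : ℂ, 0 < w.re → w.re < u → 0 < (φ w).re ∧ (φ w).re ≤ C * w.re) {w : ℂ}
    (hw0 : 0 < w.re) (hwu : w.re < u / 2) : ‖deriv φ w‖ ≤ 12 * C := by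
  set x := w.re
  have hmem : ∀ v ∈ ball (0 : ℂ) (x / 2), 0 < (w + v).re ∧ (w + v).re < 3 / 2 * x := by
    intro v hv
    rw [mem_ball_zero_iff] at hv
    have := abs_lt.1 ((abs_re_le_norm v).trans_lt hv)
    rw [add_re]
    constructor <;> simp only [x] at * <;> linarith
  have hd : HasDerivAt φ (deriv φ w) w :=
    (hφ.differentiableAt ((isOpen_strip 0 u).mem_nhds ⟨hw0, by linarith⟩)).hasDerivAt
  refine hd.le_of_lip' (by positivity) ?_
  have : ∀ᶠ v in 𝓝 w, ‖v - w‖ < x / 4 := by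
    have : ContinuousAt (fun v => ‖v - w‖) w := by fun_prop
    exact this.eventually_lt_const (by simpa using hw0)
  filter_upwards [this] with v hv
  have hb := borelCaratheodory_zero (f := fun v => φ (w + v) - φ w) (M := 3 / 2 * C * x)
    (R := x / 2) (z := v - w) (by positivity) (by
      refine DifferentiableOn.sub_const (DifferentiableOn.comp hφ (by fun_prop) fun v hv => ?_) _
      exact ⟨(hmem v hv).1, by linarith [(hmem v hv).2]⟩) (by
      intro v hv
      have h1 := hmem v hv
      have h2 := h0 _ h1.1 (by linarith)
      have h3 := h0 w hw0 (by linarith)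
      have h4 := mul_le_mul_of_nonneg_left h1.2.le hC.le
      simp only [mem_ofPred_eq, sub_re]
      linarith) (by positivity) (by rw [mem_ball_zero_iff]; linarith) (by simp)
  simp only [add_sub_cancel] at hb
  refine hb.trans ?_
  rw [div_le_iff₀ (by linarith)]
  have : 12 * C * ‖v - w‖ * (x / 4) ≤ 12 * C * ‖v - w‖ * (x / 2 - ‖v - w‖) := by
    gcongr; linarith
  linarith

/-- Logarithms of holomorphic functions on a strip whose modulus tends to `1` at the left edge
from above extend to Lipschitz functions. -/
lemma strip_log {ε : ℝ} (hε : 0 < ε) {G : ℂ → ℂ}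
    (hG : DifferentiableOn ℂ G {w | 0 < w.re ∧ w.re < ε})
    (h1 : ∀ w : ℂ, 0 < w.re → w.re < ε → 1 < ‖G w‖)
    (hlim : ∀ η > 0, ∃ δ > 0, ∀ w : ℂ, 0 < w.re → w.re < ε → w.re < δ → ‖G w‖ ≤ 1 + η) :
    ∃ ε' > 0, ∃ (C : ℝ) (K : ℝ≥0) (Φ : ℂ → ℂ), ε' < ε ∧ LipschitzWith K Φ ∧
      DifferentiableOn ℂ Φ {w | 0 < w.re ∧ w.re < ε'} ∧
      ∀ w : ℂ, 0 < w.re → w.re < ε' →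
        exp (Φ w) = G w ∧ 0 < (Φ w).re ∧ (Φ w).re ≤ C * w.re := by
  obtain ⟨δ, hδ, h2⟩ := hlim 1 one_pos
  set u := min (δ / 2) (ε / 2)
  have hu : 0 < u := lt_min (by linarith) (by linarith)
  have huδ : u < δ := (min_le_left _ _).trans_lt (by linarith)
  have huε : u < ε := (min_le_right _ _).trans_lt (by linarith)
  set S := {w : ℂ | 0 < w.re ∧ w.re < u}
  have hSε : S ⊆ {w : ℂ | 0 < w.re ∧ w.re < ε} := fun w hw => ⟨hw.1, hw.2.trans huε⟩
  obtain ⟨φ, hφd, hφe⟩ := (convex_strip 0 u).exists_holomorphic_log (isOpen_strip 0 u)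
    ⟨((u / 2 : ℝ) : ℂ), by simp only [mem_ofPred_eq, ofReal_re]; constructor <;> linarith⟩
    (hG.mono hSε) (fun z hz h => by
    have := h1 z hz.1 (hz.2.trans huε)
    rw [h, norm_zero] at this; linarith)
  have hre : ∀ w ∈ S, (φ w).re = Real.log ‖G w‖ := fun w hw => by
    rw [← hφe w hw, norm_exp, Real.log_exp]
  have hb : ∀ w : ℂ, 0 < w.re → w.re < u → 0 < (φ w).re ∧ (φ w).re ≤ u⁻¹ * w.re := by
    intro w hw0 hwu
    rw [hre w ⟨hw0, hwu⟩]
    have hG1 := h1 w hw0 (hwu.trans huε)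
    refine ⟨Real.log_pos hG1, ?_⟩
    have := strip_norm_le hu (S := {w : ℂ | 0 < w.re ∧ w.re < ε})
      (fun w hw => ⟨hw.1, hw.2.trans_lt huε⟩) hG (fun w hw hw' => by
      have := h2 w hw (hw'.trans_lt huε) (hw'.trans_lt huδ)
      linarith) (fun η hη => by
      obtain ⟨δ, hδ, h⟩ := hlim η hη
      exact ⟨δ, hδ, fun w hw hw' => h w hw.1 hw.2 hw'⟩) hw0 hwu.le
    calc Real.log ‖G w‖ ≤ Real.log (2 ^ (w.re / u)) := Real.log_le_log (by linarith) this
      _ = w.re / u * Real.log 2 := Real.log_rpow (by norm_num) _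
      _ ≤ w.re / u * 1 := by
        have := Real.log_two_lt_d9
        gcongr; linarith
      _ = u⁻¹ * w.re := by ring
  have hC : 0 < u⁻¹ := by positivity
  have hlip : LipschitzOnWith (Real.toNNReal (12 * u⁻¹)) φ {w : ℂ | 0 < w.re ∧ w.re < u / 2} := by
    refine Convex.lipschitzOnWith_of_nnnorm_deriv_le (𝕜 := ℂ) (fun w hw => ?_) (fun w hw => ?_)
      (convex_strip 0 (u / 2))
    · exact hφd.differentiableAt ((isOpen_strip 0 u).mem_nhds ⟨hw.1, by linarith [hw.2]⟩)
    · have := strip_deriv_le hC hφd hb hw.1 hw.2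
      rw [← NNReal.coe_le_coe, coe_nnnorm, Real.coe_toNNReal _ (by positivity)]
      exact this
  obtain ⟨Φ, hΦ, hEq⟩ := hlip.extend_finite_dimension
  refine ⟨u / 2, by positivity, u⁻¹, _, Φ, by linarith, hΦ, ?_, fun w h0 hw => ?_⟩
  · refine DifferentiableOn.congr (hφd.mono fun w hw => ⟨hw.1, by linarith [hw.2]⟩) fun w hw => ?_
    exact (hEq hw).symm
  · rw [← hEq (show w ∈ {w : ℂ | 0 < w.re ∧ w.re < u / 2} from ⟨h0, hw⟩)]
    exact ⟨hφe w ⟨h0, by linarith⟩, hb w h0 (by linarith)⟩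

lemma strip_mono {ε C : ℝ} {K : ℝ≥0} {Φ : ℂ → ℂ} (hε : 0 < ε) (hΦ : LipschitzWith K Φ)
    (hd : DifferentiableOn ℂ Φ {w | 0 < w.re ∧ w.re < ε})
    (h : ∀ w : ℂ, 0 < w.re → w.re < ε → 0 < (Φ w).re ∧ (Φ w).re ≤ C * w.re) :
    Monotone fun θ : ℝ => (Φ (θ * I)).im := by
  intro θ₁ θ₂ hθ
  by_contra! hlt
  have hc := hΦ.continuous
  set a : ℝ := (Φ (θ₁ * I)).im - (Φ (θ₂ * I)).im
  have ha : 0 < a := sub_pos.2 hlt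
  have hcont : Continuous fun x : ℝ => (Φ (x + θ₁ * I)).im - (Φ (x + θ₂ * I)).im := by fun_prop
  have hev : ∀ᶠ x : ℝ in 𝓝 0, a / 2 < (Φ (x + θ₁ * I)).im - (Φ (x + θ₂ * I)).im := by
    refine hcont.continuousAt.eventually_const_lt ?_
    simp only [Complex.ofReal_zero, zero_add]
    exact _root_.half_lt_self ha
  obtain ⟨τ, hτ, hball⟩ := Metric.eventually_nhds_iff.1 hev
  set σ := min (τ / 2) (ε / 2)
  have hσ : 0 < σ := lt_min (by linarith) (by linarith)
  have hσε : σ < ε := (min_le_right _ _).trans_lt (by linarith)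
  have hστ : σ < τ := (min_le_left _ _).trans_lt (by linarith)
  have hrect := integral_boundary_rect_eq_zero_of_continuousOn_of_differentiableOn Φ
    (⟨0, θ₁⟩ : ℂ) ⟨σ, θ₂⟩ hc.continuousOn (hd.mono fun w hw => by
      have := hw.1
      simp only [min_eq_left hσ.le, max_eq_right hσ.le] at this
      exact ⟨this.1, this.2.trans hσε⟩)
  simp only [Complex.ofReal_zero, zero_add, smul_eq_mul] at hrect
  have e := congrArg im hrect
  have hI (f : ℝ → ℂ) (hf : Continuous f) (p q : ℝ) :
      (∫ x in p..q, f x).im = ∫ x in p..q, (f x).im :=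
    (imCLM.intervalIntegral_comp_comm (hf.intervalIntegrable p q)).symm
  have hR (f : ℝ → ℂ) (hf : Continuous f) (p q : ℝ) :
      (∫ x in p..q, f x).re = ∫ x in p..q, (f x).re :=
    (reCLM.intervalIntegral_comp_comm (hf.intervalIntegrable p q)).symm
  rw [sub_im, add_im, sub_im, I_mul_im, I_mul_im, hI _ (by fun_prop), hI _ (by fun_prop),
    hR _ (by fun_prop), hR _ (by fun_prop), zero_im,
    ← intervalIntegral.integral_sub ((by fun_prop : Continuous _).intervalIntegrable _ _)
      ((by fun_prop : Continuous _).intervalIntegrable _ _)] at e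
  have e0 : ∀ y : ℝ, (Φ (y * I)).re = 0 := by
    intro y
    have h1 : Tendsto (fun x : ℝ => (Φ (x + y * I)).re) (𝓝[>] 0) (𝓝 (Φ (y * I)).re) := by
      have : Continuous fun x : ℝ => (Φ (x + y * I)).re := by fun_prop
      simpa using (this.tendsto 0).mono_left nhdsWithin_le_nhds
    have h2 : Tendsto (fun x : ℝ => C * x) (𝓝[>] 0) (𝓝 0) := by
      have : Continuous fun x : ℝ => C * x := by fun_prop
      simpa using (this.tendsto 0).mono_left nhdsWithin_le_nhds
    have h3 : ∀ᶠ x : ℝ in 𝓝[>] 0, 0 < x ∧ x < ε := Ioo_mem_nhdsGT hε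
    refine le_antisymm (le_of_tendsto_of_tendsto h1 h2 ?_) (ge_of_tendsto h1 ?_)
    · filter_upwards [h3] with x hx
      simpa using (h (x + y * I) (by simpa using hx.1) (by simpa using hx.2)).2
    · filter_upwards [h3] with x hx
      exact (h (x + y * I) (by simpa using hx.1) (by simpa using hx.2)).1.le
  simp only [e0, intervalIntegral.integral_zero, sub_zero] at e
  have i1 : 0 ≤ ∫ y in θ₁..θ₂, (Φ (σ + y * I)).re :=
    intervalIntegral.integral_nonneg hθ fun y _ =>
      (h (σ + y * I) (by simpa using hσ) (by simpa using hσε)).1.le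
  have i2 : ∫ x in (0:ℝ)..σ, a / 2 ≤
      ∫ x in (0:ℝ)..σ, ((Φ (x + θ₁ * I)).im - (Φ (x + θ₂ * I)).im) := by
    refine intervalIntegral.integral_mono_on hσ.le (by simp) (hcont.intervalIntegrable _ _)
      fun x hx => (hball ?_).le
    rw [Real.dist_0_eq_abs, abs_of_nonneg hx.1]
    exact hx.2.trans_lt hστ
  rw [intervalIntegral.integral_const, sub_zero, smul_eq_mul] at i2
  have : 0 < σ * (a / 2) := by positivity
  linarith

/-- Boundary extension at a circle: a holomorphic function on an exterior collar of a circle whose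
values approach another circle from outside extends continuously to the circle, by a monotone
map. -/
lemma exists_circle_extension {f : ℂ → ℂ} {c c' : ℂ} {r r' δ : ℝ} (hr : 0 < r) (hr' : 0 < r')
    (hδ : 0 < δ) (hf : DifferentiableOn ℂ f {z | r < ‖z - c‖ ∧ ‖z - c‖ < r + δ})
    (h1 : ∀ z, r < ‖z - c‖ → ‖z - c‖ < r + δ → r' < ‖f z - c'‖)
    (hlim : ∀ η > 0, ∃ τ > 0, ∀ z, r < ‖z - c‖ → ‖z - c‖ < r + δ → ‖z - c‖ < r + τ →
      ‖f z - c'‖ ≤ r' + η) :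
    ∃ (η : ℝ → ℝ) (k : ℤ) (K : ℝ≥0), LipschitzWith K η ∧ Monotone η ∧
      (∀ θ, η (θ + 2 * Real.pi) = η θ + 2 * Real.pi * k) ∧
      ∀ θ, Tendsto f (𝓝[{z | r < ‖z - c‖}] circleMap c r θ) (𝓝 (circleMap c' r' (η θ))) := by
  set ε := Real.log (1 + δ / r)
  have hε : 0 < ε := Real.log_pos (by have := div_pos hδ hr; linarith)
  set E : ℂ → ℂ := fun w => c + r * exp w
  have hEn : ∀ w, ‖E w - c‖ = r * Real.exp w.re := fun w => by
    simp only [E]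
    rw [add_sub_cancel_left, norm_mul, norm_real, Real.norm_of_nonneg hr.le, norm_exp]
  have hE1 : ∀ w : ℂ, 0 < w.re → r < ‖E w - c‖ := fun w hw => by
    rw [hEn]
    have := Real.one_lt_exp_iff.2 hw
    nlinarith
  have hE2 : ∀ τ > 0, ∀ w : ℂ, w.re < Real.log (1 + τ / r) → ‖E w - c‖ < r + τ := by
    intro τ hτ w hw
    rw [hEn]
    have h2 := (Real.lt_log_iff_exp_lt (by positivity)).1 hw
    calc r * Real.exp w.re < r * (1 + τ / r) := by gcongr
      _ = r + τ := by field_simp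
  set G : ℂ → ℂ := fun w => (f (E w) - c') / r'
  have hGn : ∀ w, ‖G w‖ = ‖f (E w) - c'‖ / r' := fun w => by
    simp only [G, norm_div, norm_real, Real.norm_of_nonneg hr'.le]
  obtain ⟨ε', hε', C, K, Φ, hεε, hΦ, hΦd, hΦG⟩ := strip_log hε (G := G) (by
      refine DifferentiableOn.div_const (DifferentiableOn.sub_const ?_ _) _
      refine hf.comp (by fun_prop) fun w hw => ⟨hE1 w hw.1, hE2 δ hδ w hw.2⟩) (by
      intro w h0 hw
      rw [hGn, lt_div_iff₀ hr', one_mul]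
      exact h1 _ (hE1 w h0) (hE2 δ hδ w hw)) (by
      intro η hη
      obtain ⟨τ, hτ, h⟩ := hlim (η * r') (by positivity)
      refine ⟨Real.log (1 + τ / r), Real.log_pos (by have := div_pos hτ hr; linarith), ?_⟩
      intro w h0 hw hwτ
      rw [hGn, div_le_iff₀ hr']
      have := h _ (hE1 w h0) (hE2 δ hδ w hw) (hE2 τ hτ w hwτ)
      linarith)
  have hc := hΦ.continuous
  have hlimx : ∀ y : ℝ, ∀ g : ℂ → ℂ, Continuous g →
      Tendsto (fun x : ℝ => g (x + y * I)) (𝓝[>] 0) (𝓝 (g (y * I))) := by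
    intro y g hg
    have : Continuous fun x : ℝ => g (x + y * I) := by fun_prop
    simpa using (this.tendsto 0).mono_left nhdsWithin_le_nhds
  have h3 : ∀ᶠ x : ℝ in 𝓝[>] 0, 0 < x ∧ x < ε' := Ioo_mem_nhdsGT hε'
  have e0 : ∀ y : ℝ, (Φ (y * I)).re = 0 := by
    intro y
    have h1 : Tendsto (fun x : ℝ => (Φ (x + y * I)).re) (𝓝[>] 0) (𝓝 (Φ (y * I)).re) :=
      (continuous_re.tendsto _).comp (hlimx y Φ hc)
    have h2 : Tendsto (fun x : ℝ => C * x) (𝓝[>] 0) (𝓝 0) := by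
      have : Continuous fun x : ℝ => C * x := by fun_prop
      simpa using (this.tendsto 0).mono_left nhdsWithin_le_nhds
    refine le_antisymm (le_of_tendsto_of_tendsto h1 h2 ?_) (ge_of_tendsto h1 ?_)
    · filter_upwards [h3] with x hx
      simpa using (hΦG (x + y * I) (by simpa using hx.1) (by simpa using hx.2)).2.2
    · filter_upwards [h3] with x hx
      exact (hΦG (x + y * I) (by simpa using hx.1) (by simpa using hx.2)).2.1.le
  obtain ⟨k, hk⟩ := const_of_exp_eq_one
    (φ := fun θ : ℝ => Φ ((θ : ℂ) * I + 2 * Real.pi * I) - Φ (θ * I)) (by fun_prop) (by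
    intro θ
    have t := hlimx θ (fun w => exp (Φ (w + 2 * Real.pi * I) - Φ w)) (by fun_prop)
    refine tendsto_nhds_unique t (tendsto_const_nhds.congr' ?_)
    filter_upwards [h3] with x hx
    have a1 := (hΦG (x + θ * I) (by simpa using hx.1) (by simpa using hx.2)).1
    have a2 := (hΦG (x + θ * I + 2 * Real.pi * I) (by simpa using hx.1) (by simpa using hx.2)).1
    have a3 : G (x + θ * I + 2 * Real.pi * I) = G (x + θ * I) := by
      simp only [G, E]
      rw [exp_add _ (2 * Real.pi * I), exp_two_pi_mul_I, mul_one]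
    rw [exp_sub, a2, a3, ← a1, div_self (exp_ne_zero _)])
  refine ⟨fun θ => (Φ (θ * I)).im, k, K, ?_, strip_mono hε' hΦ hΦd (fun w h0 hw => (hΦG w h0 hw).2),
    fun θ => ?_, fun θ => ?_⟩
  · refine LipschitzWith.of_dist_le_mul fun x y => ?_
    have := hΦ.dist_le_mul (x * I) (y * I)
    rw [Real.dist_eq, ← sub_im]
    refine (abs_im_le_norm _).trans ?_
    rw [← dist_eq_norm]
    have e : dist ((x : ℂ) * I) (y * I) = dist x y := by
      rw [dist_eq_norm, ← sub_mul, norm_mul, norm_I, mul_one, ← Complex.ofReal_sub, norm_real,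
        Real.norm_eq_abs, Real.dist_eq]
    rwa [e] at this
  · have := congrArg im (hk θ)
    simp only [Complex.ofReal_add, Complex.ofReal_mul, Complex.ofReal_ofNat, add_mul]
    rw [sub_im] at this
    have e : ((k : ℂ) * (2 * Real.pi * I)).im = 2 * Real.pi * k := by simp; ring
    linarith
  · have hrne : (r : ℂ) ≠ 0 := by exact_mod_cast hr.ne'
    set q : ℂ := r * exp (θ * I)
    have hq : q ≠ 0 := mul_ne_zero hrne (exp_ne_zero _)
    have hz0 : circleMap c r θ - c = q := by simp [circleMap, q]
    have hqn : ‖q‖ = r := by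
      simp only [q]
      rw [norm_mul, norm_exp_ofReal_mul_I, mul_one, norm_real, Real.norm_of_nonneg hr.le]
    set w : ℂ → ℂ := fun z => log ((z - c) / q) + θ * I
    have hwc : ContinuousAt w (circleMap c r θ) := by
      refine ContinuousAt.add (ContinuousAt.clog (by fun_prop) ?_) continuousAt_const
      rw [hz0, div_self hq]; exact one_mem_slitPlane
    have hw0 : w (circleMap c r θ) = θ * I := by
      simp only [w]; rw [hz0, div_self hq, Complex.log_one, zero_add]
    have hwre : ∀ z, (w z).re = Real.log (‖z - c‖ / r) := fun z => by
      simp only [w]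
      rw [add_re, log_re, norm_div, hqn]; simp
    have hEw : ∀ z, z ≠ c → E (w z) = z := fun z hz => by
      simp only [E, w]
      rw [exp_add, exp_log (div_ne_zero (sub_ne_zero.2 hz) hq)]
      simp only [q]
      field_simp
      ring
    have hlimΦ : Tendsto (fun z => c' + r' * exp (Φ (w z))) (𝓝 (circleMap c r θ))
        (𝓝 (c' + r' * exp (Φ (θ * I)))) := by
      rw [← hw0]
      have : ContinuousAt (fun z => c' + r' * exp (Φ (w z))) (circleMap c r θ) := by
        refine continuousAt_const.add (continuousAt_const.mul ?_)
        exact (continuous_exp.comp hc).continuousAt.comp hwc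
      exact this
    have hgoal : circleMap c' r' (Φ (θ * I)).im = c' + r' * exp (Φ (θ * I)) := by
      rw [circleMap]
      congr 3
      apply Complex.ext <;> simp [e0]
    rw [hgoal]
    refine (hlimΦ.mono_left nhdsWithin_le_nhds).congr' ?_
    have hnear : ∀ᶠ z in 𝓝 (circleMap c r θ), (w z).re < ε' := by
      have : ContinuousAt (fun z => (w z).re) (circleMap c r θ) := continuous_re.continuousAt.comp hwc
      refine this.eventually_lt_const ?_
      simp only [hw0]
      simpa using hε'
    filter_upwards [self_mem_nhdsWithin, nhdsWithin_le_nhds hnear] with z hz hzε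
    have hz' : r < ‖z - c‖ := hz
    have hzc : z ≠ c := by
      rintro rfl
      simp at hz'; linarith
    have hpos : 0 < (w z).re := by
      rw [hwre]; exact Real.log_pos ((one_lt_div hr).2 hz')
    rw [(hΦG (w z) hpos hzε).1]
    simp only [G, hEw z hzc]
    have : (r' : ℂ) ≠ 0 := by exact_mod_cast hr'.ne'
    field_simp
    ring

/-- The open annulus with inner radius `1`. -/
def collar (δ : ℝ) : Set ℂ := {ζ | 1 < ‖ζ‖ ∧ ‖ζ‖ < 1 + δ}

/-- The filter of approach to the unit circle from outside. -/
def collarFilter : Filter ℂ := comap (fun ζ : ℂ => ‖ζ‖) (𝓝[>] 1)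

lemma isPreconnected_annulus {E : Type*} [NormedAddCommGroup E] [NormedSpace ℝ E]
    (h : 1 < Module.rank ℝ E) {a : ℝ} (ha : 0 ≤ a) (b : ℝ) :
    IsPreconnected {x : E | a < ‖x‖ ∧ ‖x‖ < b} := by
  have : {x : E | a < ‖x‖ ∧ ‖x‖ < b} =
      (fun p : ℝ × E => p.1 • p.2) '' (Ioo a b ×ˢ sphere (0 : E) 1) := by
    ext x
    constructor
    · rintro ⟨h1, h2⟩
      have hx : ‖x‖ ≠ 0 := (ha.trans_lt h1).ne'
      refine ⟨(‖x‖, ‖x‖⁻¹ • x), ⟨⟨h1, h2⟩, ?_⟩, ?_⟩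
      · simp [norm_smul, hx]
      · simp [smul_smul, hx]
    · rintro ⟨⟨t, y⟩, ⟨⟨h1, h2⟩, h3⟩, rfl⟩
      have h3 : ‖y‖ = 1 := by simpa using h3
      have h1 : a < t := h1
      have h2 : t < b := h2
      simp only [mem_ofPred_eq, norm_smul, h3, mul_one, Real.norm_of_nonneg (ha.trans h1.le)]
      exact ⟨h1, h2⟩
  rw [this]
  exact (isPreconnected_Ioo.prod (isPreconnected_sphere h 0 1)).image _ (by fun_prop)

lemma rank_complex_gt : 1 < Module.rank ℝ ℂ := by
  rw [Complex.rank_real_complex]; norm_num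

lemma isPreconnected_collar (δ : ℝ) : IsPreconnected (collar δ) :=
  isPreconnected_annulus rank_complex_gt zero_le_one _

lemma isOpen_collar (δ : ℝ) : IsOpen (collar δ) :=
  (isOpen_lt continuous_const continuous_norm).inter (isOpen_lt continuous_norm continuous_const)

lemma collar_mono {δ δ' : ℝ} (h : δ ≤ δ') : collar δ ⊆ collar δ' :=
  fun _ hζ => ⟨hζ.1, hζ.2.trans_le (by linarith)⟩

lemma collarFilter_hasBasis : collarFilter.HasBasis (fun τ : ℝ => 0 < τ) collar := by
  have h := (nhdsGT_basis (1 : ℝ)).comap (fun ζ : ℂ => ‖ζ‖)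
  refine h.to_hasBasis (fun b hb => ⟨b - 1, by linarith, fun ζ hζ => ⟨hζ.1, by linarith [hζ.2]⟩⟩)
    (fun τ hτ => ⟨1 + τ, by linarith, fun ζ hζ => ⟨hζ.1, hζ.2⟩⟩)

lemma eventually_collar {P : ℂ → Prop} :
    (∀ᶠ ζ in collarFilter, P ζ) ↔ ∃ τ > 0, ∀ ζ ∈ collar τ, P ζ :=
  collarFilter_hasBasis.eventually_iff

lemma collar_mem {δ : ℝ} (hδ : 0 < δ) : collar δ ∈ collarFilter := collarFilter_hasBasis.mem_of_mem hδ

instance collarFilter_neBot : collarFilter.NeBot := by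
  refine collarFilter_hasBasis.neBot_iff.2 fun {τ} hτ => ⟨((1 + τ / 2 : ℝ) : ℂ), ?_⟩
  rw [collar, mem_ofPred_eq, norm_real, Real.norm_of_nonneg (by linarith)]
  constructor <;> linarith

/-- A holomorphic function on a collar with constant limit on the circle is constant. -/
lemma collar_const {δ : ℝ} (hδ : 0 < δ) {g : ℂ → ℂ} (hg : DifferentiableOn ℂ g (collar δ)) {x : ℂ}
    (hx : Tendsto g collarFilter (𝓝 x)) : ∃ τ > 0, τ ≤ δ ∧ ∀ ζ ∈ collar τ, g ζ = x := by
  have hb : ∀ η > 0, ∃ τ > 0, ∀ ζ ∈ collar τ, ‖g ζ - x‖ ≤ η := by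
    intro η hη
    have := Metric.tendsto_nhds.1 hx η hη
    rw [eventually_collar] at this
    obtain ⟨τ, hτ, h⟩ := this
    exact ⟨τ, hτ, fun ζ hζ => by rw [← dist_eq_norm]; exact (h ζ hζ).le⟩
  obtain ⟨τ₁, hτ₁, h1⟩ := hb 1 one_pos
  set τ₀ := min δ τ₁
  have hτ₀ : 0 < τ₀ := lt_min hδ hτ₁
  set u := Real.log (1 + τ₀) / 2
  have hu : 0 < u := half_pos (Real.log_pos (by linarith))
  have hmem : ∀ τ > 0, ∀ w : ℂ, 0 < w.re → w.re < Real.log (1 + τ) → exp w ∈ collar τ := by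
    intro τ hτ w h0 hw
    rw [collar, mem_ofPred_eq, norm_exp]
    exact ⟨Real.one_lt_exp_iff.2 h0, (Real.lt_log_iff_exp_lt (by positivity)).1 hw⟩
  have hus : ∀ w : ℂ, 0 < w.re → w.re ≤ u → exp w ∈ collar τ₀ := fun w h0 hw =>
    hmem τ₀ hτ₀ w h0 (lt_of_le_of_lt hw (by simp only [u] at *; linarith))
  have key : ∀ w : ℂ, 0 < w.re → w.re ≤ u / 2 → g (exp w) = x := by
    intro w h0 hw
    have hle : ∀ η, 0 < η → η < 1 → ‖g (exp w) - x‖ ≤ η ^ (1 / 2 : ℝ) := by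
      intro η hη hη1
      obtain ⟨τ, hτ, h⟩ := hb η hη
      set l := min (Real.log (1 + τ) / 2) (w.re / 2)
      have hlog : 0 < Real.log (1 + τ) := Real.log_pos (by linarith)
      have hl0 : 0 < l := lt_min (by linarith) (by linarith)
      have hlw : l < w.re := (min_le_right _ _).trans_lt (by linarith)
      have hlτ : l < Real.log (1 + τ) := (min_le_left _ _).trans_lt (by linarith)
      have hlu : l < u := by linarith
      have hcl := closure_verticalStrip_subset l u
      have hn : ∀ v : ℂ, 0 < v.re → v.re ≤ u → ‖g (exp v) - x‖ ≤ 1 := fun v hv hv' =>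
        h1 _ (collar_mono (min_le_right _ _) (hus v hv hv'))
      have := HadamardThreeLines.norm_le_interp_of_mem_verticalClosedStrip'
        (f := fun v => g (exp v) - x) (z := w) (a := η) (b := 1) hlu ⟨hlw.le, by linarith⟩
        (DifferentiableOn.diffContOnCl (DifferentiableOn.sub_const
          (hg.comp (by fun_prop) fun v hv => collar_mono (min_le_left _ _) (hus v
            (hl0.trans_le (hcl hv).1) (hcl hv).2)) _)) (by
          refine ⟨1, ?_⟩
          rintro _ ⟨v, hv, rfl⟩
          exact hn v (hl0.trans_le hv.1) hv.2)
        (fun v hv => h _ (hmem τ hτ v (by rw [show v.re = l from hv]; exact hl0)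
          (by rw [show v.re = l from hv]; exact hlτ)))
        (fun v hv => hn v (by rw [show v.re = u from hv]; exact hu) (show v.re = u from hv).le)
      rw [Real.one_rpow, mul_one] at this
      refine this.trans (Real.rpow_le_rpow_of_exponent_ge hη hη1.le ?_)
      have : (w.re - l) / (u - l) ≤ 1 / 2 := by
        rw [div_le_iff₀ (by linarith)]; linarith
      linarith
    have ht : Tendsto (fun η : ℝ => η ^ (1 / 2 : ℝ)) (𝓝[>] 0) (𝓝 0) := by
      have := (Real.continuousAt_rpow_const 0 (1 / 2) (Or.inr (by norm_num))).tendsto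
      rw [Real.zero_rpow (by norm_num)] at this
      exact this.mono_left nhdsWithin_le_nhds
    have := ge_of_tendsto ht (show ∀ᶠ η : ℝ in 𝓝[>] 0, ‖g (exp w) - x‖ ≤ η ^ (1 / 2 : ℝ) by
      filter_upwards [Ioo_mem_nhdsGT (show (0 : ℝ) < 1 by norm_num)] with η hη
      exact hle η hη.1 hη.2)
    exact sub_eq_zero.1 (norm_le_zero_iff.1 this)
  refine ⟨min δ (Real.exp (u / 2) - 1), lt_min hδ (by
    have := Real.one_lt_exp_iff.2 (half_pos hu); linarith), min_le_left _ _, fun ζ hζ => ?_⟩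
  have hζ0 : ζ ≠ 0 := by
    rintro rfl
    have := hζ.1; simp at this; linarith
  have hpos : 0 < ‖ζ‖ := norm_pos_iff.2 hζ0
  rw [← exp_log hζ0]
  refine key _ ?_ ?_
  · rw [log_re]; exact Real.log_pos hζ.1
  · rw [log_re, Real.log_le_iff_le_exp hpos]
    have := hζ.2
    have h' := min_le_right δ (Real.exp (u / 2) - 1)
    linarith

/-- A one-sided conformal chart of a domain at a boundary circle. -/
structure IsCollar (Ω : Set ℂ) (e : ℂ → ℂ) (δ : ℝ) : Prop where
  pos : 0 < δ
  diff : DifferentiableOn ℂ e (collar δ)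
  inj : InjOn e (collar δ)
  maps : MapsTo e (collar δ) Ω
  proper : ∀ z ∈ Ω, ∃ V ∈ 𝓝 z, ∀ᶠ ζ in collarFilter, e ζ ∉ V

lemma IsCollar.mono {Ω : Set ℂ} {e : ℂ → ℂ} {δ δ' : ℝ} (h : IsCollar Ω e δ) (h0 : 0 < δ')
    (hδ : δ' ≤ δ) : IsCollar Ω e δ' :=
  ⟨h0, h.diff.mono (collar_mono hδ), h.inj.mono (collar_mono hδ),
    fun _ hζ => h.maps (collar_mono hδ hζ), h.proper⟩

/-- `f` maps the boundary circle with chart `e` to the circle with center `c'` and radius `r'`. -/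
def CircleLim (Ω : Set ℂ) (e f : ℂ → ℂ) (c' : ℂ) (r' : ℝ) : Prop :=
  0 < r' ∧ Tendsto (fun ζ => ‖f (e ζ) - c'‖) collarFilter (𝓝 r') ∧ ∀ z ∈ Ω, ‖f z - c'‖ ≠ r'

lemma mem_of_cluster_subset {X : Type*} [TopologicalSpace X] [CompactSpace X] {M : Filter X}
    {O : Set X} (hO : IsOpen O) (h : {y | ClusterPt y M} ⊆ O) : O ∈ M := by
  by_contra hn
  have : (M ⊓ 𝓟 Oᶜ).NeBot := by
    rwa [← notMem_iff_inf_principal_compl]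
  obtain ⟨y, hy, hcl⟩ := hO.isClosed_compl.isCompact (f := M ⊓ 𝓟 Oᶜ) inf_le_right
  exact hy (h (hcl.mono inf_le_left))

/-- The cluster set of an image of a collar is connected. -/
lemma isPreconnected_cluster {X : Type*} [TopologicalSpace X] [CompactSpace X] [T2Space X]
    {F : ℂ → X} {δ : ℝ} (hδ : 0 < δ) (hF : ContinuousOn F (collar δ)) :
    IsPreconnected {y | ClusterPt y (map F collarFilter)} := by
  set Cl := {y | ClusterPt y (map F collarFilter)} with hCl
  have hclosed : IsClosed Cl := isClosed_setOfPred_clusterPt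
  rw [isPreconnected_iff_subset_of_disjoint_closed]
  intro u v hu hv hsub hdisj
  have hd : Disjoint (Cl ∩ u) (Cl ∩ v) := by
    rw [Set.disjoint_iff]
    rintro y ⟨⟨h1, h2⟩, -, h3⟩
    exact (hdisj ▸ (⟨h1, h2, h3⟩ : y ∈ Cl ∩ (u ∩ v)) : y ∈ (∅ : Set X))
  obtain ⟨U, V, hU, hV, hUs, hVs, hUV⟩ := normal_separation (hclosed.inter hu) (hclosed.inter hv) hd
  have hUVmem : U ∪ V ∈ map F collarFilter := by
    refine mem_of_cluster_subset (hU.union hV) fun y hy => ?_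
    rcases hsub hy with h | h
    exacts [Or.inl (hUs ⟨hy, h⟩), Or.inr (hVs ⟨hy, h⟩)]
  obtain ⟨τ, hτ, hτs⟩ := collarFilter_hasBasis.mem_iff.1 hUVmem
  have hpre : IsPreconnected (F '' collar (min τ δ)) :=
    (isPreconnected_collar _).image _ (hF.mono (collar_mono (min_le_right _ _)))
  have himg : F '' collar (min τ δ) ⊆ U ∪ V := by
    rintro _ ⟨ζ, hζ, rfl⟩
    exact hτs (collar_mono (min_le_left _ _) hζ)
  have hmem : F '' collar (min τ δ) ∈ map F collarFilter :=
    image_mem_map (collar_mem (lt_min hτ hδ))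
  have fin : ∀ {A B : Set X}, IsOpen B → Disjoint A B → F '' collar (min τ δ) ⊆ A → Cl ∩ B = ∅ := by
    intro A B hB hAB hA
    rw [Set.eq_empty_iff_forall_notMem]
    rintro y ⟨hy, hyB⟩
    have h1 : ClusterPt y (𝓟 A) := hy.mono (le_principal_iff.2 (mem_of_superset hmem hA))
    rw [← mem_closure_iff_clusterPt] at h1
    exact (hAB.closure_left hB).le_bot ⟨h1, hyB⟩
  rcases hpre.subset_or_subset hU hV hUV himg with h | h
  · left
    intro y hy
    rcases hsub hy with hyu | hyv
    · exact hyu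
    · have := fin hV hUV h
      exact absurd (this ▸ (⟨hy, hVs ⟨hy, hyv⟩⟩ : y ∈ Cl ∩ V)) (notMem_empty y)
  · right
    intro y hy
    rcases hsub hy with hyu | hyv
    · have := fin hU hUV.symm h
      exact absurd (this ▸ (⟨hy, hUs ⟨hy, hyu⟩⟩ : y ∈ Cl ∩ U)) (notMem_empty y)
    · exact hyv

/-- Injective holomorphic functions are open. -/
lemma image_mem_nhds_of_injOn {f : ℂ → ℂ} {U V : Set ℂ} (hU : IsOpen U)
    (hf : DifferentiableOn ℂ f U) (hi : InjOn f U) {z : ℂ} (hz : z ∈ U) (hV : V ∈ 𝓝 z) :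
    f '' V ∈ 𝓝 (f z) := by
  have ha : AnalyticAt ℂ f z := hf.analyticAt (hU.mem_nhds hz)
  rcases ha.eventually_constant_or_nhds_le_map_nhds with h | h
  · exfalso
    have h2 : ∀ᶠ w in 𝓝 z, w = z := by
      filter_upwards [h, hU.mem_nhds hz] with w hw hwU using hi hwU hz hw
    have h3 : ∀ᶠ w in 𝓝[≠] z, w = z := nhdsWithin_le_nhds h2
    have h4 : ∀ᶠ w in 𝓝[≠] z, w ≠ z := self_mem_nhdsWithin
    obtain ⟨w, h5, h6⟩ := (h3.and h4).exists
    exact h6 h5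
  · exact h (image_mem_map hV)

lemma collar_two_points {τ : ℝ} (hτ : 0 < τ) : ∃ a ∈ collar τ, ∃ b ∈ collar τ, a ≠ b := by
  refine ⟨((1 + τ / 2 : ℝ) : ℂ), ?_, ((1 + τ / 3 : ℝ) : ℂ), ?_, fun h => ?_⟩
  · rw [collar, mem_ofPred_eq, norm_real, Real.norm_of_nonneg (by linarith)]
    constructor <;> linarith
  · rw [collar, mem_ofPred_eq, norm_real, Real.norm_of_nonneg (by linarith)]
    constructor <;> linarith
  · have := ofReal_injective h
    linarith

/-- A conformal map onto a circle domain maps boundary circles to boundary circles. -/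
lemma ConformalMapOnto.exists_circleLim {Ω D : Set ℂ} {e f : ℂ → ℂ} {δ : ℝ} (hΩ : IsOpen Ω)
    (he : IsCollar Ω e δ) (hD : IsNormalizedCircleDomain D) (hf : ConformalMapOnto f Ω D) :
    ∃ c' r', CircleLim Ω e f c' r' := by
  obtain ⟨hfd, hfi, hfD⟩ := hf
  set F : ℂ → OnePoint ℂ := fun ζ => ((f (e ζ) : ℂ) : OnePoint ℂ)
  have hfe : DifferentiableOn ℂ (fun ζ => f (e ζ)) (collar δ) := hfd.comp he.diff he.maps
  have hfei : InjOn (fun ζ => f (e ζ)) (collar δ) := fun a ha b hb hab =>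
    he.inj ha hb (hfi (he.maps ha) (he.maps hb) hab)
  have hF : ContinuousOn F (collar δ) := OnePoint.continuous_coe.comp_continuousOn hfe.continuousOn
  have hpre := isPreconnected_cluster he.pos hF
  set Cl := {y | ClusterPt y (map F collarFilter)} with hCl
  have hopen : IsOpen (sph D) := OnePoint.isOpenEmbedding_coe.isOpenMap _ hD.1
  have hmemD : ∀ z ∈ Ω, f z ∈ D := fun z hz => hfD ▸ mem_image_of_mem f hz
  have hfr : Cl ⊆ frontier (sph D) := by
    intro y hy
    rw [hopen.frontier_eq]
    constructor
    · rw [mem_closure_iff_clusterPt]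
      refine hy.mono (le_principal_iff.2 (mem_map.2 ?_))
      filter_upwards [collar_mem he.pos] with ζ hζ
      exact mem_image_of_mem _ (hmemD _ (he.maps hζ))
    · rintro ⟨w, hw, rfl⟩
      rw [← hfD] at hw
      obtain ⟨z, hz, rfl⟩ := hw
      obtain ⟨V, hV, hVe⟩ := he.proper z hz
      have h1 : f '' (V ∩ Ω) ∈ 𝓝 (f z) :=
        image_mem_nhds_of_injOn hΩ hfd hfi hz (inter_mem hV (hΩ.mem_nhds hz))
      have h2 : (fun z : ℂ => (z : OnePoint ℂ)) '' (f '' (V ∩ Ω)) ∈ 𝓝 ((f z : ℂ) : OnePoint ℂ) :=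
        OnePoint.isOpenEmbedding_coe.image_mem_nhds.2 h1
      have h3 := clusterPt_iff_frequently.1 hy _ h2
      rw [Filter.frequently_map] at h3
      obtain ⟨ζ, ⟨w, ⟨v, ⟨hvV, hvΩ⟩, rfl⟩, hw⟩, hζ1, hζ2⟩ :=
        (h3.and_eventually (hVe.and (collar_mem he.pos))).exists
      have : f v = f (e ζ) := OnePoint.coe_injective hw
      have := hfi hvΩ (he.maps hζ2) this
      exact hζ1 (this ▸ hvV)
  obtain ⟨y₀, hy₀⟩ : Cl.Nonempty := by
    obtain ⟨y, -, hy⟩ := isCompact_univ (f := map F collarFilter) (by simp)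
    exact ⟨y, hy⟩
  have hcomp : Cl ⊆ connectedComponentIn (frontier (sph D)) y₀ :=
    hpre.subset_connectedComponentIn hy₀ hfr
  rcases hD.2.2 y₀ (hfr hy₀) with h | ⟨c', r', hr', h⟩
  · exfalso
    have hlim : Tendsto F collarFilter (𝓝 y₀) :=
      le_nhds_of_unique_clusterPt fun y hy => by
        have := hcomp hy
        rw [h] at this
        exact this
    induction y₀ using OnePoint.rec with
    | infty =>
      have h1 : Tendsto (fun ζ => f (e ζ)) collarFilter (cocompact ℂ) := by
        rw [← Metric.cobounded_eq_cocompact] at *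
        have := OnePoint.comap_coe_nhds_infty (X := ℂ)
        rw [coclosedCompact_eq_cocompact] at this
        rw [Metric.cobounded_eq_cocompact, ← this, tendsto_comap_iff]
        exact hlim
      have h2 : Tendsto (fun ζ => (f (e ζ))⁻¹) collarFilter (𝓝 0) :=
        (tendsto_inv₀_cobounded (α := ℂ)).comp (by rwa [Metric.cobounded_eq_cocompact])
      have h3 : ∀ᶠ ζ in collarFilter, f (e ζ) ≠ 0 := by
        have := h1 (isCompact_singleton (x := (0 : ℂ))).compl_mem_cocompact
        filter_upwards [this] with ζ hζ using hζ
      obtain ⟨τ, hτ, h4⟩ := eventually_collar.1 h3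
      obtain ⟨σ, hσ, hσ', h5⟩ := collar_const (lt_min hτ he.pos) (g := fun ζ => (f (e ζ))⁻¹)
        ((hfe.mono (collar_mono (min_le_right _ _))).inv fun ζ hζ =>
          h4 ζ (collar_mono (min_le_left _ _) hζ)) h2
      obtain ⟨a, ha, -⟩ := collar_two_points hσ
      exact h4 a (collar_mono (hσ'.trans (min_le_left _ _)) ha) (inv_eq_zero.1 (h5 a ha))
    | coe x =>
      have h1 : Tendsto (fun ζ => f (e ζ)) collarFilter (𝓝 x) :=
        OnePoint.isOpenEmbedding_coe.tendsto_nhds_iff.2 hlim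
      obtain ⟨σ, hσ, hσ', h5⟩ := collar_const he.pos hfe h1
      obtain ⟨a, ha, b, hb, hab⟩ := collar_two_points hσ
      exact hab (hfei (collar_mono hσ' ha) (collar_mono hσ' hb) ((h5 a ha).trans (h5 b hb).symm))
  · refine ⟨c', r', hr', ?_, fun z hz hzr => ?_⟩
    · rw [Metric.tendsto_nhds]
      intro ε hε
      have hO : IsOpen {w : ℂ | dist ‖w - c'‖ r' < ε} := isOpen_lt (by fun_prop) continuous_const
      have := mem_of_cluster_subset (M := map F collarFilter)
        (OnePoint.isOpenEmbedding_coe.isOpenMap _ hO) (fun y hy => by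
          have hy' := hcomp hy
          rw [h] at hy'
          obtain ⟨w, hw, rfl⟩ := hy'
          refine ⟨w, ?_, rfl⟩
          rw [mem_sphere, dist_eq_norm] at hw
          simpa [hw] using hε)
      filter_upwards [this] with ζ hζ
      obtain ⟨w, hw, hwζ⟩ := hζ
      have : w = f (e ζ) := OnePoint.coe_injective hwζ
      rw [← this]; exact hw
    · have h1 : ((f z : ℂ) : OnePoint ℂ) ∈ frontier (sph D) := by
        refine connectedComponentIn_subset _ y₀ ?_
        rw [h]
        exact mem_image_of_mem _ (by rw [mem_sphere, dist_eq_norm]; exact hzr)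
      rw [hopen.frontier_eq] at h1
      exact h1.2 (mem_image_of_mem _ (hmemD z hz))

lemma isPreconnected_annulus_center (c : ℂ) {a : ℝ} (ha : 0 ≤ a) (b : ℝ) :
    IsPreconnected {w : ℂ | a < ‖w - c‖ ∧ ‖w - c‖ < b} := by
  convert (isPreconnected_annulus rank_complex_gt ha b).image (fun w => w + c) (by fun_prop) using 1
  ext w
  constructor
  · intro h
    exact ⟨w - c, h, by simp⟩
  · rintro ⟨v, hv, rfl⟩
    simpa using hv

section
variable {Ω : Set ℂ} {e f : ℂ → ℂ} {δ r' : ℝ} {c' : ℂ}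

lemma CircleLim.cover_aux (he : IsCollar Ω e δ) (hfd : DifferentiableOn ℂ f Ω)
    (hfi : InjOn f Ω) (hl : CircleLim Ω e f c' r') {T : Set ℂ} (hT : IsPreconnected T)
    (ha : ∃ ζ ∈ collar (δ / 2), f (e ζ) ∈ T) (hb : ∀ ζ : ℂ, ‖ζ‖ = 1 + δ / 2 → f (e ζ) ∉ T)
    (hc : ∀ w ∈ T, ‖w - c'‖ ≠ r') : T ⊆ (fun ζ => f (e ζ)) '' collar (δ / 2) := by
  have hδ := he.pos
  have hge : DifferentiableOn ℂ (fun ζ => f (e ζ)) (collar δ) := hfd.comp he.diff he.maps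
  have hgi : InjOn (fun ζ => f (e ζ)) (collar δ) := fun a ha b hb hab =>
    he.inj ha hb (hfi (he.maps ha) (he.maps hb) hab)
  have hsub : collar (δ / 2) ⊆ collar δ := collar_mono (by linarith)
  refine hT.subset_of_closure_inter_subset ?_ ?_ ?_
  · rw [isOpen_iff_mem_nhds]
    rintro _ ⟨ζ, hζ, rfl⟩
    exact image_mem_nhds_of_injOn (isOpen_collar δ) hge hgi (hsub hζ)
      ((isOpen_collar _).mem_nhds hζ)
  · obtain ⟨ζ, hζ, h⟩ := ha
    exact ⟨_, h, mem_image_of_mem _ hζ⟩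
  · rintro w ⟨hw, hwT⟩
    set κ := |‖w - c'‖ - r'| / 2
    have hκ : 0 < κ := half_pos (abs_pos.2 (sub_ne_zero.2 (hc w hwT)))
    obtain ⟨σ, hσ, hσ'⟩ := eventually_collar.1 (Metric.tendsto_nhds.1 hl.2.1 κ hκ)
    set Kσ : Set ℂ := {ζ | 1 + σ / 2 ≤ ‖ζ‖ ∧ ‖ζ‖ ≤ 1 + δ / 2}
    have hK : IsCompact Kσ := by
      refine Metric.isCompact_of_isClosed_isBounded
        ((isClosed_le continuous_const continuous_norm).inter
          (isClosed_le continuous_norm continuous_const)) ?_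
      refine (isBounded_closedBall (x := (0 : ℂ)) (r := 1 + δ / 2)).subset fun ζ hζ => ?_
      rw [mem_closedBall_zero_iff]; exact hζ.2
    have hKs : Kσ ⊆ collar δ := fun ζ hζ => ⟨by linarith [hζ.1], by linarith [hζ.2]⟩
    have hcl : closure ((fun ζ => f (e ζ)) '' collar (δ / 2)) ⊆
        {v | dist ‖v - c'‖ r' ≤ κ} ∪ (fun ζ => f (e ζ)) '' Kσ := by
      refine closure_minimal ?_ (IsClosed.union (isClosed_le (by fun_prop) continuous_const)
        (hK.image_of_continuousOn (hge.continuousOn.mono hKs)).isClosed)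
      rintro _ ⟨ζ, hζ, rfl⟩
      rcases lt_or_ge ‖ζ‖ (1 + σ) with h | h
      · exact Or.inl (hσ' ζ ⟨hζ.1, h⟩).le
      · exact Or.inr ⟨ζ, ⟨by linarith, hζ.2.le⟩, rfl⟩
    rcases hcl hw with h | ⟨ζ, hζ, rfl⟩
    · exfalso
      have h : |‖w - c'‖ - r'| ≤ κ := h
      simp only [κ] at h hκ
      linarith
    · refine ⟨ζ, ⟨by linarith [hζ.1], lt_of_le_of_ne hζ.2 fun h => hb ζ h hwT⟩, rfl⟩

lemma sphere_subset_collar (hδ : 0 < δ) : sphere (0 : ℂ) (1 + δ / 2) ⊆ collar δ := fun ζ hζ => by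
  rw [mem_sphere_zero_iff_norm] at hζ
  exact ⟨by linarith, by linarith⟩

/-- The image of a collar contains a one-sided collar of the image circle. -/
lemma CircleLim.cover_out (he : IsCollar Ω e δ) (hfd : DifferentiableOn ℂ f Ω)
    (hfi : InjOn f Ω) (hl : CircleLim Ω e f c' r') (h : ∀ z ∈ Ω, r' < ‖f z - c'‖) :
    ∃ τ > 0, ∀ w, r' < ‖w - c'‖ → ‖w - c'‖ < r' + τ → ∃ ζ ∈ collar δ, f (e ζ) = w := by
  have hδ := he.pos
  have hS := sphere_subset_collar hδ
  have hge := (hfd.comp he.diff he.maps).continuousOn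
  obtain ⟨ζ₀, hζ₀, hmin⟩ := (isCompact_sphere (0 : ℂ) (1 + δ / 2)).exists_isMinOn
    (NormedSpace.sphere_nonempty.2 (by linarith))
    (f := fun ζ => ‖f (e ζ) - c'‖) ((hge.mono hS).sub continuousOn_const).norm
  have hm := h _ (he.maps (hS hζ₀))
  refine ⟨‖f (e ζ₀) - c'‖ - r', by linarith, fun w hw1 hw2 => ?_⟩
  have := hl.cover_aux he hfd hfi
    (isPreconnected_annulus_center c' hl.1.le ‖f (e ζ₀) - c'‖) ?_ (fun ζ hζ hmem => ?_)
    (fun v hv => hv.1.ne') (show w ∈ _ from ⟨hw1, by linarith⟩)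
  · obtain ⟨ζ, hζ, rfl⟩ := this
    exact ⟨ζ, collar_mono (by linarith) hζ, rfl⟩
  · obtain ⟨ζ, h1, h2⟩ := ((hl.2.1.eventually_lt_const hm).and
      (collar_mem (half_pos hδ))).exists
    exact ⟨ζ, h2, h _ (he.maps (collar_mono (by linarith) h2)), h1⟩
  · have := hmin (show ζ ∈ sphere (0 : ℂ) (1 + δ / 2) by simpa using hζ)
    simp only [mem_ofPred_eq] at this
    linarith [hmem.2]

lemma CircleLim.cover_in (he : IsCollar Ω e δ) (hfd : DifferentiableOn ℂ f Ω)
    (hfi : InjOn f Ω) (hl : CircleLim Ω e f c' r') (h : ∀ z ∈ Ω, ‖f z - c'‖ < r') :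
    ∃ τ > 0, ∀ w, ‖w - c'‖ < r' → r' - τ < ‖w - c'‖ → ∃ ζ ∈ collar δ, f (e ζ) = w := by
  have hδ := he.pos
  have hS := sphere_subset_collar hδ
  have hge := (hfd.comp he.diff he.maps).continuousOn
  obtain ⟨ζ₀, hζ₀, hmax⟩ := (isCompact_sphere (0 : ℂ) (1 + δ / 2)).exists_isMaxOn
    (NormedSpace.sphere_nonempty.2 (by linarith))
    (f := fun ζ => ‖f (e ζ) - c'‖) ((hge.mono hS).sub continuousOn_const).norm
  have hm := h _ (he.maps (hS hζ₀))
  refine ⟨r' - ‖f (e ζ₀) - c'‖, by linarith, fun w hw1 hw2 => ?_⟩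
  have := hl.cover_aux he hfd hfi
    (isPreconnected_annulus_center c' (norm_nonneg (f (e ζ₀) - c')) r') ?_ (fun ζ hζ hmem => ?_)
    (fun v hv => hv.2.ne) (show w ∈ _ from ⟨by linarith, hw1⟩)
  · obtain ⟨ζ, hζ, rfl⟩ := this
    exact ⟨ζ, collar_mono (by linarith) hζ, rfl⟩
  · obtain ⟨ζ, h1, h2⟩ := ((hl.2.1.eventually_const_lt hm).and
      (collar_mem (half_pos hδ))).exists
    exact ⟨ζ, h2, h1, h _ (he.maps (collar_mono (by linarith) h2))⟩
  · have := hmax (show ζ ∈ sphere (0 : ℂ) (1 + δ / 2) by simpa using hζ)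
    simp only [mem_ofPred_eq] at this
    linarith [hmem.1]

lemma CircleLim.gt_or_lt (hΩc : IsPreconnected Ω) (hfd : DifferentiableOn ℂ f Ω)
    (hl : CircleLim Ω e f c' r') :
    (∀ z ∈ Ω, r' < ‖f z - c'‖) ∨ (∀ z ∈ Ω, ‖f z - c'‖ < r') := by
  have hc : ContinuousOn (fun z => ‖f z - c'‖) Ω := (hfd.continuousOn.sub continuousOn_const).norm
  have hp := (hΩc.image _ hc).ordConnected
  by_contra! hcon
  obtain ⟨⟨a, ha, ha'⟩, b, hb, hb'⟩ := hcon
  obtain ⟨z, hz, hzr⟩ := hp.out (mem_image_of_mem _ ha) (mem_image_of_mem _ hb) ⟨ha', hb'⟩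
  exact hl.2.2 z hz hzr

lemma CircleLim.affine {a b : ℂ} (ha : a ≠ 0) (hl : CircleLim Ω e f c' r') :
    CircleLim Ω e (fun z => a * f z + b) (a * c' + b) (‖a‖ * r') := by
  have ha' : 0 < ‖a‖ := norm_pos_iff.2 ha
  have h : ∀ z, ‖a * f z + b - (a * c' + b)‖ = ‖a‖ * ‖f z - c'‖ := fun z => by
    rw [← norm_mul]; congr 1; ring
  refine ⟨mul_pos ha' hl.1, ?_, fun z hz => ?_⟩
  · simp only [h]
    exact hl.2.1.const_mul _
  · simp only [h]
    exact fun h2 => hl.2.2 z hz (mul_left_cancel₀ ha'.ne' h2)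

/-- The circle with center `c'` and radius `r'` does not pass through a point isolated from the
image. -/
lemma CircleLim.center_ne (hΩc : IsPreconnected Ω) (he : IsCollar Ω e δ)
    (hfd : DifferentiableOn ℂ f Ω) (hfi : InjOn f Ω) (hl : CircleLim Ω e f c' r') {ε : ℝ}
    (hε : 0 < ε) (h : ∀ z ∈ Ω, ε ≤ ‖f z‖) : ‖c'‖ ≠ r' := by
  intro h0
  have hw : ∀ t : ℝ, ‖(t : ℂ) * c'‖ = |t| * r' := fun t => by
    rw [norm_mul, norm_real, Real.norm_eq_abs, h0]
  have hwc : ∀ t : ℝ, ‖(t : ℂ) * c' - c'‖ = |t - 1| * r' := fun t => by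
    rw [← hw]; push_cast; ring_nf
  have hsm : ∀ {τ : ℝ}, 0 < τ → ∃ t, 0 < t ∧ 0 < t * r' ∧ t * r' < τ ∧ t * r' < ε ∧ t < 1 := by
    intro τ hτ
    have := hl.1
    have h1 : Tendsto (fun t => t * r') (𝓝[>] 0) (𝓝 0) := by
      simpa using ((continuous_mul_const r').tendsto 0).mono_left nhdsWithin_le_nhds
    obtain ⟨t, h2, h3, h4, h5⟩ := ((h1.eventually_lt_const hτ).and
      ((h1.eventually_lt_const hε).and (Ioo_mem_nhdsGT one_pos))).exists
    exact ⟨t, h4, mul_pos h4 this, h2, h3, h5⟩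
  rcases hl.gt_or_lt hΩc hfd with h1 | h1
  · obtain ⟨τ, hτ, ht⟩ := hl.cover_out he hfd hfi h1
    obtain ⟨t, h2, h3, h4⟩ := hsm hτ
    obtain ⟨ζ, hζ, hw'⟩ := ht (((-t : ℝ) : ℂ) * c') (by rw [hwc, abs_of_neg] <;> linarith)
      (by rw [hwc, abs_of_neg] <;> linarith)
    have := h _ (he.maps hζ)
    rw [hw', hw, abs_neg, abs_of_pos h2] at this
    linarith
  · obtain ⟨τ, hτ, ht⟩ := hl.cover_in he hfd hfi h1
    obtain ⟨t, h2, h3, h4, h5⟩ := hsm hτ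
    obtain ⟨ζ, hζ, hw'⟩ := ht ((t : ℂ) * c') (by rw [hwc, abs_of_neg] <;> linarith)
      (by rw [hwc, abs_of_neg] <;> linarith)
    have := h _ (he.maps hζ)
    rw [hw', hw, abs_of_pos h2] at this
    linarith

lemma norm_inv_sub_sq {w c : ℂ} {r : ℝ} (hw : w ≠ 0) (h : ‖c‖ ^ 2 - r ^ 2 ≠ 0) :
    ‖w⁻¹ - starRingEnd ℂ c / ((‖c‖ ^ 2 - r ^ 2 : ℝ) : ℂ)‖ ^ 2 - (r / (‖c‖ ^ 2 - r ^ 2)) ^ 2 =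
      (‖w - c‖ ^ 2 - r ^ 2) / (‖w‖ ^ 2 * (‖c‖ ^ 2 - r ^ 2)) := by
  set d := ‖c‖ ^ 2 - r ^ 2 with hd
  have hdC : (d : ℂ) ≠ 0 := by exact_mod_cast h
  have e1 : w⁻¹ - starRingEnd ℂ c / (d : ℂ) = (d - w * starRingEnd ℂ c) / (w * d) := by
    field_simp
  have hw2 : ‖w‖ ^ 2 ≠ 0 := pow_ne_zero 2 (norm_ne_zero_iff.2 hw)
  have e2 : ‖(d : ℂ) - w * starRingEnd ℂ c‖ ^ 2 - r ^ 2 * ‖w‖ ^ 2 = d * (‖w - c‖ ^ 2 - r ^ 2) := by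
    have hc : ‖c‖ ^ 2 = c.re ^ 2 + c.im ^ 2 := by rw [Complex.sq_norm, normSq_apply]; ring
    have hr2 : r ^ 2 = c.re ^ 2 + c.im ^ 2 - d := by rw [← hc, hd]; ring
    rw [hr2]
    simp only [Complex.sq_norm, normSq_apply, sub_re, sub_im, mul_re, mul_im, conj_re, conj_im,
      ofReal_re, ofReal_im]
    ring
  rw [e1, norm_div, norm_mul, norm_real, div_pow, mul_pow, Real.norm_eq_abs, sq_abs, div_pow]
  rw [div_sub_div _ _ (by positivity) (by positivity), div_eq_div_iff (by positivity)
    (mul_ne_zero hw2 h)]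
  linear_combination (‖w‖ ^ 2 * d ^ 3) * e2

lemma CircleLim.inv (hΩc : IsPreconnected Ω) (he : IsCollar Ω e δ)
    (hfd : DifferentiableOn ℂ f Ω) (hfi : InjOn f Ω) (hl : CircleLim Ω e f c' r') {ε : ℝ}
    (hε : 0 < ε) (h : ∀ z ∈ Ω, ε ≤ ‖f z‖) : ∃ c'' r'', CircleLim Ω e (fun z => (f z)⁻¹) c'' r'' := by
  have hne := hl.center_ne hΩc he hfd hfi hε h
  have hr := hl.1
  set d := ‖c'‖ ^ 2 - r' ^ 2
  have hd : d ≠ 0 := fun h0 => hne (by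
    have : ‖c'‖ ^ 2 = r' ^ 2 := by simp only [d] at h0; linarith
    exact (pow_left_inj₀ (norm_nonneg _) hr.le two_ne_zero).1 this)
  set c'' := starRingEnd ℂ c' / (d : ℂ)
  have key : ∀ z ∈ Ω, ‖(f z)⁻¹ - c''‖ ^ 2 - (r' / d) ^ 2 =
      (‖f z - c'‖ ^ 2 - r' ^ 2) / (‖f z‖ ^ 2 * d) := fun z hz =>
    norm_inv_sub_sq (norm_pos_iff.1 (hε.trans_le (h z hz))) hd
  refine ⟨c'', |r' / d|, abs_pos.2 (div_ne_zero hr.ne' hd), ?_, fun z hz h2 => ?_⟩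
  · have h1 : Tendsto (fun ζ => (‖f (e ζ) - c'‖ ^ 2 - r' ^ 2) / (‖f (e ζ)‖ ^ 2 * d)) collarFilter
        (𝓝 0) := by
      have h2 : Tendsto (fun ζ => |‖f (e ζ) - c'‖ ^ 2 - r' ^ 2| * (1 / (ε ^ 2 * |d|))) collarFilter
          (𝓝 0) := by
        have := ((hl.2.1.pow 2).sub_const (r' ^ 2)).abs.mul_const (1 / (ε ^ 2 * |d|))
        rwa [sub_self, abs_zero, zero_mul] at this
      refine squeeze_zero_norm' ?_ h2
      filter_upwards [collar_mem he.pos] with ζ hζ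
      have h3 := h _ (he.maps hζ)
      have hd' : 0 < |d| := abs_pos.2 hd
      rw [Real.norm_eq_abs, abs_div, abs_mul, abs_of_nonneg (sq_nonneg ‖f (e ζ)‖),
        div_eq_mul_one_div]
      gcongr
    have h3 : Tendsto (fun ζ => ‖(f (e ζ))⁻¹ - c''‖ ^ 2) collarFilter (𝓝 ((r' / d) ^ 2)) := by
      have h4 := h1.add_const ((r' / d) ^ 2)
      rw [zero_add] at h4
      refine h4.congr' ?_
      filter_upwards [collar_mem he.pos] with ζ hζ
      rw [← key _ (he.maps hζ)]; ring
    have := h3.sqrt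
    simp only [Real.sqrt_sq (norm_nonneg _), Real.sqrt_sq_eq_abs] at this
    exact this
  · have h3 := key z hz
    simp only at h2
    rw [h2, sq_abs, sub_self] at h3
    have h4 : 0 < ‖f z‖ ^ 2 := pow_pos (hε.trans_le (h z hz)) 2
    have h5 := (div_eq_zero_iff.1 h3.symm).resolve_right (mul_ne_zero h4.ne' hd)
    exact hl.2.2 z hz ((pow_left_inj₀ (norm_nonneg _) hr.le two_ne_zero).1 (by linarith))
end

lemma IsMobiusOn.of_affine {f : ℂ → ℂ} {Ω : Set ℂ} {a b : ℂ} (ha : a ≠ 0)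
    (h : IsMobiusOn (fun z => a * f z + b) Ω) : IsMobiusOn f Ω := by
  obtain ⟨p, q, r, s, hd, h⟩ := h
  refine ⟨p - b * r, q - b * s, a * r, a * s, ?_, fun z hz => ?_⟩
  · have : (p - b * r) * (a * s) - (q - b * s) * (a * r) = a * (p * s - q * r) := by ring
    rw [this]
    exact mul_ne_zero ha hd
  · obtain ⟨h1, h2⟩ := h z hz
    have h3 : a * r * z + a * s = a * (r * z + s) := by ring
    rw [h3]
    refine ⟨mul_ne_zero ha h1, ?_⟩
    rw [eq_div_iff h1] at h2
    rw [eq_div_iff (mul_ne_zero ha h1)]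
    linear_combination h2

lemma IsMobiusOn.of_inv {f : ℂ → ℂ} {Ω : Set ℂ} (h0 : ∀ z ∈ Ω, f z ≠ 0)
    (h : IsMobiusOn (fun z => (f z)⁻¹) Ω) : IsMobiusOn f Ω := by
  obtain ⟨p, q, r, s, hd, h⟩ := h
  refine ⟨r, s, p, q, fun h' => hd (by linear_combination -h'), fun z hz => ?_⟩
  obtain ⟨h1, h2⟩ := h z hz
  have h3 := h0 z hz
  rw [eq_div_iff h1] at h2
  have h4 : r * z + s = f z * (p * z + q) := by rw [← h2]; field_simp
  have h5 : p * z + q ≠ 0 := fun h5 => h1 (by rw [h4, h5, mul_zero])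
  exact ⟨h5, by rw [h4]; field_simp⟩

/-- Injective holomorphic functions on `Ω` that map each of the given boundary circles of `Ω` to a
circle. -/
structure CircleMapOn {ι : Type*} (Ω : Set ℂ) (e : ι → ℂ → ℂ) (f : ℂ → ℂ) : Prop where
  diff : DifferentiableOn ℂ f Ω
  inj : InjOn f Ω
  lim : ∀ i, ∃ c r, CircleLim Ω (e i) f c r

section

variable {ι : Type*} {Ω : Set ℂ} {e : ι → ℂ → ℂ} {δ : ι → ℝ} {f : ℂ → ℂ}

lemma CircleMapOn.affine {a b : ℂ} (ha : a ≠ 0) (h : CircleMapOn Ω e f) :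
    CircleMapOn Ω e (fun z => a * f z + b) := by
  refine ⟨(h.diff.const_mul a).add_const b, fun z hz w hw hzw => h.inj hz hw ?_, fun i => ?_⟩
  · have : a * f z + b = a * f w + b := hzw
    exact mul_left_cancel₀ ha (add_right_cancel this)
  · obtain ⟨c, r, hl⟩ := h.lim i
    exact ⟨_, _, hl.affine ha⟩

lemma CircleMapOn.inv (hΩc : IsPreconnected Ω) (he : ∀ i, IsCollar Ω (e i) (δ i))
    (h : CircleMapOn Ω e f) {ε : ℝ} (hε : 0 < ε) (hf : ∀ z ∈ Ω, ε ≤ ‖f z‖) :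
    CircleMapOn Ω e (fun z => (f z)⁻¹) := by
  refine ⟨h.diff.inv fun z hz => norm_pos_iff.1 (hε.trans_le (hf z hz)),
    fun z hz w hw hzw => h.inj hz hw (inv_injective hzw), fun i => ?_⟩
  obtain ⟨c, r, hl⟩ := h.lim i
  exact hl.inv hΩc (he i) h.diff h.inj hε hf

lemma CircleMapOn.exists_disc (hΩc : IsPreconnected Ω) (he : ∀ i, IsCollar Ω (e i) (δ i))
    (h : CircleMapOn Ω e f) (o : ι) :
    ∃ g, CircleMapOn Ω e g ∧ (∀ z ∈ Ω, ‖g z‖ < 1) ∧ CircleLim Ω (e o) g 0 1 ∧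
      (IsMobiusOn g Ω → IsMobiusOn f Ω) := by
  obtain ⟨c, r, hl⟩ := h.lim o
  have hr := hl.1
  have hrC : (r : ℂ)⁻¹ ≠ 0 := inv_ne_zero (by exact_mod_cast hr.ne')
  have hA := h.affine (b := -(r : ℂ)⁻¹ * c) hrC
  have hB := hl.affine (b := -(r : ℂ)⁻¹ * c) hrC
  rw [neg_mul, add_neg_cancel, norm_inv, norm_real, Real.norm_of_nonneg hr.le,
    inv_mul_cancel₀ hr.ne'] at hB
  rw [neg_mul] at hA
  rcases hB.gt_or_lt hΩc hA.diff with h1 | h1 <;> simp only [sub_zero] at h1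
  · have hlt := fun z hz => inv_lt_one_of_one_lt₀ (h1 z hz)
    simp only [← norm_inv] at hlt
    refine ⟨_, hA.inv hΩc he one_pos fun z hz => (h1 z hz).le, hlt, ⟨one_pos, ?_, fun z hz => ?_⟩,
      fun hM => (hM.of_inv fun z hz => norm_pos_iff.1 (one_pos.trans (h1 z hz))).of_affine hrC⟩
    · simpa using hB.2.1.inv₀ one_ne_zero
    · rw [sub_zero]; exact (hlt z hz).ne
  · exact ⟨_, hA, h1, hB, fun hM => hM.of_affine hrC⟩

lemma one_sub_norm_sq_blaschke {a w : ℂ} (h : 1 - starRingEnd ℂ a * w ≠ 0) :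
    1 - ‖(w - a) / (1 - starRingEnd ℂ a * w)‖ ^ 2 =
      (1 - ‖a‖ ^ 2) * (1 - ‖w‖ ^ 2) / ‖1 - starRingEnd ℂ a * w‖ ^ 2 := by
  have h2 : ‖1 - starRingEnd ℂ a * w‖ ^ 2 ≠ 0 := pow_ne_zero 2 (norm_ne_zero_iff.2 h)
  rw [norm_div, div_pow, eq_div_iff h2, sub_mul, div_mul_cancel₀ _ h2]
  simp only [← normSq_eq_norm_sq, normSq_apply]
  simp
  ring

lemma CircleMapOn.exists_zero (hΩc : IsPreconnected Ω) (he : ∀ i, IsCollar Ω (e i) (δ i))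
    (h : CircleMapOn Ω e f) (o : ι) (h1 : ∀ z ∈ Ω, ‖f z‖ < 1) (hl : CircleLim Ω (e o) f 0 1)
    {z₀ : ℂ} (hz₀ : z₀ ∈ Ω) :
    ∃ g, CircleMapOn Ω e g ∧ (∀ z ∈ Ω, ‖g z‖ < 1) ∧ CircleLim Ω (e o) g 0 1 ∧ g z₀ = 0 ∧
      (IsMobiusOn g Ω → IsMobiusOn f Ω) := by
  by_cases ha0 : f z₀ = 0
  · exact ⟨f, h, h1, hl, ha0, id⟩
  set a := f z₀ with ha
  have ha1 : ‖a‖ < 1 := h1 _ hz₀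
  have hc0 : starRingEnd ℂ a ≠ 0 := by simpa using ha0
  have hlow : ∀ w : ℂ, ‖w‖ < 1 → 1 - ‖a‖ ≤ ‖1 - starRingEnd ℂ a * w‖ := fun w hw => by
    have h2 := norm_sub_norm_le (1 : ℂ) (starRingEnd ℂ a * w)
    rw [norm_one, norm_mul, RCLike.norm_conj] at h2
    nlinarith [norm_nonneg a]
  have hne : ∀ w : ℂ, ‖w‖ < 1 → 1 - starRingEnd ℂ a * w ≠ 0 := fun w hw =>
    norm_pos_iff.1 ((sub_pos.2 ha1).trans_le (hlow w hw))
  have haa : 1 / starRingEnd ℂ a - a ≠ 0 := by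
    intro h0
    have h2 : a * starRingEnd ℂ a = 1 := by
      rw [sub_eq_zero, div_eq_iff hc0] at h0
      exact h0.symm
    have h3 := congrArg norm h2
    rw [norm_mul, RCLike.norm_conj, norm_one] at h3
    nlinarith [norm_nonneg a]
  have hform : ∀ w : ℂ, ‖w‖ < 1 → (1 / starRingEnd ℂ a - a) * (-starRingEnd ℂ a * w + 1)⁻¹ +
      -(1 / starRingEnd ℂ a) = (w - a) / (1 - starRingEnd ℂ a * w) := fun w hw => by
    have h2 := hne w hw
    have h3 : -starRingEnd ℂ a * w + 1 = 1 - starRingEnd ℂ a * w := by ring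
    rw [h3]
    field_simp
    ring
  have hA := h.affine (b := 1) (neg_ne_zero.2 hc0)
  have hlow' : ∀ z ∈ Ω, 1 - ‖a‖ ≤ ‖-starRingEnd ℂ a * f z + 1‖ := fun z hz => by
    rw [show -starRingEnd ℂ a * f z + 1 = 1 - starRingEnd ℂ a * f z by ring]
    exact hlow _ (h1 z hz)
  have hB := (hA.inv hΩc he (sub_pos.2 ha1) hlow').affine (b := -(1 / starRingEnd ℂ a)) haa
  have hlt : ∀ w : ℂ, ‖w‖ < 1 → ‖(w - a) / (1 - starRingEnd ℂ a * w)‖ < 1 := fun w hw => by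
    have h2 := one_sub_norm_sq_blaschke (hne w hw)
    have h3 : 0 < ‖1 - starRingEnd ℂ a * w‖ := norm_pos_iff.2 (hne w hw)
    have h4 : 0 < (1 - ‖a‖ ^ 2) * (1 - ‖w‖ ^ 2) / ‖1 - starRingEnd ℂ a * w‖ ^ 2 := by
      have := norm_nonneg w
      have := norm_nonneg a
      refine div_pos (mul_pos ?_ ?_) (by positivity) <;> nlinarith
    rw [← h2] at h4
    nlinarith [norm_nonneg ((w - a) / (1 - starRingEnd ℂ a * w))]
  refine ⟨_, hB, fun z hz => ?_, ⟨one_pos, ?_, fun z hz => ?_⟩, ?_, fun hM =>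
    ((hM.of_affine haa).of_inv fun z hz =>
      norm_pos_iff.1 ((sub_pos.2 ha1).trans_le (hlow' z hz))).of_affine (neg_ne_zero.2 hc0)⟩
  · rw [hform _ (h1 z hz)]; exact hlt _ (h1 z hz)
  · have hm : ∀ᶠ ζ in collarFilter, e o ζ ∈ Ω :=
      mem_of_superset (collar_mem (he o).pos) fun ζ hζ => (he o).maps hζ
    have hl' : Tendsto (fun ζ => ‖f (e o ζ)‖) collarFilter (𝓝 1) := by simpa using hl.2.1
    have hup : Tendsto (fun ζ => Real.sqrt (1 - (1 - ‖a‖ ^ 2) * (1 - ‖f (e o ζ)‖ ^ 2) /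
        (1 - ‖a‖) ^ 2)) collarFilter (𝓝 1) := by
      simpa using (((((hl'.pow 2).const_sub 1).const_mul (1 - ‖a‖ ^ 2)).div_const
        ((1 - ‖a‖) ^ 2)).const_sub 1).sqrt
    refine tendsto_of_tendsto_of_tendsto_of_le_of_le' hup tendsto_const_nhds ?_ ?_
    · filter_upwards [hm] with ζ hζ
      have hw := h1 _ hζ
      rw [sub_zero, hform _ hw]
      refine Real.sqrt_le_iff.2 ⟨norm_nonneg _, ?_⟩
      have h2 := one_sub_norm_sq_blaschke (hne _ hw)
      have h3 : (1 - ‖a‖ ^ 2) * (1 - ‖f (e o ζ)‖ ^ 2) / ‖1 - starRingEnd ℂ a * f (e o ζ)‖ ^ 2 ≤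
          (1 - ‖a‖ ^ 2) * (1 - ‖f (e o ζ)‖ ^ 2) / (1 - ‖a‖) ^ 2 := by
        have ha2 := sub_pos.2 ha1
        have hlw := hlow _ hw
        have : 0 ≤ (1 - ‖a‖ ^ 2) * (1 - ‖f (e o ζ)‖ ^ 2) := by
          have := norm_nonneg a
          have := norm_nonneg (f (e o ζ))
          refine mul_nonneg ?_ ?_ <;> nlinarith
        gcongr
      linarith
    · filter_upwards [hm] with ζ hζ
      rw [sub_zero, hform _ (h1 _ hζ)]
      exact (hlt _ (h1 _ hζ)).le
  · simp only [sub_zero, hform _ (h1 z hz)]; exact (hlt _ (h1 z hz)).ne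
  · rw [hform _ (h1 _ hz₀), ← ha, sub_self, zero_div]

/-- Shrinking disjoint collars: injectivity prevents two of them from having common images. -/
lemma CircleMapOn.not_common {i j : ι} (he : ∀ i, IsCollar Ω (e i) (δ i)) (h : CircleMapOn Ω e f)
    {τ : ℝ} (hd : Disjoint (e i '' collar τ) (e j '' collar τ)) {ζ ξ : ℂ}
    (hζ : ζ ∈ collar (min τ (δ i))) (hξ : ξ ∈ collar (min τ (δ j))) : f (e i ζ) ≠ f (e j ξ) :=
  fun heq => Set.disjoint_left.1 hd (mem_image_of_mem _ (collar_mono (min_le_left _ _) hζ))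
    (h.inj ((he i).maps (collar_mono (min_le_right _ _) hζ))
      ((he j).maps (collar_mono (min_le_right _ _) hξ)) heq ▸
        mem_image_of_mem _ (collar_mono (min_le_left _ _) hξ))

lemma closedBall_subset_of_annulus {c c' : ℂ} {r r' τ : ℝ} (hr : 0 < r) (hτ : 0 < τ)
    (h : ∀ w, ‖w - c‖ < r → r - τ < ‖w - c‖ → ‖w - c'‖ ≤ r') : ‖c - c'‖ + r ≤ r' := by
  obtain ⟨u, hu, huc⟩ := RCLike.exists_norm_mul_eq_self (c - c')
  refine le_of_forall_pos_lt_add fun η hη => ?_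
  set s := min (r / 2) (min (τ / 2) (η / 2))
  have hs : 0 < s := lt_min (by linarith) (lt_min (by linarith) (by linarith))
  have hs1 : s ≤ r / 2 := min_le_left _ _
  have hs2 : s ≤ τ / 2 := (min_le_right _ _).trans (min_le_left _ _)
  have hs3 : s ≤ η / 2 := (min_le_right _ _).trans (min_le_right _ _)
  have hn : ‖c + ((r - s : ℝ) : ℂ) * u - c‖ = r - s := by
    rw [add_sub_cancel_left, norm_mul, hu, mul_one, norm_real, Real.norm_of_nonneg (by linarith)]
  have h1 := h (c + ((r - s : ℝ) : ℂ) * u) (by rw [hn]; linarith) (by rw [hn]; linarith)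
  have h2 : c + ((r - s : ℝ) : ℂ) * u - c' = ((‖c - c'‖ + (r - s) : ℝ) : ℂ) * u := by
    push_cast
    linear_combination -huc
  rw [h2, norm_mul, hu, mul_one, norm_real, Real.norm_of_nonneg (by
    have := norm_nonneg (c - c'); linarith)] at h1
  linarith

section

variable (he : ∀ i, IsCollar Ω (e i) (δ i))
  (hdisj : ∀ i j, i ≠ j → ∃ τ > 0, Disjoint (e i '' collar τ) (e j '' collar τ))
  (h : CircleMapOn Ω e f)
include he hdisj h

lemma CircleMapOn.exterior (hΩc : IsPreconnected Ω) {o : ι} (h1 : ∀ z ∈ Ω, ‖f z‖ < 1)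
    (hl : CircleLim Ω (e o) f 0 1) {i : ι} (hi : i ≠ o) {c : ℂ} {r : ℝ}
    (hc : CircleLim Ω (e i) f c r) : ∀ z ∈ Ω, r < ‖f z - c‖ := by
  refine (hc.gt_or_lt hΩc h.diff).resolve_right fun hlt => ?_
  obtain ⟨τ, hτ, hd⟩ := hdisj i o hi
  have hcov : ∀ {j : ι} {c : ℂ} {r : ℝ}, CircleLim Ω (e j) f c r → (∀ z ∈ Ω, ‖f z - c‖ < r) →
      ∃ σ > 0, ∀ w, ‖w - c‖ < r → r - σ < ‖w - c‖ → ∃ ζ ∈ collar (min τ (δ j)), f (e j ζ) = w :=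
    fun {j c r} hl hlt => hl.cover_in ((he j).mono (lt_min hτ (he j).pos) (min_le_right _ _))
      h.diff h.inj hlt
  obtain ⟨σ, hσ, hs⟩ := hcov hc hlt
  obtain ⟨σ', hσ', hs'⟩ := hcov hl (by simpa using h1)
  have hmem : ∀ {j : ι} {ζ}, ζ ∈ collar (min τ (δ j)) → e j ζ ∈ Ω := fun {j ζ} hζ =>
    (he j).maps (collar_mono (min_le_right _ _) hζ)
  have h2 := closedBall_subset_of_annulus (c' := 0) (r' := 1) hc.1 hσ fun w hw hw' => by
    obtain ⟨ζ, hζ, rfl⟩ := hs w hw hw'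
    rw [sub_zero]; exact (h1 _ (hmem hζ)).le
  have h3 := closedBall_subset_of_annulus (c' := c) (r' := r) one_pos hσ' fun w hw hw' => by
    obtain ⟨ζ, hζ, rfl⟩ := hs' w hw hw'
    exact (hlt _ (hmem hζ)).le
  rw [sub_zero] at h2
  rw [zero_sub, norm_neg] at h3
  have hr1 : r = 1 := by have := norm_nonneg c; linarith
  have hc0 : c = 0 := norm_le_zero_iff.1 (by linarith)
  subst hr1 hc0
  set s := min (1 / 2) (min (σ / 2) (σ' / 2))
  have hs0 : 0 < s := lt_min (by norm_num) (lt_min (by linarith) (by linarith))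
  have e1 : s ≤ 1 / 2 := min_le_left _ _
  have e2 : s ≤ σ / 2 := (min_le_right _ _).trans (min_le_left _ _)
  have e3 : s ≤ σ' / 2 := (min_le_right _ _).trans (min_le_right _ _)
  have hn : ‖((1 - s : ℝ) : ℂ) - 0‖ = 1 - s := by
    rw [sub_zero, norm_real, Real.norm_of_nonneg (by linarith)]
  obtain ⟨ζ, hζ, hζ'⟩ := hs _ (by rw [hn]; linarith) (by rw [hn]; linarith)
  obtain ⟨ξ, hξ, hξ'⟩ := hs' _ (by rw [hn]; linarith) (by rw [hn]; linarith)
  exact h.not_common he hd hζ hξ (hζ'.trans hξ'.symm)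

variable {i j : ι} (hij : i ≠ j) {ci cj : ℂ} {ri rj : ℝ}
  (hi : CircleLim Ω (e i) f ci ri) (hi' : ∀ z ∈ Ω, ri < ‖f z - ci‖)
  (hj : CircleLim Ω (e j) f cj rj) (hj' : ∀ z ∈ Ω, rj < ‖f z - cj‖)
include hij hi hi' hj hj'

lemma CircleMapOn.disjoint_aux (hr : ri ≤ rj) :
    ri + rj < ‖cj - ci‖ := by
  obtain ⟨τ, hτ, hd⟩ := hdisj i j hij
  have hcov : ∀ {j : ι} {c : ℂ} {r : ℝ}, CircleLim Ω (e j) f c r → (∀ z ∈ Ω, r < ‖f z - c‖) →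
      ∃ σ > 0, ∀ w, r < ‖w - c‖ → ‖w - c‖ < r + σ → ∃ ζ ∈ collar (min τ (δ j)), f (e j ζ) = w :=
    fun {j c r} hl hlt => hl.cover_out ((he j).mono (lt_min hτ (he j).pos) (min_le_right _ _))
      h.diff h.inj hlt
  have hmem : ∀ {j : ι} {ζ}, ζ ∈ collar (min τ (δ j)) → e j ζ ∈ Ω := fun {j ζ} hζ =>
    (he j).maps (collar_mono (min_le_right _ _) hζ)
  obtain ⟨σ, hσ, hs⟩ := hcov hi hi'
  obtain ⟨σ', hσ', hs'⟩ := hcov hj hj'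
  by_contra! hle
  have hri := hi.1
  by_cases heq : ci = cj ∧ ri = rj
  · obtain ⟨rfl, rfl⟩ := heq
    set s := min (σ / 2) (σ' / 2)
    have hs0 : 0 < s := lt_min (by linarith) (by linarith)
    have e2 : s ≤ σ / 2 := min_le_left _ _
    have e3 : s ≤ σ' / 2 := min_le_right _ _
    have hn : ‖ci + ((ri + s : ℝ) : ℂ) - ci‖ = ri + s := by
      rw [add_sub_cancel_left, norm_real, Real.norm_of_nonneg (by linarith)]
    obtain ⟨ζ, hζ, hζ'⟩ := hs _ (by rw [hn]; linarith) (by rw [hn]; linarith)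
    obtain ⟨ξ, hξ, hξ'⟩ := hs' _ (by rw [hn]; linarith) (by rw [hn]; linarith)
    exact h.not_common he hd hζ hξ (hζ'.trans hξ'.symm)
  obtain ⟨u, hu, huc⟩ := RCLike.exists_norm_mul_eq_self (cj - ci)
  have hpos : 0 < rj - ri + ‖cj - ci‖ := by
    by_contra! h0
    have h1 := norm_nonneg (cj - ci)
    have h2 : ‖cj - ci‖ ≤ 0 := by linarith
    exact heq ⟨(sub_eq_zero.1 (norm_le_zero_iff.1 h2)).symm, by linarith⟩
  set s := min (σ / 2) (rj - ri + ‖cj - ci‖)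
  have hs0 : 0 < s := lt_min (by linarith) hpos
  have e2 : s ≤ σ / 2 := min_le_left _ _
  have e3 : s ≤ rj - ri + ‖cj - ci‖ := min_le_right _ _
  have hn : ‖ci + ((ri + s : ℝ) : ℂ) * u - ci‖ = ri + s := by
    rw [add_sub_cancel_left, norm_mul, hu, mul_one, norm_real, Real.norm_of_nonneg (by linarith)]
  obtain ⟨ζ, hζ, hζ'⟩ := hs _ (by rw [hn]; linarith) (by rw [hn]; linarith)
  have h1 := hj' _ (hmem hζ)
  rw [hζ', show ci + ((ri + s : ℝ) : ℂ) * u - cj = ((ri + s - ‖cj - ci‖ : ℝ) : ℂ) * u by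
    push_cast; linear_combination huc, norm_mul, hu, mul_one, norm_real] at h1
  have h2 : ‖ri + s - ‖cj - ci‖‖ ≤ rj := abs_le.2 ⟨by linarith, by linarith⟩
  linarith

lemma CircleMapOn.disjoint : Disjoint (closedBall ci ri) (closedBall cj rj) := by
  refine closedBall_disjoint_closedBall ?_
  rw [dist_eq_norm]
  rcases le_total ri rj with hr | hr
  · rw [← norm_neg, neg_sub]
    exact h.disjoint_aux he hdisj hij hi hi' hj hj' hr
  · rw [add_comm]
    exact h.disjoint_aux he hdisj hij.symm hj hj' hi hi' hr

end

lemma CircleLim.closedBall_subset (he : ∀ i, IsCollar Ω (e i) (δ i)) (h : CircleMapOn Ω e f)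
    (h1 : ∀ z ∈ Ω, ‖f z‖ < 1) {i : ι} {c : ℂ} {r : ℝ} (hc : CircleLim Ω (e i) f c r)
    (hc' : ∀ z ∈ Ω, r < ‖f z - c‖) : ‖c‖ + r ≤ 1 := by
  obtain ⟨τ, hτ, hs⟩ := hc.cover_out (he i) h.diff h.inj hc'
  have := closedBall_subset_of_annulus (c := c) (c' := 0) (r' := 1) (r := r + τ) (τ := τ)
    (by linarith [hc.1]) hτ fun w hw hw' => by
      obtain ⟨ζ, hζ, rfl⟩ := hs w (by linarith) hw
      rw [sub_zero]; exact (h1 _ ((he i).maps hζ)).le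
  rw [sub_zero] at this
  linarith

/-- The normalization of a conformal map onto a circle domain. -/
theorem ConformalMapOnto.exists_normalized {D : Set ℂ} (hΩ : IsOpen Ω) (hΩc : IsPreconnected Ω)
    (he : ∀ i, IsCollar Ω (e i) (δ i))
    (hdisj : ∀ i j, i ≠ j → ∃ τ > 0, Disjoint (e i '' collar τ) (e j '' collar τ))
    (hD : IsNormalizedCircleDomain D) (hf : ConformalMapOnto f Ω D) (o : ι) {z₀ : ℂ}
    (hz₀ : z₀ ∈ Ω) : ∃ (g : ℂ → ℂ) (c : ι → ℂ) (r : ι → ℝ), DifferentiableOn ℂ g Ω ∧ InjOn g Ω ∧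
      g z₀ = 0 ∧ (∀ z ∈ Ω, ‖g z‖ < 1) ∧ Tendsto (fun ζ => ‖g (e o ζ)‖) collarFilter (𝓝 1) ∧
      (∀ i, i ≠ o → 0 < r i ∧ (∀ z ∈ Ω, r i < ‖g z - c i‖) ∧ ‖c i‖ + r i ≤ 1 ∧
        Tendsto (fun ζ => ‖g (e i ζ) - c i‖) collarFilter (𝓝 (r i))) ∧
      (∀ i j, i ≠ o → j ≠ o → i ≠ j → Disjoint (closedBall (c i) (r i)) (closedBall (c j) (r j))) ∧
      (IsMobiusOn g Ω → IsMobiusOn f Ω) := by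
  have h : CircleMapOn Ω e f := ⟨hf.1, hf.2.1, fun i => hf.exists_circleLim hΩ (he i) hD⟩
  obtain ⟨g₁, hg₁, h1, hl1, hM1⟩ := h.exists_disc hΩc he o
  obtain ⟨g, hg, h1, hl, hz, hM⟩ := hg₁.exists_zero hΩc he o h1 hl1 hz₀
  choose c r hc using hg.lim
  have hext : ∀ i, i ≠ o → ∀ z ∈ Ω, r i < ‖g z - c i‖ := fun i hi =>
    hg.exterior he hdisj hΩc h1 hl hi (hc i)
  exact ⟨g, c, r, hg.diff, hg.inj, hz, h1, by simpa using hl.2.1, fun i hi =>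
    ⟨(hc i).1, hext i hi, (hc i).closedBall_subset he hg h1 (hext i hi), (hc i).2.1⟩,
    fun i j hi hj hij => hg.disjoint he hdisj hij (hc i) (hext i hi) (hc j) (hext j hj),
    fun hM' => hM1 (hM hM')⟩

end

/-- An injective holomorphic function has nonvanishing derivative. -/
lemma deriv_ne_zero_of_injOn {U : Set ℂ} (hU : IsOpen U) {f : ℂ → ℂ} (hf : DifferentiableOn ℂ f U)
    (hi : InjOn f U) {z₀ : ℂ} (hz₀ : z₀ ∈ U) : deriv f z₀ ≠ 0 := by
  have hfa : AnalyticAt ℂ f z₀ := hf.analyticAt (hU.mem_nhds hz₀)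
  have hsub : AnalyticAt ℂ (fun z => f z - f z₀) z₀ := hfa.sub analyticAt_const
  have hne : ¬∀ᶠ z in 𝓝 z₀, f z - f z₀ = 0 := by
    intro h
    have h1 : ∀ᶠ z in 𝓝[≠] z₀, f z - f z₀ = 0 ∧ z ∈ U :=
      (h.and (hU.mem_nhds hz₀)).filter_mono nhdsWithin_le_nhds
    obtain ⟨z, ⟨hz, hzU⟩, hzne⟩ := (h1.and self_mem_nhdsWithin).exists
    exact hzne (hi hzU hz₀ (sub_eq_zero.1 hz))
  obtain ⟨n, g, hg, hg0, hfg⟩ := hsub.exists_eventuallyEq_pow_smul_nonzero_iff.2 hne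
  have hn0 : n ≠ 0 := by
    rintro rfl
    have := hfg.self_of_nhds
    simp at this
    exact hg0 this.symm
  rcases eq_or_ne n 1 with rfl | hn1
  · have hd : HasDerivAt (fun z => (z - z₀) ^ 1 • g z) (g z₀) z₀ := by
      have := ((hasDerivAt_id z₀).sub_const z₀).mul hg.differentiableAt.hasDerivAt
      simpa [Pi.mul_def] using this
    have hd2 : HasDerivAt (fun z => f z - f z₀) (g z₀) z₀ := hd.congr_of_eventuallyEq hfg
    have := hd2.add_const (f z₀)
    simp only [sub_add_cancel] at this
    rw [this.deriv]; exact hg0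
  exfalso
  have hnC : (n : ℂ) ≠ 0 := by exact_mod_cast hn0
  set p : ℂ → ℂ := fun z => exp (log (g z / g z₀) / n) with hp
  have hq : AnalyticAt ℂ (fun z => g z / g z₀) z₀ := hg.div analyticAt_const hg0
  have hpa : AnalyticAt ℂ p z₀ := by
    refine ((hq.clog ?_).div analyticAt_const hnC).cexp
    rw [div_self hg0]; exact one_mem_slitPlane
  have hp0 : p z₀ = 1 := by simp [hp, hg0]
  have hha : AnalyticAt ℂ (fun z => (z - z₀) * p z) z₀ := (analyticAt_id.sub analyticAt_const).mul hpa
  have hder : HasDerivAt (fun z => (z - z₀) * p z) 1 z₀ := by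
    have := ((hasDerivAt_id z₀).sub_const z₀).mul hpa.differentiableAt.hasDerivAt
    simpa [hp0, Pi.mul_def] using this
  have hst : HasStrictDerivAt (fun z => (z - z₀) * p z) 1 z₀ := by
    have := hha.hasStrictDerivAt
    rwa [hder.deriv] at this
  have hmap := hst.map_nhds_eq one_ne_zero
  have hgne : ∀ᶠ z in 𝓝 z₀, g z ≠ 0 := hg.continuousAt.eventually_ne hg0
  set S := {z | z ∈ U ∧ f z - f z₀ = g z₀ * ((z - z₀) * p z) ^ n}
  have hS : S ∈ 𝓝 z₀ := by
    filter_upwards [hU.mem_nhds hz₀, hfg, hgne] with z h1 h2 h3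
    refine ⟨h1, ?_⟩
    have : p z ^ n = g z / g z₀ := by
      simp only [hp]
      rw [← Complex.exp_nat_mul, mul_div_cancel₀ _ hnC, exp_log (div_ne_zero h3 hg0)]
    rw [h2, mul_pow, this, smul_eq_mul]
    field_simp
  have him : (fun z => (z - z₀) * p z) '' S ∈ 𝓝 (0 : ℂ) := by
    have := image_mem_map (m := fun z => (z - z₀) * p z) hS
    rw [hmap] at this
    simpa using this
  set ω := exp (2 * Real.pi * I / n)
  have hω : IsPrimitiveRoot ω n := Complex.isPrimitiveRoot_exp n hn0
  have hω1 : ω ≠ 1 := hω.ne_one (by omega)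
  have him2 : ∀ᶠ t in 𝓝 (0 : ℂ), ω * t ∈ (fun z => (z - z₀) * p z) '' S := by
    have : Tendsto (fun t : ℂ => ω * t) (𝓝 0) (𝓝 0) := by
      have := (continuous_const_mul ω).tendsto (0 : ℂ)
      rwa [mul_zero] at this
    exact this him
  have h3 : ∀ᶠ t in 𝓝[≠] (0 : ℂ), t ∈ (fun z => (z - z₀) * p z) '' S ∧
      ω * t ∈ (fun z => (z - z₀) * p z) '' S := (him2.and him).mono (fun t h => ⟨h.2, h.1⟩)
        |>.filter_mono nhdsWithin_le_nhds
  obtain ⟨t, ⟨⟨a, ha, hat⟩, ⟨b, hb, hbt⟩⟩, ht⟩ := (h3.and self_mem_nhdsWithin).exists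
  have hab : a = b := by
    refine hi ha.1 hb.1 ?_
    have h1 := ha.2
    have h2 := hb.2
    simp only at hat hbt
    rw [hat] at h1
    rw [hbt, mul_pow, hω.pow_eq_one, one_mul] at h2
    linear_combination h1 - h2
  subst hab
  have h5 : t = ω * t := hat.symm.trans hbt
  have : (ω - 1) * t = 0 := by linear_combination -h5
  rcases mul_eq_zero.1 this with h | h
  · exact hω1 (sub_eq_zero.1 h)
  · exact ht h

/-- The Poisson kernel of the half plane, without the factor `1 / π`. -/
def poisson (a y : ℝ) : ℝ := a / (a ^ 2 + y ^ 2)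

lemma poisson_nonneg {a : ℝ} (ha : 0 ≤ a) (y : ℝ) : 0 ≤ poisson a y := by
  unfold poisson; positivity

lemma measurable_poisson : Measurable (fun p : ℝ × ℝ => poisson p.1 p.2) := by
  unfold poisson
  fun_prop

@[fun_prop]
lemma Measurable.poisson {α : Type*} [MeasurableSpace α] {f g : α → ℝ} (hf : Measurable f)
    (hg : Measurable g) : Measurable (fun x => poisson (f x) (g x)) :=
  measurable_poisson.comp (hf.prodMk hg)

lemma poisson_neg (a y : ℝ) : poisson a (-y) = poisson a y := by simp [poisson]

lemma poisson_le_inv {a : ℝ} (ha : 0 < a) (y : ℝ) : poisson a y ≤ 1 / a := by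
  rw [poisson, div_le_div_iff₀ (by positivity) ha]
  nlinarith [sq_nonneg y]

lemma hasDerivAt_arctan_div {a : ℝ} (ha : 0 < a) (c v : ℝ) :
    HasDerivAt (fun v => Real.arctan ((v - c) / a)) (poisson a (v - c)) v := by
  have h := (((hasDerivAt_id v).sub_const c).div_const a).arctan
  refine h.congr_deriv ?_
  simp only [poisson, id]
  field_simp

lemma tendsto_arctan_div_atTop {a : ℝ} (ha : 0 < a) (c : ℝ) :
    Tendsto (fun v => Real.arctan ((v - c) / a)) atTop (𝓝 (Real.pi / 2)) :=
  (Real.tendsto_arctan_atTop.mono_right nhdsWithin_le_nhds).comp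
    ((tendsto_atTop_add_const_right atTop (-c) tendsto_id).atTop_div_const ha)

lemma tendsto_arctan_div_atBot {a : ℝ} (ha : 0 < a) (c : ℝ) :
    Tendsto (fun v => Real.arctan ((v - c) / a)) atBot (𝓝 (-(Real.pi / 2))) :=
  (Real.tendsto_arctan_atBot.mono_right nhdsWithin_le_nhds).comp
    ((tendsto_atBot_add_const_right atBot (-c) tendsto_id).atBot_div_const ha)

lemma integrable_poisson {a : ℝ} (ha : 0 < a) (c : ℝ) :
    Integrable (fun v => poisson a (v - c)) := by
  have h : Integrable (poisson a) := by
    have := (integrable_inv_one_add_sq.comp_div ha.ne').const_mul (1 / a)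
    refine this.congr (ae_of_all _ fun v => ?_)
    simp only [poisson]
    field_simp
  exact h.comp_sub_right c

lemma integral_poisson {a : ℝ} (ha : 0 < a) (c : ℝ) : ∫ v, poisson a (v - c) = Real.pi := by
  rw [integral_of_hasDerivAt_of_tendsto (fun v => hasDerivAt_arctan_div ha c v)
    (integrable_poisson ha c) (tendsto_arctan_div_atBot ha c) (tendsto_arctan_div_atTop ha c)]
  ring

lemma tendsto_log_ratio {l : Filter ℝ} (hl : Tendsto (fun v : ℝ => v⁻¹) l (𝓝 0))
    (hl' : ∀ᶠ v in l, v ≠ 0) {t x : ℝ} (y : ℝ) (ht : 0 < t) (hx : 0 < x) :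
    Tendsto (fun v => Real.log (t ^ 2 + v ^ 2) - Real.log (x ^ 2 + (v - y) ^ 2)) l (𝓝 0) := by
  have h1 : Tendsto (fun v : ℝ => Real.log (t ^ 2 * v⁻¹ ^ 2 + 1) -
      Real.log (x ^ 2 * v⁻¹ ^ 2 + (1 - y * v⁻¹) ^ 2)) l (𝓝 0) := by
    have : Tendsto (fun v : ℝ => Real.log (t ^ 2 * v⁻¹ ^ 2 + 1) -
      Real.log (x ^ 2 * v⁻¹ ^ 2 + (1 - y * v⁻¹) ^ 2)) l (𝓝 (Real.log (t ^ 2 * 0 ^ 2 + 1) -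
      Real.log (x ^ 2 * 0 ^ 2 + (1 - y * 0) ^ 2))) := by
      refine Tendsto.sub ?_ ?_
      · exact (((hl.pow 2).const_mul _).add_const 1).log (by norm_num)
      · exact (((hl.pow 2).const_mul _).add (((hl.const_mul y).const_sub 1).pow 2)).log
          (by norm_num)
    simpa using this
  refine h1.congr' ?_
  filter_upwards [hl'] with v hv
  have hv2 : (v ^ 2) ≠ 0 := pow_ne_zero 2 hv
  have e1 : t ^ 2 + v ^ 2 = v ^ 2 * (t ^ 2 * v⁻¹ ^ 2 + 1) := by field_simp
  have e2 : x ^ 2 + (v - y) ^ 2 = v ^ 2 * (x ^ 2 * v⁻¹ ^ 2 + (1 - y * v⁻¹) ^ 2) := by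
    field_simp
  have hp : 0 < x ^ 2 + (v - y) ^ 2 := by positivity
  rw [e1, e2, Real.log_mul hv2 (by positivity), Real.log_mul hv2 (fun h => by
    rw [e2, h, mul_zero] at hp; exact lt_irrefl _ hp)]
  ring

/-- The semigroup property of the Poisson kernel. -/
lemma integral_poisson_mul {x t y : ℝ} (hx : 0 < x) (ht : 0 < t) (hy : y ≠ 0) :
    ∫ v, poisson x (v - y) * poisson t v = Real.pi * poisson (x + t) y := by
  have hD : (y ^ 2 + (x + t) ^ 2) * (y ^ 2 + (x - t) ^ 2) ≠ 0 := by positivity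
  set D := (y ^ 2 + (x + t) ^ 2) * (y ^ 2 + (x - t) ^ 2)
  have hder : ∀ v, HasDerivAt (fun v => y * x * t / D * (Real.log (t ^ 2 + v ^ 2) -
      Real.log (x ^ 2 + (v - y) ^ 2)) + x * (x ^ 2 + y ^ 2 - t ^ 2) / D *
      Real.arctan ((v - 0) / t) + t * (y ^ 2 + t ^ 2 - x ^ 2) / D * Real.arctan ((v - y) / x))
      (poisson x (v - y) * poisson t v) v := by
    intro v
    have h1 : HasDerivAt (fun v : ℝ => t ^ 2 + v ^ 2) (2 * v) v := by
      simpa using ((hasDerivAt_id v).pow 2).const_add (t ^ 2)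
    have h2 : HasDerivAt (fun v : ℝ => x ^ 2 + (v - y) ^ 2) (2 * (v - y)) v := by
      simpa using (((hasDerivAt_id v).sub_const y).pow 2).const_add (x ^ 2)
    have hp1 : t ^ 2 + v ^ 2 ≠ 0 := by positivity
    have hp2 : x ^ 2 + (v - y) ^ 2 ≠ 0 := by positivity
    refine (((((h1.log hp1).sub (h2.log hp2)).const_mul (y * x * t / D)).add
      ((hasDerivAt_arctan_div ht 0 v).const_mul _)).add
      ((hasDerivAt_arctan_div hx y v).const_mul _)).congr_deriv ?_
    simp only [poisson, sub_zero]
    field_simp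
    simp only [D]
    ring
  have hint : Integrable (fun v => poisson x (v - y) * poisson t v) := by
    have := (integrable_poisson ht 0).bdd_mul (c := 1 / x) (f := fun v => poisson x (v - y))
      (Measurable.aestronglyMeasurable (by fun_prop)) (ae_of_all _ fun v => by
        rw [Real.norm_of_nonneg (poisson_nonneg hx.le _)]
        exact poisson_le_inv hx _)
    simpa using this
  have hinf : ∀ l : Filter ℝ, Tendsto (fun v : ℝ => v⁻¹) l (𝓝 0) → (∀ᶠ v in l, v ≠ 0) → ∀ m : ℝ,
      (∀ {a : ℝ} (_ : 0 < a) (c : ℝ), Tendsto (fun v => Real.arctan ((v - c) / a)) l (𝓝 m)) →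
      Tendsto (fun v => y * x * t / D * (Real.log (t ^ 2 + v ^ 2) -
      Real.log (x ^ 2 + (v - y) ^ 2)) + x * (x ^ 2 + y ^ 2 - t ^ 2) / D *
      Real.arctan ((v - 0) / t) + t * (y ^ 2 + t ^ 2 - x ^ 2) / D * Real.arctan ((v - y) / x)) l
      (𝓝 (y * x * t / D * 0 + x * (x ^ 2 + y ^ 2 - t ^ 2) / D * m +
        t * (y ^ 2 + t ^ 2 - x ^ 2) / D * m)) := fun l h1 h2 m h3 =>
    (((tendsto_log_ratio h1 h2 y ht hx).const_mul _).add ((h3 ht 0).const_mul _)).add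
      ((h3 hx y).const_mul _)
  rw [integral_of_hasDerivAt_of_tendsto hder hint
    (hinf atBot tendsto_inv_atBot_zero (eventually_ne_atBot 0) _ tendsto_arctan_div_atBot)
    (hinf atTop tendsto_inv_atTop_zero (eventually_ne_atTop 0) _ tendsto_arctan_div_atTop)]
  have hq : (x + t) ^ 2 + y ^ 2 ≠ 0 := by positivity
  rw [poisson]
  field_simp
  simp only [D]
  ring

lemma lintegral_poisson {a : ℝ} (ha : 0 < a) (c : ℝ) :
    ∫⁻ v, ENNReal.ofReal (poisson a (v - c)) = ENNReal.ofReal Real.pi := by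
  rw [← integral_poisson ha c, ofReal_integral_eq_lintegral_ofReal (integrable_poisson ha c)
    (ae_of_all _ fun v => poisson_nonneg ha.le _)]

lemma lintegral_poisson' {a : ℝ} (ha : 0 < a) (c : ℝ) :
    ∫⁻ v, ENNReal.ofReal (poisson a (c - v)) = ENNReal.ofReal Real.pi := by
  rw [← lintegral_poisson ha c]
  exact lintegral_congr fun v => by rw [← neg_sub, poisson_neg]

lemma lintegral_poisson_mul {x t y u : ℝ} (hx : 0 < x) (ht : 0 < t) (hy : y ≠ u) :
    ∫⁻ v, ENNReal.ofReal (poisson x (y - v)) * ENNReal.ofReal (poisson t (v - u)) =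
      ENNReal.ofReal Real.pi * ENNReal.ofReal (poisson (x + t) (y - u)) := by
  have h := integral_poisson_mul hx ht (sub_ne_zero.2 hy)
  rw [← ENNReal.ofReal_mul Real.pi_pos.le, ← h, ofReal_integral_eq_lintegral_ofReal]
  · refine (lintegral_add_right_eq_self _ u).symm.trans (lintegral_congr fun v => ?_)
    rw [ENNReal.ofReal_mul (poisson_nonneg hx.le _), ← poisson_neg, add_sub_cancel_right,
      show -(y - (v + u)) = v - (y - u) by ring]
  · have := (integrable_poisson ht 0).bdd_mul (c := 1 / x) (f := fun v => poisson x (v - (y - u)))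
      (Measurable.aestronglyMeasurable (by fun_prop)) (ae_of_all _ fun v => by
        rw [Real.norm_of_nonneg (poisson_nonneg hx.le _)]
        exact poisson_le_inv hx _)
    simpa using this
  · exact ae_of_all _ fun v => mul_nonneg (poisson_nonneg hx.le _) (poisson_nonneg ht.le _)

/-- A superposition of Poisson kernels at heights between `τ` and `1`. -/
def bump (τ v : ℝ) : ℝ≥0∞ := ∫⁻ a in Ioc τ 1, ENNReal.ofReal (2 * poisson a v)

lemma measurable_bump (τ : ℝ) : Measurable (bump τ) := by
  unfold bump
  exact Measurable.lintegral_prod_right' (f := fun p : ℝ × ℝ => ENNReal.ofReal (2 * poisson p.2 p.1))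
    (by fun_prop)

lemma le_bump {τ v : ℝ} (hτ : 0 < τ) (hτ1 : τ ≤ 1) (hv : |v| ≤ τ) :
    ENNReal.ofReal (Real.log (1 / τ)) ≤ bump τ v := by
  have h1 : Real.log (1 / τ) = ∫ a in Ioc τ 1, 1 / a := by
    rw [← intervalIntegral.integral_of_le hτ1, integral_one_div_of_pos hτ one_pos]
  have hint : IntegrableOn (fun a : ℝ => 1 / a) (Ioc τ 1) := by
    rw [← intervalIntegrable_iff_integrableOn_Ioc_of_le hτ1]
    refine intervalIntegral.intervalIntegrable_one_div (fun x hx => ?_) continuousOn_id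
    rw [uIcc_of_le hτ1] at hx
    exact (hτ.trans_le hx.1).ne'
  rw [h1, ofReal_integral_eq_lintegral_ofReal hint ((ae_restrict_iff' measurableSet_Ioc).2
    (ae_of_all _ fun a ha => by have := hτ.trans ha.1; simp only [Pi.zero_apply]; positivity))]
  refine setLIntegral_mono' measurableSet_Ioc fun a ha => ENNReal.ofReal_le_ofReal ?_
  have ha0 := hτ.trans ha.1
  have hv2 : v ^ 2 ≤ a ^ 2 := sq_le_sq' (by have := neg_abs_le v; linarith [ha.1])
    (by have := le_abs_self v; linarith [ha.1])
  rw [poisson, mul_div_assoc', div_le_div_iff₀ ha0 (by positivity)]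
  nlinarith

lemma lintegral_poisson_bump {τ t v : ℝ} (hτ : 0 < τ) (ht : 0 < t) (hv : v ≠ 0) :
    ∫⁻ u, ENNReal.ofReal (poisson t (v - u)) * bump τ u ≤
      ENNReal.ofReal Real.pi * (bump τ v + ENNReal.ofReal (2 * t)) := by
  have h1 : ∫⁻ u, ENNReal.ofReal (poisson t (v - u)) * bump τ u =
      ∫⁻ a in Ioc τ 1, ∫⁻ u, ENNReal.ofReal (poisson t (v - u)) *
        ENNReal.ofReal (2 * poisson a u) := by
    simp only [bump]
    rw [lintegral_lintegral_swap]
    · refine lintegral_congr fun u => ?_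
      rw [lintegral_const_mul _ (by fun_prop)]
    · fun_prop
  have h2 : ∀ a ∈ Ioc τ 1, ∫⁻ u, ENNReal.ofReal (poisson t (v - u)) *
      ENNReal.ofReal (2 * poisson a u) =
      ENNReal.ofReal Real.pi * ENNReal.ofReal (2 * poisson (a + t) v) := fun a ha => by
    have h3 := lintegral_poisson_mul ht (hτ.trans ha.1) hv
    simp only [sub_zero] at h3
    rw [ENNReal.ofReal_mul zero_le_two, mul_left_comm, add_comm a, ← h3, ← lintegral_const_mul _
      (by fun_prop)]
    refine lintegral_congr fun u => ?_
    rw [ENNReal.ofReal_mul zero_le_two]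
    ring
  rw [h1, setLIntegral_congr_fun measurableSet_Ioc h2, lintegral_const_mul _ (by fun_prop)]
  gcongr
  have h4 : ∫⁻ a in Ioc τ 1, ENNReal.ofReal (2 * poisson (a + t) v) =
      ∫⁻ a in Ioc (τ + t) (1 + t), ENNReal.ofReal (2 * poisson a v) := by
    rw [← lintegral_indicator measurableSet_Ioc, ← lintegral_indicator measurableSet_Ioc]
    refine Eq.trans ?_ (lintegral_add_right_eq_self _ t)
    refine lintegral_congr fun a => ?_
    simp [indicator]
  rw [h4]
  have hsub : Ioc (τ + t) (1 + t) ⊆ Ioc τ 1 ∪ Ioc 1 (1 + t) := fun a ha => by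
    rcases le_or_gt a 1 with h | h
    · exact Or.inl ⟨by linarith [ha.1], h⟩
    · exact Or.inr ⟨h, ha.2⟩
  refine (lintegral_mono_set hsub).trans ((lintegral_union_le _ _ _).trans ?_)
  refine add_le_add le_rfl ?_
  calc ∫⁻ a in Ioc 1 (1 + t), ENNReal.ofReal (2 * poisson a v)
      ≤ ∫⁻ _ in Ioc 1 (1 + t), ENNReal.ofReal 2 := by
        refine setLIntegral_mono' measurableSet_Ioc fun a ha => ENNReal.ofReal_le_ofReal ?_
        have h5 := poisson_le_inv (one_pos.trans ha.1) v
        have h6 : 1 / a ≤ 1 := by rw [div_le_one (one_pos.trans ha.1)]; exact ha.1.le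
        linarith
    _ = ENNReal.ofReal (2 * t) := by
        rw [setLIntegral_const, Real.volume_Ioc, ← ENNReal.ofReal_mul zero_le_two]
        congr 2; ring

lemma lintegral_bump_le {τ : ℝ} (hτ : 0 < τ) (c : ℝ) :
    ∫⁻ v, bump τ (v - c) ≤ ENNReal.ofReal (2 * Real.pi) := by
  rw [lintegral_sub_right_eq_self]
  simp only [bump]
  rw [lintegral_lintegral_swap (by fun_prop)]
  have h2 : ∀ a ∈ Ioc τ 1, ∫⁻ v, ENNReal.ofReal (2 * poisson a v) =
      ENNReal.ofReal (2 * Real.pi) := fun a ha => by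
    have h3 := lintegral_poisson (hτ.trans ha.1) 0
    simp only [sub_zero] at h3
    rw [ENNReal.ofReal_mul zero_le_two, ← h3, ← lintegral_const_mul _ (by fun_prop)]
    exact lintegral_congr fun u => ENNReal.ofReal_mul zero_le_two
  rw [setLIntegral_congr_fun measurableSet_Ioc h2, setLIntegral_const, Real.volume_Ioc]
  calc _ ≤ ENNReal.ofReal (2 * Real.pi) * ENNReal.ofReal 1 := by gcongr; linarith
    _ = _ := by simp

lemma poisson_add_ge {t : ℝ} (ht : 0 ≤ t) (v : ℝ) : poisson 1 v - t ≤ poisson (1 + t) v := by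
  have h1 : 0 < 1 ^ 2 + v ^ 2 := by positivity
  have h2 : 0 < (1 + t) ^ 2 + v ^ 2 := by positivity
  have h3 : poisson (1 + t) v - (poisson 1 v - t) = (t * (v ^ 2 - (1 + t)) +
      t * ((1 ^ 2 + v ^ 2) * ((1 + t) ^ 2 + v ^ 2))) / ((1 ^ 2 + v ^ 2) * ((1 + t) ^ 2 + v ^ 2)) := by
    rw [poisson, poisson]; field_simp; ring
  have h4 : 0 ≤ poisson (1 + t) v - (poisson 1 v - t) := by
    rw [h3]
    refine div_nonneg ?_ (by positivity)
    rw [← mul_add]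
    refine mul_nonneg ht ?_
    have : 0 ≤ v ^ 2 := sq_nonneg v
    nlinarith [mul_nonneg this ht, mul_nonneg this (sq_nonneg t), mul_nonneg this this]
  linarith

section

variable {ι : Type*} (τ y : ι → ℝ)

/-- The weighted sum of the bumps centered at the points `y j`. -/
def barrier (v : ℝ) : ℝ≥0∞ := ∑' j, ENNReal.ofReal (1 / Real.log (1 / τ j)) * bump (τ j) (v - y j)

/-- A density vanishing near the points `y j`. -/
def density (v : ℝ) : ℝ≥0∞ := ENNReal.ofReal (2 * poisson 1 v) - (1 + barrier τ y v)

variable {τ y}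

lemma measurable_barrier [Countable ι] : Measurable (barrier τ y) := by
  unfold barrier
  exact Measurable.tsum fun j =>
    ((measurable_bump (τ j)).comp (measurable_id.sub_const (y j))).const_mul _

lemma measurable_density [Countable ι] : Measurable (density τ y) := by
  unfold density
  have := measurable_barrier (τ := τ) (y := y)
  fun_prop

lemma density_le_one (v : ℝ) : density τ y v ≤ 1 := by
  have h := poisson_le_inv one_pos v
  refine tsub_le_iff_right.2 ?_
  calc ENNReal.ofReal (2 * poisson 1 v) ≤ ENNReal.ofReal 2 :=
        ENNReal.ofReal_le_ofReal (by norm_num at h; linarith)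
    _ = 1 + 1 := by norm_num
    _ ≤ 1 + (1 + barrier τ y v) := by gcongr; exact le_self_add

lemma density_eq_zero_of_one_le {v : ℝ} (hv : 1 ≤ |v|) : density τ y v = 0 := by
  refine tsub_eq_zero_iff_le.2 (le_trans ?_ le_self_add)
  rw [← ENNReal.ofReal_one]
  refine ENNReal.ofReal_le_ofReal ?_
  have : 1 ≤ v ^ 2 := by rw [← sq_abs]; nlinarith
  rw [poisson, mul_one_div, div_le_one (by positivity)]
  linarith

lemma density_eq_zero_of_near (hτ : ∀ j, 0 < τ j ∧ τ j < 1) {v : ℝ} {j : ι} (hv : |v - y j| ≤ τ j) :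
    density τ y v = 0 := by
  have hlog : 0 < Real.log (1 / τ j) := Real.log_pos (by
    rw [one_lt_div (hτ j).1]; exact (hτ j).2)
  refine tsub_eq_zero_iff_le.2 ?_
  have h := poisson_le_inv one_pos v
  have h1 : 1 ≤ barrier τ y v := by
    refine le_trans ?_ (ENNReal.le_tsum j)
    calc (1 : ℝ≥0∞) = ENNReal.ofReal (1 / Real.log (1 / τ j)) *
          ENNReal.ofReal (Real.log (1 / τ j)) := by
          rw [← ENNReal.ofReal_mul (by positivity), one_div_mul_cancel hlog.ne',
            ENNReal.ofReal_one]
      _ ≤ _ := by gcongr; exact le_bump (hτ j).1 (hτ j).2.le hv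
  calc ENNReal.ofReal (2 * poisson 1 v) ≤ ENNReal.ofReal 2 :=
        ENNReal.ofReal_le_ofReal (by norm_num at h; linarith)
    _ = 1 + 1 := by norm_num
    _ ≤ 1 + barrier τ y v := by gcongr

lemma lintegral_poisson_barrier [Countable ι] (hτ : ∀ j, 0 < τ j ∧ τ j < 1)
    (hs : ∑' j, ENNReal.ofReal (1 / Real.log (1 / τ j)) ≤ ENNReal.ofReal (1 / 20)) {t v : ℝ}
    (ht : 0 < t) (hv : ∀ j, v ≠ y j) :
    ∫⁻ u, ENNReal.ofReal (poisson t (v - u)) * barrier τ y u ≤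
      ENNReal.ofReal Real.pi * (barrier τ y v + ENNReal.ofReal t) := by
  have hm : ∀ j, Measurable fun v => bump (τ j) (v - y j) := fun j =>
    (measurable_bump (τ j)).comp (measurable_id.sub_const (y j))
  simp only [barrier, ← ENNReal.tsum_mul_left]
  rw [lintegral_tsum fun j => by have := hm j; fun_prop]
  have h1 : ∀ j, ∫⁻ u, ENNReal.ofReal (poisson t (v - u)) *
      (ENNReal.ofReal (1 / Real.log (1 / τ j)) * bump (τ j) (u - y j)) ≤
      ENNReal.ofReal (1 / Real.log (1 / τ j)) * (ENNReal.ofReal Real.pi *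
        (bump (τ j) (v - y j) + ENNReal.ofReal (2 * t))) := fun j => by
    have h2 := lintegral_poisson_bump (hτ j).1 ht (sub_ne_zero.2 (hv j))
    refine le_trans (le_of_eq ?_) (mul_le_mul_right h2 _)
    rw [← lintegral_const_mul _ (by have := measurable_bump (τ j); fun_prop),
      ← lintegral_sub_right_eq_self (fun u => ENNReal.ofReal (1 / Real.log (1 / τ j)) *
        (ENNReal.ofReal (poisson t (v - y j - u)) * bump (τ j) u)) (y j)]
    refine lintegral_congr fun u => ?_
    rw [sub_sub_sub_cancel_right]
    ring
  refine (ENNReal.tsum_le_tsum h1).trans ?_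
  calc _ = ENNReal.ofReal Real.pi * (∑' j, ENNReal.ofReal (1 / Real.log (1 / τ j)) *
        bump (τ j) (v - y j) + (∑' j, ENNReal.ofReal (1 / Real.log (1 / τ j))) *
          ENNReal.ofReal (2 * t)) := by
        rw [← ENNReal.tsum_mul_right, ← ENNReal.tsum_add, ← ENNReal.tsum_mul_left]
        exact tsum_congr fun j => by ring
    _ ≤ ENNReal.ofReal Real.pi * (∑' j, ENNReal.ofReal (1 / Real.log (1 / τ j)) *
        bump (τ j) (v - y j) + ENNReal.ofReal (1 / 20) * ENNReal.ofReal (2 * t)) := by gcongr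
    _ ≤ _ := by
        rw [← ENNReal.ofReal_mul (by norm_num)]
        gcongr
        linarith

lemma density_le_lintegral [Countable ι] (hτ : ∀ j, 0 < τ j ∧ τ j < 1)
    (hs : ∑' j, ENNReal.ofReal (1 / Real.log (1 / τ j)) ≤ ENNReal.ofReal (1 / 20)) {t v : ℝ}
    (ht : 0 < t) (hv : ∀ j, v ≠ y j) (hv0 : v ≠ 0) :
    ENNReal.ofReal Real.pi * density τ y v ≤
      (∫⁻ u, ENNReal.ofReal (poisson t (v - u)) * density τ y u) +
        ENNReal.ofReal (3 * Real.pi * t) := by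
  have hpi := Real.pi_pos
  have hb := measurable_barrier (τ := τ) (y := y)
  have hd := measurable_density (τ := τ) (y := y)
  have h1 : ENNReal.ofReal Real.pi * ENNReal.ofReal (2 * poisson 1 v) ≤
      (∫⁻ u, ENNReal.ofReal (poisson t (v - u)) * ENNReal.ofReal (2 * poisson 1 u)) +
      ENNReal.ofReal (2 * Real.pi * t) := by
    have h2 := lintegral_poisson_mul ht one_pos hv0
    simp only [sub_zero] at h2
    have h3 : ∫⁻ u, ENNReal.ofReal (poisson t (v - u)) * ENNReal.ofReal (2 * poisson 1 u) =
        ENNReal.ofReal Real.pi * ENNReal.ofReal (2 * poisson (t + 1) v) := by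
      rw [ENNReal.ofReal_mul zero_le_two, mul_left_comm, ← h2, ← lintegral_const_mul _
        (by fun_prop)]
      refine lintegral_congr fun u => ?_
      rw [ENNReal.ofReal_mul zero_le_two]
      ring
    have h5 := poisson_nonneg (show 0 ≤ t + 1 by linarith) v
    rw [h3, ← ENNReal.ofReal_mul hpi.le, ← ENNReal.ofReal_mul hpi.le,
      ← ENNReal.ofReal_add (by positivity) (by positivity)]
    refine ENNReal.ofReal_le_ofReal ?_
    have h4 := poisson_add_ge ht.le v
    rw [add_comm] at h4
    nlinarith
  have h6 : ∫⁻ u, ENNReal.ofReal (poisson t (v - u)) * ENNReal.ofReal (2 * poisson 1 u) ≤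
      (∫⁻ u, ENNReal.ofReal (poisson t (v - u)) * density τ y u) + (ENNReal.ofReal Real.pi +
        ENNReal.ofReal Real.pi * (barrier τ y v + ENNReal.ofReal t)) := by
    calc _ ≤ ∫⁻ u, (ENNReal.ofReal (poisson t (v - u)) * density τ y u +
          (ENNReal.ofReal (poisson t (v - u)) + ENNReal.ofReal (poisson t (v - u)) *
            barrier τ y u)) := by
          refine lintegral_mono fun u => ?_
          calc _ ≤ ENNReal.ofReal (poisson t (v - u)) * (density τ y u + (1 + barrier τ y u)) := by
                gcongr; exact le_tsub_add
            _ = _ := by ring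
      _ = (∫⁻ u, ENNReal.ofReal (poisson t (v - u)) * density τ y u) + (ENNReal.ofReal Real.pi +
        ∫⁻ u, ENNReal.ofReal (poisson t (v - u)) * barrier τ y u) := by
          rw [lintegral_add_left (by fun_prop), lintegral_add_left (by fun_prop),
            lintegral_poisson' ht]
      _ ≤ _ := by gcongr; exact lintegral_poisson_barrier hτ hs ht hv
  have e : ENNReal.ofReal (3 * Real.pi * t) = ENNReal.ofReal Real.pi * ENNReal.ofReal t +
      ENNReal.ofReal (2 * Real.pi * t) := by
    rw [← ENNReal.ofReal_mul hpi.le, ← ENNReal.ofReal_add (by positivity) (by positivity)]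
    congr 1; ring
  have hden : density τ y v = ENNReal.ofReal (2 * poisson 1 v) - (1 + barrier τ y v) := rfl
  rw [hden, ENNReal.mul_sub (fun _ _ => ENNReal.ofReal_ne_top)]
  refine tsub_le_iff_right.2 ((h1.trans (add_le_add h6 le_rfl)).trans (le_of_eq ?_))
  rw [e]
  ring

lemma lintegral_density_pos [Countable ι] (hτ : ∀ j, 0 < τ j ∧ τ j < 1)
    (hs : ∑' j, ENNReal.ofReal (1 / Real.log (1 / τ j)) ≤ ENNReal.ofReal (1 / 20)) :
    0 < ∫⁻ v, density τ y v := by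
  have hb := measurable_barrier (τ := τ) (y := y)
  have h1 : ∫⁻ v, barrier τ y v ≤ ENNReal.ofReal (2 / 5) := by
    simp only [barrier]
    have hm : ∀ j, Measurable fun v => bump (τ j) (v - y j) := fun j =>
      (measurable_bump (τ j)).comp (measurable_id.sub_const (y j))
    rw [lintegral_tsum fun j => ((hm j).const_mul _).aemeasurable]
    calc _ ≤ ∑' j, ENNReal.ofReal (1 / Real.log (1 / τ j)) * ENNReal.ofReal (2 * Real.pi) := by
          refine ENNReal.tsum_le_tsum fun j => ?_
          rw [lintegral_const_mul _ (hm j)]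
          gcongr
          exact lintegral_bump_le (hτ j).1 (y j)
      _ = (∑' j, ENNReal.ofReal (1 / Real.log (1 / τ j))) * ENNReal.ofReal (2 * Real.pi) :=
          ENNReal.tsum_mul_right
      _ ≤ ENNReal.ofReal (1 / 20) * ENNReal.ofReal (2 * Real.pi) := by gcongr
      _ ≤ _ := by
          rw [← ENNReal.ofReal_mul (by norm_num)]
          refine ENNReal.ofReal_le_ofReal ?_
          have := Real.pi_lt_four
          linarith
  have h2 : ENNReal.ofReal (3 / 5) ≤ (∫⁻ v, density τ y v) + ENNReal.ofReal (2 / 5) := by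
    calc ENNReal.ofReal (3 / 5) = ∫⁻ _ in Icc (-1 / 2 : ℝ) (1 / 2), ENNReal.ofReal (3 / 5) := by
          rw [setLIntegral_const, Real.volume_Icc]; norm_num
      _ ≤ ∫⁻ v in Icc (-1 / 2 : ℝ) (1 / 2), (density τ y v + barrier τ y v) := by
          refine setLIntegral_mono' measurableSet_Icc fun v hv => ?_
          refine (ENNReal.add_le_add_iff_left ENNReal.one_ne_top).1 ?_
          calc (1 : ℝ≥0∞) + ENNReal.ofReal (3 / 5) ≤ ENNReal.ofReal (2 * poisson 1 v) := by
                rw [← ENNReal.ofReal_one, ← ENNReal.ofReal_add (by norm_num) (by norm_num)]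
                refine ENNReal.ofReal_le_ofReal ?_
                have : v ^ 2 ≤ 1 / 4 := by nlinarith [hv.1, hv.2]
                rw [poisson, mul_one_div, le_div_iff₀ (by positivity)]
                nlinarith
            _ ≤ density τ y v + (1 + barrier τ y v) := le_tsub_add
            _ = _ := by ring
      _ ≤ ∫⁻ v, (density τ y v + barrier τ y v) := setLIntegral_le_lintegral _ _
      _ = (∫⁻ v, density τ y v) + ∫⁻ v, barrier τ y v := lintegral_add_right _ hb
      _ ≤ _ := by gcongr
  by_contra h0
  rw [not_lt, nonpos_iff_eq_zero] at h0
  rw [h0, zero_add, ENNReal.ofReal_le_ofReal_iff (by norm_num)] at h2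
  norm_num at h2

end

lemma cauchy_transform_differentiableAt {α : Type*} [MeasurableSpace α] {m : Measure α}
    [IsFiniteMeasure m] {w : α → ℂ} (hw : Measurable w) {K : Set ℂ} (hK : IsClosed K)
    (hm : ∀ᵐ a ∂m, w a ∈ K) {z : ℂ} (hz : z ∉ K) :
    Integrable (fun a => (z - w a)⁻¹) m ∧
      DifferentiableAt ℂ (fun z => ∫ a, (z - w a)⁻¹ ∂m) z := by
  obtain ⟨r, hr, hrK⟩ := Metric.isOpen_iff.1 hK.isOpen_compl z hz
  have hr2 : 0 < r / 2 := by positivity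
  have hfar : ∀ᵐ a ∂m, ∀ x ∈ ball z (r / 2), r / 2 ≤ ‖x - w a‖ := by
    filter_upwards [hm] with a ha x hx
    by_contra! h
    refine hrK ?_ ha
    rw [mem_ball, dist_comm, dist_eq_norm] at hx ⊢
    calc ‖z - w a‖ = ‖(z - x) + (x - w a)‖ := by congr 1; ring
      _ ≤ _ := norm_add_le _ _
      _ < r := by linarith
  have hmeas : ∀ x : ℂ, AEStronglyMeasurable (fun a => (x - w a)⁻¹) m := fun x =>
    (by fun_prop : Measurable fun a => (x - w a)⁻¹).aestronglyMeasurable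
  have hint : Integrable (fun a => (z - w a)⁻¹) m := by
    refine Integrable.of_bound (hmeas z) (r / 2)⁻¹ ?_
    filter_upwards [hfar] with a ha
    rw [norm_inv]
    exact inv_anti₀ hr2 (ha z (mem_ball_self hr2))
  refine ⟨hint, ?_⟩
  have h := hasDerivAt_integral_of_dominated_loc_of_deriv_le (μ := m)
    (F := fun z a => (z - w a)⁻¹) (F' := fun z a => -1 / (z - w a) ^ 2)
    (bound := fun _ => ((r / 2) ^ 2)⁻¹) (ball_mem_nhds z hr2)
    (Eventually.of_forall hmeas) hint
    (by fun_prop : Measurable fun a => -1 / (z - w a) ^ 2).aestronglyMeasurable ?_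
    (integrable_const _) ?_
  · exact h.2.differentiableAt
  · filter_upwards [hfar] with a ha x hx
    rw [norm_div, norm_neg, norm_one, norm_pow, one_div]
    have := ha x hx
    exact inv_anti₀ (by positivity) (by gcongr)
  · filter_upwards [hfar] with a ha x hx
    have h0 : x - w a ≠ 0 := norm_pos_iff.1 (hr2.trans_le (ha x hx))
    exact ((hasDerivAt_id x).sub_const (w a)).inv h0

/-- The Cauchy transform of a measure carried by the imaginary axis. -/
def axisCauchy (ν : Measure ℝ) (z : ℂ) : ℂ := ∫ u, (z - u * I)⁻¹ ∂ν

lemma re_inv_axis (z : ℂ) (u : ℝ) : ((z - u * I)⁻¹).re = poisson z.re (z.im - u) := by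
  rw [inv_re, normSq_apply, poisson]
  simp [pow_two]

section axis

variable {ν : Measure ℝ}

lemma axisCauchy_reflect (z : ℂ) :
    axisCauchy ν (-(starRingEnd ℂ) z) = -(starRingEnd ℂ) (axisCauchy ν z) := by
  rw [axisCauchy, axisCauchy, ← integral_conj, ← integral_neg]
  refine integral_congr_ae (ae_of_all _ fun u => ?_)
  simp only [map_inv₀, map_sub, map_mul, conj_ofReal, conj_I, ← inv_neg]
  congr 1
  ring

variable [IsFiniteMeasure ν]

lemma axisCauchy_off {z : ℂ} (hz : z.re ≠ 0) :
    Integrable (fun u : ℝ => (z - u * I)⁻¹) ν ∧ DifferentiableAt ℂ (axisCauchy ν) z :=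
  cauchy_transform_differentiableAt (w := fun u : ℝ => u * I) (by fun_prop)
    (isClosed_eq continuous_re continuous_const : IsClosed {z : ℂ | z.re = 0})
    (ae_of_all _ fun u => by simp) hz

lemma axisCauchy_re {z : ℂ} (hz : z.re ≠ 0) :
    (axisCauchy ν z).re = ∫ u, poisson z.re (z.im - u) ∂ν := by
  rw [axisCauchy, ← reCLM_apply, ← ContinuousLinearMap.integral_comp_comm _ (axisCauchy_off hz).1]
  simp only [reCLM_apply, re_inv_axis]

lemma axisCauchy_measurable : Measurable (axisCauchy ν) := by
  have h : StronglyMeasurable (fun p : ℂ × ℝ => (p.1 - p.2 * I)⁻¹) :=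
    (by fun_prop : Measurable (fun p : ℂ × ℝ => (p.1 - p.2 * I)⁻¹)).stronglyMeasurable
  exact h.integral_prod_right'.measurable

lemma axisCauchy_re_pos (hν : ν ≠ 0) {z : ℂ} (hz : 0 < z.re) : 0 < (axisCauchy ν z).re := by
  rw [axisCauchy_re hz.ne']
  have hi : Integrable (fun u => poisson z.re (z.im - u)) ν := by
    have := (axisCauchy_off (ν := ν) hz.ne').1.re
    simpa only [RCLike.re_to_complex, re_inv_axis] using this
  have hp : ∀ u, 0 < poisson z.re (z.im - u) := fun u => by unfold poisson; positivity
  rw [integral_pos_iff_support_of_nonneg (fun u => (hp u).le) hi]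
  rw [Function.support_eq_univ fun u => (hp u).ne', Measure.measure_univ_pos]
  exact hν

/-- The Poisson extension of `ν` is almost increasing along horizontal lines and bounded. -/
structure IsAxisMonotone (ν : Measure ℝ) (C : ℝ) : Prop where
  nonneg : 0 ≤ C
  mono : ∀ z : ℂ, ∀ t : ℝ, 0 < z.re → 0 < t →
    (axisCauchy ν z).re ≤ (axisCauchy ν (z + t)).re + C * t
  re_le : ∀ z : ℂ, 0 < z.re → (axisCauchy ν z).re ≤ 4
  mass : ν.real univ ≤ 2
  supp : ∀ᵐ u ∂ν, |u| ≤ 1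

variable {C : ℝ}

lemma IsAxisMonotone.deriv_re (h : IsAxisMonotone ν C) {z : ℂ} (hz : 0 < z.re) :
    -C ≤ (deriv (axisCauchy ν) z).re := by
  have hd := (axisCauchy_off (ν := ν) hz.ne').2.hasDerivAt
  have h1 : HasDerivAt (fun t : ℝ => (axisCauchy ν (z + t)).re) (deriv (axisCauchy ν) z).re 0 := by
    have h2 : HasDerivAt (fun t : ℂ => axisCauchy ν (z + t)) (deriv (axisCauchy ν) z)
        ((0 : ℝ) : ℂ) := by
      rw [← add_zero z, ← Complex.ofReal_zero] at hd
      simpa using HasDerivAt.comp_const_add z _ hd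
    exact h2.real_of_complex
  rw [hasDerivAt_iff_tendsto_slope] at h1
  have h2 : Tendsto (slope (fun t : ℝ => (axisCauchy ν (z + t)).re) 0) (𝓝[>] 0)
      (𝓝 (deriv (axisCauchy ν) z).re) :=
    h1.mono_left (nhdsWithin_mono _ fun t (ht : 0 < t) => ht.ne')
  refine ge_of_tendsto h2 ?_
  filter_upwards [self_mem_nhdsWithin] with t (ht : 0 < t)
  rw [slope_def_field, sub_zero, Complex.ofReal_zero, add_zero, le_div_iff₀ ht]
  linarith [h.mono z t hz ht]

lemma IsAxisMonotone.mono_right (h : IsAxisMonotone ν C) {z w : ℂ} (hz : 0 < z.re)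
    (hw : 0 < w.re) :
    -C * ‖z - w‖ ^ 2 ≤ ((axisCauchy ν z - axisCauchy ν w) * (starRingEnd ℂ) (z - w)).re := by
  set c := (starRingEnd ℂ) (z - w) with hc
  have hpos : ∀ s ∈ Icc (0 : ℝ) 1, 0 < (w + s * (z - w)).re := fun s hs => by
    have : (w + s * (z - w)).re = (1 - s) * w.re + s * z.re := by simp; ring
    rw [this]
    rcases hs.1.eq_or_lt with h0 | h0
    · rw [← h0]; linarith
    · have := mul_nonneg (sub_nonneg.2 hs.2) hw.le
      have := mul_pos h0 hz
      linarith
  have hd : ∀ s ∈ Icc (0 : ℝ) 1, HasDerivAt (fun s : ℝ => (axisCauchy ν (w + s * (z - w)) * c).re)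
      ((deriv (axisCauchy ν) (w + s * (z - w))).re * ‖z - w‖ ^ 2) s := fun s hs => by
    have h1 := (axisCauchy_off (ν := ν) (hpos s hs).ne').2.hasDerivAt
    have h2 : HasDerivAt (fun t : ℂ => w + t * (z - w)) (z - w) (s : ℂ) := by
      simpa using ((hasDerivAt_id (s : ℂ)).mul_const (z - w)).const_add w
    have h3 := ((h1.comp (s : ℂ) h2).mul_const c).real_of_complex
    refine h3.congr_deriv ?_
    have : (z - w) * c = ((‖z - w‖ ^ 2 : ℝ) : ℂ) := by
      rw [hc, mul_conj, normSq_eq_norm_sq]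
    rw [mul_assoc, this, re_mul_ofReal]
  have h4 := (convex_Icc (0 : ℝ) 1).mul_sub_le_image_sub_of_le_deriv
    (f := fun s : ℝ => (axisCauchy ν (w + s * (z - w)) * c).re) (C := -C * ‖z - w‖ ^ 2)
    (fun s hs => (hd s hs).continuousAt.continuousWithinAt)
    (fun s hs => (hd s (interior_subset hs)).differentiableAt.differentiableWithinAt)
    (fun s hs => by
      rw [(hd s (interior_subset hs)).deriv]
      exact mul_le_mul_of_nonneg_right (h.deriv_re (hpos s (interior_subset hs))) (by positivity))
    0 (by simp) 1 (by simp) zero_le_one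
  simp only [Complex.ofReal_one, one_mul, Complex.ofReal_zero, zero_mul, add_zero, sub_zero,
    mul_one, add_sub_cancel] at h4
  rwa [sub_mul, sub_re]

lemma IsAxisMonotone.norm_le (h : IsAxisMonotone ν C) {z : ℂ} (hz : z.re ≠ 0) :
    ‖axisCauchy ν z‖ ≤ 6 + 4 * C := by
  have hfar : ∀ z : ℂ, 2 ≤ |z.im| → ‖axisCauchy ν z‖ ≤ 2 := fun z hz => by
    have h1 : ‖axisCauchy ν z‖ ≤ 1 * ν.real univ := by
      refine norm_integral_le_of_norm_le_const ?_
      filter_upwards [h.supp] with u hu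
      rw [norm_inv]
      refine inv_le_one_of_one_le₀ ?_
      refine le_trans ?_ (abs_im_le_norm _)
      have : (z - u * I).im = z.im - u := by simp
      rw [this]
      have := abs_sub_abs_le_abs_sub z.im u
      linarith
    linarith [h.mass]
  have hpos : ∀ z : ℂ, 0 < z.re → ‖axisCauchy ν z‖ ≤ 6 + 4 * C := fun z hz => by
    have hC := h.nonneg
    by_cases hz2 : 2 ≤ |z.im|
    · linarith [hfar z hz2]
    push Not at hz2
    rw [abs_lt] at hz2
    have h0 : 0 ≤ (axisCauchy ν z).re := by
      rw [axisCauchy_re hz.ne']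
      exact integral_nonneg fun u => poisson_nonneg hz.le _
    have h1 := h.mono_right (z := z) (w := z - 4 * I) hz (by simpa using hz)
    have h2 := h.mono_right (z := z + 4 * I) (w := z) (by simpa using hz) hz
    have h3 := (abs_im_le_norm _).trans (hfar (z - 4 * I) (by
      have : (z - 4 * I).im = z.im - 4 := by simp
      rw [this, le_abs]; right; linarith))
    have h4 := (abs_im_le_norm _).trans (hfar (z + 4 * I) (by
      have : (z + 4 * I).im = z.im + 4 := by simp
      rw [this, le_abs]; left; linarith))
    rw [abs_le] at h3 h4
    have e1 : z - (z - 4 * I) = 4 * I := by ring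
    have e2 : z + 4 * I - z = 4 * I := by ring
    have e3 : ‖4 * I‖ = 4 := by simp
    rw [e1, e3] at h1
    rw [e2, e3] at h2
    simp only [map_mul, conj_I, mul_re, sub_re, sub_im, mul_im, map_ofNat] at h1 h2
    norm_num at h1 h2
    have h5 : |(axisCauchy ν z).im| ≤ 2 + 4 * C := by rw [abs_le]; constructor <;> linarith
    have h6 : |(axisCauchy ν z).re| ≤ 4 := by rw [abs_of_nonneg h0]; exact h.re_le z hz
    linarith [norm_le_abs_re_add_abs_im (axisCauchy ν z)]
  rcases hz.lt_or_gt with hz | hz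
  · have h1 := hpos (-(starRingEnd ℂ) z) (by simpa using hz)
    rwa [axisCauchy_reflect, norm_neg, norm_conj] at h1
  · exact hpos z hz

lemma IsAxisMonotone.mono_across (h : IsAxisMonotone ν C) {z w : ℂ} (hz : 0 < z.re)
    (hw : w.re < 0) :
    -C * ‖z - w‖ ^ 2 ≤ ((axisCauchy ν z - axisCauchy ν w) * (starRingEnd ℂ) (z - w)).re := by
  set v := z - w with hv
  have hvre : 0 < v.re := by simp only [hv, sub_re]; linarith
  set α : ℝ := z.re / v.re with hα
  have hα0 : 0 < α := by positivity
  have hα1 : 0 < 1 - α := by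
    rw [sub_pos, hα, div_lt_one hvre, hv, sub_re]; linarith
  have hp : (z - α * v).re = 0 := by
    rw [sub_re, re_ofReal_mul, hα, div_mul_cancel₀ _ hvre.ne', sub_self]
  set p := z - α * v with hpdef
  have hzp : z - p = α * v := by rw [hpdef]; ring
  have hpw : p - w = (1 - α : ℝ) * v := by rw [hpdef, hv]; push_cast; ring
  set B := 6 + 4 * C with hB
  have hBn : ∀ z : ℂ, z.re ≠ 0 → ‖axisCauchy ν z‖ ≤ B := fun z hz => h.norm_le hz
  have hstep : ∀ (β δ : ℝ) (Δ : ℂ), 0 < β → ‖Δ‖ ≤ 2 * B → 0 < δ →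
      -C * ‖(β : ℂ) * v - δ‖ ^ 2 ≤ (Δ * (starRingEnd ℂ) ((β : ℂ) * v - δ)).re →
      (-C * ‖(β : ℂ) * v - δ‖ ^ 2 - 2 * B * δ) / β ≤ (Δ * (starRingEnd ℂ) v).re :=
    fun β δ Δ hβ hΔ hδ hle => by
      rw [div_le_iff₀ hβ]
      have e : (Δ * (starRingEnd ℂ) ((β : ℂ) * v - δ)).re =
          (Δ * (starRingEnd ℂ) v).re * β - Δ.re * δ := by
        rw [map_sub, map_mul, conj_ofReal, conj_ofReal, mul_sub, sub_re, mul_left_comm,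
          re_ofReal_mul, re_mul_ofReal, mul_comm β]
      rw [e] at hle
      have h1 := (abs_le.1 ((abs_re_le_norm Δ).trans hΔ)).1
      nlinarith
  have key : ∀ᶠ δ : ℝ in 𝓝[>] 0, (-C * ‖(α : ℂ) * v - δ‖ ^ 2 - 2 * B * δ) / α +
      (-C * ‖((1 - α : ℝ) : ℂ) * v - δ‖ ^ 2 - 2 * B * δ) / (1 - α) ≤
      ((axisCauchy ν z - axisCauchy ν w) * (starRingEnd ℂ) v).re := by
    filter_upwards [self_mem_nhdsWithin] with δ (hδ : 0 < δ)
    have hpr : (p + δ).re = δ := by simp [hp]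
    have hpl : (p - δ).re = -δ := by simp [hp]
    have hrefl : p - δ = -(starRingEnd ℂ) (p + δ) := by
      apply Complex.ext <;> simp [hp]
    have hG : axisCauchy ν (p + δ) - axisCauchy ν (p - δ) =
        ((2 * (axisCauchy ν (p + δ)).re : ℝ) : ℂ) := by
      rw [hrefl, axisCauchy_reflect, sub_neg_eq_add, add_conj]
    have h0 : 0 ≤ (axisCauchy ν (p + δ)).re := by
      rw [axisCauchy_re (by rw [hpr]; exact hδ.ne')]
      exact integral_nonneg fun u => poisson_nonneg (by rw [hpr]; exact hδ.le) _
    have hb1 : ‖axisCauchy ν z - axisCauchy ν (p + δ)‖ ≤ 2 * B :=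
      (norm_sub_le _ _).trans (by
        linarith [hBn z hz.ne', hBn (p + δ) (by rw [hpr]; exact hδ.ne')])
    have hb2 : ‖axisCauchy ν (p - δ) - axisCauchy ν w‖ ≤ 2 * B :=
      (norm_sub_le _ _).trans (by
        linarith [hBn w hw.ne, hBn (p - δ) (by rw [hpl]; exact (neg_lt_zero.2 hδ).ne)])
    have e1 : z - (p + δ) = (α : ℂ) * v - δ := by rw [← hzp]; ring
    have e2 : p - δ - w = ((1 - α : ℝ) : ℂ) * v - δ := by rw [← hpw]; ring
    have m1 := h.mono_right (z := z) (w := p + δ) hz (by rw [hpr]; exact hδ)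
    have m2 := h.mono_right (z := -(starRingEnd ℂ) w) (w := -(starRingEnd ℂ) (p - δ))
      (by simpa using hw) (by simpa [hp] using hδ)
    rw [e1] at m1
    have e3 : -(starRingEnd ℂ) w - -(starRingEnd ℂ) (p - δ) = (starRingEnd ℂ) (p - δ - w) := by
      simp only [map_sub]; ring
    rw [e3, axisCauchy_reflect, axisCauchy_reflect, norm_conj, conj_conj, e2] at m2
    have e4 : (-(starRingEnd ℂ) (axisCauchy ν w) - -(starRingEnd ℂ) (axisCauchy ν (p - δ))) *
        (((1 - α : ℝ) : ℂ) * v - δ) = (starRingEnd ℂ) ((axisCauchy ν (p - δ) - axisCauchy ν w) *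
          (starRingEnd ℂ) (((1 - α : ℝ) : ℂ) * v - δ)) := by
      simp only [map_mul, map_sub, conj_conj]; ring
    rw [e4, conj_re] at m2
    have s1 := hstep α δ _ hα0 hb1 hδ m1
    have s2 := hstep (1 - α) δ _ hα1 hb2 hδ m2
    have e5 : (axisCauchy ν z - axisCauchy ν w) * (starRingEnd ℂ) v =
        (axisCauchy ν z - axisCauchy ν (p + δ)) * (starRingEnd ℂ) v +
        (axisCauchy ν (p + δ) - axisCauchy ν (p - δ)) * (starRingEnd ℂ) v +
        (axisCauchy ν (p - δ) - axisCauchy ν w) * (starRingEnd ℂ) v := by ring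
    have h6 : 0 ≤ ((axisCauchy ν (p + δ) - axisCauchy ν (p - δ)) * (starRingEnd ℂ) v).re := by
      rw [hG, re_ofReal_mul, conj_re]
      positivity
    rw [e5, add_re, add_re]
    linarith
  have hlim : Tendsto (fun δ : ℝ => (-C * ‖(α : ℂ) * v - δ‖ ^ 2 - 2 * B * δ) / α +
      (-C * ‖((1 - α : ℝ) : ℂ) * v - δ‖ ^ 2 - 2 * B * δ) / (1 - α)) (𝓝[>] 0)
      (𝓝 (-C * ‖v‖ ^ 2)) := by
    have hc : Continuous (fun δ : ℝ => (-C * ‖(α : ℂ) * v - δ‖ ^ 2 - 2 * B * δ) / α +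
      (-C * ‖((1 - α : ℝ) : ℂ) * v - δ‖ ^ 2 - 2 * B * δ) / (1 - α)) := by fun_prop
    refine (hc.tendsto' 0 _ ?_).mono_left nhdsWithin_le_nhds
    simp only [Complex.ofReal_zero, sub_zero, mul_zero, norm_mul, norm_real, Real.norm_eq_abs,
      abs_of_pos hα0, abs_of_pos hα1]
    field_simp
    ring
  exact le_of_tendsto hlim key

lemma IsAxisMonotone.strong_mono (h : IsAxisMonotone ν C) {z w : ℂ} (hz : z.re ≠ 0)
    (hw : w.re ≠ 0) :
    -C * ‖z - w‖ ^ 2 ≤ ((axisCauchy ν z - axisCauchy ν w) * (starRingEnd ℂ) (z - w)).re := by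
  rcases hz.lt_or_gt with hz | hz <;> rcases hw.lt_or_gt with hw | hw
  · have m := h.mono_right (z := -(starRingEnd ℂ) z) (w := -(starRingEnd ℂ) w)
      (by simpa using hz) (by simpa using hw)
    have e3 : -(starRingEnd ℂ) z - -(starRingEnd ℂ) w = -(starRingEnd ℂ) (z - w) := by
      simp only [map_sub]; ring
    rw [e3, axisCauchy_reflect, axisCauchy_reflect, norm_neg, norm_conj, map_neg, conj_conj] at m
    refine m.trans (le_of_eq ?_)
    rw [← conj_re]
    congr 1
    simp only [map_mul, map_sub, map_neg, conj_conj]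
    ring
  · have m := h.mono_across hw hz
    rw [norm_sub_rev] at m
    refine m.trans (le_of_eq ?_)
    congr 1
    simp only [map_sub]; ring
  · exact h.mono_across hz hw
  · exact h.mono_right hz hw

end axis

section

variable {ι : Type*} {τ y : ι → ℝ}

/-- The measure with the given density. -/
def densityMeasure (τ y : ι → ℝ) : Measure ℝ := volume.withDensity (density τ y)

lemma density_le_indicator (v : ℝ) :
    density τ y v ≤ (Icc (-1 : ℝ) 1).indicator (fun _ => 1) v := by
  by_cases hv : v ∈ Icc (-1 : ℝ) 1
  · rw [indicator_of_mem hv]; exact density_le_one v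
  · rw [indicator_of_notMem hv]
    refine (density_eq_zero_of_one_le ?_).le
    by_contra! h
    exact hv (abs_le.1 h.le)

lemma densityMeasure_univ_le : densityMeasure τ y univ ≤ 2 := by
  rw [densityMeasure, withDensity_apply _ MeasurableSet.univ, setLIntegral_univ]
  refine (lintegral_mono density_le_indicator).trans ?_
  rw [lintegral_indicator measurableSet_Icc, setLIntegral_const, Real.volume_Icc]
  norm_num

instance : IsFiniteMeasure (densityMeasure τ y) :=
  ⟨densityMeasure_univ_le.trans_lt (by norm_num)⟩

lemma densityMeasure_ae [Countable ι] {P : ℝ → Prop} (h : ∀ v, density τ y v ≠ 0 → P v) :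
    ∀ᵐ v ∂densityMeasure τ y, P v := by
  rw [densityMeasure, ae_withDensity_iff measurable_density]
  exact ae_of_all _ h

lemma lintegral_densityMeasure [Countable ι] {f : ℝ → ℝ≥0∞} (hf : Measurable f) :
    ∫⁻ u, f u ∂densityMeasure τ y = ∫⁻ u, density τ y u * f u := by
  rw [densityMeasure, lintegral_withDensity_eq_lintegral_mul _ measurable_density hf]
  rfl

lemma ofReal_axisCauchy_re [Countable ι] {z : ℂ} (hz : 0 < z.re) :
    ENNReal.ofReal (axisCauchy (densityMeasure τ y) z).re =
      ∫⁻ u, density τ y u * ENNReal.ofReal (poisson z.re (z.im - u)) := by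
  have hi : Integrable (fun u => poisson z.re (z.im - u)) (densityMeasure τ y) := by
    have := (axisCauchy_off (ν := densityMeasure τ y) hz.ne').1.re
    simpa only [RCLike.re_to_complex, re_inv_axis] using this
  rw [axisCauchy_re hz.ne', ofReal_integral_eq_lintegral_ofReal hi
    (ae_of_all _ fun u => poisson_nonneg hz.le _), lintegral_densityMeasure (by fun_prop)]

lemma isAxisMonotone_densityMeasure [Countable ι] (hτ : ∀ j, 0 < τ j ∧ τ j < 1)
    (hs : ∑' j, ENNReal.ofReal (1 / Real.log (1 / τ j)) ≤ ENNReal.ofReal (1 / 20)) :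
    IsAxisMonotone (densityMeasure τ y) (3 * Real.pi) where
  nonneg := by positivity
  mono := fun z t hz ht => by
    have hd := measurable_density (τ := τ) (y := y)
    have hpi := Real.pi_pos
    have hzt : 0 < (z + t).re := by simp; linarith
    have hnn : 0 ≤ (axisCauchy (densityMeasure τ y) (z + t)).re := by
      rw [axisCauchy_re hzt.ne']
      exact integral_nonneg fun u => poisson_nonneg hzt.le _
    rw [← ENNReal.ofReal_le_ofReal_iff (by positivity), ENNReal.ofReal_add hnn (by positivity),
      ofReal_axisCauchy_re hz, ofReal_axisCauchy_re hzt]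
    have hre : (z + t).re = z.re + t := by simp
    have him : (z + t).im = z.im := by simp
    rw [hre, him]
    refine (ENNReal.mul_le_mul_iff_right (a := ENNReal.ofReal Real.pi) (by simpa using hpi)
      ENNReal.ofReal_ne_top).1 ?_
    have hae : ∀ᵐ v : ℝ, (∀ j, v ≠ y j) ∧ v ≠ 0 := by
      rw [eventually_and, eventually_countable_forall]
      exact ⟨fun j => by simp [ae_iff], by simp [ae_iff]⟩
    calc ENNReal.ofReal Real.pi * ∫⁻ u, density τ y u * ENNReal.ofReal (poisson z.re (z.im - u))
        = ∫⁻ v, ENNReal.ofReal (poisson z.re (z.im - v)) * (ENNReal.ofReal Real.pi *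
            density τ y v) := by
          rw [← lintegral_const_mul _ (by fun_prop)]
          exact lintegral_congr fun v => by ring
      _ ≤ ∫⁻ v, ENNReal.ofReal (poisson z.re (z.im - v)) *
            ((∫⁻ u, ENNReal.ofReal (poisson t (v - u)) * density τ y u) +
              ENNReal.ofReal (3 * Real.pi * t)) := by
          refine lintegral_mono_ae ?_
          filter_upwards [hae] with v hv
          gcongr
          exact density_le_lintegral hτ hs ht hv.1 hv.2
      _ = (∫⁻ v, ENNReal.ofReal (poisson z.re (z.im - v)) *
            ∫⁻ u, ENNReal.ofReal (poisson t (v - u)) * density τ y u) +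
            ENNReal.ofReal Real.pi * ENNReal.ofReal (3 * Real.pi * t) := by
          simp only [mul_add]
          rw [lintegral_add_right _ (by fun_prop), lintegral_mul_const _ (by fun_prop),
            lintegral_poisson' hz]
      _ = (∫⁻ u, ENNReal.ofReal Real.pi * (density τ y u *
            ENNReal.ofReal (poisson (z.re + t) (z.im - u)))) +
            ENNReal.ofReal Real.pi * ENNReal.ofReal (3 * Real.pi * t) := by
          congr 1
          calc _ = ∫⁻ v, ∫⁻ u, ENNReal.ofReal (poisson z.re (z.im - v)) *
                (ENNReal.ofReal (poisson t (v - u)) * density τ y u) :=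
                lintegral_congr fun v => (lintegral_const_mul _ (by fun_prop)).symm
            _ = ∫⁻ u, ∫⁻ v, ENNReal.ofReal (poisson z.re (z.im - v)) *
                (ENNReal.ofReal (poisson t (v - u)) * density τ y u) :=
                lintegral_lintegral_swap (by fun_prop)
            _ = _ := by
              have hu : ∀ᵐ u : ℝ, z.im ≠ u := by
                have : ∀ᵐ u : ℝ, u ≠ z.im := by simp [ae_iff]
                filter_upwards [this] with u hu using hu.symm
              refine lintegral_congr_ae ?_
              filter_upwards [hu] with u hu
              rw [mul_left_comm, ← lintegral_poisson_mul hz ht hu,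
                ← lintegral_const_mul _ (by fun_prop)]
              exact lintegral_congr fun v => by ring
      _ = _ := by
          rw [lintegral_const_mul _ (by fun_prop), mul_add]
  re_le := fun z hz => by
    have hd := measurable_density (τ := τ) (y := y)
    rw [← ENNReal.ofReal_le_ofReal_iff (by norm_num), ofReal_axisCauchy_re hz]
    calc _ ≤ ∫⁻ u, ENNReal.ofReal (poisson z.re (z.im - u)) :=
          lintegral_mono fun u => mul_le_of_le_one_left' (density_le_one u)
      _ = ENNReal.ofReal Real.pi := lintegral_poisson' hz _
      _ ≤ _ := ENNReal.ofReal_le_ofReal Real.pi_le_four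
  mass := by
    have := ENNReal.toReal_mono (by norm_num) (densityMeasure_univ_le (τ := τ) (y := y))
    simpa [Measure.real] using this
  supp := densityMeasure_ae fun v hv => by
    by_contra! h
    exact hv (density_eq_zero_of_one_le h.le)

lemma densityMeasure_ne_zero [Countable ι] (hτ : ∀ j, 0 < τ j ∧ τ j < 1)
    (hs : ∑' j, ENNReal.ofReal (1 / Real.log (1 / τ j)) ≤ ENNReal.ofReal (1 / 20)) :
    densityMeasure τ y ≠ 0 := fun h => by
  have h1 := lintegral_density_pos (y := y) hτ hs
  rw [← setLIntegral_univ, ← withDensity_apply _ MeasurableSet.univ] at h1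
  change 0 < densityMeasure τ y univ at h1
  rw [h] at h1
  simp at h1

end

/-- Every nonempty perfect compact set of reals carries a probability measure without atoms. -/
lemma Perfect.exists_measure {E : Set ℝ} (hE : Perfect E) (hne : E.Nonempty) :
    ∃ μ : Measure ℝ, IsProbabilityMeasure μ ∧ NullSingletonClass μ ∧ ∀ᵐ s ∂μ, s ∈ E := by
  obtain ⟨φ, hφ, hφc, hφi⟩ := hE.exists_nat_bool_injection hne
  have hunc : ¬ Countable (ℕ → Bool) := by
    rw [← Cardinal.mk_le_aleph0_iff]
    simp [Cardinal.aleph0_lt_continuum]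
  let e : ℝ ≃ᵐ (ℕ → Bool) := PolishSpace.measurableEquivOfNotCountable
    (not_countable_iff.2 inferInstance) hunc
  let P : Measure ℝ := volume.restrict (Icc 0 1)
  have hP : IsProbabilityMeasure P := ⟨by simp [P]⟩
  have hm : Measurable (φ ∘ e) := hφc.measurable.comp e.measurable
  refine ⟨P.map (φ ∘ e), Measure.isProbabilityMeasure_map hm.aemeasurable, ⟨fun x => ?_⟩, ?_⟩
  · rw [Measure.map_apply hm (measurableSet_singleton x)]
    refine Set.Subsingleton.measure_zero (fun a ha b hb => ?_) P
    exact (hφi.comp e.injective) ((mem_singleton_iff.1 ha).trans (mem_singleton_iff.1 hb).symm)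
  · refine (ae_map_iff hm.aemeasurable hE.closed.measurableSet).2 (ae_of_all _ fun a => ?_)
    exact hφ (mem_range_self _)

/-- A continuous semimonotone bounded perturbation of the identity is a homeomorphism. -/
lemma exists_homeomorph_of_semimonotone {g : ℂ → ℂ} {ε C B : ℝ} (hg : Continuous g)
    (hε : 0 < ε) (hεC : ε * C ≤ 1 / 2) (hB : ∀ z, ‖g z‖ ≤ B)
    (hmono : ∀ z w, -C * ‖z - w‖ ^ 2 ≤ ((g z - g w) * (starRingEnd ℂ) (z - w)).re) :
    ∃ h : Homeomorph ℂ ℂ, ∀ z, h z = z + ε * g z := by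
  set f : ℂ → ℂ := fun z => z + ε * g z with hf
  have hfc : Continuous f := by fun_prop
  have hanti : AntilipschitzWith 2 f := by
    refine AntilipschitzWith.of_le_mul_dist fun z w => ?_
    rw [dist_eq_norm, dist_eq_norm]
    rcases eq_or_ne z w with rfl | hne
    · simp
    have hpos : 0 < ‖z - w‖ := norm_pos_iff.2 (sub_ne_zero.2 hne)
    have h1 : ((f z - f w) * (starRingEnd ℂ) (z - w)).re =
        ‖z - w‖ ^ 2 + ε * ((g z - g w) * (starRingEnd ℂ) (z - w)).re := by
      have : (f z - f w) * (starRingEnd ℂ) (z - w) = ((‖z - w‖ ^ 2 : ℝ) : ℂ) +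
          ε * ((g z - g w) * (starRingEnd ℂ) (z - w)) := by
        rw [← normSq_eq_norm_sq, ← mul_conj, hf]; ring
      rw [this, add_re, ofReal_re, re_ofReal_mul]
    have h2 := re_le_norm ((f z - f w) * (starRingEnd ℂ) (z - w))
    rw [norm_mul, norm_conj, h1] at h2
    have h3 := mul_le_mul_of_nonneg_left (hmono z w) hε.le
    have h4 : ε * (-C * ‖z - w‖ ^ 2) ≥ -(1 / 2) * ‖z - w‖ ^ 2 := by
      have := mul_le_mul_of_nonneg_right hεC (sq_nonneg ‖z - w‖)
      linarith
    have h5 : 1 / 2 * ‖z - w‖ * ‖z - w‖ ≤ ‖f z - f w‖ * ‖z - w‖ := by nlinarith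
    have := le_of_mul_le_mul_right h5 hpos
    push_cast
    linarith
  have hsurj : Function.Surjective f := fun b => by
    by_contra! hb
    have hB0 : 0 ≤ B := (norm_nonneg _).trans (hB 0)
    set R := ε * B + ‖b‖ + 1 with hR
    have hRpos : 0 < R := by positivity
    have hw0 : HasWind (circLoop (fun z => f z - b) 0 R) 0 :=
      HasWind.zero_of_ball hRpos (by fun_prop) (fun z _ => sub_ne_zero.2 (hb z))
    have hw1 : HasWind (circLoop (fun z => z - 0) 0 R) 1 := HasWind.sub_inside (by simpa using hRpos)
    have hne : ∀ θ, circleMap 0 R θ ≠ 0 := fun θ => circleMap_ne_center hRpos.ne'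
    have hw2 : HasWind (fun θ => circLoop (fun z => f z - b) 0 R θ *
        (circLoop (fun z => z - 0) 0 R θ)⁻¹) 0 := by
      refine HasWind.zero_of_near (b := 1) (R := (ε * B + ‖b‖) / R) ?_ ?_ ?_ ?_
      · simp only [circLoop, sub_zero]
        exact ((hfc.comp (continuous_circleMap 0 R)).sub continuous_const).mul
          ((continuous_circleMap 0 R).inv₀ hne)
      · intro θ
        simp only [circLoop, periodic_circleMap 0 R θ]
      · rw [norm_one, div_lt_one hRpos, hR]; linarith
      · intro θ
        simp only [circLoop, sub_zero]
        rw [mem_closedBall, dist_eq_norm]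
        have e : (f (circleMap 0 R θ) - b) * (circleMap 0 R θ)⁻¹ - 1 =
            (ε * g (circleMap 0 R θ) - b) / circleMap 0 R θ := by
          have := hne θ
          rw [hf]; field_simp; ring
        rw [e, norm_div, norm_circleMap_zero, abs_of_pos hRpos]
        gcongr
        refine (norm_sub_le _ _).trans ?_
        rw [norm_mul, norm_real, Real.norm_of_nonneg hε.le]
        have := hB (circleMap 0 R θ)
        gcongr
    have := hw2.unique (hw0.mul hw1.inv)
    norm_num at this
  let e := Equiv.ofBijective f ⟨hanti.injective, hsurj⟩
  have hinv : LipschitzWith 2 e.symm := hanti.to_rightInverse e.apply_symm_apply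
  exact ⟨⟨e, hfc, hinv.continuous⟩, fun z => rfl⟩

section convolution

variable {ν μ : Measure ℝ} [IsFiniteMeasure ν] [IsProbabilityMeasure μ] [NullSingletonClass μ] {C : ℝ}

/-- The Cauchy transform of a product measure, as a superposition of horizontal translates. -/
def shiftedCauchy (ν μ : Measure ℝ) (z : ℂ) : ℂ := ∫ s, axisCauchy ν (z - (s : ℝ)) ∂μ

omit [IsProbabilityMeasure μ] in
lemma ae_re_ne (z : ℂ) : ∀ᵐ s : ℝ ∂μ, (z - (s : ℝ)).re ≠ 0 := by
  have : ∀ᵐ s : ℝ ∂μ, s ≠ z.re := by simp [ae_iff]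
  filter_upwards [this] with s hs h
  rw [sub_re, ofReal_re, sub_eq_zero] at h
  exact hs h.symm

lemma IsAxisMonotone.integrable_shift (h : IsAxisMonotone ν C) (z : ℂ) :
    Integrable (fun s : ℝ => axisCauchy ν (z - (s : ℝ))) μ := by
  refine Integrable.of_bound (C := 6 + 4 * C)
    ((axisCauchy_measurable (ν := ν)).comp (by fun_prop)).aestronglyMeasurable ?_
  filter_upwards [ae_re_ne z] with s hs using h.norm_le hs

lemma IsAxisMonotone.norm_shiftedCauchy_le (h : IsAxisMonotone ν C) (z : ℂ) :
    ‖shiftedCauchy ν μ z‖ ≤ 6 + 4 * C := by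
  have := norm_integral_le_of_norm_le_const (μ := μ)
    (f := fun s : ℝ => axisCauchy ν (z - (s : ℝ))) (C := 6 + 4 * C) (by
      filter_upwards [ae_re_ne z] with s hs using h.norm_le hs)
  simpa [shiftedCauchy] using this

lemma IsAxisMonotone.continuous_shiftedCauchy (h : IsAxisMonotone ν C) :
    Continuous (shiftedCauchy ν μ) := by
  refine continuous_iff_continuousAt.2 fun z => ?_
  refine continuousAt_of_dominated (bound := fun _ => 6 + 4 * C)
    (Eventually.of_forall fun x => (h.integrable_shift x).aestronglyMeasurable)
    (Eventually.of_forall fun x => ?_) (integrable_const _) ?_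
  · filter_upwards [ae_re_ne x] with s hs using h.norm_le hs
  · filter_upwards [ae_re_ne z] with s hs
    exact ContinuousAt.comp (f := fun z : ℂ => z - (s : ℂ)) (axisCauchy_off hs).2.continuousAt
      (by fun_prop)

lemma IsAxisMonotone.strong_mono_shiftedCauchy (h : IsAxisMonotone ν C) (z w : ℂ) :
    -C * ‖z - w‖ ^ 2 ≤
      ((shiftedCauchy ν μ z - shiftedCauchy ν μ w) * (starRingEnd ℂ) (z - w)).re := by
  have hi := ((h.integrable_shift (μ := μ) z).sub (h.integrable_shift w)).mul_const
    ((starRingEnd ℂ) (z - w))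
  simp only [Pi.sub_apply] at hi
  rw [shiftedCauchy, shiftedCauchy, ← integral_sub (h.integrable_shift z) (h.integrable_shift w),
    ← integral_mul_const, ← reCLM_apply, ← ContinuousLinearMap.integral_comp_comm _ hi]
  have h1 : -C * ‖z - w‖ ^ 2 = ∫ _, -C * ‖z - w‖ ^ 2 ∂μ := by simp
  rw [h1]
  refine integral_mono_ae (integrable_const _) (reCLM.integrable_comp hi) ?_
  filter_upwards [ae_re_ne z, ae_re_ne w] with s hz hw
  have := h.strong_mono hz hw
  rw [sub_sub_sub_cancel_right] at this
  simpa only [reCLM_apply] using this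

omit [NullSingletonClass μ] in
lemma differentiableAt_shiftedCauchy {E F : Set ℝ} (hE : IsClosed E) (hF : IsClosed F)
    (hμ : ∀ᵐ s ∂μ, s ∈ E) (hν : ∀ᵐ u ∂ν, u ∈ F) {z : ℂ} (hz : ¬ (z.re ∈ E ∧ z.im ∈ F)) :
    DifferentiableAt ℂ (shiftedCauchy ν μ) z := by
  have hK : IsClosed {z : ℂ | z.re ∈ E ∧ z.im ∈ F} :=
    (hE.preimage continuous_re).inter (hF.preimage continuous_im)
  have hae : ∀ᵐ p ∂(μ.prod ν), ((p.1 : ℂ) + p.2 * I) ∈ {z : ℂ | z.re ∈ E ∧ z.im ∈ F} := by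
    have h1 : ∀ᵐ p ∂(μ.prod ν), p.1 ∈ E := Measure.quasiMeasurePreserving_fst.ae hμ
    have h2 : ∀ᵐ p ∂(μ.prod ν), p.2 ∈ F := Measure.quasiMeasurePreserving_snd.ae hν
    filter_upwards [h1, h2] with p hp1 hp2
    simpa using ⟨hp1, hp2⟩
  have hd : ∀ z ∉ {z : ℂ | z.re ∈ E ∧ z.im ∈ F}, _ := fun z hz =>
    cauchy_transform_differentiableAt (m := μ.prod ν)
      (w := fun p : ℝ × ℝ => (p.1 : ℂ) + p.2 * I) (by fun_prop) hK hae (z := z) hz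
  refine (hd z hz).2.congr_of_eventuallyEq ?_
  filter_upwards [hK.isOpen_compl.mem_nhds hz] with x hx
  rw [integral_prod _ (hd x hx).1]
  simp only [shiftedCauchy, axisCauchy, sub_add_eq_sub_sub]

lemma IsAxisMonotone.exists_nonmobius_homeomorph (h : IsAxisMonotone ν C) (hν0 : ν ≠ 0)
    {E F : Set ℝ} (hE : IsCompact E) (hF : IsClosed F)
    (hμ : ∀ᵐ s ∂μ, s ∈ E) (hν : ∀ᵐ u ∂ν, u ∈ F) :
    ∃ h : Homeomorph ℂ ℂ, (∀ z : ℂ, ¬ (z.re ∈ E ∧ z.im ∈ F) → DifferentiableAt ℂ (h : ℂ → ℂ) z) ∧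
      ¬ IsMobiusOn (h : ℂ → ℂ) univ := by
  have hC := h.nonneg
  set ε : ℝ := 1 / (2 * (C + 1)) with hε
  have hεpos : 0 < ε := by positivity
  obtain ⟨φ, hφ⟩ := exists_homeomorph_of_semimonotone (h.continuous_shiftedCauchy (μ := μ)) hεpos
    (by rw [hε, div_mul_eq_mul_div, div_le_div_iff₀ (by positivity) two_pos]; linarith)
    h.norm_shiftedCauchy_le h.strong_mono_shiftedCauchy
  refine ⟨φ, fun z hz => ?_, ?_⟩
  · rw [funext hφ]
    exact differentiableAt_id.add
      ((differentiableAt_shiftedCauchy hE.isClosed hF hμ hν hz).const_mul _)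
  rintro ⟨a, b, c, d, hdet, hm⟩
  have hc : c = 0 := by
    by_contra hc
    refine (hm (-d / c) (mem_univ _)).1 ?_
    field_simp
    ring
  subst hc
  have hd0 : d ≠ 0 := by simpa using (hm 0 (mem_univ _)).1
  set A := (a / d - 1) / ε with hA
  have hε0 : (ε : ℂ) ≠ 0 := by exact_mod_cast hεpos.ne'
  have hlin : ∀ z, shiftedCauchy ν μ z = A * z + b / d / ε := fun z => by
    have h1 := (hm z (mem_univ _)).2
    rw [hφ, zero_mul, zero_add] at h1
    have : shiftedCauchy ν μ z = ((a * z + b) / d - z) / ε := by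
      rw [← h1]; field_simp; ring
    rw [this, hA]
    field_simp
    ring
  obtain ⟨M, hM⟩ := hE.isBounded.subset_closedBall 0
  set R := |M| + 1 with hR
  have hRE : ∀ s ∈ E, |s| < R := fun s hs => by
    have := hM hs
    rw [mem_closedBall, dist_zero_right, Real.norm_eq_abs] at this
    exact this.trans_lt (by linarith [le_abs_self M])
  have hre : ∀ z, (shiftedCauchy ν μ z).re = ∫ s, (axisCauchy ν (z - (s : ℝ))).re ∂μ := fun z => by
    rw [shiftedCauchy, ← reCLM_apply, ← ContinuousLinearMap.integral_comp_comm _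
      (h.integrable_shift z)]
    rfl
  have hpos : ∀ᵐ s : ℝ ∂μ, 0 < (axisCauchy ν ((R : ℂ) - (s : ℝ))).re := by
    filter_upwards [hμ] with s hs
    refine axisCauchy_re_pos hν0 ?_
    rw [sub_re, ofReal_re, ofReal_re]
    linarith [(abs_lt.1 (hRE s hs)).2]
  have hneg : ∀ᵐ s : ℝ ∂μ, (axisCauchy ν (((-R : ℝ) : ℂ) - (s : ℝ))).re ≤ 0 := by
    filter_upwards [hμ] with s hs
    have e : ((-R : ℝ) : ℂ) - (s : ℝ) = -(starRingEnd ℂ) ((R : ℂ) + s) := by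
      simp only [map_add, conj_ofReal]; push_cast; ring
    rw [e, axisCauchy_reflect, neg_re, conj_re, neg_nonpos]
    refine (axisCauchy_re_pos hν0 ?_).le
    rw [add_re, ofReal_re, ofReal_re]
    linarith [(abs_lt.1 (hRE s hs)).1]
  have h1 : 0 < (shiftedCauchy ν μ R).re := by
    rw [hre, integral_pos_iff_support_of_nonneg_ae (hpos.mono fun s hs => hs.le)
      (by simpa using (h.integrable_shift (μ := μ) R).re)]
    have : Function.support (fun s : ℝ => (axisCauchy ν ((R : ℂ) - (s : ℝ))).re) =ᵐ[μ] univ := by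
      rw [eventuallyEq_univ]
      filter_upwards [hpos] with s hs using hs.ne'
    rw [measure_congr this, measure_univ]
    exact one_pos
  have h2 : (shiftedCauchy ν μ ((-R : ℝ) : ℂ)).re ≤ 0 := by
    rw [hre]
    exact integral_nonpos_of_ae hneg
  have hA0 : A = 0 := by
    by_contra hA0
    have h3 := hlin ((2 * (6 + 4 * C) + 1 : ℝ) / A)
    have h4 := hlin 0
    rw [mul_div_cancel₀ _ hA0] at h3
    rw [mul_zero, zero_add] at h4
    have h5 : shiftedCauchy ν μ ((2 * (6 + 4 * C) + 1 : ℝ) / A) - shiftedCauchy ν μ 0 =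
        ((2 * (6 + 4 * C) + 1 : ℝ) : ℂ) := by rw [h3, h4]; ring
    have h6 := norm_sub_le (shiftedCauchy ν μ ((2 * (6 + 4 * C) + 1 : ℝ) / A)) (shiftedCauchy ν μ 0)
    rw [h5, norm_real, Real.norm_of_nonneg (by positivity)] at h6
    linarith [h.norm_shiftedCauchy_le (μ := μ) ((2 * (6 + 4 * C) + 1 : ℝ) / A),
      h.norm_shiftedCauchy_le (μ := μ) 0]
  rw [hlin, hA0] at h1 h2
  simp only [zero_mul] at h1 h2
  linarith

end convolution

lemma Perfect.exists_nonmobius_homeomorph {ι : Type*} [Countable ι] {τ y : ι → ℝ}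
    (hτ : ∀ j, 0 < τ j ∧ τ j < 1)
    (hs : ∑' j, ENNReal.ofReal (1 / Real.log (1 / τ j)) ≤ ENNReal.ofReal (1 / 20))
    {E F : Set ℝ} (hE : Perfect E) (hEc : IsCompact E) (hne : E.Nonempty) (hF : IsClosed F)
    (hcov : ∀ v, |v| < 1 → v ∉ F → ∃ j, |v - y j| ≤ τ j) :
    ∃ h : Homeomorph ℂ ℂ, (∀ z : ℂ, ¬ (z.re ∈ E ∧ z.im ∈ F) → DifferentiableAt ℂ (h : ℂ → ℂ) z) ∧
      ¬ IsMobiusOn (h : ℂ → ℂ) univ := by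
  obtain ⟨μ, h1, h2, h3⟩ := hE.exists_measure hne
  refine (isAxisMonotone_densityMeasure hτ hs).exists_nonmobius_homeomorph (μ := μ)
    (densityMeasure_ne_zero (y := y) hτ hs) hEc hF h3 (densityMeasure_ae fun v hv => ?_)
  by_contra hvF
  have hv1 : |v| < 1 := by
    by_contra! h
    exact hv (density_eq_zero_of_one_le h)
  obtain ⟨j, hj⟩ := hcov v hv1 hvF
  exact hv (density_eq_zero_of_near hτ hj)

/-- A compact set with arbitrarily small connected punctured neighbourhoods. -/
def IsCell (C : Set ℂ) : Prop :=
  IsCompact C ∧ ∀ U, IsOpen U → C ⊆ U → ∃ V, IsOpen V ∧ C ⊆ V ∧ V ⊆ U ∧ IsPreconnected (V \ C)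

lemma isCell_image_closedBall {E : Type*} [NormedAddCommGroup E] [NormedSpace ℝ E] [ProperSpace E]
    (hE : 1 < Module.rank ℝ E) (φ : E ≃ₜ ℂ) : IsCell (φ '' closedBall 0 1) := by
  refine ⟨(isCompact_closedBall 0 1).image φ.continuous, fun U hU hCU => ?_⟩
  obtain ⟨δ, hδ, hδU⟩ := (isCompact_closedBall (0 : E) 1).exists_thickening_subset_open
    (hU.preimage φ.continuous) (image_subset_iff.1 hCU)
  rw [thickening_closedBall hδ zero_le_one] at hδU
  refine ⟨φ '' ball 0 (δ + 1), φ.isOpenMap _ isOpen_ball,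
    image_mono (closedBall_subset_ball (by linarith)), image_subset_iff.2 hδU, ?_⟩
  rw [← image_sdiff φ.injective]
  have : ball (0 : E) (δ + 1) \ closedBall 0 1 = {x | 1 < ‖x‖ ∧ ‖x‖ < δ + 1} := by
    ext x
    simp only [Set.mem_sdiff, mem_ball_zero_iff, mem_closedBall_zero_iff, not_le, mem_ofPred_eq]
    exact and_comm
  rw [this]
  exact (isPreconnected_annulus hE zero_le_one _).image _ φ.continuous.continuousOn

lemma isCell_closedBall (c : ℂ) {r : ℝ} (hr : 0 < r) : IsCell (closedBall c r) := by
  have hr' : (r : ℂ) ≠ 0 := by exact_mod_cast hr.ne'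
  have h := isCell_image_closedBall rank_complex_gt
    ((Homeomorph.mulLeft₀ (r : ℂ) hr').trans (Homeomorph.addLeft c))
  convert h using 1
  ext z
  simp only [mem_image, Homeomorph.trans_apply, Homeomorph.coe_addLeft, Homeomorph.coe_mulLeft₀,
    mem_closedBall, dist_eq_norm, sub_zero]
  constructor
  · intro hz
    refine ⟨(z - c) / r, ?_, by field_simp; ring⟩
    rw [norm_div, norm_real, Real.norm_of_nonneg hr.le, div_le_one hr]
    exact hz
  · rintro ⟨w, hw, rfl⟩
    rw [add_sub_cancel_left, norm_mul, norm_real, Real.norm_of_nonneg hr.le]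
    nlinarith

/-- The closed rectangle with centre `q.1` and half side lengths `q.2`. -/
def box (q : ℂ × ℝ × ℝ) : Set ℂ := {z | |z.re - q.1.re| ≤ q.2.1 ∧ |z.im - q.1.im| ≤ q.2.2}

/-- The open rectangle with centre `q.1` and half side lengths `q.2`. -/
def openBox (q : ℂ × ℝ × ℝ) : Set ℂ := {z | |z.re - q.1.re| < q.2.1 ∧ |z.im - q.1.im| < q.2.2}

lemma openBox_subset_box (q : ℂ × ℝ × ℝ) : openBox q ⊆ box q := fun _ h => ⟨h.1.le, h.2.le⟩

lemma isOpen_openBox (q : ℂ × ℝ × ℝ) : IsOpen (openBox q) :=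
  IsOpen.inter (isOpen_lt (f := fun z : ℂ => |z.re - q.1.re|) (by fun_prop) continuous_const)
    (isOpen_lt (f := fun z : ℂ => |z.im - q.1.im|) (by fun_prop) continuous_const)

lemma isClosed_box (q : ℂ × ℝ × ℝ) : IsClosed (box q) :=
  IsClosed.inter (isClosed_le (f := fun z : ℂ => |z.re - q.1.re|) (by fun_prop) continuous_const)
    (isClosed_le (f := fun z : ℂ => |z.im - q.1.im|) (by fun_prop) continuous_const)

lemma isCell_box {q : ℂ × ℝ × ℝ} (h1 : 0 < q.2.1) (h2 : 0 < q.2.2) : IsCell (box q) := by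
  let φ : ℝ × ℝ ≃ₜ ℂ := ((Homeomorph.mulLeft₀ q.2.1 h1.ne').prodCongr
    (Homeomorph.mulLeft₀ q.2.2 h2.ne')).trans
      (equivRealProdCLM.symm.toHomeomorph.trans (Homeomorph.addLeft q.1))
  have hrank : 1 < Module.rank ℝ (ℝ × ℝ) := by
    simp [one_add_one_eq_two]
  convert isCell_image_closedBall hrank φ using 1
  have hre : ∀ p, (φ p).re = q.1.re + q.2.1 * p.1 := fun p => by simp [φ]
  have him : ∀ p, (φ p).im = q.1.im + q.2.2 * p.2 := fun p => by simp [φ]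
  ext z
  constructor
  · intro hz
    refine ⟨((z.re - q.1.re) / q.2.1, (z.im - q.1.im) / q.2.2), ?_, ?_⟩
    · rw [mem_closedBall_zero_iff, Prod.norm_def, max_le_iff]
      simp only [norm_div, Real.norm_eq_abs, abs_of_pos h1, abs_of_pos h2]
      exact ⟨(div_le_one h1).2 hz.1, (div_le_one h2).2 hz.2⟩
    · apply Complex.ext
      · rw [hre]; field_simp; ring
      · rw [him]; field_simp; ring
  · rintro ⟨p, hp, rfl⟩
    rw [mem_closedBall_zero_iff, Prod.norm_def, max_le_iff, Real.norm_eq_abs,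
      Real.norm_eq_abs] at hp
    constructor
    · rw [hre, add_sub_cancel_left, abs_mul, abs_of_pos h1]; nlinarith
    · rw [him, add_sub_cancel_left, abs_mul, abs_of_pos h2]; nlinarith

lemma IsCell.isPreconnected_diff {U C : Set ℂ} (hC : IsCell C) (hU : IsOpen U)
    (hUc : IsPreconnected U) (hCU : C ⊆ U) : IsPreconnected (U \ C) := by
  obtain ⟨V, hV, hCV, hVU, hVc⟩ := hC.2 U hU hCU
  have key : ∀ A B : Set ℂ, IsOpen A → IsOpen B → U \ C ⊆ A ∪ B → (U \ C ∩ A).Nonempty →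
      (U \ C ∩ B).Nonempty → ¬ (U \ C ∩ (A ∩ B)).Nonempty → V \ C ⊆ A → False := by
    intro A B hA hB hcov hAn hBn hAB hVA
    obtain ⟨x, hx, hxV, hxB⟩ := hUc (A ∪ V) (B \ C) (hA.union hV)
      (hB.sdiff hC.1.isClosed) (fun x hx => by
        by_cases hxC : x ∈ C
        · exact Or.inl (Or.inr (hCV hxC))
        · rcases hcov ⟨hx, hxC⟩ with h | h
          · exact Or.inl (Or.inl h)
          · exact Or.inr ⟨h, hxC⟩)
      (hAn.mono fun x hx => ⟨hx.1.1, Or.inl hx.2⟩) (hBn.mono fun x hx => ⟨hx.1.1, hx.2, hx.1.2⟩)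
    refine hAB ⟨x, ⟨hx, hxB.2⟩, ?_, hxB.1⟩
    rcases hxV with h | h
    · exact h
    · exact hVA ⟨h, hxB.2⟩
  intro A B hA hB hcov hAn hBn
  by_contra hAB
  have hUC := hU.sdiff hC.1.isClosed
  have hVU' : V \ C ⊆ U \ C := sdiff_subset_sdiff_left hVU
  rcases IsPreconnected.subset_or_subset (hA.inter hUC) (hB.inter hUC)
    (disjoint_left.2 fun x h1 h2 => hAB ⟨x, h1.2, h1.1, h2.1⟩)
    (fun x hx => (hcov (hVU' hx)).imp (fun h => ⟨h, hVU' hx⟩) fun h => ⟨h, hVU' hx⟩) hVc with h | h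
  · exact key A B hA hB hcov hAn hBn hAB fun x hx => (h hx).1
  · exact key B A hB hA (by rwa [union_comm]) hBn hAn (by rwa [inter_comm B]) fun x hx => (h hx).1

lemma isPreconnected_diff_sUnion {U : Set ℂ} (hU : IsOpen U) (hUc : IsPreconnected U)
    {s : Set (Set ℂ)} (hs : s.Finite) (hcell : ∀ C ∈ s, IsCell C ∧ C ⊆ U)
    (hdisj : s.PairwiseDisjoint id) : IsPreconnected (U \ ⋃₀ s) := by
  induction s, hs using Set.Finite.induction_on with
  | empty => simpa using hUc
  | @insert C s hC hs ih =>
    have h1 := ih (fun C hC => hcell C (mem_insert_of_mem _ hC))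
      (hdisj.subset (subset_insert _ _))
    have hcl : IsClosed (⋃₀ s) := by
      rw [sUnion_eq_biUnion]
      exact hs.isClosed_biUnion fun C hC => (hcell C (mem_insert_of_mem _ hC)).1.1.isClosed
    rw [sUnion_insert, union_comm, ← Set.sdiff_sdiff]
    refine (hcell C (mem_insert _ _)).1.isPreconnected_diff (hU.sdiff hcl) h1 fun x hx =>
      ⟨(hcell C (mem_insert _ _)).2 hx, ?_⟩
    rintro ⟨C', hC', hx'⟩
    exact disjoint_left.1 (hdisj (mem_insert _ _) (mem_insert_of_mem _ hC')
      (by rintro rfl; exact hC hC')) hx hx'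

section

variable {D : ℕ → Finset (ℂ × ℝ)} {Q : ℕ → Finset (ℂ × ℝ × ℝ)}

/-- The union of the boxes of a generation. -/
def cellSet (Q : ℕ → Finset (ℂ × ℝ × ℝ)) (n : ℕ) : Set ℂ := ⋃ q ∈ Q n, box q

/-- The set of points lying in boxes of all generations. -/
def limitSet (Q : ℕ → Finset (ℂ × ℝ × ℝ)) : Set ℂ := ⋂ n, cellSet Q n

/-- The disc of radius `10` without the limit set and all the small discs. -/
def cellDomain (D : ℕ → Finset (ℂ × ℝ)) (Q : ℕ → Finset (ℂ × ℝ × ℝ)) : Set ℂ :=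
  {z ∈ ball 0 10 | z ∉ limitSet Q ∧ ∀ n, ∀ p ∈ D n, z ∉ closedBall p.1 p.2}

/-- Nested generations of boxes, together with discs between the generations. -/
structure CellSystem (D : ℕ → Finset (ℂ × ℝ)) (Q : ℕ → Finset (ℂ × ℝ × ℝ)) : Prop where
  rad_pos : ∀ n, ∀ p ∈ D n, 0 < p.2
  box_pos : ∀ n, ∀ q ∈ Q n, 0 < q.2.1 ∧ 0 < q.2.2
  box_zero : ∀ q ∈ Q 0, box q ⊆ ball 0 10 ∧ Disjoint (ball 0 1) (box q)
  disc_sub : ∀ n, ∀ p ∈ D n, ∃ q ∈ Q n, closedBall p.1 p.2 ⊆ openBox q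
  box_sub : ∀ n, ∀ q ∈ Q (n + 1), ∃ q' ∈ Q n, box q ⊆ openBox q'
  box_disj : ∀ n, ∀ q ∈ Q n, ∀ q' ∈ Q n, q ≠ q' → Disjoint (box q) (box q')
  disc_disj : ∀ n, ∀ p ∈ D n, ∀ p' ∈ D n, p ≠ p' →
    Disjoint (closedBall p.1 p.2) (closedBall p'.1 p'.2)
  disc_box_disj : ∀ n, ∀ p ∈ D n, ∀ q ∈ Q (n + 1), Disjoint (closedBall p.1 p.2) (box q)
  small : ∀ η > 0, ∃ n, ∀ q ∈ Q n, q.2.1 < η ∧ q.2.2 < η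

namespace CellSystem

variable (h : CellSystem D Q)
include h

lemma cellSet_anti : Antitone (cellSet Q) := by
  refine antitone_nat_of_succ_le fun n z hz => ?_
  simp only [cellSet, mem_iUnion] at hz ⊢
  obtain ⟨q, hq, hz⟩ := hz
  obtain ⟨q', hq', hs⟩ := h.box_sub n q hq
  exact ⟨q', hq', openBox_subset_box _ (hs hz)⟩

lemma disc_subset_cellSet {n : ℕ} {p : ℂ × ℝ} (hp : p ∈ D n) :
    closedBall p.1 p.2 ⊆ cellSet Q n := fun z hz => by
  obtain ⟨q, hq, hs⟩ := h.disc_sub n p hp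
  simp only [cellSet, mem_iUnion]
  exact ⟨q, hq, openBox_subset_box _ (hs hz)⟩

lemma disc_cellSet_disj {n m : ℕ} (hnm : n < m) {p : ℂ × ℝ} (hp : p ∈ D n) :
    Disjoint (closedBall p.1 p.2) (cellSet Q m) := by
  refine disjoint_left.2 fun z hz hz' => ?_
  have := h.cellSet_anti (Nat.succ_le_of_lt hnm) hz'
  simp only [cellSet, mem_iUnion] at this
  obtain ⟨q, hq, hzq⟩ := this
  exact disjoint_left.1 (h.disc_box_disj n p hp q hq) hz hzq

lemma disc_disj_all {n m : ℕ} {p p' : ℂ × ℝ} (hp : p ∈ D n) (hp' : p' ∈ D m) (hne : p ≠ p') :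
    Disjoint (closedBall p.1 p.2) (closedBall p'.1 p'.2) := by
  rcases lt_trichotomy n m with hnm | rfl | hnm
  · exact (h.disc_cellSet_disj hnm hp).mono_right (h.disc_subset_cellSet hp')
  · exact h.disc_disj n p hp p' hp' hne
  · exact ((h.disc_cellSet_disj hnm hp').mono_right (h.disc_subset_cellSet hp)).symm

lemma cellSet_subset_ball (n : ℕ) : cellSet Q n ⊆ ball 0 10 := fun z hz => by
  have := h.cellSet_anti (Nat.zero_le n) hz
  simp only [cellSet, mem_iUnion] at this
  obtain ⟨q, hq, hzq⟩ := this
  exact (h.box_zero q hq).1 hzq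

omit h in
lemma isClosed_cellSet (n : ℕ) : IsClosed (cellSet Q n) :=
  isClosed_biUnion_finset fun q _ => isClosed_box q

lemma mem_cellDomain_of {n : ℕ} {z : ℂ} (hz : z ∈ ball 0 10) (hzn : z ∉ cellSet Q n)
    (hd : ∀ m < n, ∀ p ∈ D m, z ∉ closedBall p.1 p.2) : z ∈ cellDomain D Q := by
  refine ⟨hz, fun h' => hzn (mem_iInter.1 h' n), fun m p hp hzp => ?_⟩
  rcases lt_or_ge m n with hm | hm
  · exact hd m hm p hp hzp
  · exact hzn (h.cellSet_anti hm (h.disc_subset_cellSet hp hzp))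

/-- The complement of the discs of the generations before `n` and the boxes of generation `n`. -/
lemma exists_isOpen_isPreconnected (n : ℕ) : ∃ U : Set ℂ, IsOpen U ∧ IsPreconnected U ∧
    ∀ z, z ∈ U ↔ z ∈ ball 0 10 ∧ z ∉ cellSet Q n ∧ ∀ m < n, ∀ p ∈ D m, z ∉ closedBall p.1 p.2 := by
  set s : Set (Set ℂ) := box '' (Q n) ∪
    ⋃ m ∈ Iio n, (fun p : ℂ × ℝ => closedBall p.1 p.2) '' (D m) with hs
  have hfin : s.Finite := ((Q n).finite_toSet.image _).union
    ((finite_Iio n).biUnion fun m _ => (D m).finite_toSet.image _)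
  have hmem : ∀ C, C ∈ s ↔ (∃ q ∈ Q n, box q = C) ∨
      ∃ m < n, ∃ p ∈ D m, closedBall p.1 p.2 = C := by
    intro C
    simp only [hs, mem_union, mem_image, Finset.mem_coe, mem_iUnion, mem_Iio, exists_prop]
  have hcell : ∀ C ∈ s, IsCell C ∧ C ⊆ ball 0 10 := by
    intro C hC
    rcases (hmem C).1 hC with ⟨q, hq, rfl⟩ | ⟨m, -, p, hp, rfl⟩
    · exact ⟨isCell_box (h.box_pos n q hq).1 (h.box_pos n q hq).2,
        (subset_biUnion_of_mem (u := box) (show q ∈ (Q n : Set _) from hq)).trans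
          (h.cellSet_subset_ball n)⟩
    · exact ⟨isCell_closedBall _ (h.rad_pos m p hp),
        (h.disc_subset_cellSet hp).trans (h.cellSet_subset_ball m)⟩
  have hbox : ∀ q ∈ Q n, box q ⊆ cellSet Q n := fun q hq =>
    subset_biUnion_of_mem (u := box) (show q ∈ (Q n : Set _) from hq)
  have hdisj : s.PairwiseDisjoint id := by
    intro C hC C' hC' hne
    rcases (hmem C).1 hC with ⟨q, hq, rfl⟩ | ⟨m, hm, p, hp, rfl⟩ <;>
      rcases (hmem C').1 hC' with ⟨q', hq', rfl⟩ | ⟨m', hm', p', hp', rfl⟩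
    · exact h.box_disj n q hq q' hq' (by rintro rfl; exact hne rfl)
    · exact ((h.disc_cellSet_disj hm' hp').mono_right (hbox q hq)).symm
    · exact (h.disc_cellSet_disj hm hp).mono_right (hbox q' hq')
    · exact h.disc_disj_all hp hp' (by rintro rfl; exact hne rfl)
  have hcl : IsClosed (⋃₀ s) := by
    rw [sUnion_eq_biUnion]
    exact hfin.isClosed_biUnion fun C hC => (hcell C hC).1.1.isClosed
  refine ⟨ball 0 10 \ ⋃₀ s, isOpen_ball.sdiff hcl, isPreconnected_diff_sUnion isOpen_ball
    (convex_ball _ _).isPreconnected hfin hcell hdisj, fun z => ?_⟩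
  have : z ∈ ⋃₀ s ↔ z ∈ cellSet Q n ∨ ∃ m < n, ∃ p ∈ D m, z ∈ closedBall p.1 p.2 := by
    simp only [mem_sUnion, hmem, cellSet, mem_iUnion]
    constructor
    · rintro ⟨C, ⟨q, hq, rfl⟩ | ⟨m, hm, p, hp, rfl⟩, hz⟩
      · exact Or.inl ⟨q, hq, hz⟩
      · exact Or.inr ⟨m, hm, p, hp, hz⟩
    · rintro (⟨q, hq, hz⟩ | ⟨m, hm, p, hp, hz⟩)
      · exact ⟨_, Or.inl ⟨q, hq, rfl⟩, hz⟩
      · exact ⟨_, Or.inr ⟨m, hm, p, hp, rfl⟩, hz⟩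
  rw [Set.mem_sdiff, this]
  push Not
  rfl

lemma mem_cellDomain_iff {z : ℂ} : z ∈ cellDomain D Q ↔ ∃ n, z ∈ ball 0 10 ∧ z ∉ cellSet Q n ∧
    ∀ m < n, ∀ p ∈ D m, z ∉ closedBall p.1 p.2 := by
  constructor
  · rintro ⟨h1, h2, h3⟩
    simp only [limitSet, mem_iInter, not_forall] at h2
    obtain ⟨n, hn⟩ := h2
    exact ⟨n, h1, hn, fun m _ => h3 m⟩
  · rintro ⟨n, h1, h2, h3⟩
    exact h.mem_cellDomain_of h1 h2 h3

lemma ball_one_subset : ball 0 1 ⊆ cellDomain D Q := fun z hz => by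
  refine h.mem_cellDomain_of (n := 0) (ball_subset_ball (by norm_num) hz) (fun hz' => ?_) (by simp)
  simp only [cellSet, mem_iUnion] at hz'
  obtain ⟨q, hq, hzq⟩ := hz'
  exact disjoint_left.1 (h.box_zero q hq).2 hz hzq

lemma isOpen_cellDomain : IsOpen (cellDomain D Q) := by
  choose U hU _ hmem using h.exists_isOpen_isPreconnected
  have : cellDomain D Q = ⋃ n, U n := by
    ext z
    rw [h.mem_cellDomain_iff, mem_iUnion]
    simp only [hmem]
  rw [this]
  exact isOpen_iUnion hU

lemma isConnected_cellDomain : IsConnected (cellDomain D Q) := by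
  choose U _ hUc hmem using h.exists_isOpen_isPreconnected
  have : cellDomain D Q = ⋃ n, U n := by
    ext z
    rw [h.mem_cellDomain_iff, mem_iUnion]
    simp only [hmem]
  refine ⟨⟨0, h.ball_one_subset (mem_ball_self one_pos)⟩, ?_⟩
  rw [this]
  have h0 : ∀ n, (0 : ℂ) ∈ U n := fun n => by
    rw [hmem]
    obtain ⟨q1, q2⟩ : (0 : ℂ) ∈ ball 0 10 ∧ (0 : ℂ) ∉ cellSet Q 0 := by
      refine ⟨mem_ball_self (by norm_num), fun hz' => ?_⟩
      simp only [cellSet, mem_iUnion] at hz'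
      obtain ⟨q, hq, hzq⟩ := hz'
      exact disjoint_left.1 (h.box_zero q hq).2 (mem_ball_self one_pos) hzq
    exact ⟨q1, fun hz => q2 (h.cellSet_anti (Nat.zero_le n) hz), fun m _ p hp hz =>
      q2 (h.cellSet_anti (Nat.zero_le m) (h.disc_subset_cellSet hp hz))⟩
  exact isPreconnected_iUnion ⟨0, mem_iInter.2 h0⟩ hUc

lemma exists_collar {n : ℕ} {p : ℂ × ℝ} (hp : p ∈ D n) : ∃ δ > 0, ∀ z : ℂ, p.2 < ‖z - p.1‖ →
    ‖z - p.1‖ < p.2 + δ → z ∈ cellDomain D Q := by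
  set T : Set ℂ := (ball 0 10)ᶜ ∪ (cellSet Q (n + 1) ∪
    ⋃ m ∈ Iio (n + 1), ⋃ p' ∈ {p' | p' ∈ D m ∧ p' ≠ p}, closedBall p'.1 p'.2) with hT
  have hTc : IsClosed T := isOpen_ball.isClosed_compl.union ((isClosed_cellSet _).union
    ((finite_Iio _).isClosed_biUnion fun m _ =>
      ((D m).finite_toSet.subset fun p' hp' => hp'.1).isClosed_biUnion fun p' _ =>
        isClosed_closedBall))
  have hsub : closedBall p.1 p.2 ⊆ Tᶜ := by
    intro z hz hzT
    rcases hzT with hzT | hzT | hzT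
    · exact hzT (h.cellSet_subset_ball n (h.disc_subset_cellSet hp hz))
    · exact disjoint_left.1 (h.disc_cellSet_disj n.lt_succ_self hp) hz hzT
    · simp only [mem_iUnion] at hzT
      obtain ⟨m, -, p', hp', hz'⟩ := hzT
      exact disjoint_left.1 (h.disc_disj_all hp hp'.1 hp'.2.symm) hz hz'
  obtain ⟨δ, hδ, hδT⟩ := (isCompact_closedBall p.1 p.2).exists_thickening_subset_open
    hTc.isOpen_compl hsub
  rw [thickening_closedBall hδ (h.rad_pos n p hp).le] at hδT
  refine ⟨δ, hδ, fun z h1 h2 => ?_⟩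
  have hz : z ∉ T := hδT (by rw [mem_ball, dist_eq_norm]; linarith)
  refine h.mem_cellDomain_of (n := n + 1) (not_not.1 fun h' => hz (Or.inl h'))
    (fun h' => hz (Or.inr (Or.inl h'))) fun m hm p' hp' hz' => ?_
  by_cases hpp : p' = p
  · rw [hpp, mem_closedBall, dist_eq_norm] at hz'
    linarith
  · refine hz (Or.inr (Or.inr ?_))
    simp only [mem_iUnion]
    exact ⟨m, hm, p', ⟨hp', hpp⟩, hz'⟩

lemma exists_outer_collar : ∃ R₀, 0 < R₀ ∧ R₀ < 10 ∧ cellSet Q 0 ⊆ ball 0 R₀ ∧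
    ∀ z : ℂ, R₀ ≤ ‖z‖ → ‖z‖ < 10 → z ∈ cellDomain D Q := by
  have hc : IsCompact (cellSet Q 0) := (isCompact_closedBall (0 : ℂ) 10).of_isClosed_subset
    (isClosed_cellSet 0) ((h.cellSet_subset_ball 0).trans ball_subset_closedBall)
  obtain ⟨R, h1, h2⟩ : ∃ R < 10, cellSet Q 0 ⊆ ball 0 R :=
    exists_lt_subset_ball hc.isClosed (h.cellSet_subset_ball 0)
  refine ⟨max R 1, by positivity, max_lt h1 (by norm_num), h2.trans
    (ball_subset_ball (le_max_left _ _)), fun z h3 h4 => ?_⟩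
  refine h.mem_cellDomain_of (n := 0) (by simpa using h4) (fun h5 => ?_) (by simp)
  have := h2 h5
  rw [mem_ball_zero_iff] at this
  linarith [le_max_left R 1]

end CellSystem

end

lemma connectedComponentIn_subset_of_isolated {B S U T : Set ℂ} (hU : IsOpen U) (hT : IsClosed T)
    (hBU : ∀ z ∈ B, z ∈ U ↔ z ∈ S) (hBT : ∀ z ∈ B, z ∈ T ↔ z ∈ S) {x : ℂ} (hxB : x ∈ B)
    (hxS : x ∈ S) : connectedComponentIn B x ⊆ S := by
  have hsub := connectedComponentIn_subset B x
  have hx := mem_connectedComponentIn hxB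
  intro y hy
  by_contra hyS
  have hyT : y ∈ Tᶜ := fun hy' => hyS ((hBT y (hsub hy)).1 hy')
  have hcov : connectedComponentIn B x ⊆ U ∪ Tᶜ := fun z hz => by
    by_cases hzS : z ∈ S
    · exact Or.inl ((hBU z (hsub hz)).2 hzS)
    · exact Or.inr fun hz' => hzS ((hBT z (hsub hz)).1 hz')
  obtain ⟨z, hz, hzU, hzT⟩ := isPreconnected_connectedComponentIn U Tᶜ hU hT.isOpen_compl
    hcov ⟨x, hx, (hBU x hxB).2 hxS⟩ ⟨y, hy, hyT⟩
  exact hzT ((hBT z (hsub hz)).2 ((hBU z (hsub hz)).1 hzU))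

lemma sphere_subset_closure {Ω : Set ℂ} {c : ℂ} {r : ℝ}
    (h : ∃ᶠ t : ℝ in 𝓝 1, ∀ u : ℂ, ‖u‖ = r → c + t * u ∈ Ω) : sphere c r ⊆ closure Ω := by
  intro z hz
  rw [mem_sphere, dist_eq_norm] at hz
  have hc : Tendsto (fun t : ℝ => c + t * (z - c)) (𝓝 1) (𝓝 z) := by
    have : Continuous (fun t : ℝ => c + t * (z - c)) := by fun_prop
    simpa using this.tendsto 1
  exact mem_closure_of_frequently_of_tendsto (h.mono fun t ht => ht _ hz) hc

lemma frontier_sph {Ω : Set ℂ} (hb : Bornology.IsBounded Ω) (hΩ : IsOpen Ω) :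
    frontier (sph Ω) = sph (frontier Ω) := by
  have hcl : closure (sph Ω) = sph (closure Ω) := by
    refine Subset.antisymm (closure_minimal (image_mono subset_closure) ?_)
      (image_closure_subset_closure_image OnePoint.continuous_coe)
    exact (hb.isCompact_closure.image OnePoint.continuous_coe).isClosed
  have ho : IsOpen (sph Ω) := OnePoint.isOpenEmbedding_coe.isOpenMap _ hΩ
  rw [ho.frontier_eq, hΩ.frontier_eq, hcl]
  exact (image_sdiff OnePoint.coe_injective _ _).symm

lemma connectedComponentIn_sph {B : Set ℂ} {x : ℂ} (hx : x ∈ B) :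
    connectedComponentIn (sph B) (x : OnePoint ℂ) = sph (connectedComponentIn B x) := by
  refine Subset.antisymm ?_
    (OnePoint.continuous_coe.continuousOn.image_connectedComponentIn_subset hx)
  have hsub := connectedComponentIn_subset (sph B) (x : OnePoint ℂ)
  obtain ⟨S, hS⟩ : ∃ S : Set ℂ, sph S = connectedComponentIn (sph B) (x : OnePoint ℂ) :=
    subset_range_iff_exists_image_eq.1 (hsub.trans (image_subset_range _ _))
  have hxS : (x : OnePoint ℂ) ∈ sph S := hS ▸ mem_connectedComponentIn ⟨x, hx, rfl⟩
  rw [← hS] at hsub ⊢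
  refine image_mono (IsPreconnected.subset_connectedComponentIn ?_ ?_ ?_)
  · rw [← OnePoint.isOpenEmbedding_coe.isInducing.isPreconnected_image]
    change IsPreconnected (sph S)
    rw [hS]
    exact isPreconnected_connectedComponentIn
  · exact (OnePoint.coe_injective.mem_set_image).1 hxS
  · exact (image_subset_image_iff OnePoint.coe_injective).1 hsub

lemma IsNormalizedCircleDomain.of_bounded {Ω : Set ℂ} (hb : Bornology.IsBounded Ω)
    (hΩ : IsOpen Ω) (hc : IsConnected Ω) (h : ∀ x ∈ frontier Ω,
      connectedComponentIn (frontier Ω) x ⊆ {x} ∨ ∃ c r, 0 < r ∧ x ∈ sphere c r ∧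
        sphere c r ⊆ frontier Ω ∧ connectedComponentIn (frontier Ω) x ⊆ sphere c r) :
    IsNormalizedCircleDomain Ω := by
  refine ⟨hΩ, hc, ?_⟩
  rw [frontier_sph hb hΩ]
  rintro _ ⟨x, hx, rfl⟩
  simp only [connectedComponentIn_sph hx]
  rcases h x hx with h | ⟨c, r, hr, hxs, hs, h⟩
  · left
    rw [h.antisymm (singleton_subset_iff.2 (mem_connectedComponentIn hx))]
    exact image_singleton
  · right
    refine ⟨c, r, hr, ?_⟩
    rw [h.antisymm ((isPreconnected_sphere rank_complex_gt c r).subset_connectedComponentIn hxs hs)]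

namespace CellSystem

variable {D : ℕ → Finset (ℂ × ℝ)} {Q : ℕ → Finset (ℂ × ℝ × ℝ)} (h : CellSystem D Q)
include h

lemma boundary_mem {n : ℕ} {q : ℂ × ℝ × ℝ} (hq : q ∈ Q n) {w : ℂ} (hw : w ∈ box q)
    (hw' : w ∉ openBox q) : w ∈ cellDomain D Q := by
  have hwn : w ∈ cellSet Q n := mem_biUnion (show q ∈ (Q n : Set _) from hq) hw
  have key : ∀ q' ∈ Q n, w ∉ openBox q' := fun q' hq' hwq => by
    by_cases hqq : q = q'
    · exact hw' (hqq ▸ hwq)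
    · exact disjoint_left.1 (h.box_disj n q hq q' hq' hqq) hw (openBox_subset_box _ hwq)
  refine h.mem_cellDomain_of (n := n + 1) (h.cellSet_subset_ball n hwn) (fun h' => ?_)
    fun m hm p hp hz => ?_
  · simp only [cellSet, mem_iUnion] at h'
    obtain ⟨q', hq', hwq⟩ := h'
    obtain ⟨q'', hq'', hs⟩ := h.box_sub n q' hq'
    exact key q'' hq'' (hs hwq)
  · rcases (Nat.lt_succ_iff.1 hm).lt_or_eq with hm | rfl
    · exact disjoint_left.1 (h.disc_cellSet_disj hm hp) hz hwn
    · obtain ⟨q'', hq'', hs⟩ := h.disc_sub m p hp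
      exact key q'' hq'' (hs hz)

omit h in
lemma isBounded_cellDomain : Bornology.IsBounded (cellDomain D Q) :=
  isBounded_ball.subset fun _ hz => hz.1

lemma exists_box_subset_ball {x : ℂ} (hx : x ∈ limitSet Q) {η : ℝ} (hη : 0 < η) :
    ∃ n, ∃ q ∈ Q n, x ∈ box q ∧ box q ⊆ ball x η := by
  obtain ⟨n, hn⟩ := h.small (η / 4) (by positivity)
  have := mem_iInter.1 hx n
  simp only [cellSet, mem_iUnion] at this
  obtain ⟨q, hq, hxq⟩ := this
  refine ⟨n, q, hq, hxq, fun z hz => ?_⟩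
  have h1 := hn q hq
  rw [mem_ball, dist_eq_norm]
  refine (Complex.norm_le_abs_re_add_abs_im _).trans_lt ?_
  have h2 : |(z - x).re| ≤ 2 * q.2.1 := by
    rw [Complex.sub_re, show z.re - x.re = (z.re - q.1.re) - (x.re - q.1.re) by ring]
    linarith [abs_sub (z.re - q.1.re) (x.re - q.1.re), hz.1, hxq.1]
  have h3 : |(z - x).im| ≤ 2 * q.2.2 := by
    rw [Complex.sub_im, show z.im - x.im = (z.im - q.1.im) - (x.im - q.1.im) by ring]
    linarith [abs_sub (z.im - q.1.im) (x.im - q.1.im), hz.2, hxq.2]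
  linarith

lemma limitSet_subset_closure : limitSet Q ⊆ closure (cellDomain D Q) := by
  intro x hx
  rw [Metric.mem_closure_iff]
  intro η hη
  obtain ⟨n, q, hq, -, hs⟩ := h.exists_box_subset_ball hx hη
  obtain ⟨h1, h2⟩ := h.box_pos n q hq
  have hw : (q.1 + q.2.1 : ℂ) ∈ box q := by
    simp [box, abs_of_pos h1, h2.le]
  refine ⟨_, h.boundary_mem hq hw fun h' => ?_, ?_⟩
  · have := h'.1
    simp [abs_of_pos h1] at this
  · rw [dist_comm]
    exact hs hw

lemma sphere_subset_closure_cellDomain {n : ℕ} {p : ℂ × ℝ} (hp : p ∈ D n) :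
    sphere p.1 p.2 ⊆ closure (cellDomain D Q) := by
  have hr := h.rad_pos n p hp
  obtain ⟨δ, hδ, hs⟩ := h.exists_collar hp
  refine sphere_subset_closure ?_
  have hI : Ioo (1 : ℝ) (1 + δ / p.2) ∈ 𝓝[>] 1 :=
    Ioo_mem_nhdsGT (by have := div_pos hδ hr; linarith)
  refine Frequently.filter_mono (Eventually.frequently ?_) (nhdsWithin_le_nhds (s := Ioi 1))
  filter_upwards [hI] with t ht u hu
  have hn : ‖p.1 + t * u - p.1‖ = t * p.2 := by
    rw [add_sub_cancel_left, norm_mul, hu, norm_real, Real.norm_of_nonneg (by linarith [ht.1])]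
  have h2 := ht.2
  refine hs _ ?_ ?_
  · rw [hn]; nlinarith [ht.1]
  · rw [hn]
    have : (1 + δ / p.2) * p.2 = p.2 + δ := by field_simp
    nlinarith

lemma outer_sphere_subset_closure : sphere 0 10 ⊆ closure (cellDomain D Q) := by
  obtain ⟨R, hR, hR', -, hs⟩ := h.exists_outer_collar
  refine sphere_subset_closure ?_
  have hI : Ioo (R / 10) (1 : ℝ) ∈ 𝓝[<] 1 := Ioo_mem_nhdsLT (by linarith)
  refine Frequently.filter_mono (Eventually.frequently ?_) (nhdsWithin_le_nhds (s := Iio 1))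
  filter_upwards [hI] with t ht u hu
  have ht0 : 0 < t := lt_trans (by positivity) ht.1
  have hn : ‖(0 : ℂ) + t * u‖ = t * 10 := by
    rw [zero_add, norm_mul, hu, norm_real, Real.norm_of_nonneg ht0.le]
  refine hs _ ?_ ?_
  · rw [hn]; linarith [ht.1]
  · rw [hn]; linarith [ht.2]

lemma mem_frontier_iff {z : ℂ} : z ∈ frontier (cellDomain D Q) ↔
    z ∈ sphere 0 10 ∨ (∃ n, ∃ p ∈ D n, z ∈ sphere p.1 p.2) ∨ z ∈ limitSet Q := by
  rw [h.isOpen_cellDomain.frontier_eq]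
  constructor
  · rintro ⟨h1, h2⟩
    have h3 : z ∈ closedBall 0 10 :=
      closure_minimal (fun w hw => ball_subset_closedBall hw.1) isClosed_closedBall h1
    have h4 : ∀ n, ∀ p ∈ D n, z ∉ ball p.1 p.2 := fun n p hp =>
      closure_minimal (fun w hw hw' => hw.2.2 n p hp (ball_subset_closedBall hw'))
        isOpen_ball.isClosed_compl h1
    by_contra! h5
    refine h2 ⟨?_, h5.2.2, fun n p hp hz => ?_⟩
    · exact lt_of_le_of_ne h3 h5.1
    · exact h5.2.1 n p hp (le_antisymm hz (not_lt.1 (h4 n p hp)))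
  · rintro (hz | ⟨n, p, hp, hz⟩ | hz)
    · refine ⟨h.outer_sphere_subset_closure hz, fun h' => ?_⟩
      have := h'.1
      rw [mem_ball, mem_sphere.1 hz] at this
      exact lt_irrefl _ this
    · exact ⟨h.sphere_subset_closure_cellDomain hp hz, fun h' => h'.2.2 n p hp
        (sphere_subset_closedBall hz)⟩
    · exact ⟨h.limitSet_subset_closure hz, fun h' => h'.2.1 hz⟩

lemma limitSet_subset_frontier : limitSet Q ⊆ frontier (cellDomain D Q) :=
  fun _ hz => h.mem_frontier_iff.2 (Or.inr (Or.inr hz))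

theorem isNormalizedCircleDomain : IsNormalizedCircleDomain (cellDomain D Q) := by
  have hfr : ∀ z ∈ frontier (cellDomain D Q), z ∉ cellDomain D Q := fun z hz hz' => by
    rw [h.isOpen_cellDomain.frontier_eq] at hz
    exact hz.2 hz'
  have hcl : ∀ z ∈ frontier (cellDomain D Q), z ∈ closure (cellDomain D Q) := fun z hz =>
    frontier_subset_closure hz
  refine .of_bounded isBounded_cellDomain h.isOpen_cellDomain h.isConnected_cellDomain
    fun x hx => ?_
  rcases h.mem_frontier_iff.1 hx with hxs | ⟨n, p, hp, hxs⟩ | hxK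
  · right
    obtain ⟨R, hR, hR', -, hs⟩ := h.exists_outer_collar
    have key : ∀ z ∈ frontier (cellDomain D Q), R ≤ ‖z‖ → z ∈ sphere 0 10 := fun z hz hRz => by
      have h1 : z ∈ closedBall 0 10 :=
        closure_minimal (fun w hw => ball_subset_closedBall hw.1) isClosed_closedBall (hcl z hz)
      rw [mem_closedBall_zero_iff] at h1
      rw [mem_sphere_zero_iff_norm]
      by_contra hne
      exact hfr z hz (hs z hRz (lt_of_le_of_ne h1 hne))
    refine ⟨0, 10, by norm_num, hxs, fun z hz => h.mem_frontier_iff.2 (Or.inl hz),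
      connectedComponentIn_subset_of_isolated (U := {z | R < ‖z‖}) (T := {z | R ≤ ‖z‖})
        (isOpen_lt continuous_const continuous_norm)
        (isClosed_le continuous_const continuous_norm) (fun z hz => ⟨fun h' => ?_, fun h' => ?_⟩)
        (fun z hz => ⟨key z hz, fun h' => ?_⟩) hx hxs⟩
    · exact key z hz (le_of_lt h')
    · rw [mem_sphere_zero_iff_norm] at h'
      simpa [h'] using hR'
    · rw [mem_sphere_zero_iff_norm] at h'
      simpa [h'] using hR'.le
  · right
    have hr := h.rad_pos n p hp
    obtain ⟨δ, hδ, hs⟩ := h.exists_collar hp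
    have key : ∀ z ∈ frontier (cellDomain D Q), ‖z - p.1‖ < p.2 + δ → z ∈ sphere p.1 p.2 :=
      fun z hz hz' => by
      rw [mem_sphere, dist_eq_norm]
      rcases lt_trichotomy ‖z - p.1‖ p.2 with h1 | h1 | h1
      · have : z ∉ ball p.1 p.2 :=
          closure_minimal (fun w hw hw' => hw.2.2 n p hp (ball_subset_closedBall hw'))
            isOpen_ball.isClosed_compl (hcl z hz)
        exact absurd (by rwa [mem_ball, dist_eq_norm]) this
      · exact h1
      · exact absurd (hs z h1 hz') (hfr z hz)
    refine ⟨p.1, p.2, hr, hxs, fun z hz => h.mem_frontier_iff.2 (Or.inr (Or.inl ⟨n, p, hp, hz⟩)),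
      connectedComponentIn_subset_of_isolated (U := ball p.1 (p.2 + δ))
        (T := closedBall p.1 p.2) isOpen_ball isClosed_closedBall
        (fun z hz => ⟨fun h' => key z hz (by rwa [mem_ball, dist_eq_norm] at h'), fun h' => ?_⟩)
        (fun z hz => ⟨fun h' => key z hz ?_, fun h' => sphere_subset_closedBall h'⟩) hx hxs⟩
    · rw [mem_sphere] at h'
      rw [mem_ball]
      linarith
    · rw [mem_closedBall, dist_eq_norm] at h'
      linarith
  · left
    intro y hy
    by_contra hne
    obtain ⟨n, q, hq, hxq, hqs⟩ := h.exists_box_subset_ball hxK (dist_pos.2 (Ne.symm hne))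
    have := connectedComponentIn_subset_of_isolated (S := box q) (isOpen_openBox q) (isClosed_box q)
      (fun z hz => ⟨fun h' => openBox_subset_box q h', fun h' => by
        by_contra hz'
        exact hfr z hz (h.boundary_mem hq h' hz')⟩) (fun z hz => Iff.rfl) hx hxq hy
    have := hqs this
    rw [mem_ball, dist_comm] at this
    exact lt_irrefl _ this

end CellSystem

lemma sq_lintegral_le {α : Type*} [MeasurableSpace α] (μ : Measure α) {G : α → ℝ≥0∞}
    (hG : AEMeasurable G μ) : (∫⁻ x, G x ∂μ) ^ 2 ≤ μ univ * ∫⁻ x, G x ^ 2 ∂μ := by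
  have h := ENNReal.lintegral_mul_le_Lp_mul_Lq μ Real.HolderConjugate.two_two
    (aemeasurable_const (b := (1 : ℝ≥0∞))) hG
  simp only [Pi.mul_apply, one_mul, one_pow, lintegral_const, ENNReal.rpow_two] at h
  calc (∫⁻ x, G x ∂μ) ^ 2 ≤ (μ univ ^ (1 / 2 : ℝ) * (∫⁻ x, G x ^ 2 ∂μ) ^ (1 / 2 : ℝ)) ^ 2 := by
        gcongr
    _ = _ := by
        rw [mul_pow, ← ENNReal.rpow_two, ← ENNReal.rpow_two, ← ENNReal.rpow_mul,
          ← ENNReal.rpow_mul]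
        norm_num

/-- The measure of the image of an injective holomorphic function. -/
lemma lintegral_deriv_sq {Ω : Set ℂ} {f : ℂ → ℂ} (hΩ : IsOpen Ω) (hf : DifferentiableOn ℂ f Ω)
    (hi : InjOn f Ω) : ∫⁻ z in Ω, ‖deriv f z‖ₑ ^ 2 = volume (f '' Ω) := by
  have hd : ∀ z ∈ Ω, HasFDerivWithinAt f ((fderiv ℂ f z).restrictScalars ℝ) Ω z := fun z hz =>
    ((hf.differentiableAt (hΩ.mem_nhds hz)).hasFDerivAt.restrictScalars ℝ).hasFDerivWithinAt
  rw [← lintegral_abs_det_fderiv_eq_addHaar_image volume hΩ.measurableSet hd hi]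
  refine setLIntegral_congr_fun hΩ.measurableSet fun z hz => ?_
  have : ((fderiv ℂ f z).restrictScalars ℝ).det = ‖deriv f z‖ ^ 2 := by
    have h1 : (fderiv ℂ f z).det = deriv f z := by
      rw [← toSpanSingleton_deriv, ContinuousLinearMap.det_toSpanSingleton]
    have h2 : ((fderiv ℂ f z).restrictScalars ℝ).det = Algebra.norm ℝ (fderiv ℂ f z).det := by
      simp [ContinuousLinearMap.det, LinearMap.det_restrictScalars]
    rw [h2, h1, Algebra.norm_complex_apply, normSq_eq_norm_sq]
  simp only [this]
  rw [abs_of_nonneg (by positivity), ENNReal.ofReal_pow (norm_nonneg _), ofReal_norm]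

/-- The point with coordinates `x` along and `t` across a horizontal or vertical line through
`b`. -/
def linePoint (v : Bool) (b : ℂ) (x t : ℝ) : ℂ := if v then b + (t + x * I) else b + (x + t * I)

lemma lintegral_linePoint (v : Bool) (b : ℂ) {G : ℂ → ℝ≥0∞} (hG : Measurable G) :
    ∫⁻ t, ∫⁻ x, G (linePoint v b x t) = ∫⁻ z, G z := by
  have h0 : ∫⁻ z, G z = ∫⁻ p : ℝ × ℝ, G (b + (p.1 + p.2 * I)) := by
    rw [← lintegral_add_left_eq_self G b,
      ← volume_preserving_equiv_real_prod.symm.lintegral_comp_emb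
        measurableEquivRealProd.symm.measurableEmbedding]
    refine lintegral_congr fun p => ?_
    congr 2
    simp [measurableEquivRealProd_symm_apply, Complex.mk_eq_add_mul_I]
  have hm : Measurable fun p : ℝ × ℝ => G (b + (p.1 + p.2 * I)) := hG.comp (by fun_prop)
  rw [h0]
  cases v
  · simp only [linePoint]
    exact (lintegral_prod_symm' _ hm).symm
  · simp only [linePoint, if_true]
    exact (lintegral_prod _ hm.aemeasurable).symm

lemma continuous_linePoint (v : Bool) (b : ℂ) :
    Continuous fun p : ℝ × ℝ => linePoint v b p.2 p.1 := by
  cases v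
  · simp only [linePoint, Bool.false_eq_true, if_false]; fun_prop
  · simp only [linePoint, if_true]; fun_prop

lemma enorm_sub_le_lintegral_linePoint {Ω : Set ℂ} {f : ℂ → ℂ} (hΩ : IsOpen Ω)
    (hf : DifferentiableOn ℂ f Ω) {v : Bool} {b : ℂ} {t x y : ℝ} (hxy : x ≤ y)
    (h : ∀ s ∈ Icc x y, linePoint v b s t ∈ Ω) :
    ‖f (linePoint v b y t) - f (linePoint v b x t)‖ₑ ≤
      ∫⁻ s in Icc x y, ‖deriv f (linePoint v b s t)‖ₑ := by
  set u : ℂ := if v then I else 1 with hu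
  have hu1 : ‖u‖ₑ = 1 := by
    rw [hu]; cases v <;> simp [← ofReal_norm]
  have hl : ∀ s, HasDerivAt (fun s : ℝ => linePoint v b s t) u s := fun s => by
    have h1 : HasDerivAt (fun s : ℝ => (s : ℂ)) 1 s := Complex.ofRealCLM.hasDerivAt
    cases v
    · simpa [linePoint, hu] using (h1.add_const (t * I)).const_add b
    · simpa [linePoint, hu] using ((h1.mul_const I).const_add (t : ℂ)).const_add b
  have hd : ∀ s ∈ Icc x y, HasDerivAt (fun s : ℝ => f (linePoint v b s t))
      (deriv f (linePoint v b s t) * u) s := fun s hs =>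
    ((hf.differentiableAt (hΩ.mem_nhds (h s hs))).hasDerivAt.comp_of_eq s (hl s) rfl)
  have hcd : ContDiffOn ℝ 1 (fun s : ℝ => f (linePoint v b s t)) (Icc x y) := by
    have h1 : ContDiffOn ℝ 1 f Ω := (hf.contDiffOn hΩ).restrict_scalars ℝ
    refine h1.comp ?_ h
    refine ContDiff.contDiffOn ?_
    rw [contDiff_one_iff_deriv]
    refine ⟨fun s => (hl s).differentiableAt, ?_⟩
    rw [show deriv (fun s : ℝ => linePoint v b s t) = fun _ => u from funext fun s => (hl s).deriv]
    exact continuous_const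
  refine (enorm_sub_le_lintegral_deriv_of_contDiffOn_Icc hcd hxy).trans_eq ?_
  refine setLIntegral_congr_fun measurableSet_Icc fun s hs => ?_
  simp only [(hd s hs).deriv, enorm_mul, hu1, mul_one]

/-- The length-area method for a finite family of strips. -/
lemma exists_short_crossings {γ : Type*} {Ω : Set ℂ} {f : ℂ → ℂ} (hΩ : IsOpen Ω)
    (hf : DifferentiableOn ℂ f Ω) (hi : InjOn f Ω) (hb : ∀ z ∈ Ω, ‖f z‖ < 1) (G : Finset γ)
    (v : γ → Bool) (b : γ → ℂ) {T W : ℝ} (hT : 0 < T) (hW : 0 < W) :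
    ∃ t ∈ Ioo 0 T, ∃ L : γ → ℝ, (∀ g, 0 ≤ L g) ∧ (∑ g ∈ G, L g ^ 2) * T ≤ G.card * (W * Real.pi) ∧
      ∀ g ∈ G, ∀ x y, 0 ≤ x → x ≤ y → y ≤ W → (∀ s ∈ Icc x y, linePoint (v g) (b g) s t ∈ Ω) →
        ‖f (linePoint (v g) (b g) y t) - f (linePoint (v g) (b g) x t)‖ ≤ L g := by
  classical
  set H : ℂ → ℝ≥0∞ := Ω.indicator fun z => ‖deriv f z‖ₑ with hH
  have hHm : Measurable H := (measurable_deriv f).enorm.indicator hΩ.measurableSet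
  have harea : ∫⁻ z, H z ^ 2 ≤ ENNReal.ofReal Real.pi := by
    have h1 : ∀ z, H z ^ 2 = Ω.indicator (fun z => ‖deriv f z‖ₑ ^ 2) z := fun z => by
      by_cases hz : z ∈ Ω <;> simp [hH, hz]
    simp only [h1]
    rw [lintegral_indicator hΩ.measurableSet, lintegral_deriv_sq hΩ hf hi]
    calc volume (f '' Ω) ≤ volume (ball (0 : ℂ) 1) := measure_mono (image_subset_iff.2 fun z hz => by
          simpa using hb z hz)
      _ = _ := by
          rw [Complex.volume_ball, ENNReal.ofReal_one, one_pow, one_mul,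
            ← ENNReal.ofReal_coe_nnreal, NNReal.coe_real_pi]
  set A : γ → ℝ → ℝ≥0∞ := fun g t => ∫⁻ x in Icc 0 W, H (linePoint (v g) (b g) x t) with hA
  have hm2 : ∀ g, Measurable fun p : ℝ × ℝ => H (linePoint (v g) (b g) p.2 p.1) := fun g =>
    hHm.comp (continuous_linePoint _ _).measurable
  have hAm : ∀ g, Measurable (A g) := fun g => (hm2 g).lintegral_prod_right'
  have hA2 : ∀ g, ∫⁻ t, A g t ^ 2 ≤ ENNReal.ofReal W * ENNReal.ofReal Real.pi := fun g => by
    calc ∫⁻ t, A g t ^ 2 ≤ ∫⁻ t, ENNReal.ofReal W * ∫⁻ x, H (linePoint (v g) (b g) x t) ^ 2 := by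
          refine lintegral_mono fun t => (sq_lintegral_le _ ?_).trans ?_
          · exact ((hm2 g).comp measurable_prodMk_left).aemeasurable
          · rw [Measure.restrict_apply_univ, Real.volume_Icc, sub_zero]
            gcongr
            exact Measure.restrict_le_self
      _ = ENNReal.ofReal W * ∫⁻ t, ∫⁻ x, H (linePoint (v g) (b g) x t) ^ 2 :=
          lintegral_const_mul' _ _ ENNReal.ofReal_ne_top
      _ = ENNReal.ofReal W * ∫⁻ z, H z ^ 2 := by
          rw [lintegral_linePoint (v g) (b g) (hHm.pow_const 2)]
      _ ≤ _ := by gcongr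
  have hvol : volume (Ioo 0 T) = ENNReal.ofReal T := by rw [Real.volume_Ioo, sub_zero]
  obtain ⟨t, ht, hle⟩ := exists_le_setLAverage (μ := volume) (s := Ioo 0 T)
    (f := fun t => ∑ g ∈ G, A g t ^ 2) (by rw [hvol]; simpa using hT) (by rw [hvol]; simp)
    (Finset.measurable_sum _ fun g _ => (hAm g).pow_const 2).aemeasurable
  rw [setLAverage_eq, hvol] at hle
  have htot : ∫⁻ t in Ioo 0 T, ∑ g ∈ G, A g t ^ 2 ≤ ENNReal.ofReal (G.card * (W * Real.pi)) := by
    calc ∫⁻ t in Ioo 0 T, ∑ g ∈ G, A g t ^ 2 ≤ ∫⁻ t, ∑ g ∈ G, A g t ^ 2 :=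
          lintegral_mono' Measure.restrict_le_self le_rfl
      _ = ∑ g ∈ G, ∫⁻ t, A g t ^ 2 := lintegral_finsetSum _ fun g _ => (hAm g).pow_const 2
      _ ≤ ∑ g ∈ G, ENNReal.ofReal W * ENNReal.ofReal Real.pi := Finset.sum_le_sum fun g _ => hA2 g
      _ = _ := by
          rw [Finset.sum_const, nsmul_eq_mul, ENNReal.ofReal_mul (by positivity),
            ENNReal.ofReal_mul hW.le, ENNReal.ofReal_natCast]
  have hsum : (∑ g ∈ G, A g t ^ 2) * ENNReal.ofReal T ≤ ENNReal.ofReal (G.card * (W * Real.pi)) := by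
    rw [← ENNReal.le_div_iff_mul_le (Or.inl (by simpa using hT)) (Or.inl ENNReal.ofReal_ne_top)]
    exact hle.trans (ENNReal.div_le_div_right htot _)
  have hfin : ∀ g ∈ G, A g t ≠ ∞ := fun g hg hAg => by
    have h1 : ∑ g ∈ G, A g t ^ 2 = ∞ := ENNReal.sum_eq_top.2 ⟨g, hg, by simp [hAg]⟩
    rw [h1, ENNReal.top_mul (by simpa using hT)] at hsum
    exact ENNReal.ofReal_ne_top (top_le_iff.1 hsum)
  refine ⟨t, ht, fun g => (A g t).toReal, fun g => ENNReal.toReal_nonneg, ?_,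
    fun g hg x y hx hxy hy hΩs => ?_⟩
  · rw [← ENNReal.ofReal_le_ofReal_iff (by positivity), ENNReal.ofReal_mul
      (Finset.sum_nonneg fun g _ => by positivity), ENNReal.ofReal_sum_of_nonneg
      (fun g _ => by positivity)]
    refine le_of_eq_of_le ?_ hsum
    congr 1
    refine Finset.sum_congr rfl fun g hg => ?_
    rw [ENNReal.ofReal_pow ENNReal.toReal_nonneg, ENNReal.ofReal_toReal (hfin g hg)]
  · rw [← toReal_enorm]
    refine ENNReal.toReal_mono (hfin g hg)
      ((enorm_sub_le_lintegral_linePoint hΩ hf hxy hΩs).trans ?_)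
    calc ∫⁻ s in Icc x y, ‖deriv f (linePoint (v g) (b g) s t)‖ₑ
        = ∫⁻ s in Icc x y, H (linePoint (v g) (b g) s t) :=
          setLIntegral_congr_fun measurableSet_Icc fun s hs => by simp [hH, hΩs s hs]
      _ ≤ A g t := lintegral_mono_set (Icc_subset_Icc hx hy)

lemma ContinuousOn.exists_glue {ι : Type*} (s : Finset ι) {E : Set ℂ} {X : ℂ → ℂ} {U : ι → Set ℂ}
    {b : ι → ℂ} {R : ι → ℝ} (hX : ContinuousOn X E) (hE : IsClosed E)
    (hU : ∀ i ∈ s, IsClosed (U i)) (hR : ∀ i ∈ s, 0 < R i)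
    (hUU : ∀ i ∈ s, ∀ j ∈ s, i ≠ j → U i ∩ U j ⊆ E)
    (hXU : ∀ i ∈ s, ∀ z ∈ E ∩ U i, X z ∈ closedBall (b i) (R i)) :
    ∃ Φ : ℂ → ℂ, ContinuousOn Φ (E ∪ ⋃ i ∈ s, U i) ∧ EqOn Φ X E ∧
      ∀ i ∈ s, ∀ z ∈ U i, Φ z ∈ closedBall (b i) (R i) := by
  classical
  have h : ∀ i ∈ s, ∃ Ψ : ℂ → ℂ, Continuous Ψ ∧ (∀ z ∈ E ∩ U i, Ψ z = X z) ∧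
      ∀ z, Ψ z ∈ closedBall (b i) (R i) := fun i hi =>
    ContinuousOn.exists_tietze_closedBall (hE.inter (hU i hi)) (hX.mono inter_subset_left)
      (hR i hi) (hXU i hi)
  choose! Ψ hΨc hΨe hΨb using h
  let Φ : ℂ → ℂ := fun z => if z ∈ E then X z else
    if h : ∃ i ∈ s, z ∈ U i then Ψ h.choose z else 0
  have h1 : EqOn Φ X E := fun z hz => if_pos hz
  have h2 : ∀ i ∈ s, EqOn Φ (Ψ i) (U i) := fun i hi z hz => by
    by_cases hzE : z ∈ E
    · rw [h1 hzE, hΨe i hi z ⟨hzE, hz⟩]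
    · have hex : ∃ i ∈ s, z ∈ U i := ⟨i, hi, hz⟩
      have heq : hex.choose = i := by
        by_contra hne
        exact hzE (hUU _ hex.choose_spec.1 i hi hne ⟨hex.choose_spec.2, hz⟩)
      simp only [Φ, if_neg hzE, dif_pos hex, heq]
  refine ⟨Φ, ?_, h1, fun i hi z hz => h2 i hi hz ▸ hΨb i hi z⟩
  have key : ∀ t : Finset ι, t ⊆ s → ContinuousOn Φ (E ∪ ⋃ i ∈ t, U i) := by
    intro t
    induction t using Finset.induction_on with
    | empty => intro _; simpa using hX.congr h1
    | insert i t hi ih =>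
      intro hts
      have hit := hts (Finset.mem_insert_self i t)
      have hts' := (Finset.subset_insert i t).trans hts
      rw [Finset.set_biUnion_insert, union_comm (U i), ← union_assoc]
      exact (ih hts').union_of_isClosed ((hΨc i hit).continuousOn.congr (h2 i hit))
        (hE.union (isClosed_biUnion_finset fun j hj => hU j (hts' hj))) (hU i hit)
  exact key s Subset.rfl

/-- A family of pairwise disjoint cells between the boxes of the generations `n` and `n + 1`, each
bounded by arcs in six discs of generation `n` and by short segments between consecutive discs;
the segments can be shifted by a parameter `t`. -/
structure Mesh (D : ℕ → Finset (ℂ × ℝ)) (Q : ℕ → Finset (ℂ × ℝ × ℝ)) (n : ℕ) where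
  P : Finset (ℝ × ℝ × ℕ)
  disc : Fin 6 → ℝ × ℝ × ℕ → ℂ × ℝ
  T : ℝ
  W : ℝ
  d : ℝ
  ctr : ℝ × ℝ × ℕ → ℂ
  U : ℝ → ℝ × ℝ × ℕ → Set ℂ
  Uo : ℝ → ℝ × ℝ × ℕ → Set ℂ
  vert : Fin 6 → Bool
  base : Fin 6 → ℝ × ℝ × ℕ → ℂ
  T_pos : 0 < T
  W_pos : 0 < W
  d_pos : 0 < d
  disc_mem : ∀ l, ∀ p ∈ P, disc l p ∈ D n
  disc_inj : ∀ l, InjOn (disc l) P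
  exists_disc : ∀ j ∈ D n, ∃ l, ∃ p ∈ P, disc l p = j
  isClosed_U : ∀ t p, IsClosed (U t p)
  isOpen_Uo : ∀ t p, IsOpen (Uo t p)
  Uo_subset : ∀ t p, Uo t p ⊆ U t p
  U_subset : ∀ t ∈ Ioo 0 T, ∀ p ∈ P, U t p ⊆ cellSet Q n
  cover : ∀ t ∈ Ioo 0 T, ∀ z ∈ cellSet Q (n + 1), ∃ p ∈ P, z ∈ Uo t p
  disj : ∀ t ∈ Ioo 0 T, ∀ p ∈ P, ∀ q ∈ P, p ≠ q → Disjoint (Uo t p) (U t q)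
  edges : ∀ t ∈ Ioo 0 T, ∀ p ∈ P, ∃ α β : Fin 6 → ℝ, (∀ l, 0 ≤ α l ∧ α l < β l ∧ β l ≤ W ∧
    (∀ x ∈ Ioo (α l) (β l), linePoint (vert l) (base l p) x t ∈ cellDomain D Q) ∧
    ((linePoint (vert l) (base l p) (α l) t ∈ sphere (disc l p).1 (disc l p).2 ∧
      linePoint (vert l) (base l p) (β l) t ∈ sphere (disc (l + 1) p).1 (disc (l + 1) p).2) ∨
     (linePoint (vert l) (base l p) (β l) t ∈ sphere (disc l p).1 (disc l p).2 ∧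
      linePoint (vert l) (base l p) (α l) t ∈
        sphere (disc (l + 1) p).1 (disc (l + 1) p).2))) ∧
    ∀ z ∈ U t p, z ∉ Uo t p → (∃ l, z ∈ closedBall (disc l p).1 (disc l p).2) ∨
      ∃ l, ∃ x ∈ Ioo (α l) (β l), z = linePoint (vert l) (base l p) x t
  near : ∀ t ∈ Ioo 0 T, ∀ p ∈ P, ∀ j ∈ D n, ∀ z ∈ U t p, z ∈ closedBall j.1 j.2 →
    ∃ l, disc l p = j
  U_ctr : ∀ t ∈ Ioo 0 T, ∀ p ∈ P, U t p ⊆ closedBall (ctr p) d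
  disc_ctr : ∀ p ∈ P, ∀ l, closedBall (disc l p).1 (disc l p).2 ⊆ closedBall (ctr p) d

/-- A normalized conformal map of `cellDomain D Q` into the unit disc, whose boundary values on
the discs `p` lie on the circles with centre `c p` and radius `r p`. -/
structure NormalMap (D : ℕ → Finset (ℂ × ℝ)) (Q : ℕ → Finset (ℂ × ℝ × ℝ)) (f : ℂ → ℂ)
    (c : ℂ × ℝ → ℂ) (r : ℂ × ℝ → ℝ) : Prop where
  diff : DifferentiableOn ℂ f (cellDomain D Q)
  inj : InjOn f (cellDomain D Q)
  zero : f 0 = 0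
  lt_one : ∀ z ∈ cellDomain D Q, ‖f z‖ < 1
  outer : ∀ a < 1, ∃ R < 10, ∀ z : ℂ, R < ‖z‖ → ‖z‖ < 10 → a < ‖f z‖
  rad_pos : ∀ n, ∀ p ∈ D n, 0 < r p
  lt_norm : ∀ n, ∀ p ∈ D n, ∀ z ∈ cellDomain D Q, r p < ‖f z - c p‖
  le_one : ∀ n, ∀ p ∈ D n, ‖c p‖ + r p ≤ 1
  disj : ∀ n m, ∀ p ∈ D n, ∀ q ∈ D m, p ≠ q →
    Disjoint (closedBall (c p) (r p)) (closedBall (c q) (r q))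
  bdry : ∀ n, ∀ p ∈ D n, ∃ (η : ℝ → ℝ) (k : ℤ) (K : ℝ≥0), LipschitzWith K η ∧ Monotone η ∧
    (∀ θ, η (θ + 2 * Real.pi) = η θ + 2 * Real.pi * k) ∧
    ∀ θ, Tendsto f (𝓝[cellDomain D Q] circleMap p.1 p.2 θ) (𝓝 (circleMap (c p) (r p) (η θ)))

/-- The domain together with the circles bounding the small discs. -/
def cellDomainBdry (D : ℕ → Finset (ℂ × ℝ)) (Q : ℕ → Finset (ℂ × ℝ × ℝ)) : Set ℂ :=
  cellDomain D Q ∪ ⋃ n, ⋃ p ∈ D n, sphere p.1 p.2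

lemma exists_circleMap {z c : ℂ} {r : ℝ} (hz : z ∈ sphere c r) : ∃ θ, circleMap c r θ = z := by
  refine ⟨(z - c).arg, ?_⟩
  rw [mem_sphere, dist_eq_norm] at hz
  rw [circleMap, ← hz, Complex.norm_mul_exp_arg_mul_I]
  ring

lemma CellSystem.cellDomainBdry_subset_closure {D : ℕ → Finset (ℂ × ℝ)}
    {Q : ℕ → Finset (ℂ × ℝ × ℝ)} (h : CellSystem D Q) :
    cellDomainBdry D Q ⊆ closure (cellDomain D Q) :=
  union_subset subset_closure (iUnion_subset fun _ => iUnion₂_subset fun _ hp =>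
    h.sphere_subset_closure_cellDomain hp)

namespace NormalMap

variable {D : ℕ → Finset (ℂ × ℝ)} {Q : ℕ → Finset (ℂ × ℝ × ℝ)} {f : ℂ → ℂ} {c : ℂ × ℝ → ℂ}
  {r : ℂ × ℝ → ℝ} (N : NormalMap D Q f c r) (h : CellSystem D Q)
include N h

omit h in
lemma exists_tendsto {z : ℂ} (hz : z ∈ cellDomainBdry D Q) :
    ∃ y, Tendsto f (𝓝[cellDomain D Q] z) (𝓝 y) := by
  rcases hz with hz | hz
  · exact ⟨f z, (N.diff z hz).continuousWithinAt⟩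
  · simp only [mem_iUnion] at hz
    obtain ⟨n, p, hp, hz⟩ := hz
    obtain ⟨θ, rfl⟩ := exists_circleMap hz
    obtain ⟨η, k, K, -, -, -, hη⟩ := N.bdry n p hp
    exact ⟨_, hη θ⟩

lemma continuousOn_extend : ContinuousOn (extendFrom (cellDomain D Q) f) (cellDomainBdry D Q) :=
  continuousOn_extendFrom h.cellDomainBdry_subset_closure fun _ hz => N.exists_tendsto hz

omit h in
lemma extend_eq {z : ℂ} (hz : z ∈ cellDomain D Q) : extendFrom (cellDomain D Q) f z = f z :=
  extendFrom_eq (subset_closure hz) (N.diff z hz).continuousWithinAt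

lemma exists_extend_circle {n : ℕ} {p : ℂ × ℝ} (hp : p ∈ D n) :
    ∃ (η : ℝ → ℝ) (k : ℤ) (K : ℝ≥0), LipschitzWith K η ∧ Monotone η ∧
      (∀ θ, η (θ + 2 * Real.pi) = η θ + 2 * Real.pi * k) ∧
      ∀ θ, extendFrom (cellDomain D Q) f (circleMap p.1 p.2 θ) = circleMap (c p) (r p) (η θ) := by
  obtain ⟨η, k, K, h1, h2, h3, hη⟩ := N.bdry n p hp
  exact ⟨η, k, K, h1, h2, h3, fun θ => extendFrom_eq (h.sphere_subset_closure_cellDomain hp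
    (circleMap_mem_sphere _ (h.rad_pos n p hp).le _)) (hη θ)⟩

lemma extend_mem_sphere {n : ℕ} {p : ℂ × ℝ} (hp : p ∈ D n) {z : ℂ} (hz : z ∈ sphere p.1 p.2) :
    extendFrom (cellDomain D Q) f z ∈ sphere (c p) (r p) := by
  obtain ⟨θ, rfl⟩ := exists_circleMap hz
  obtain ⟨η, k, K, -, -, -, hη⟩ := N.exists_extend_circle h hp
  rw [hη]
  exact circleMap_mem_sphere _ (N.rad_pos n p hp).le _

/-- The distance of the values of the extension along a segment in the domain with endpoints on
two circles is controlled by its values inside the segment. -/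
lemma norm_extend_sub_le {v : Bool} {b : ℂ} {t α β L : ℝ}
    (hαβ : α < β) (hΩ : ∀ x ∈ Ioo α β, linePoint v b x t ∈ cellDomain D Q)
    (hα : linePoint v b α t ∈ cellDomainBdry D Q) (hβ : linePoint v b β t ∈ cellDomainBdry D Q)
    (hL : ∀ x y, α < x → x ≤ y → y < β → ‖f (linePoint v b y t) - f (linePoint v b x t)‖ ≤ L) :
    ∀ x ∈ Icc α β, ∀ y ∈ Icc α β, ‖extendFrom (cellDomain D Q) f (linePoint v b y t) -
      extendFrom (cellDomain D Q) f (linePoint v b x t)‖ ≤ L := by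
  set g : ℝ → ℂ := fun x => extendFrom (cellDomain D Q) f (linePoint v b x t) with hg
  have hmaps : ∀ x ∈ Icc α β, linePoint v b x t ∈ cellDomainBdry D Q := by
    intro x hx
    rcases hx.1.eq_or_lt with rfl | h1
    · exact hα
    · rcases hx.2.eq_or_lt with rfl | h2
      · exact hβ
      · exact Or.inl (hΩ x ⟨h1, h2⟩)
  have hgc : ContinuousOn g (Icc α β) := (N.continuousOn_extend h).comp
    ((continuous_linePoint v b).comp (continuous_const.prodMk continuous_id)).continuousOn hmaps
  have hgL : ∀ x ∈ Ioo α β, ∀ y ∈ Ioo α β, ‖g y - g x‖ ≤ L := by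
    intro x hx y hy
    simp only [hg, N.extend_eq (hΩ x hx), N.extend_eq (hΩ y hy)]
    rcases le_total x y with hxy | hxy
    · exact hL x y hx.1 hxy hy.2
    · rw [norm_sub_rev]; exact hL y x hy.1 hxy hx.2
  have hcl : closure (Ioo α β) = Icc α β := closure_Ioo hαβ.ne
  have hstep : ∀ w : ℂ, (∀ x ∈ Ioo α β, ‖g x - w‖ ≤ L) → ∀ x ∈ Icc α β, ‖g x - w‖ ≤ L := by
    intro w hw x hx
    have hmem : g x ∈ closure (g '' Ioo α β) := by
      rw [← hcl] at hx hgc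
      exact hgc.image_closure ⟨x, hx, rfl⟩
    have : closure (g '' Ioo α β) ⊆ closedBall w L := closure_minimal
      (image_subset_iff.2 fun x hx => by simpa [dist_eq_norm] using hw x hx) isClosed_closedBall
    simpa [dist_eq_norm] using this hmem
  intro x hx y hy
  refine hstep (g x) (fun y hy => ?_) y hy
  rw [norm_sub_rev]
  exact hstep (g y) (fun x hx => hgL y hy x hx) x hx

omit N h in
lemma mem_bdry_of_sphere {n : ℕ} {p : ℂ × ℝ} (hp : p ∈ D n) {z : ℂ} (hz : z ∈ sphere p.1 p.2) :
    z ∈ cellDomainBdry D Q :=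
  Or.inr (mem_iUnion.2 ⟨n, mem_biUnion (show p ∈ (D n : Set _) from hp) hz⟩)

/-- For some shift of the mesh, the boundary values around each cell lie in a small disc. -/
lemma exists_cell_radius {n : ℕ} (M : Mesh D Q n) : ∃ t ∈ Ioo 0 M.T, ∃ ρ : ℝ × ℝ × ℕ → ℝ,
    (∀ p ∈ M.P, 0 < ρ p) ∧
    ∑ p ∈ M.P, ρ p ^ 2 ≤ 648 * ∑ j ∈ D n, r j ^ 2 + 1000 * (M.P.card * M.W / M.T) ∧
    (∀ p ∈ M.P, ∀ l, closedBall (c (M.disc l p)) (r (M.disc l p)) ⊆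
      closedBall (c (M.disc 0 p)) (ρ p)) ∧
    ∀ p ∈ M.P, ∀ z ∈ M.U t p, z ∉ M.Uo t p →
      (∃ l, z ∈ closedBall (M.disc l p).1 (M.disc l p).2) ∨
      z ∈ cellDomain D Q ∧ f z ∈ closedBall (c (M.disc 0 p)) (ρ p) := by
  classical
  obtain ⟨t, ht, L, hL0, hLs, hL⟩ := exists_short_crossings h.isOpen_cellDomain N.diff N.inj
    N.lt_one (Finset.univ ×ˢ M.P : Finset (Fin 6 × (ℝ × ℝ × ℕ))) (fun g => M.vert g.1)
    (fun g => M.base g.1 g.2) M.T_pos M.W_pos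
  set ρ : ℝ × ℝ × ℕ → ℝ := fun p => 3 * ∑ l, r (M.disc l p) + 2 * ∑ l, L (l, p) with hρ
  have hr : ∀ p ∈ M.P, ∀ l, 0 < r (M.disc l p) := fun p hp l =>
    N.rad_pos n _ (M.disc_mem l p hp)
  have key : ∀ p ∈ M.P, (∀ l, dist (c (M.disc l p)) (c (M.disc (l + 1) p)) ≤
      r (M.disc l p) + r (M.disc (l + 1) p) + L (l, p)) ∧
      ∀ z ∈ M.U t p, z ∉ M.Uo t p →
      (∃ l, z ∈ closedBall (M.disc l p).1 (M.disc l p).2) ∨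
      z ∈ cellDomain D Q ∧ ∃ l, dist (f z) (c (M.disc l p)) ≤ r (M.disc l p) + L (l, p) := by
    intro p hp
    obtain ⟨α, β, hαβ, hcov⟩ := M.edges t ht p hp
    have hends : ∀ l, ∃ A ∈ Icc (α l) (β l), ∃ B ∈ Icc (α l) (β l),
        linePoint (M.vert l) (M.base l p) A t ∈ sphere (M.disc l p).1 (M.disc l p).2 ∧
        linePoint (M.vert l) (M.base l p) B t ∈
          sphere (M.disc (l + 1) p).1 (M.disc (l + 1) p).2 := by
      intro l
      obtain ⟨-, h2, -, -, ⟨h5, h6⟩ | ⟨h5, h6⟩⟩ := hαβ l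
      · exact ⟨α l, left_mem_Icc.2 h2.le, β l, right_mem_Icc.2 h2.le, h5, h6⟩
      · exact ⟨β l, right_mem_Icc.2 h2.le, α l, left_mem_Icc.2 h2.le, h5, h6⟩
    have hgap : ∀ l, ∀ x ∈ Icc (α l) (β l), ∀ y ∈ Icc (α l) (β l),
        ‖extendFrom (cellDomain D Q) f (linePoint (M.vert l) (M.base l p) y t) -
          extendFrom (cellDomain D Q) f (linePoint (M.vert l) (M.base l p) x t)‖ ≤ L (l, p) := by
      intro l
      obtain ⟨h1, h2, h3, h4, h5⟩ := hαβ l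
      have hm : ∀ x, linePoint (M.vert l) (M.base l p) x t ∈ sphere (M.disc l p).1 (M.disc l p).2 ∨
          linePoint (M.vert l) (M.base l p) x t ∈
            sphere (M.disc (l + 1) p).1 (M.disc (l + 1) p).2 →
          linePoint (M.vert l) (M.base l p) x t ∈ cellDomainBdry D Q := by
        rintro x (hx | hx)
        · exact mem_bdry_of_sphere (M.disc_mem l p hp) hx
        · exact mem_bdry_of_sphere (M.disc_mem (l + 1) p hp) hx
      refine N.norm_extend_sub_le h h2 h4 (hm _ ?_) (hm _ ?_) fun x y hx hxy hy =>
        hL (l, p) (by simp [hp]) x y (by linarith) hxy (by linarith) fun s hs =>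
          h4 s ⟨hx.trans_le hs.1, hs.2.trans_lt hy⟩
      · exact h5.imp (fun h => h.1) (fun h => h.2)
      · exact h5.symm.imp (fun h => h.1) (fun h => h.2)
    refine ⟨fun l => ?_, fun z hz hz' => (hcov z hz hz').imp_right ?_⟩
    · obtain ⟨A, hA, B, hB, hA', hB'⟩ := hends l
      have h1 := N.extend_mem_sphere h (M.disc_mem l p hp) hA'
      have h2 := N.extend_mem_sphere h (M.disc_mem (l + 1) p hp) hB'
      have h3 := hgap l A hA B hB
      rw [← dist_eq_norm] at h3
      rw [mem_sphere] at h1 h2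
      have h4 := dist_triangle4 (c (M.disc l p))
        (extendFrom (cellDomain D Q) f (linePoint (M.vert l) (M.base l p) A t))
        (extendFrom (cellDomain D Q) f (linePoint (M.vert l) (M.base l p) B t))
        (c (M.disc (l + 1) p))
      have h5 := dist_comm (c (M.disc l p))
        (extendFrom (cellDomain D Q) f (linePoint (M.vert l) (M.base l p) A t))
      have h6 := dist_comm
        (extendFrom (cellDomain D Q) f (linePoint (M.vert l) (M.base l p) A t))
        (extendFrom (cellDomain D Q) f (linePoint (M.vert l) (M.base l p) B t))
      linarith
    · rintro ⟨l, x, hx, rfl⟩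
      have hxΩ := (hαβ l).2.2.2.1 x hx
      refine ⟨hxΩ, l, ?_⟩
      obtain ⟨A, hA, B, hB, hA', hB'⟩ := hends l
      have h1 := N.extend_mem_sphere h (M.disc_mem l p hp) hA'
      have h3 := hgap l A hA x (Ioo_subset_Icc_self hx)
      rw [← dist_eq_norm, N.extend_eq hxΩ] at h3
      rw [mem_sphere] at h1
      have h4 := dist_triangle (f (linePoint (M.vert l) (M.base l p) x t))
        (extendFrom (cellDomain D Q) f (linePoint (M.vert l) (M.base l p) A t)) (c (M.disc l p))
      linarith
  have hdist : ∀ p ∈ M.P, ∀ l, dist (c (M.disc l p)) (c (M.disc 0 p)) ≤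
      2 * ∑ l, r (M.disc l p) + ∑ l, L (l, p) := by
    intro p hp
    have k := (key p hp).1
    have k0 := k 0
    have k1 := k 1
    have k2 := k 2
    have k3 := k 3
    have k4 := k 4
    rw [show (0 : Fin 6) + 1 = 1 from rfl] at k0
    rw [show (1 : Fin 6) + 1 = 2 from rfl] at k1
    rw [show (2 : Fin 6) + 1 = 3 from rfl] at k2
    rw [show (3 : Fin 6) + 1 = 4 from rfl] at k3
    rw [show (4 : Fin 6) + 1 = 5 from rfl] at k4
    have r0 := hr p hp 0
    have r1 := hr p hp 1
    have r2 := hr p hp 2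
    have r3 := hr p hp 3
    have r4 := hr p hp 4
    have r5 := hr p hp 5
    have l0 := hL0 (0, p)
    have l1 := hL0 (1, p)
    have l2 := hL0 (2, p)
    have l3 := hL0 (3, p)
    have l4 := hL0 (4, p)
    have l5 := hL0 (5, p)
    have t2 := dist_triangle (c (M.disc 0 p)) (c (M.disc 1 p)) (c (M.disc 2 p))
    have t3 := dist_triangle (c (M.disc 0 p)) (c (M.disc 2 p)) (c (M.disc 3 p))
    have t4 := dist_triangle (c (M.disc 0 p)) (c (M.disc 3 p)) (c (M.disc 4 p))
    have t5 := dist_triangle (c (M.disc 0 p)) (c (M.disc 4 p)) (c (M.disc 5 p))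
    rw [Fin.sum_univ_six, Fin.sum_univ_six]
    intro l
    rw [dist_comm]
    fin_cases l
    · simp only [Fin.zero_eta, dist_self]; linarith
    · change dist (c (M.disc 0 p)) (c (M.disc 1 p)) ≤ _; linarith
    · change dist (c (M.disc 0 p)) (c (M.disc 2 p)) ≤ _; linarith
    · change dist (c (M.disc 0 p)) (c (M.disc 3 p)) ≤ _; linarith
    · change dist (c (M.disc 0 p)) (c (M.disc 4 p)) ≤ _; linarith
    · change dist (c (M.disc 0 p)) (c (M.disc 5 p)) ≤ _; linarith
  have hrs : ∀ p ∈ M.P, ∀ l, r (M.disc l p) ≤ ∑ l, r (M.disc l p) := fun p hp l =>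
    Finset.single_le_sum (f := fun l => r (M.disc l p)) (fun l _ => (hr p hp l).le)
      (Finset.mem_univ l)
  have hls : ∀ p l, L (l, p) ≤ ∑ l, L (l, p) := fun p l =>
    Finset.single_le_sum (f := fun l => L (l, p)) (fun l _ => hL0 _) (Finset.mem_univ l)
  have hls0 : ∀ p, 0 ≤ ∑ l, L (l, p) := fun p => Finset.sum_nonneg fun l _ => hL0 _
  refine ⟨t, ht, ρ, fun p hp => ?_, ?_, fun p hp l => ?_, fun p hp z hz hz' =>
    ((key p hp).2 z hz hz').imp_right ?_⟩
  · have h1 := hrs p hp 0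
    have h2 := hr p hp 0
    have h3 := hls0 p
    simp only [hρ]
    linarith
  · have h1 : ∀ p ∈ M.P, ρ p ^ 2 ≤ 108 * ∑ l, r (M.disc l p) ^ 2 + 48 * ∑ l, L (l, p) ^ 2 := by
      intro p _
      have e1 := sq_sum_le_card_mul_sum_sq (s := (Finset.univ : Finset (Fin 6)))
        (f := fun l => r (M.disc l p))
      have e2 := sq_sum_le_card_mul_sum_sq (s := (Finset.univ : Finset (Fin 6)))
        (f := fun l => L (l, p))
      simp only [Finset.card_univ, Fintype.card_fin, Nat.cast_ofNat] at e1 e2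
      simp only [hρ]
      nlinarith [sq_nonneg (3 * ∑ l, r (M.disc l p) - 2 * ∑ l, L (l, p))]
    have h2 : ∑ p ∈ M.P, ∑ l, r (M.disc l p) ^ 2 ≤ 6 * ∑ j ∈ D n, r j ^ 2 := by
      rw [Finset.sum_comm]
      calc ∑ l, ∑ p ∈ M.P, r (M.disc l p) ^ 2 ≤ ∑ _l : Fin 6, ∑ j ∈ D n, r j ^ 2 := by
            refine Finset.sum_le_sum fun l _ => ?_
            rw [← Finset.sum_image (f := fun j => r j ^ 2) (M.disc_inj l)]
            refine Finset.sum_le_sum_of_subset_of_nonneg ?_ fun _ _ _ => sq_nonneg _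
            exact Finset.image_subset_iff.2 (M.disc_mem l)
        _ = _ := by simp
    have h3 : ∑ p ∈ M.P, ∑ l, L (l, p) ^ 2 ≤ 6 * Real.pi * (M.P.card * M.W / M.T) := by
      rw [Finset.sum_product_right] at hLs
      rw [Finset.card_product, Finset.card_univ, Fintype.card_fin] at hLs
      push_cast at hLs
      rw [← mul_div_assoc, le_div_iff₀ M.T_pos]
      calc _ ≤ _ := hLs
        _ = _ := by ring
    have h4 : 0 ≤ M.P.card * M.W / M.T := by
      have := M.T_pos
      have := M.W_pos
      positivity
    calc ∑ p ∈ M.P, ρ p ^ 2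
        ≤ ∑ p ∈ M.P, (108 * ∑ l, r (M.disc l p) ^ 2 + 48 * ∑ l, L (l, p) ^ 2) :=
          Finset.sum_le_sum h1
      _ = 108 * ∑ p ∈ M.P, ∑ l, r (M.disc l p) ^ 2 + 48 * ∑ p ∈ M.P, ∑ l, L (l, p) ^ 2 := by
          rw [Finset.sum_add_distrib, ← Finset.mul_sum, ← Finset.mul_sum]
      _ ≤ _ := by nlinarith [Real.pi_lt_d2]
  · refine closedBall_subset_closedBall' ?_
    have h1 := hdist p hp l
    have h2 := hrs p hp l
    have h3 := hls0 p
    simp only [hρ]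
    linarith
  · rintro ⟨hzΩ, l, hl⟩
    refine ⟨hzΩ, ?_⟩
    have h1 := hdist p hp l
    have h2 := hrs p hp l
    have h3 := hls p l
    have h4 := dist_triangle (f z) (c (M.disc l p)) (c (M.disc 0 p))
    rw [mem_closedBall]
    simp only [hρ]
    linarith

end NormalMap

open Classical in
/-- The discs of the generations below `n`. -/
def lowDiscs (D : ℕ → Finset (ℂ × ℝ)) (n : ℕ) : Finset (ℂ × ℝ) := (Finset.range n).biUnion D

lemma mem_lowDiscs {D : ℕ → Finset (ℂ × ℝ)} {n : ℕ} {p : ℂ × ℝ} :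
    p ∈ lowDiscs D n ↔ ∃ m < n, p ∈ D m := by
  simp [lowDiscs]

/-- There is a continuous map `X` off the discs of generation `< n` agreeing with `f` on the circles
bounding them, and sent into small discs near the mesh points where it leaves `f`. -/
abbrev Mesh.HasExtension {D : ℕ → Finset (ℂ × ℝ)} {Q : ℕ → Finset (ℂ × ℝ × ℝ)} {n : ℕ}
    (M : Mesh D Q n) (f : ℂ → ℂ) (c : ℂ × ℝ → ℂ) (ρ : ℝ × ℝ × ℕ → ℝ) (R : ℝ) : Prop :=
  ∃ (X : ℂ → ℂ) (V : Set ℂ),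
    ContinuousOn X (closedBall 0 R \ ⋃ j ∈ lowDiscs D n, ball j.1 j.2) ∧
    IsOpen V ∧ V ⊆ cellDomain D Q ∧ EqOn X f V ∧ ball 0 1 ⊆ V ∧
    (∀ j ∈ lowDiscs D n, ∀ z ∈ sphere j.1 j.2, X z = extendFrom (cellDomain D Q) f z) ∧
    (∀ z, ‖z‖ = R → X z = f z) ∧
    ∀ z ∈ closedBall 0 R \ ⋃ j ∈ lowDiscs D n, ball j.1 j.2, z ∈ V ∨ ‖z‖ = R ∨
      (∃ j ∈ lowDiscs D n, z ∈ sphere j.1 j.2) ∨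
      ∃ p ∈ M.P, z ∈ closedBall (M.ctr p) M.d ∧ X z ∈ closedBall (c (M.disc 0 p)) (ρ p)

namespace NormalMap

variable {D : ℕ → Finset (ℂ × ℝ)} {Q : ℕ → Finset (ℂ × ℝ × ℝ)} {f : ℂ → ℂ} {c : ℂ × ℝ → ℂ}
  {r : ℂ × ℝ → ℝ} (N : NormalMap D Q f c r) (h : CellSystem D Q)
include N h

/-- A continuous extension of the map across the cells of a mesh, whose values on each cell lie in
a small disc. -/
lemma exists_extension {n : ℕ} (M : Mesh D Q n) : ∃ ρ : ℝ × ℝ × ℕ → ℝ, (∀ p ∈ M.P, 0 < ρ p) ∧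
    ∑ p ∈ M.P, ρ p ^ 2 ≤ 648 * ∑ j ∈ D n, r j ^ 2 + 1000 * (M.P.card * M.W / M.T) ∧
    ∀ R, cellSet Q 0 ⊆ ball 0 R → 1 ≤ R → R < 10 → M.HasExtension f c ρ R := by
  classical
  obtain ⟨t, ht, ρ, hρ0, hρs, hρd, hρU⟩ := N.exists_cell_radius h M
  refine ⟨ρ, hρ0, hρs, fun R hR hR1 hR10 => ?_⟩
  set fb := extendFrom (cellDomain D Q) f with hfb
  set Y := closedBall (0 : ℂ) R \ ⋃ j ∈ lowDiscs D n, ball j.1 j.2 with hY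
  set E₀ := Y \ ((⋃ j ∈ D n, ball j.1 j.2) ∪ ⋃ p ∈ M.P, M.Uo t p) with hE₀
  set E₁ := E₀ ∪ ⋃ j ∈ D n, closedBall j.1 j.2 with hE₁
  have hYc : IsClosed Y := isClosed_closedBall.sdiff
    (isOpen_biUnion fun _ _ => isOpen_ball)
  have hE₀c : IsClosed E₀ := hYc.sdiff ((isOpen_biUnion fun _ _ => isOpen_ball).union
    (isOpen_biUnion fun p _ => M.isOpen_Uo t p))
  have hE₁c : IsClosed E₁ := hE₀c.union (isClosed_biUnion_finset fun _ _ => isClosed_closedBall)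
  have hYb : Y ⊆ ball 0 10 := fun z hz => by
    have := mem_closedBall.1 hz.1
    rw [mem_ball]; linarith
  have hlow : ∀ j ∈ lowDiscs D n, ∀ z ∈ closedBall j.1 j.2, z ∉ cellSet Q n := by
    intro j hj z hz hz'
    obtain ⟨m, hm, hj⟩ := mem_lowDiscs.1 hj
    exact disjoint_left.1 (h.disc_cellSet_disj hm hj) hz hz'
  have hcR : ∀ m, cellSet Q m ⊆ ball 0 R := fun m => (h.cellSet_anti m.zero_le).trans hR
  have hcY : ∀ z ∈ cellSet Q n, z ∈ Y := by
    intro z hz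
    refine ⟨ball_subset_closedBall (hcR n hz), ?_⟩
    simp only [mem_iUnion, not_exists]
    exact fun j hj hzj => hlow j hj z (ball_subset_closedBall hzj) hz
  have hsph : ∀ {z : ℂ} {j : ℂ × ℝ}, z ∈ closedBall j.1 j.2 → z ∉ ball j.1 j.2 →
      z ∈ sphere j.1 j.2 := by
    intro z j h1 h2
    rw [mem_ball, not_lt] at h2
    exact le_antisymm h1 h2
  have hYs : ∀ z ∈ Y, ∀ j ∈ lowDiscs D n, z ∈ closedBall j.1 j.2 → z ∈ sphere j.1 j.2 :=
    fun z hz j hj hzj => hsph hzj fun hb => hz.2 (mem_biUnion (show j ∈ (_ : Set _) from hj) hb)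
  have hE₀b : E₀ ⊆ cellDomainBdry D Q := by
    intro z hz
    by_cases h1 : ∃ m, ∃ p ∈ D m, z ∈ sphere p.1 p.2
    · obtain ⟨m, p, hp, hzp⟩ := h1
      exact mem_bdry_of_sphere hp hzp
    push Not at h1
    refine Or.inl (h.mem_cellDomain_of (n := n + 1) (hYb hz.1) ?_ ?_)
    · intro hz'
      obtain ⟨p, hp, hzp⟩ := M.cover t ht z hz'
      exact hz.2 (Or.inr (mem_biUnion (show p ∈ (_ : Set _) from hp) hzp))
    · intro m hm p hp hzp
      refine h1 m p hp (hsph hzp fun hb => ?_)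
      rcases Nat.lt_succ_iff_lt_or_eq.1 hm with hm | rfl
      · exact hz.1.2 (mem_biUnion (show p ∈ (_ : Set _) from mem_lowDiscs.2 ⟨m, hm, hp⟩) hb)
      · exact hz.2 (Or.inl (mem_biUnion (show p ∈ (_ : Set _) from hp) hb))
  obtain ⟨Φ, hΦc, hΦe, hΦb⟩ := ContinuousOn.exists_glue (D n)
    ((N.continuousOn_extend h).mono hE₀b) hE₀c (fun j _ => isClosed_closedBall (x := j.1) (ε := j.2))
    (N.rad_pos n)
    (fun i hi j hj hij z hz => (disjoint_left.1 (h.disc_disj n i hi j hj hij) hz.1 hz.2).elim)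
    (b := c) (fun i hi z hz => by
      refine sphere_subset_closedBall (N.extend_mem_sphere h hi (hsph hz.2 fun hb => ?_))
      exact hz.1.2 (Or.inl (mem_biUnion (show i ∈ (_ : Set _) from hi) hb)))
  obtain ⟨X, hXc, hXe, hXb⟩ := ContinuousOn.exists_glue M.P hΦc hE₁c
    (fun p _ => M.isClosed_U t p) hρ0
    (fun p hp q hq hpq z hz => by
      by_cases hd : ∃ j ∈ D n, z ∈ closedBall j.1 j.2
      · obtain ⟨j, hj, hzj⟩ := hd
        exact Or.inr (mem_biUnion (show j ∈ (_ : Set _) from hj) hzj)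
      push Not at hd
      refine Or.inl ⟨hcY z (M.U_subset t ht p hp hz.1), ?_⟩
      rintro (hz' | hz')
      · simp only [mem_iUnion] at hz'
        obtain ⟨j, hj, hzj⟩ := hz'
        exact hd j hj (ball_subset_closedBall hzj)
      · simp only [mem_iUnion] at hz'
        obtain ⟨q', hq', hzq⟩ := hz'
        by_cases hqp : q' = p
        · subst hqp
          exact disjoint_left.1 (M.disj t ht q' hp q hq hpq) hzq hz.2
        · exact disjoint_left.1 (M.disj t ht q' hq' p hp hqp) hzq hz.1)
    (b := fun p => c (M.disc 0 p)) (fun p hp z hz => by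
      have hdisc : ∀ j ∈ D n, z ∈ closedBall j.1 j.2 →
          Φ z ∈ closedBall (c (M.disc 0 p)) (ρ p) := by
        intro j hj hzj
        obtain ⟨l, rfl⟩ := M.near t ht p hp j hj z hz.2 hzj
        exact hρd p hp l (hΦb _ hj z hzj)
      rcases hz.1 with hz1 | hz1
      · have hzUo : z ∉ M.Uo t p := fun hz' =>
          hz1.2 (Or.inr (mem_biUnion (show p ∈ (_ : Set _) from hp) hz'))
        rcases hρU p hp z hz.2 hzUo with ⟨l, hl⟩ | ⟨hzΩ, hzf⟩
        · exact hdisc _ (M.disc_mem l p hp) hl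
        · rwa [hΦe hz1, N.extend_eq hzΩ]
      · simp only [mem_iUnion] at hz1
        obtain ⟨j, hj, hzj⟩ := hz1
        exact hdisc j hj hzj)
  set V := ball (0 : ℂ) R \ ((⋃ j ∈ lowDiscs D n, closedBall j.1 j.2) ∪
    ((⋃ j ∈ D n, closedBall j.1 j.2) ∪ ⋃ p ∈ M.P, M.U t p)) with hV
  have hVE : V ⊆ E₀ := by
    rintro z ⟨hz1, hz2⟩
    refine ⟨⟨ball_subset_closedBall hz1, fun hz' => hz2 (Or.inl ?_)⟩,
      fun hz' => hz2 (Or.inr (hz'.imp (fun hz' => ?_) fun hz' => ?_))⟩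
    · exact iUnion₂_mono (fun j _ => ball_subset_closedBall) hz'
    · exact iUnion₂_mono (fun j _ => ball_subset_closedBall) hz'
    · exact iUnion₂_mono (fun p _ => M.Uo_subset t p) hz'
  have hVΩ : V ⊆ cellDomain D Q := by
    intro z hz
    rcases hE₀b (hVE hz) with h1 | h1
    · exact h1
    · exfalso
      simp only [mem_iUnion] at h1
      obtain ⟨m, p, hp, hzp⟩ := h1
      have hzp := sphere_subset_closedBall hzp
      rcases lt_trichotomy m n with hm | rfl | hm
      · exact hz.2 (Or.inl (mem_biUnion (show p ∈ (_ : Set _) from mem_lowDiscs.2 ⟨m, hm, hp⟩) hzp))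
      · exact hz.2 (Or.inr (Or.inl (mem_biUnion (show p ∈ (_ : Set _) from hp) hzp)))
      · obtain ⟨q, hq, hzq⟩ := M.cover t ht z
          (h.cellSet_anti (Nat.succ_le_of_lt hm) (h.disc_subset_cellSet hp hzp))
        exact hz.2 (Or.inr (Or.inr (mem_biUnion (show q ∈ (_ : Set _) from hq)
          (M.Uo_subset t q hzq))))
  have hXfb : ∀ z ∈ E₀, X z = fb z := fun z hz => by rw [hXe (Or.inl hz), hΦe hz]
  have hE₀of : ∀ z ∈ Y, z ∉ cellSet Q n → z ∈ E₀ := by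
    refine fun z hz hzn => ⟨hz, ?_⟩
    rintro (hz' | hz')
    · simp only [mem_iUnion] at hz'
      obtain ⟨j, hj, hzj⟩ := hz'
      exact hzn (h.disc_subset_cellSet hj (ball_subset_closedBall hzj))
    · simp only [mem_iUnion] at hz'
      obtain ⟨p, hp, hzp⟩ := hz'
      exact hzn (M.U_subset t ht p hp (M.Uo_subset t p hzp))
  refine ⟨X, V, hXc.mono fun z hz => ?_, ?_, hVΩ, fun z hz => ?_, fun z hz => ?_,
    fun j hj z hz => ?_, fun z hz => ?_, fun z hz => ?_⟩
  · by_cases h1 : z ∈ E₁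
    · exact Or.inl h1
    · right
      by_contra h2
      refine h1 (Or.inl ⟨hz, ?_⟩)
      rintro (hz' | hz')
      · exact h1 (Or.inr (iUnion₂_mono (fun j _ => ball_subset_closedBall) hz'))
      · exact h2 (iUnion₂_mono (fun p _ => M.Uo_subset t p) hz')
  · exact isOpen_ball.sdiff ((isClosed_biUnion_finset fun _ _ => isClosed_closedBall).union
      ((isClosed_biUnion_finset fun _ _ => isClosed_closedBall).union
      (isClosed_biUnion_finset fun p _ => M.isClosed_U t p)))
  · exact (hXfb z (hVE hz)).trans (N.extend_eq (hVΩ hz))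
  · have h0 : ∀ m, z ∉ cellSet Q m := fun m hm => by
      have := h.cellSet_anti m.zero_le hm
      simp only [cellSet, mem_iUnion] at this
      obtain ⟨q, hq, hzq⟩ := this
      exact disjoint_left.1 (h.box_zero q hq).2 hz hzq
    refine ⟨ball_subset_ball hR1 hz, ?_⟩
    rintro (hz' | hz' | hz') <;> simp only [mem_iUnion] at hz' <;> obtain ⟨j, hj, hzj⟩ := hz'
    · obtain ⟨m, hm, hj⟩ := mem_lowDiscs.1 hj
      exact h0 m (h.disc_subset_cellSet hj hzj)
    · exact h0 n (h.disc_subset_cellSet hj hzj)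
    · exact h0 n (M.U_subset t ht j hj hzj)
  · refine hXfb z (hE₀of z ?_ (hlow j hj z (sphere_subset_closedBall hz)))
    obtain ⟨m, hm, hj'⟩ := mem_lowDiscs.1 hj
    refine ⟨ball_subset_closedBall (hcR m (h.disc_subset_cellSet hj'
      (sphere_subset_closedBall hz))), fun hz' => ?_⟩
    simp only [mem_iUnion] at hz'
    obtain ⟨i, hi, hzi⟩ := hz'
    obtain ⟨m', hm', hi'⟩ := mem_lowDiscs.1 hi
    by_cases hij : i = j
    · subst hij
      exact (mem_ball.1 hzi).ne (mem_sphere.1 hz)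
    · exact disjoint_left.1 (h.disc_disj_all hi' hj' hij) (ball_subset_closedBall hzi)
        (sphere_subset_closedBall hz)
  · have h0 : ∀ m, z ∉ cellSet Q m := fun m hm => by
      have := mem_ball_zero_iff.1 (hcR m hm)
      linarith
    have hzY : z ∈ Y := by
      refine ⟨mem_closedBall_zero_iff.2 hz.le, fun hz' => ?_⟩
      simp only [mem_iUnion] at hz'
      obtain ⟨i, hi, hzi⟩ := hz'
      obtain ⟨m', hm', hi'⟩ := mem_lowDiscs.1 hi
      exact h0 m' (h.disc_subset_cellSet hi' (ball_subset_closedBall hzi))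
    rw [hXfb z (hE₀of z hzY (h0 n)), hfb]
    refine N.extend_eq (h.mem_cellDomain_of (hYb hzY) (h0 0) fun m hm => ?_)
    omega
  · by_cases h1 : z ∈ V
    · exact Or.inl h1
    by_cases h2 : ‖z‖ = R
    · exact Or.inr (Or.inl h2)
    refine Or.inr (Or.inr ?_)
    have h3 : z ∈ ball 0 R :=
      mem_ball_zero_iff.2 (lt_of_le_of_ne (mem_closedBall_zero_iff.1 hz.1) h2)
    have h4 := not_not.1 fun h4 => h1 ⟨h3, h4⟩
    rcases h4 with h4 | h4 | h4 <;> simp only [mem_iUnion] at h4 <;> obtain ⟨j, hj, hzj⟩ := h4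
    · exact Or.inl ⟨j, hj, hYs z hz j hj hzj⟩
    · right
      obtain ⟨l, p, hp, rfl⟩ := M.exists_disc j hj
      refine ⟨p, hp, M.disc_ctr p hp l hzj, hρd p hp l ?_⟩
      rw [hXe (Or.inr (mem_biUnion (show M.disc l p ∈ (_ : Set _) from hj) hzj))]
      exact hΦb _ hj z hzj
    · exact Or.inr ⟨j, hj, M.U_ctr t ht j hj hzj, hXb j hj z hzj⟩

end NormalMap

lemma LipschitzWith.volume_range_eq_zero {φ : ℝ → ℂ} {K : ℝ≥0} (h : LipschitzWith K φ) :
    volume (range φ) = 0 := by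
  have h1 : LipschitzWith (1 * K) (fun x => Complex.measurableEquivPi (φ x)) := by
    refine LipschitzWith.comp (f := fun z : ℂ => Complex.measurableEquivPi z) ?_ h
    refine LipschitzWith.of_dist_le_mul fun x y => ?_
    rw [NNReal.coe_one, one_mul, dist_pi_le_iff dist_nonneg]
    intro i
    rw [Complex.dist_eq, Real.dist_eq]
    fin_cases i
    · simpa [Complex.measurableEquivPi] using Complex.abs_re_le_norm (x - y)
    · simpa [Complex.measurableEquivPi] using Complex.abs_im_le_norm (x - y)
  have h2 := h1.dimH_range_le
  rw [Real.dimH_univ] at h2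
  have h3 : volume (range fun x => Complex.measurableEquivPi (φ x)) = 0 := by
    rw [← hausdorffMeasure_pi_real]
    have := hausdorffMeasure_of_dimH_lt (d := 2) (h2.trans_lt (by norm_num))
    simpa using this
  have h4 := Complex.volume_preserving_equiv_pi.measure_preimage_equiv
    (range fun x => Complex.measurableEquivPi (φ x))
  rw [h3] at h4
  refine measure_mono_null ?_ h4
  rintro _ ⟨x, rfl⟩
  exact ⟨x, rfl⟩

lemma norm_div_sub_div_le {a a' b b' : ℂ} {m : ℝ} (hm : 0 < m) (hb : m ≤ ‖b‖) (hb' : m ≤ ‖b'‖) :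
    ‖a / b - a' / b'‖ ≤ ‖a - a'‖ / m + ‖a'‖ * ‖b - b'‖ / m ^ 2 := by
  have h1 : 0 < ‖b‖ := hm.trans_le hb
  have h2 : 0 < ‖b'‖ := hm.trans_le hb'
  have e : a / b - a' / b' = (a - a') / b - a' * (b - b') / (b * b') := by
    field_simp [norm_pos_iff.1 h1, norm_pos_iff.1 h2]
    ring
  rw [e]
  refine (norm_sub_le _ _).trans (add_le_add ?_ ?_)
  · rw [norm_div]; gcongr
  · rw [norm_div, norm_mul, norm_mul, sq]; gcongr

lemma LipschitzWith.div_complex {φ ψ : ℝ → ℂ} {K K' : ℝ≥0} (h : LipschitzWith K φ)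
    (h' : LipschitzWith K' ψ) {A m : ℝ≥0} (hm : 0 < m) (hA : ∀ x, ‖φ x‖ ≤ A)
    (hψ : ∀ x, m ≤ ‖ψ x‖) : LipschitzWith (K / m + A * K' / m ^ 2) (fun x => φ x / ψ x) := by
  refine LipschitzWith.of_dist_le_mul fun x y => ?_
  rw [dist_eq_norm]
  refine (norm_div_sub_div_le (NNReal.coe_pos.2 hm) (hψ x) (hψ y)).trans ?_
  have h1 := h.dist_le_mul x y
  have h2 := h'.dist_le_mul x y
  rw [dist_eq_norm] at h1 h2
  push_cast
  calc _ ≤ (K * dist x y) / m + A * (K' * dist x y) / m ^ 2 := by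
        have := hA y
        gcongr
    _ = _ := by ring

/-- Stability of the winding number under small perturbations. -/
lemma HasWind.of_norm_sub_lt {v w : ℝ → ℂ} {k : ℤ} (hv : HasWind v k) (hvc : Continuous v)
    (hw : Continuous w) (hvp : ∀ θ, v (θ + 2 * Real.pi) = v θ)
    (hwp : ∀ θ, w (θ + 2 * Real.pi) = w θ) (h : ∀ θ, ‖v θ - w θ‖ < ‖v θ‖) : HasWind w k := by
  have h0 : ∀ θ, v θ ≠ 0 := fun θ => norm_pos_iff.1 ((norm_nonneg _).trans_lt (h θ))
  have h1 : HasWind (fun θ => 1 - (v θ - w θ) / v θ) 0 := by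
    refine HasWind.zero_of_slit (continuous_const.sub ((hvc.sub hw).div hvc h0)) ?_ ?_
    · intro θ; simp only [hvp, hwp]
    · intro θ
      apply one_sub_mem_slitPlane
      rw [norm_div, div_lt_one (norm_pos_iff.2 (h0 θ))]
      exact h θ
  have h2 := hv.mul h1
  rw [add_zero] at h2
  refine h2.congr fun θ => ?_
  have := h0 θ
  field_simp
  ring

/-- The zeros on a compact set of a function that is analytic near each of them and not locally
zero are finite in number. -/
lemma finite_zeros {K : Set ℂ} (hK : IsCompact K) {W : ℂ → ℂ} (hW : ContinuousOn W K)
    (h : ∀ z ∈ K, W z = 0 → AnalyticAt ℂ W z ∧ ¬∀ᶠ w in 𝓝 z, W w = 0) :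
    {z ∈ K | W z = 0}.Finite := by
  have hc : IsCompact {z ∈ K | W z = 0} := by
    have := hW.preimage_isClosed_of_isClosed hK.isClosed (isClosed_singleton (x := (0 : ℂ)))
    exact hK.of_isClosed_subset this inter_subset_left
  refine hc.finite (isDiscrete_iff_nhdsNE.2 fun z hz => ?_)
  rcases (h z hz.1 hz.2).1.eventually_eq_zero_or_eventually_ne_zero with h1 | h1
  · exact ((h z hz.1 hz.2).2 h1).elim
  · rw [← disjoint_iff]
    exact Filter.disjoint_principal_right.2 (h1.mono fun w hw hw' => hw hw'.2)

namespace NormalMap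

variable {D : ℕ → Finset (ℂ × ℝ)} {Q : ℕ → Finset (ℂ × ℝ × ℝ)} {f : ℂ → ℂ} {c : ℂ × ℝ → ℂ}
  {r : ℂ × ℝ → ℝ} (N : NormalMap D Q f c r) (h : CellSystem D Q)
include N h

lemma exists_outer_radius {lam : ℂ} (hl : ‖lam‖ ≠ 10) : ∃ R, cellSet Q 0 ⊆ ball 0 R ∧ 1 < R ∧
    R < 10 ∧ (∀ z : ℂ, ‖z‖ = R → f z ≠ 0) ∧
    ((∀ z : ℂ, ‖z‖ = R → ‖lam * f z‖ < R) ∨ ∀ z : ℂ, ‖z‖ = R → R < ‖lam * f z‖) := by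
  obtain ⟨R₀, h1, h2, h3, h4⟩ := h.exists_outer_collar
  have hne : ∀ R, R₀ < R → R < 10 → ∀ z : ℂ, ‖z‖ = R → f z ≠ 0 := by
    intro R hR hR' z hz h0
    have := N.inj (h4 z (by linarith) (by linarith)) (h.ball_one_subset (mem_ball_self one_pos))
      (h0.trans N.zero.symm)
    rw [this, norm_zero] at hz
    linarith
  rcases lt_or_gt_of_ne hl with hl | hl
  · obtain ⟨R, hR, hR'⟩ := exists_between (max_lt (max_lt h2 (show (1 : ℝ) < 10 by norm_num)) hl)
    simp only [max_lt_iff] at hR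
    refine ⟨R, h3.trans (ball_subset_ball hR.1.1.le), hR.1.2, hR', hne R hR.1.1 hR',
      Or.inl fun z hz => ?_⟩
    have := N.lt_one z (h4 z (by linarith) (by linarith))
    rw [norm_mul]
    nlinarith [norm_nonneg lam]
  · obtain ⟨R₁, hR₁, hR₁'⟩ := N.outer (10 / ‖lam‖) ((div_lt_one (by linarith)).2 hl)
    obtain ⟨R, hR, hR'⟩ := exists_between
      (max_lt (max_lt h2 (show (1 : ℝ) < 10 by norm_num)) hR₁)
    simp only [max_lt_iff] at hR
    refine ⟨R, h3.trans (ball_subset_ball hR.1.1.le), hR.1.2, hR', hne R hR.1.1 hR',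
      Or.inr fun z hz => ?_⟩
    have := hR₁' z (by linarith) (by linarith)
    rw [div_lt_iff₀ (by linarith)] at this
    rw [norm_mul]
    linarith

/-- If `λ f(z) - z` had a zero besides the origin, the argument principle for an extension of `f`
would give the winding number at least two along a large circle, where it is one. -/
lemma false_of_second_zero {n : ℕ} (M : Mesh D Q n) {ρ : ℝ × ℝ × ℕ → ℝ}
    (hext : ∀ R, cellSet Q 0 ⊆ ball 0 R → 1 ≤ R → R < 10 → M.HasExtension f c ρ R)
    (hm : ∀ p ∈ M.P, (0 : ℂ) ∉ closedBall (c (M.disc 0 p)) (ρ p))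
    {lam : ℂ} (hloc : ∀ z ∈ cellDomain D Q, ¬∀ᶠ w in 𝓝 z, lam * f w - w = 0)
    (hl : ‖lam‖ ≠ 10) {z₁ : ℂ} (hz₁ : z₁ ∈ ball (0 : ℂ) 1) (hz₁0 : z₁ ≠ 0) (hlz : lam * f z₁ = z₁)
    (hcirc : ∀ m, ∀ j ∈ D m, ∀ z ∈ sphere j.1 j.2, lam * extendFrom (cellDomain D Q) f z ≠ z)
    (hbad : ∀ p ∈ M.P, ∀ z ∈ closedBall (M.ctr p) M.d, ∀ w ∈ closedBall (c (M.disc 0 p)) (ρ p),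
      lam * w ≠ z) : False := by
  classical
  have h0Ω := h.ball_one_subset (mem_ball_self one_pos)
  have hlam : lam ≠ 0 := by rintro rfl; exact hz₁0 (by rw [← hlz, zero_mul])
  obtain ⟨R, hR, hR1, hR10, hfR, houter⟩ := N.exists_outer_radius h hl
  have hR0 : 0 < R := by linarith
  obtain ⟨X, V, hXc, hVo, hVΩ, hXV, hBV, hXs, hXR, hcases⟩ := hext R hR hR1.le hR10
  set s := lowDiscs D n with hs
  set Y := closedBall (0 : ℂ) R \ ⋃ j ∈ s, ball j.1 j.2 with hY
  have hs' : ∀ j ∈ s, ∃ m, j ∈ D m := fun j hj => by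
    obtain ⟨m, -, hj⟩ := mem_lowDiscs.1 hj
    exact ⟨m, hj⟩
  have hrs : ∀ j ∈ s, 0 < j.2 := fun j hj => by
    obtain ⟨m, hj⟩ := hs' j hj
    exact h.rad_pos m j hj
  have hin : ∀ j ∈ s, closedBall j.1 j.2 ⊆ ball 0 R := fun j hj => by
    obtain ⟨m, hj⟩ := hs' j hj
    exact (h.disc_subset_cellSet hj).trans ((h.cellSet_anti m.zero_le).trans hR)
  have hdis : (s : Set (ℂ × ℝ)).PairwiseDisjoint fun j => closedBall j.1 j.2 := by
    intro i hi j hj hij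
    obtain ⟨m, hi⟩ := hs' i hi
    obtain ⟨m', hj⟩ := hs' j hj
    exact h.disc_disj_all hi hj hij
  have hsY : ∀ j ∈ s, ∀ z ∈ sphere j.1 j.2, z ∈ Y := by
    intro j hj z hz
    refine ⟨ball_subset_closedBall (hin j hj (sphere_subset_closedBall hz)), fun hz' => ?_⟩
    simp only [mem_iUnion] at hz'
    obtain ⟨i, hi, hzi⟩ := hz'
    by_cases hij : i = j
    · subst hij
      exact (mem_ball.1 hzi).ne (mem_sphere.1 hz)
    · exact disjoint_left.1 (hdis hi hj hij) (ball_subset_closedBall hzi)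
        (sphere_subset_closedBall hz)
  have hRY : ∀ z : ℂ, ‖z‖ = R → z ∈ Y := by
    intro z hz
    refine ⟨mem_closedBall_zero_iff.2 hz.le, fun hz' => ?_⟩
    simp only [mem_iUnion] at hz'
    obtain ⟨i, hi, hzi⟩ := hz'
    exact (mem_ball_zero_iff.1 (hin i hi (ball_subset_closedBall hzi))).ne hz
  have hnR : ∀ θ, ‖circleMap 0 R θ‖ = R := fun θ => by simp [abs_of_pos hR0]
  have hloopR : Continuous (circLoop X 0 R) :=
    hXc.comp_continuous (continuous_circleMap 0 R) fun θ => hRY _ (hnR θ)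
  have hloop : ∀ j ∈ s, Continuous (circLoop X j.1 j.2) := fun j hj =>
    hXc.comp_continuous (continuous_circleMap _ _) fun θ =>
      hsY j hj _ (circleMap_mem_sphere _ (hrs j hj).le θ)
  have hper : ∀ (W : ℂ → ℂ) (a : ℂ) (t θ : ℝ),
      circLoop W a t (θ + 2 * Real.pi) = circLoop W a t θ := fun W a t θ => by
    simp only [circLoop, periodic_circleMap a t θ]
  have hXan : ∀ z ∈ V, AnalyticAt ℂ X z := fun z hz =>
    ((N.diff.analyticAt (h.isOpen_cellDomain.mem_nhds (hVΩ hz)))).congr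
      ((hXV.symm).eventuallyEq_of_mem (hVo.mem_nhds hz))
  have hVn : ∀ z ∈ V, ∀ j ∈ s, z ∉ closedBall j.1 j.2 := fun z hz j hj => by
    obtain ⟨m, hj⟩ := hs' j hj
    exact (hVΩ hz).2.2 m j hj
  have h0V : (0 : ℂ) ∈ V := hBV (mem_ball_self one_pos)
  have hX0 : X 0 = 0 := by rw [hXV h0V, N.zero]
  -- the winding number of the extension itself
  have hwX : HasWind (circLoop X 0 R) 1 := by
    have hloc0 : ¬∀ᶠ w in 𝓝 (0 : ℂ), X w = 0 := by
      intro hw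
      have h1 : deriv X 0 = 0 := by
        have : X =ᶠ[𝓝 0] fun _ => (0 : ℂ) := hw
        rw [this.deriv_eq, deriv_const]
      have h2 : X =ᶠ[𝓝 0] f := hXV.eventuallyEq_of_mem (hVo.mem_nhds h0V)
      rw [h2.deriv_eq] at h1
      exact deriv_ne_zero_of_injOn h.isOpen_cellDomain N.diff N.inj h0Ω h1
    obtain ⟨m, hm1, hm2⟩ := HasWind.argument_principle (k := fun _ => 0) hR0 s (W := X)
      (c := Prod.fst) (r := Prod.snd) {0} hrs hdis hin hXc (fun j hj => by
        obtain ⟨m, hj'⟩ := hs' j hj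
        refine HasWind.zero_of_near (hloop j hj) (hper X _ _) (b := c j) (R := r j) ?_ fun θ => ?_
        · have := N.lt_norm m j hj' 0 h0Ω
          rwa [N.zero, zero_sub, norm_neg] at this
        · have hz := circleMap_mem_sphere j.1 (hrs j hj).le θ
          rw [circLoop, hXs j hj _ hz]
          exact sphere_subset_closedBall (N.extend_mem_sphere h hj' hz))
      (by
        intro z hz
        rw [Finset.mem_singleton] at hz
        subst hz
        exact ⟨mem_ball_self hR0, hVn 0 h0V, hX0, hXan 0 h0V, hloc0⟩)
      (by
        intro z hz hz0
        rw [Finset.mem_singleton]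
        rcases hcases z hz with h1 | h1 | ⟨j, hj, h1⟩ | ⟨p, hp, -, h1⟩
        · refine N.inj (hVΩ h1) h0Ω ?_
          rw [← hXV h1, hz0, N.zero]
        · exact (hfR z h1 (by rw [← hXR z h1, hz0])).elim
        · obtain ⟨m, hj'⟩ := hs' j hj
          have h2 := N.extend_mem_sphere h hj' h1
          rw [← hXs j hj z h1, hz0, mem_sphere, dist_eq_norm, zero_sub, norm_neg] at h2
          have := N.lt_norm m j hj' 0 h0Ω
          rw [N.zero, zero_sub, norm_neg] at this
          linarith
        · rw [hz0] at h1
          exact (hm p hp h1).elim)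
    have h1 : m 0 = 1 := (hm2 0 (Finset.mem_singleton_self 0)).2 (by
      have h2 : X =ᶠ[𝓝 0] f := hXV.eventuallyEq_of_mem (hVo.mem_nhds h0V)
      rw [h2.deriv_eq]
      exact deriv_ne_zero_of_injOn h.isOpen_cellDomain N.diff N.inj h0Ω)
    simpa [h1] using hm1
  -- the winding number of the difference
  set W : ℂ → ℂ := fun z => lam * X z - z with hW
  have hWc : ContinuousOn W Y := (continuousOn_const.mul hXc).sub continuousOn_id
  have hWloopR : Continuous (circLoop W 0 R) :=
    (continuous_const.mul hloopR).sub (continuous_circleMap 0 R)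
  have hWR : HasWind (circLoop W 0 R) 1 := by
    rcases houter with ho | ho
    · have h1 : HasWind (fun θ => (-1 : ℂ) * circLoop (fun z => z - 0) 0 R θ) (0 + 1) :=
        (HasWind.zero_of_near (w := fun _ => (-1 : ℂ)) (b := -1) (R := 0) continuous_const
          (fun _ => rfl) (by simp) (by simp)).mul (HasWind.sub_inside (by simpa using hR0))
      rw [zero_add] at h1
      refine h1.of_norm_sub_lt ?_ hWloopR (fun θ => by rw [hper]) (hper W 0 R) fun θ => ?_
      · exact continuous_const.mul ((continuous_circleMap 0 R).sub continuous_const)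
      · have h2 := ho _ (hnR θ)
        simp only [circLoop, hW, sub_zero, neg_mul, one_mul, norm_neg, hnR, hXR _ (hnR θ)]
        rw [show ∀ a b : ℂ, -b - (a - b) = -a from fun a b => by ring, norm_neg]
        exact h2
    · have h1 : HasWind (fun θ => lam * circLoop X 0 R θ) (0 + 1) :=
        (HasWind.zero_of_near (w := fun _ => lam) (b := lam) (R := 0) continuous_const
          (fun _ => rfl) (norm_pos_iff.2 hlam) (by simp)).mul hwX
      rw [zero_add] at h1
      refine h1.of_norm_sub_lt (continuous_const.mul hloopR) hWloopR (fun θ => by rw [hper])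
        (hper W 0 R) fun θ => ?_
      have h2 := ho _ (hnR θ)
      simp only [circLoop, hW, hXR _ (hnR θ)]
      rw [_root_.sub_sub_cancel, hnR]
      exact h2
  have hW0 : ∀ z ∈ Y, W z = 0 → z ∈ V := by
    intro z hz hz0
    have hz0' : lam * X z = z := sub_eq_zero.1 hz0
    rcases hcases z hz with h1 | h1 | ⟨j, hj, h1⟩ | ⟨p, hp, h2, h1⟩
    · exact h1
    · exfalso
      rw [hXR z h1] at hz0'
      rcases houter with ho | ho
      · have := ho z h1
        rw [hz0', h1] at this
        exact lt_irrefl _ this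
      · have := ho z h1
        rw [hz0', h1] at this
        exact lt_irrefl _ this
    · obtain ⟨m, hj'⟩ := hs' j hj
      rw [hXs j hj z h1] at hz0'
      exact (hcirc m j hj' z h1 hz0').elim
    · exact (hbad p hp z h2 _ h1 hz0').elim
  have hWan : ∀ z ∈ V, AnalyticAt ℂ W z ∧ ¬∀ᶠ w in 𝓝 z, W w = 0 := by
    intro z hz
    refine ⟨(analyticAt_const.mul (hXan z hz)).sub analyticAt_id, fun hw => hloc z (hVΩ hz) ?_⟩
    filter_upwards [hw, hVo.mem_nhds hz] with w hw hwV
    rwa [← hXV hwV]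
  have hYc : IsCompact Y := (isCompact_closedBall 0 R).diff
    (isOpen_biUnion fun _ _ => isOpen_ball)
  have hfin : {z ∈ Y | W z = 0}.Finite :=
    finite_zeros hYc hWc fun z hz hz0 => hWan z (hW0 z hz hz0)
  have hk : ∀ j ∈ s, ∃ k : ℤ, 0 ≤ k ∧ HasWind (circLoop W j.1 j.2) k := by
    intro j hj
    obtain ⟨m, hj'⟩ := hs' j hj
    have hmem : ∀ θ, circleMap j.1 j.2 θ ∈ sphere j.1 j.2 := circleMap_mem_sphere _ (hrs j hj).le
    obtain ⟨k, hk⟩ := HasWind.exists (w := circLoop W j.1 j.2)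
      ((continuous_const.mul (hloop j hj)).sub (continuous_circleMap _ _)) (fun θ => by
        simp only [circLoop, hW, hXs j hj _ (hmem θ)]
        exact sub_ne_zero.2 (hcirc m j hj' _ (hmem θ))) (hper W _ _)
    refine ⟨k, ?_, hk⟩
    obtain ⟨η, k', K, h1, h2, h3, h4⟩ := N.exists_extend_circle h hj'
    refine HasWind.nonneg_of_circles (c := j.1) (c1 := lam * c j) (r := j.2) (r1 := ‖lam‖ * r j)
      (η := fun θ => η θ + lam.arg) (k := k') (hrs j hj)
      (mul_pos (norm_pos_iff.2 hlam) (N.rad_pos m j hj')) (h1.continuous.add continuous_const)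
      (h2.add_const _) (fun θ => by rw [h3]; ring) (hk.congr fun θ => ?_)
    simp only [circLoop, hW, hXs j hj _ (hmem θ), h4]
    congr 1
    simp only [circleMap]
    push_cast
    rw [add_mul, exp_add]
    have := Complex.norm_mul_exp_arg_mul_I lam
    linear_combination ((r j : ℂ) * exp (η θ * I)) * this
  choose! k hk0 hk using hk
  have hYR : ∀ z ∈ Y, W z = 0 → z ∈ ball 0 R := by
    intro z hz hz0
    refine mem_ball_zero_iff.2 (lt_of_le_of_ne (mem_closedBall_zero_iff.1 hz.1) fun h1 => ?_)
    have hz0' : lam * X z = z := sub_eq_zero.1 hz0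
    rw [hXR z h1] at hz0'
    rcases houter with ho | ho <;> have := ho z h1 <;> rw [hz0', h1] at this <;>
      exact lt_irrefl _ this
  obtain ⟨m, hm1, hm2⟩ := HasWind.argument_principle (k := k) hR0 s (W := W)
    (c := Prod.fst) (r := Prod.snd) hfin.toFinset hrs hdis hin hWc hk
    (by
      intro z hz
      rw [Set.Finite.mem_toFinset] at hz
      have hzV := hW0 z hz.1 hz.2
      exact ⟨hYR z hz.1 hz.2, hVn z hzV, hz.2, hWan z hzV⟩)
    (by
      intro z hz hz0
      rw [Set.Finite.mem_toFinset]
      exact ⟨hz, hz0⟩)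
  have hBY : ∀ z ∈ ball (0 : ℂ) 1, z ∈ Y := by
    intro z hz
    refine ⟨closedBall_subset_closedBall hR1.le (ball_subset_closedBall hz), fun hz' => ?_⟩
    simp only [mem_iUnion] at hz'
    obtain ⟨i, hi, hzi⟩ := hz'
    exact hVn z (hBV hz) i hi (ball_subset_closedBall hzi)
  have hz0Z : (0 : ℂ) ∈ hfin.toFinset := by
    rw [Set.Finite.mem_toFinset]
    exact ⟨hBY 0 (mem_ball_self one_pos), by simp [hW, hX0]⟩
  have hz1Z : z₁ ∈ hfin.toFinset := by
    rw [Set.Finite.mem_toFinset]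
    exact ⟨hBY z₁ hz₁, by simp only [hW, hXV (hBV hz₁), hlz, sub_self]⟩
  have h1 := hm1.unique hWR
  have h2 : (2 : ℤ) ≤ ∑ z ∈ hfin.toFinset, (m z : ℤ) := by
    calc (2 : ℤ) ≤ ∑ z ∈ {0, z₁}, (m z : ℤ) := by
          rw [Finset.sum_pair hz₁0.symm]
          have := (hm2 0 hz0Z).1
          have := (hm2 z₁ hz1Z).1
          omega
      _ ≤ _ := Finset.sum_le_sum_of_subset_of_nonneg (by
          intro z hz
          simp only [Finset.mem_insert, Finset.mem_singleton] at hz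
          rcases hz with rfl | rfl
          · exact hz0Z
          · exact hz1Z) fun _ _ _ => Int.natCast_nonneg _
  have h3 : 0 ≤ ∑ i ∈ s, k i := Finset.sum_nonneg hk0
  omega

omit h in
lemma sum_sq_le (n : ℕ) : ∑ j ∈ lowDiscs D n, r j ^ 2 ≤ 1 := by
  have hs : ∀ j ∈ lowDiscs D n, ∃ m, j ∈ D m := fun j hj => by
    obtain ⟨m, -, hj⟩ := mem_lowDiscs.1 hj
    exact ⟨m, hj⟩
  have hvol : ∀ (a : ℂ) (t : ℝ), 0 ≤ t →
      volume (closedBall a t) = ENNReal.ofReal (t ^ 2) * NNReal.pi := fun a t ht => by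
    rw [Complex.volume_closedBall, ENNReal.ofReal_pow ht]
  have h1 : volume (⋃ j ∈ lowDiscs D n, closedBall (c j) (r j)) =
      ∑ j ∈ lowDiscs D n, volume (closedBall (c j) (r j)) := by
    refine measure_biUnion_finset (fun i hi j hj hij => ?_) fun j _ =>
      isClosed_closedBall.measurableSet
    obtain ⟨m, hi⟩ := hs i hi
    obtain ⟨m', hj⟩ := hs j hj
    exact N.disj m m' i hi j hj hij
  have h2 : ⋃ j ∈ lowDiscs D n, closedBall (c j) (r j) ⊆ closedBall 0 1 := by
    refine iUnion₂_subset fun j hj => ?_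
    obtain ⟨m, hj⟩ := hs j hj
    refine closedBall_subset_closedBall' ?_
    rw [dist_zero_right, add_comm]
    exact N.le_one m j hj
  have h3 := measure_mono (μ := volume) h2
  rw [h1, hvol 0 1 zero_le_one, Finset.sum_congr rfl fun j hj => hvol (c j) (r j) (by
    obtain ⟨m, hj⟩ := hs j hj
    exact (N.rad_pos m j hj).le), ← Finset.sum_mul,
    ← ENNReal.ofReal_sum_of_nonneg fun j _ => sq_nonneg (r j)] at h3
  have h4 := (ENNReal.mul_le_mul_iff_left (by simp [NNReal.pi_ne_zero]) (by simp)).1 h3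
  simpa using (ENNReal.ofReal_le_ofReal_iff (by norm_num)).1 h4

lemma exists_sum_sq_lt {η : ℝ} (hη : 0 < η) : ∃ n₀, ∀ n ≥ n₀, ∑ j ∈ D n, r j ^ 2 < η := by
  classical
  have hsucc : ∀ n, ∑ j ∈ lowDiscs D (n + 1), r j ^ 2 =
      ∑ j ∈ lowDiscs D n, r j ^ 2 + ∑ j ∈ D n, r j ^ 2 := by
    intro n
    rw [← Finset.sum_union]
    · congr 1
      ext j
      simp only [Finset.mem_union, mem_lowDiscs]
      constructor
      · rintro ⟨m, hm, hj⟩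
        rcases Nat.lt_succ_iff_lt_or_eq.1 hm with hm | rfl
        · exact Or.inl ⟨m, hm, hj⟩
        · exact Or.inr hj
      · rintro (⟨m, hm, hj⟩ | hj)
        · exact ⟨m, hm.trans n.lt_succ_self, hj⟩
        · exact ⟨n, n.lt_succ_self, hj⟩
    · rw [Finset.disjoint_left]
      intro j hj hj'
      obtain ⟨m, hm, hj⟩ := mem_lowDiscs.1 hj
      have hc : j.1 ∈ closedBall j.1 j.2 := mem_closedBall_self (h.rad_pos m j hj).le
      exact disjoint_left.1 (h.disc_cellSet_disj hm hj) hc (h.disc_subset_cellSet hj' hc)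
  have hmono : Monotone fun n => ∑ j ∈ lowDiscs D n, r j ^ 2 := monotone_nat_of_le_succ fun n => by
    rw [hsucc]
    exact le_add_of_nonneg_right (Finset.sum_nonneg fun _ _ => sq_nonneg _)
  have hlim := tendsto_atTop_ciSup hmono ⟨1, by rintro _ ⟨n, rfl⟩; exact N.sum_sq_le n⟩
  have hdiff := (hlim.comp (tendsto_add_atTop_nat 1)).sub hlim
  rw [sub_self] at hdiff
  obtain ⟨n₀, hn₀⟩ := eventually_atTop.1 (hdiff.eventually (gt_mem_nhds hη))
  refine ⟨n₀, fun n hn => ?_⟩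
  have := hn₀ n hn
  simp only [Function.comp_apply, hsucc] at this
  linarith

lemma exists_le_norm_center : ∃ m > 0, ∀ n, ∀ j ∈ D n, m ≤ ‖c j‖ := by
  have h1 : f '' cellDomain D Q ∈ 𝓝 (0 : ℂ) := by
    have h0 := h.ball_one_subset (mem_ball_self one_pos)
    have := image_mem_nhds_of_injOn h.isOpen_cellDomain N.diff N.inj h0
      (h.isOpen_cellDomain.mem_nhds h0)
    rwa [N.zero] at this
  obtain ⟨m, hm, hball⟩ := Metric.mem_nhds_iff.1 h1
  refine ⟨m, hm, fun n j hj => ?_⟩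
  by_contra! hlt
  obtain ⟨z, hz, hzc⟩ := hball (mem_ball_zero_iff.2 hlt)
  have := N.lt_norm n j hj z hz
  rw [hzc, sub_self, norm_zero] at this
  exact (N.rad_pos n j hj).not_gt this

/-- Only countably many circles have to be avoided by the parameter. -/
lemma volume_boundary_quotients : volume (⋃ n, ⋃ j ∈ D n,
    (fun z => z / extendFrom (cellDomain D Q) f z) '' sphere j.1 j.2) = 0 := by
  refine measure_iUnion_null fun n => (measure_biUnion_null_iff (D n).countable_toSet).2
    fun j hj => ?_
  have h0 := N.lt_norm n j hj 0 (h.ball_one_subset (mem_ball_self one_pos))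
  rw [N.zero, zero_sub, norm_neg] at h0
  obtain ⟨η, k, K, h1, h2, h3, h4⟩ := N.exists_extend_circle h hj
  have hr := h.rad_pos n j hj
  have hL := LipschitzWith.div_complex (lipschitzWith_circleMap j.1 j.2)
    ((lipschitzWith_circleMap (c j) (r j)).comp h1) (A := ‖j.1‖₊ + Real.toNNReal j.2)
    (m := Real.toNNReal (‖c j‖ - r j)) (Real.toNNReal_pos.2 (sub_pos.2 h0))
    (fun θ => by
      push_cast
      rw [Real.coe_toNNReal _ hr.le]
      refine (norm_add_le _ _).trans ?_
      simp [abs_of_pos hr])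
    (fun θ => by
      rw [Real.coe_toNNReal _ (sub_pos.2 h0).le]
      have := norm_sub_le_norm_add (c j) (circleMap 0 (r j) (η θ))
      have e : c j + circleMap 0 (r j) (η θ) = circleMap (c j) (r j) (η θ) := by simp [circleMap]
      rw [e] at this
      simpa [abs_of_pos (N.rad_pos n j hj)] using this)
  refine measure_mono_null ?_ hL.volume_range_eq_zero
  rintro _ ⟨z, hz, rfl⟩
  obtain ⟨θ, rfl⟩ := exists_circleMap hz
  exact ⟨θ, by simp only [h4, Function.comp_apply]⟩

/-- Rigidity: a normalized map of a cell domain with arbitrarily thin meshes is a rotation. -/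
theorem isMobiusOn (hg : ∀ η > 0, ∀ n₀, ∃ n ≥ n₀, ∃ M : Mesh D Q n, M.P.card * M.d ^ 2 < η ∧
    M.P.card * M.W < η * M.T) : IsMobiusOn f (cellDomain D Q) := by
  have hΩ := h.isOpen_cellDomain
  have h0Ω := h.ball_one_subset (mem_ball_self one_pos)
  by_cases hlin : ∃ lam : ℂ, ∀ z ∈ cellDomain D Q, lam * f z = z
  · obtain ⟨lam, hlam⟩ := hlin
    have hne : lam ≠ 0 := by
      rintro rfl
      have := hlam (1 / 2) (h.ball_one_subset (by simp; norm_num))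
      norm_num at this
    exact ⟨1, 0, 0, lam, by simpa using hne, fun z hz => ⟨by simpa using hne, by
      rw [eq_div_iff (by simpa using hne)]
      linear_combination hlam z hz⟩⟩
  exfalso
  have hloc : ∀ lam : ℂ, ∀ z ∈ cellDomain D Q, ¬∀ᶠ w in 𝓝 z, lam * f w - w = 0 := by
    intro lam z hz hev
    refine hlin ⟨lam, fun w hw => ?_⟩
    have hd : DifferentiableOn ℂ (fun w => lam * f w - w) (cellDomain D Q) :=
      (N.diff.const_mul lam).sub differentiableOn_id
    exact sub_eq_zero.1 ((hd.analyticOnNhd hΩ).eqOn_zero_of_preconnected_of_eventuallyEq_zero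
      h.isConnected_cellDomain.isPreconnected hz hev hw)
  set B : Set ℂ := ball (1 / 2) (1 / 4) with hB
  have hB1 : ∀ z ∈ B, z ∈ ball (0 : ℂ) 1 ∧ z ≠ 0 := by
    intro z hz
    rw [hB, mem_ball, dist_eq_norm] at hz
    have h2 : ‖(1 / 2 : ℂ)‖ = 1 / 2 := by norm_num
    constructor
    · rw [mem_ball_zero_iff]
      have := norm_add_le (z - 1 / 2) (1 / 2)
      rw [sub_add_cancel, h2] at this
      linarith
    · rintro rfl
      rw [zero_sub, norm_neg, h2] at hz
      norm_num at hz
  have hBΩ : B ⊆ cellDomain D Q := fun z hz => h.ball_one_subset (hB1 z hz).1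
  have hf0 : ∀ z ∈ B, f z ≠ 0 := fun z hz hz0 =>
    (hB1 z hz).2 (N.inj (hBΩ hz) h0Ω (hz0.trans N.zero.symm))
  set F : ℂ → ℂ := fun z => z / f z with hF
  have hFan : AnalyticOnNhd ℂ F B :=
    (differentiableOn_id.div (N.diff.mono hBΩ) hf0).analyticOnNhd isOpen_ball
  have hBm : (1 / 2 : ℂ) ∈ B := mem_ball_self (by norm_num)
  have hopen : IsOpen (F '' B) := by
    rcases hFan.is_constant_or_isOpen (convex_ball _ _).isPreconnected with ⟨w, hw⟩ | ho
    · refine absurd ?_ (hloc w _ (hBΩ hBm))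
      filter_upwards [isOpen_ball.mem_nhds hBm] with z hz
      rw [← hw z hz, hF]
      simp only [div_mul_cancel₀ _ (hf0 z hz), sub_self]
    · exact ho B subset_rfl isOpen_ball
  have hpos : 0 < volume (F '' B) := hopen.measure_pos volume ⟨_, mem_image_of_mem _ hBm⟩
  obtain ⟨ε, hε, hεV⟩ := ENNReal.exists_nnreal_pos_mul_lt (a := (NNReal.pi : ℝ≥0∞)) (by simp)
    hpos.ne'
  obtain ⟨m, hm, hmc⟩ := N.exists_le_norm_center h
  set m' := m / 2 with hm'
  have hm0 : 0 < m' := by positivity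
  set C := 1 / m' + 11 / m' ^ 2 with hC
  have hC0 : 0 < C := by positivity
  have hε' : (0 : ℝ) < ε := hε
  set κ := min (m' ^ 2) (ε / (4 * C ^ 2)) with hκ
  have hκ0 : 0 < κ := by positivity
  set η := min 1 (κ / 1648) with hη
  have hη0 : 0 < η := by positivity
  have hηκ : 1648 * η ≤ κ := by linarith [min_le_right 1 (κ / 1648)]
  obtain ⟨n₀, hn₀⟩ := N.exists_sum_sq_lt h hη0
  obtain ⟨n, hn, M, hM1, hM2⟩ := hg η hη0 n₀
  obtain ⟨ρ, hρ0, hρs, hext⟩ := N.exists_extension h M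
  have hσ := hn₀ n hn
  have hWT : M.P.card * M.W / M.T < η := (div_lt_iff₀ M.T_pos).2 hM2
  have hρκ : ∑ p ∈ M.P, ρ p ^ 2 ≤ κ := by linarith
  have hρm : ∀ p ∈ M.P, ρ p ≤ m' := fun p hp => by
    have h1 := Finset.single_le_sum (f := fun p => ρ p ^ 2) (fun _ _ => sq_nonneg _) hp
    exact (sq_le_sq₀ (hρ0 p hp).le hm0.le).1 ((h1.trans hρκ).trans (min_le_left _ _))
  have hd1 : ∀ p ∈ M.P, M.d ≤ 1 := fun p hp => by
    have h1 : (1 : ℝ) ≤ M.P.card := by exact_mod_cast Finset.card_pos.2 ⟨p, hp⟩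
    have h2 : M.d ^ 2 < 1 := by nlinarith [min_le_left 1 (κ / 1648), sq_nonneg M.d]
    nlinarith [M.d_pos]
  have hctr : ∀ p ∈ M.P, ‖M.ctr p‖ ≤ 11 := fun p hp => by
    have hj := M.disc_mem 0 p hp
    have hcj := mem_closedBall_self (x := (M.disc 0 p).1) (h.rad_pos n _ hj).le
    have h1 := M.disc_ctr p hp 0 hcj
    have h2 := h.cellSet_subset_ball n (h.disc_subset_cellSet hj hcj)
    rw [mem_closedBall, dist_comm, dist_eq_norm] at h1
    rw [mem_ball_zero_iff] at h2
    have h3 := norm_add_le (M.ctr p - (M.disc 0 p).1) (M.disc 0 p).1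
    rw [sub_add_cancel] at h3
    linarith [hd1 p hp]
  set Λ : Set ℂ := ⋃ p ∈ M.P, closedBall (M.ctr p / c (M.disc 0 p)) (C * (M.d + ρ p)) with hΛ
  have hΛv : volume Λ < volume (F '' B) := by
    refine lt_of_le_of_lt ((measure_biUnion_finset_le _ _).trans ?_) hεV
    calc ∑ p ∈ M.P, volume (closedBall (M.ctr p / c (M.disc 0 p)) (C * (M.d + ρ p)))
        ≤ ∑ p ∈ M.P, ENNReal.ofReal (2 * C ^ 2 * (M.d ^ 2 + ρ p ^ 2)) * NNReal.pi := by
          refine Finset.sum_le_sum fun p hp => ?_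
          have := M.d_pos
          have := hρ0 p hp
          rw [Complex.volume_closedBall, ← ENNReal.ofReal_pow (by positivity)]
          gcongr
          nlinarith [mul_nonneg (sq_nonneg C) (sq_nonneg (M.d - ρ p))]
      _ = ENNReal.ofReal (2 * C ^ 2 * (M.P.card * M.d ^ 2 + ∑ p ∈ M.P, ρ p ^ 2)) * NNReal.pi := by
          rw [← Finset.sum_mul, ← ENNReal.ofReal_sum_of_nonneg fun p _ => by positivity,
            ← Finset.mul_sum, Finset.sum_add_distrib, Finset.sum_const, nsmul_eq_mul]
      _ ≤ ε * NNReal.pi := by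
          gcongr
          rw [← ENNReal.ofReal_coe_nnreal]
          refine ENNReal.ofReal_le_ofReal ?_
          have h1 : κ * (4 * C ^ 2) ≤ ε := (le_div_iff₀ (by positivity)).1 (min_le_right _ _)
          have h2 : M.P.card * M.d ^ 2 + ∑ p ∈ M.P, ρ p ^ 2 ≤ 2 * κ := by linarith
          nlinarith [mul_le_mul_of_nonneg_left h2 (sq_nonneg C)]
  obtain ⟨lam, ⟨z₁, hz₁, hlam⟩, hnot⟩ : ∃ lam ∈ F '' B, lam ∉ Λ ∪ ((⋃ n, ⋃ j ∈ D n,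
      (fun z => z / extendFrom (cellDomain D Q) f z) '' sphere j.1 j.2) ∪ sphere 0 10) := by
    by_contra! hcon
    refine hΛv.not_ge ((measure_mono hcon).trans ((measure_union_le _ _).trans ?_))
    rw [measure_union_null (N.volume_boundary_quotients h) (Measure.addHaar_sphere _ _ _),
      add_zero]
  simp only [mem_union, not_or] at hnot
  obtain ⟨hn1, hn2, hn3⟩ := hnot
  have hwm : ∀ p ∈ M.P, ∀ w ∈ closedBall (c (M.disc 0 p)) (ρ p), m' ≤ ‖w‖ := fun p hp w hw => by
    rw [mem_closedBall, dist_comm, dist_eq_norm] at hw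
    have h1 := norm_add_le (c (M.disc 0 p) - w) w
    rw [sub_add_cancel] at h1
    have := hmc n _ (M.disc_mem 0 p hp)
    linarith [hρm p hp]
  refine N.false_of_second_zero h M hext (fun p hp h0 => ?_) (hloc lam) (fun hl => hn3 (by
    simpa using hl)) (hB1 z₁ hz₁).1 (hB1 z₁ hz₁).2 ?_ (fun k j hj z hz hlz => hn2 ?_)
    fun p hp z hz w hw hlw => hn1 ?_
  · have := hwm p hp 0 h0
    rw [norm_zero] at this
    linarith
  · rw [← hlam]
    exact div_mul_cancel₀ _ (hf0 z₁ hz₁)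
  · simp only [mem_iUnion]
    refine ⟨k, j, hj, z, hz, ?_⟩
    have hs := N.extend_mem_sphere h hj hz
    have hne : extendFrom (cellDomain D Q) f z ≠ 0 := by
      intro h0
      have := N.lt_norm k j hj 0 h0Ω
      rw [h0, mem_sphere, dist_eq_norm] at hs
      rw [N.zero] at this
      exact this.ne' hs
    exact (div_eq_iff hne).2 hlz.symm
  · have hw' := hwm p hp w hw
    have hw0 : w ≠ 0 := norm_pos_iff.1 (hm0.trans_le hw')
    refine mem_iUnion₂.2 ⟨p, hp, ?_⟩
    have hlw' : lam = z / w := (eq_div_iff hw0).2 hlw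
    have hc' : m' ≤ ‖c (M.disc 0 p)‖ := by
      have := hmc n _ (M.disc_mem 0 p hp)
      linarith
    rw [mem_closedBall, dist_eq_norm, hlw']
    rw [mem_closedBall, dist_eq_norm] at hz hw
    refine (norm_div_sub_div_le hm0 hw' hc').trans ?_
    have h1 : ‖z - M.ctr p‖ / m' ≤ M.d / m' := by gcongr
    have h2 : ‖M.ctr p‖ * ‖w - c (M.disc 0 p)‖ / m' ^ 2 ≤ 11 * ρ p / m' ^ 2 := by
      gcongr
      exact hctr p hp
    have h3 : C * (M.d + ρ p) = M.d / m' + 11 * ρ p / m' ^ 2 +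
        (ρ p / m' + 11 * M.d / m' ^ 2) := by
      rw [hC]; ring
    have h4 : 0 < ρ p / m' + 11 * M.d / m' ^ 2 := by
      have := hρ0 p hp
      have := M.d_pos
      positivity
    linarith

end NormalMap

/-- The chart of the exterior of a disc. -/
def discChart (p : ℂ × ℝ) (ζ : ℂ) : ℂ := p.1 + p.2 * ζ

lemma norm_discChart_sub {p : ℂ × ℝ} (hp : 0 < p.2) (ζ : ℂ) : ‖discChart p ζ - p.1‖ = p.2 * ‖ζ‖ := by
  rw [discChart, add_sub_cancel_left, norm_mul, norm_real, Real.norm_of_nonneg hp.le]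

namespace CellSystem

variable {D : ℕ → Finset (ℂ × ℝ)} {Q : ℕ → Finset (ℂ × ℝ × ℝ)} (h : CellSystem D Q)
include h

lemma isCollar_discChart {n : ℕ} {p : ℂ × ℝ} (hp : p ∈ D n) :
    ∃ δ, IsCollar (cellDomain D Q) (discChart p) δ := by
  obtain ⟨δ, hδ, hmem⟩ := h.exists_collar hp
  have hr := h.rad_pos n p hp
  refine ⟨δ / p.2, by positivity, ?_, ?_, fun ζ hζ => hmem _ ?_ ?_, fun z hz => ?_⟩
  · unfold discChart
    fun_prop
  · intro ζ _ ζ' _ he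
    have hr' : (p.2 : ℂ) ≠ 0 := by exact_mod_cast hr.ne'
    exact mul_left_cancel₀ hr' (add_left_cancel he)
  · rw [norm_discChart_sub hr]
    exact lt_mul_of_one_lt_right hr hζ.1
  · rw [norm_discChart_sub hr]
    have := mul_lt_mul_of_pos_left hζ.2 hr
    rwa [mul_add, mul_one, mul_div_cancel₀ _ hr.ne'] at this
  · have hz' : p.2 < ‖z - p.1‖ := by
      have := hz.2.2 n p hp
      simpa [dist_eq_norm] using this
    refine ⟨{w | (p.2 + ‖z - p.1‖) / 2 < ‖w - p.1‖}, ?_, eventually_collar.2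
      ⟨(‖z - p.1‖ - p.2) / (2 * p.2), by have := sub_pos.2 hz'; positivity, fun ζ hζ hV => ?_⟩⟩
    · exact (isOpen_lt continuous_const (by fun_prop)).mem_nhds
        (show (p.2 + ‖z - p.1‖) / 2 < ‖z - p.1‖ by linarith)
    · rw [mem_ofPred_eq, norm_discChart_sub hr] at hV
      have := mul_lt_mul_of_pos_left hζ.2 hr
      have e : p.2 * (1 + (‖z - p.1‖ - p.2) / (2 * p.2)) = (p.2 + ‖z - p.1‖) / 2 := by
        field_simp
        ring
      linarith

lemma isCollar_outer : ∃ δ, IsCollar (cellDomain D Q) (fun ζ => 10 / ζ) δ := by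
  obtain ⟨R, hR0, hR, -, hmem⟩ := h.exists_outer_collar
  have hn : ∀ ζ : ℂ, ‖10 / ζ‖ = 10 / ‖ζ‖ := fun ζ => by rw [norm_div]; norm_num
  have hδ : 0 < 10 / R - 1 := sub_pos.2 ((one_lt_div hR0).2 hR)
  have hz : ∀ ζ ∈ collar (10 / R - 1), ζ ≠ 0 := fun ζ hζ =>
    norm_pos_iff.1 (zero_lt_one.trans hζ.1)
  refine ⟨10 / R - 1, hδ, ?_, ?_, fun ζ hζ => hmem _ ?_ ?_, fun z hz => ?_⟩
  · exact (differentiableOn_const _).div differentiableOn_id hz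
  · intro ζ hζ ζ' hζ' he
    have he' : (10 : ℂ) / ζ = 10 / ζ' := he
    rw [div_eq_div_iff (hz ζ hζ) (hz ζ' hζ')] at he'
    exact (mul_left_cancel₀ (by norm_num) he').symm
  · have h1 := hζ.2
    rw [add_sub_cancel, lt_div_iff₀ hR0] at h1
    rw [hn, le_div_iff₀ (zero_lt_one.trans hζ.1)]
    linarith
  · rw [hn]
    exact div_lt_self (by norm_num) hζ.1
  · have hz' : ‖z‖ < 10 := by simpa using hz.1
    refine ⟨ball 0 ((10 + ‖z‖) / 2), isOpen_ball.mem_nhds (by simp; linarith), eventually_collar.2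
      ⟨20 / (10 + ‖z‖) - 1, sub_pos.2 ((one_lt_div (by positivity)).2 (by linarith)),
      fun ζ hζ hV => ?_⟩⟩
    have h0 : 0 < 10 + ‖z‖ := by positivity
    have h1 := hζ.2
    rw [add_sub_cancel, lt_div_iff₀ h0] at h1
    rw [mem_ball_zero_iff, hn, div_lt_iff₀ (zero_lt_one.trans hζ.1)] at hV
    linarith

lemma disjoint_discChart {n m : ℕ} {p q : ℂ × ℝ} (hp : p ∈ D n) (hq : q ∈ D m) (hne : p ≠ q) :
    ∃ τ > 0, Disjoint (discChart p '' collar τ) (discChart q '' collar τ) := by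
  have hr := h.rad_pos n p hp
  have hr' := h.rad_pos m q hq
  have hd := (disjoint_closedBall_closedBall_iff hr.le hr'.le).1 (h.disc_disj_all hp hq hne)
  refine ⟨(dist p.1 q.1 - (p.2 + q.2)) / (p.2 + q.2), by have := sub_pos.2 hd; positivity, ?_⟩
  rw [disjoint_left]
  rintro _ ⟨ζ, hζ, rfl⟩ ⟨ζ', hζ', he⟩
  have h1 := norm_discChart_sub hr ζ
  have h2 := norm_discChart_sub hr' ζ'
  rw [he] at h2
  have h3 := mul_lt_mul_of_pos_left hζ.2 hr
  have h4 := mul_lt_mul_of_pos_left hζ'.2 hr'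
  have h5 := dist_triangle_left p.1 q.1 (discChart p ζ)
  rw [dist_eq_norm (discChart p ζ), dist_eq_norm (discChart p ζ), h1, h2] at h5
  have e : (p.2 + q.2) * (1 + (dist p.1 q.1 - (p.2 + q.2)) / (p.2 + q.2)) = dist p.1 q.1 := by
    field_simp
    ring
  linarith [add_mul p.2 q.2 (1 + (dist p.1 q.1 - (p.2 + q.2)) / (p.2 + q.2))]

lemma disjoint_outer {n : ℕ} {p : ℂ × ℝ} (hp : p ∈ D n) :
    ∃ τ > 0, Disjoint ((fun ζ : ℂ => 10 / ζ) '' collar τ) (discChart p '' collar τ) := by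
  obtain ⟨R, hR0, hR, hQ, -⟩ := h.exists_outer_collar
  have hr := h.rad_pos n p hp
  obtain ⟨δ, hδ, hsub⟩ := (isCompact_closedBall p.1 p.2).exists_thickening_subset_open
    isOpen_ball (((h.disc_subset_cellSet hp).trans (h.cellSet_anti n.zero_le)).trans hQ)
  rw [thickening_closedBall hδ hr.le] at hsub
  refine ⟨min (δ / p.2) (10 / R - 1), lt_min (by positivity)
    (sub_pos.2 ((one_lt_div hR0).2 hR)), disjoint_left.2 ?_⟩
  rintro _ ⟨ζ, hζ, rfl⟩ ⟨ζ', hζ', he⟩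
  have h1 : discChart p ζ' ∈ ball p.1 (δ + p.2) := by
    rw [mem_ball, dist_eq_norm, norm_discChart_sub hr]
    have h2 := mul_lt_mul_of_pos_left (hζ'.2.trans_le (add_le_add_right (min_le_left _ _) _)) hr
    rw [mul_add, mul_one, mul_div_cancel₀ _ hr.ne'] at h2
    linarith
  have h2 := hsub h1
  have h3 := hζ.2.trans_le (add_le_add_right (min_le_right _ _) _)
  rw [add_sub_cancel, lt_div_iff₀ hR0] at h3
  rw [he, mem_ball_zero_iff, norm_div, div_lt_iff₀ (zero_lt_one.trans hζ.1)] at h2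
  norm_num at h2
  linarith

/-- Conformal maps onto circle domains can be normalized. -/
lemma exists_normalMap {f : ℂ → ℂ} {V : Set ℂ} (hV : IsNormalizedCircleDomain V)
    (hf : ConformalMapOnto f (cellDomain D Q) V) : ∃ g c r, NormalMap D Q g c r ∧
      (IsMobiusOn g (cellDomain D Q) → IsMobiusOn f (cellDomain D Q)) := by
  classical
  set ι := Option {p : ℂ × ℝ // ∃ n, p ∈ D n}
  set e : ι → ℂ → ℂ := fun i => i.elim (fun ζ => 10 / ζ) fun p => discChart p.1 with he
  have hcol : ∀ i, ∃ δ, IsCollar (cellDomain D Q) (e i) δ := by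
    rintro (_ | ⟨p, n, hp⟩)
    · exact h.isCollar_outer
    · exact h.isCollar_discChart hp
  choose δ hδ using hcol
  have hdisj : ∀ i j, i ≠ j → ∃ τ > 0, Disjoint (e i '' collar τ) (e j '' collar τ) := by
    rintro (_ | ⟨p, n, hp⟩) (_ | ⟨q, m, hq⟩) hij
    · exact absurd rfl hij
    · exact h.disjoint_outer hq
    · obtain ⟨τ, hτ, hd⟩ := h.disjoint_outer hp
      exact ⟨τ, hτ, hd.symm⟩
    · exact h.disjoint_discChart hp hq fun hpq => hij (by subst hpq; rfl)
  obtain ⟨g, c, r, hg, hgi, hg0, hg1, hgo, hgc, hgd, hM⟩ := hf.exists_normalized h.isOpen_cellDomain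
    h.isConnected_cellDomain.isPreconnected hδ hdisj hV none
    (h.ball_one_subset (mem_ball_self one_pos))
  set i : ℂ × ℝ → ι := fun p => if hp : ∃ n, p ∈ D n then some ⟨p, hp⟩ else none with hi
  have his : ∀ n p (hp : p ∈ D n), i p = some ⟨p, n, hp⟩ := fun n p hp => dif_pos ⟨n, hp⟩
  have hin : ∀ n, ∀ p ∈ D n, i p ≠ none := fun n p hp => by simp [his n p hp]
  refine ⟨g, fun p => c (i p), fun p => r (i p), ⟨hg, hgi, hg0, hg1, fun a ha => ?_,
    fun n p hp => (hgc _ (hin n p hp)).1, fun n p hp => (hgc _ (hin n p hp)).2.1,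
    fun n p hp => (hgc _ (hin n p hp)).2.2.1, fun n m p hp q hq hpq =>
      hgd _ _ (hin n p hp) (hin m q hq) ?_, fun n p hp => ?_⟩, hM⟩
  · obtain ⟨τ, hτ, hτa⟩ := eventually_collar.1 (hgo.eventually (lt_mem_nhds ha))
    refine ⟨10 / (1 + τ), div_lt_self (by norm_num) (by linarith), fun z hz1 hz2 => ?_⟩
    have hz0 : 0 < ‖z‖ := lt_trans (by positivity) hz1
    have hn : ‖10 / z‖ = 10 / ‖z‖ := by rw [norm_div]; norm_num
    have := hτa (10 / z) ⟨by rw [hn]; exact (one_lt_div hz0).2 hz2, by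
      rw [hn, div_lt_iff₀ hz0, mul_comm]
      exact (div_lt_iff₀ (by linarith)).1 hz1⟩
    have e1 : e none (10 / z) = z := by
      simp only [he, Option.elim_none]
      rw [div_div_cancel₀ (by norm_num)]
    rwa [e1] at this
  · rw [his n p hp, his m q hq]
    exact fun he => hpq (congrArg Subtype.val (Option.some.inj he))
  · obtain ⟨δ', hδ', hmem⟩ := h.exists_collar hp
    have hr := h.rad_pos n p hp
    obtain ⟨h1, h2, -, h4⟩ := hgc _ (hin n p hp)
    have hsub : {z | p.2 < ‖z - p.1‖ ∧ ‖z - p.1‖ < p.2 + δ'} ⊆ cellDomain D Q :=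
      fun z hz => hmem z hz.1 hz.2
    obtain ⟨η, k, K, a1, a2, a3, a4⟩ := exists_circle_extension (c' := c (i p)) hr h1 hδ'
      (hg.mono hsub) (fun z hz hz' => h2 z (hmem z hz hz')) (fun η hη => by
        obtain ⟨τ, hτ, hτa⟩ := eventually_collar.1
          (h4.eventually (gt_mem_nhds (lt_add_of_pos_right (r (i p)) hη)))
        refine ⟨p.2 * τ, by positivity, fun z hz _ hz' => ?_⟩
        have hr' : (p.2 : ℂ) ≠ 0 := by exact_mod_cast hr.ne'
        have hn : ‖(z - p.1) / p.2‖ = ‖z - p.1‖ / p.2 := by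
          rw [norm_div, norm_real, Real.norm_of_nonneg hr.le]
        have := hτa ((z - p.1) / p.2) ⟨by rw [hn]; exact (one_lt_div hr).2 hz, by
          rw [hn, div_lt_iff₀ hr]
          linarith⟩
        have e1 : e (i p) ((z - p.1) / p.2) = z := by
          simp only [his n p hp, he, Option.elim_some, discChart]
          rw [mul_div_cancel₀ _ hr', add_sub_cancel]
        rw [e1] at this
        exact this.le)
    refine ⟨η, k, K, a1, a2, a3, fun θ => (a4 θ).mono_left (nhdsWithin_mono _ fun z hz => ?_)⟩
    have := hz.2.2 n p hp
    simpa [dist_eq_norm] using this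

theorem isMobiusOn (hg : ∀ η > 0, ∀ n₀, ∃ n ≥ n₀, ∃ M : Mesh D Q n, M.P.card * M.d ^ 2 < η ∧
    M.P.card * M.W < η * M.T) {f : ℂ → ℂ} {V : Set ℂ} (hV : IsNormalizedCircleDomain V)
    (hf : ConformalMapOnto f (cellDomain D Q) V) : IsMobiusOn f (cellDomain D Q) := by
  obtain ⟨g, c, r, N, hM⟩ := h.exists_normalMap hV hf
  exact hM (N.isMobiusOn h hg)

end CellSystem

/-- Parameters of a planar construction of boxes and discs. The boxes of generation `n` have
lower side centred at a point of `S n ×ℂ A n`, width `2 * ρ n` and height `ℓ n`. -/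
structure Grid where
  S : ℕ → Finset ℝ
  A : ℕ → Finset ℝ
  ρ : ℕ → ℝ
  ℓ : ℕ → ℝ
  ε : ℕ → ℝ
  k : ℕ → ℕ
  S_zero : S 0 = {5}
  A_zero : A 0 = {-2}
  ρ_zero : ρ 0 = 1
  ℓ_zero : ℓ 0 = 4
  S_succ : ∀ n x, x ∈ S (n + 1) ↔ ∃ s ∈ S n, x = s - ρ n / 2 ∨ x = s + ρ n / 2
  A_succ : ∀ n x, x ∈ A (n + 1) ↔ ∃ a ∈ A n, ∃ i : ℕ, i + 1 < k n ∧
    x = a + (i + 1 / 2) * (ℓ n / k n) + 2 * ρ (n + 1)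
  ℓ_succ : ∀ n, ℓ (n + 1) = ℓ n / k n - 4 * ρ (n + 1)
  ρ_pos : ∀ n, 0 < ρ n
  ε_pos : ∀ n, 0 < ε n
  ε_le : ∀ n, ε n ≤ 1 / 4
  two_le_k : ∀ n, 2 ≤ k n
  le_ρ : ∀ n, 16 * (ℓ n / k n) ≤ ρ n
  ρ_le : ∀ n, 16 * ρ (n + 1) ≤ ℓ n / k n
  card_mul_area : ∀ n, ((S (n + 1)).card * (A n).card * k n : ℝ) * (3 * (ℓ n / k n)) ^ 2 ≤ 1 / (n + 1)
  card_mul_ε : ∀ n, ((S (n + 1)).card * (A n).card * k n : ℝ) * (3 * ε n) ≤ 1 / (n + 1)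
  log_le : ∀ n, ((A n).card * k n : ℝ) * (1 / Real.log (1 / (4 * ρ (n + 1)))) ≤ (1 / 2) ^ n / 40

namespace Grid

variable (G : Grid)

/-- The distance of consecutive levels of discs. -/
def d (n : ℕ) : ℝ := G.ℓ n / G.k n
/-- The width of the gaps between the discs. -/
def δ (n : ℕ) : ℝ := G.ε n ^ 2 * G.ρ (n + 1)
/-- The radius of the large discs. -/
def r (n : ℕ) : ℝ := (G.d n - G.δ n) / 2
/-- The horizontal distance of the centres of the discs on a level. -/
def g (n : ℕ) : ℝ := G.ρ (n + 1) + G.δ n + G.r n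
/-- The levels on which the discs are centred. -/
def y (n : ℕ) (a : ℝ) (i : ℕ) : ℝ := a + (i + 1 / 2) * G.d n

/-- The discs of generation `n` on the vertical line through `s`, and the discs to its left and
right. -/
def disc (n : ℕ) (s y : ℝ) (τ : ℤ) : ℂ × ℝ :=
  (⟨s + τ * G.g n, y⟩, if τ = 0 then G.ρ (n + 1) else G.r n)

open Classical in
def discs (n : ℕ) : Finset (ℂ × ℝ) :=
  (G.S (n + 1) ×ˢ G.A n ×ˢ Finset.range (G.k n) ×ˢ ({-1, 0, 1} : Finset ℤ)).image
    fun p => G.disc n p.1 (G.y n p.2.1 p.2.2.1) p.2.2.2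

open Classical in
def boxes (n : ℕ) : Finset (ℂ × ℝ × ℝ) :=
  (G.S n ×ˢ G.A n).image fun p => (⟨p.1, p.2 + G.ℓ n / 2⟩, G.ρ n, G.ℓ n / 2)

lemma mem_discs {n : ℕ} {p : ℂ × ℝ} : p ∈ G.discs n ↔ ∃ s ∈ G.S (n + 1), ∃ a ∈ G.A n, ∃ i < G.k n,
    ∃ τ : ℤ, (τ = -1 ∨ τ = 0 ∨ τ = 1) ∧ p = G.disc n s (G.y n a i) τ := by
  simp only [discs, Finset.mem_image, Finset.mem_product, Finset.mem_range, Finset.mem_insert,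
    Finset.mem_singleton, Prod.exists]
  constructor
  · rintro ⟨s, a, i, τ, ⟨hs, ha, hi, hτ⟩, rfl⟩
    exact ⟨s, hs, a, ha, i, hi, τ, hτ, rfl⟩
  · rintro ⟨s, hs, a, ha, i, hi, τ, hτ, rfl⟩
    exact ⟨s, a, i, τ, ⟨hs, ha, hi, hτ⟩, rfl⟩

lemma mem_boxes {n : ℕ} {q : ℂ × ℝ × ℝ} : q ∈ G.boxes n ↔ ∃ s ∈ G.S n, ∃ a ∈ G.A n,
    q = (⟨s, a + G.ℓ n / 2⟩, G.ρ n, G.ℓ n / 2) := by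
  simp only [boxes, Finset.mem_image, Finset.mem_product, Prod.exists]
  constructor
  · rintro ⟨s, a, ⟨hs, ha⟩, rfl⟩
    exact ⟨s, hs, a, ha, rfl⟩
  · rintro ⟨s, hs, a, ha, rfl⟩
    exact ⟨s, a, ⟨hs, ha⟩, rfl⟩

lemma mem_cellSet {n : ℕ} {z : ℂ} : z ∈ cellSet G.boxes n ↔ ∃ s ∈ G.S n, ∃ a ∈ G.A n,
    |z.re - s| ≤ G.ρ n ∧ |z.im - (a + G.ℓ n / 2)| ≤ G.ℓ n / 2 := by
  simp only [cellSet, mem_iUnion, mem_boxes]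
  constructor
  · rintro ⟨q, ⟨s, hs, a, ha, rfl⟩, hz⟩
    exact ⟨s, hs, a, ha, hz⟩
  · rintro ⟨s, hs, a, ha, hz⟩
    exact ⟨_, ⟨s, hs, a, ha, rfl⟩, hz⟩

lemma k_pos (n : ℕ) : (0 : ℝ) < G.k n := by
  have := G.two_le_k n
  positivity

lemma k_mul_d (n : ℕ) : G.k n * G.d n = G.ℓ n := mul_div_cancel₀ _ (G.k_pos n).ne'

/-- The sizes of the objects of generation `n`. -/
lemma sizes (n : ℕ) : 0 < G.ρ (n + 1) ∧ 16 * G.ρ (n + 1) ≤ G.d n ∧ 16 * G.d n ≤ G.ρ n ∧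
    0 < G.δ n ∧ 16 * G.δ n ≤ G.ρ (n + 1) ∧ 2 * G.r n + G.δ n = G.d n ∧
    G.g n = G.ρ (n + 1) + G.δ n + G.r n ∧ G.ℓ (n + 1) = G.d n - 4 * G.ρ (n + 1) := by
  have h1 := G.ρ_pos (n + 1)
  have h2 := G.ε_pos n
  have h3 : G.ε n ^ 2 ≤ (1 / 4) ^ 2 := pow_le_pow_left₀ h2.le (G.ε_le n) 2
  refine ⟨h1, G.ρ_le n, G.le_ρ n, by unfold δ; positivity, ?_, by unfold r; ring, rfl, G.ℓ_succ n⟩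
  unfold δ
  nlinarith

lemma ℓ_pos (n : ℕ) : 0 < G.ℓ n := by
  rw [← G.k_mul_d]
  obtain ⟨h1, h2, -⟩ := G.sizes n
  exact mul_pos (G.k_pos n) (by linarith)

lemma ρ_le_pow (n : ℕ) : G.ρ n ≤ (1 / 2) ^ n := by
  induction n with
  | zero => simp [G.ρ_zero]
  | succ n ih =>
    obtain ⟨h1, h2, h3, -⟩ := G.sizes n
    rw [pow_succ]
    linarith

lemma y_mem (n : ℕ) (a : ℝ) {i : ℕ} (hi : i < G.k n) :
    a + G.d n / 2 ≤ G.y n a i ∧ G.y n a i ≤ a + G.ℓ n - G.d n / 2 := by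
  obtain ⟨h1, h2, -⟩ := G.sizes n
  have hi' : (i : ℝ) + 1 ≤ G.k n := by exact_mod_cast hi
  have h3 : 0 ≤ (i : ℝ) * G.d n := by
    have : 0 ≤ G.d n := by linarith
    positivity
  have h4 : ((i : ℝ) + 1) * G.d n ≤ G.k n * G.d n := by
    gcongr
    linarith
  rw [G.k_mul_d] at h4
  unfold y
  constructor <;> linarith

lemma y_succ (n : ℕ) (a : ℝ) (i : ℕ) : G.y n a (i + 1) = G.y n a i + G.d n := by
  unfold y
  push_cast
  ring

lemma S_succ_sep_of {n : ℕ} (hS : ∀ s ∈ G.S n, ∀ s' ∈ G.S n, s ≠ s' → 8 * G.ρ n ≤ |s - s'|)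
    {x x' : ℝ} (hx : x ∈ G.S (n + 1)) (hx' : x' ∈ G.S (n + 1)) (hne : x ≠ x') :
    G.ρ n ≤ |x - x'| := by
  have h1 := G.ρ_pos n
  obtain ⟨s, hs, hxs⟩ := (G.S_succ n x).1 hx
  obtain ⟨s', hs', hxs'⟩ := (G.S_succ n x').1 hx'
  by_cases hss : s = s'
  · subst hss
    rcases hxs with rfl | rfl <;> rcases hxs' with rfl | rfl
    · exact absurd rfl hne
    · rw [le_abs]; right; linarith
    · rw [le_abs]; left; linarith
    · exact absurd rfl hne
  · have := hS s hs s' hs' hss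
    rw [le_abs] at this ⊢
    rcases this with this | this <;> [left; right] <;>
      rcases hxs with rfl | rfl <;> rcases hxs' with rfl | rfl <;> linarith

lemma S_sep (n : ℕ) : ∀ s ∈ G.S n, ∀ s' ∈ G.S n, s ≠ s' → 8 * G.ρ n ≤ |s - s'| := by
  induction n with
  | zero =>
    intro s hs s' hs' hne
    rw [G.S_zero, Finset.mem_singleton] at hs hs'
    exact absurd (hs.trans hs'.symm) hne
  | succ n ih =>
    intro x hx x' hx' hne
    obtain ⟨h1, h2, h3, -⟩ := G.sizes n
    linarith [G.S_succ_sep_of ih hx hx' hne]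

lemma S_succ_sep {n : ℕ} {s s' : ℝ} (hs : s ∈ G.S (n + 1)) (hs' : s' ∈ G.S (n + 1)) (hne : s ≠ s') :
    16 * G.d n ≤ |s - s'| :=
  (G.le_ρ n).trans (G.S_succ_sep_of (G.S_sep n) hs hs' hne)

lemma level_sep_of {n : ℕ} (hA : ∀ a ∈ G.A n, ∀ a' ∈ G.A n, a ≠ a' → G.ℓ n + 4 * G.ρ n ≤ |a - a'|)
    {a a' : ℝ} (ha : a ∈ G.A n) (ha' : a' ∈ G.A n) {i i' : ℕ} (hi : i < G.k n) (hi' : i' < G.k n)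
    (hne : a = a' → i ≠ i') : G.d n ≤ |G.y n a i - G.y n a' i'| := by
  obtain ⟨h1, h2, h3, -⟩ := G.sizes n
  by_cases haa : a = a'
  · subst haa
    have hii := hne rfl
    have e : G.y n a i - G.y n a i' = ((i : ℝ) - i') * G.d n := by unfold y; ring
    have h4 : (1 : ℝ) ≤ |(i : ℝ) - i'| := by
      have : (1 : ℤ) ≤ |(i : ℤ) - i'| := Int.one_le_abs (by omega)
      exact_mod_cast this
    rw [e, abs_mul, abs_of_nonneg (by linarith : 0 ≤ G.d n)]
    nlinarith
  · have h4 := hA a ha a' ha' haa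
    have h5 := G.y_mem n a hi
    have h6 := G.y_mem n a' hi'
    have h7 := G.ρ_pos n
    rw [le_abs] at h4 ⊢
    rcases h4 with h4 | h4 <;> [left; right] <;> linarith

lemma A_sep (n : ℕ) : ∀ a ∈ G.A n, ∀ a' ∈ G.A n, a ≠ a' → G.ℓ n + 4 * G.ρ n ≤ |a - a'| := by
  induction n with
  | zero =>
    intro a ha a' ha' hne
    rw [G.A_zero, Finset.mem_singleton] at ha ha'
    exact absurd (ha.trans ha'.symm) hne
  | succ n ih =>
    intro x hx x' hx' hne
    obtain ⟨a, ha, i, hi, rfl⟩ := (G.A_succ n x).1 hx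
    obtain ⟨a', ha', i', hi', rfl⟩ := (G.A_succ n x').1 hx'
    have := G.level_sep_of ih ha ha' ((Nat.lt_succ_self i).trans hi)
      ((Nat.lt_succ_self i').trans hi') (by rintro rfl rfl; exact hne rfl)
    rw [G.ℓ_succ, add_sub_add_right_eq_sub, sub_add_cancel]
    exact this

lemma level_sep {n : ℕ} {a a' : ℝ} (ha : a ∈ G.A n) (ha' : a' ∈ G.A n) {i i' : ℕ} (hi : i < G.k n)
    (hi' : i' < G.k n) (hne : a = a' → i ≠ i') : G.d n ≤ |G.y n a i - G.y n a' i'| :=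
  G.level_sep_of (G.A_sep n) ha ha' hi hi' hne

lemma level_cases {n : ℕ} {a a' : ℝ} (ha : a ∈ G.A n) (ha' : a' ∈ G.A n) {i i' : ℕ}
    (hi : i + 1 < G.k n) (hi' : i' < G.k n) : (a' = a ∧ i' = i) ∨ (a' = a ∧ i' = i + 1) ∨
    G.y n a' i' ≤ G.y n a i - G.d n ∨ G.y n a i + 2 * G.d n ≤ G.y n a' i' := by
  obtain ⟨h1, h2, -⟩ := G.sizes n
  by_cases h3 : a' = a → i' ≠ i
  · by_cases h4 : a' = a → i' ≠ i + 1
    · have h5 := G.level_sep ha' ha hi' (by omega) h3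
      have h6 := G.level_sep ha' ha hi' hi h4
      rw [G.y_succ] at h6
      rw [le_abs] at h5 h6
      right; right
      rcases h5 with h5 | h5 <;> rcases h6 with h6 | h6 <;>
        first
        | (left; linarith)
        | (right; linarith)
    · push Not at h4
      exact Or.inr (Or.inl h4)
  · push Not at h3
    exact Or.inl h3

lemma disc_bounds {n : ℕ} {s y : ℝ} {τ : ℤ} (hτ : τ = -1 ∨ τ = 0 ∨ τ = 1) {z : ℂ}
    (hz : z ∈ closedBall (G.disc n s y τ).1 (G.disc n s y τ).2) :
    |z.re - (s + τ * G.g n)| ≤ (G.disc n s y τ).2 ∧ |z.re - s| ≤ G.ρ (n + 1) + G.d n ∧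
    |z.im - y| ≤ (G.disc n s y τ).2 := by
  obtain ⟨h1, h2, h3, h4, h5, h6, h7, -⟩ := G.sizes n
  rw [mem_closedBall, dist_eq_norm] at hz
  have hre := (abs_re_le_norm _).trans hz
  have him := (abs_im_le_norm _).trans hz
  refine ⟨hre, ?_, him⟩
  simp only [disc, sub_re] at hre
  rw [abs_le] at hre ⊢
  rcases hτ with rfl | rfl | rfl <;> norm_num at hre <;> constructor <;> linarith

lemma disc_rad {n : ℕ} {s y : ℝ} {τ : ℤ} :
    0 < (G.disc n s y τ).2 ∧ G.ρ (n + 1) ≤ (G.disc n s y τ).2 ∧ (G.disc n s y τ).2 ≤ G.r n := by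
  obtain ⟨h1, h2, h3, h4, h5, h6, h7, -⟩ := G.sizes n
  simp only [disc]
  split_ifs <;> refine ⟨?_, ?_, ?_⟩ <;> linarith

theorem cellSystem : CellSystem G.discs G.boxes where
  rad_pos n p hp := by
    obtain ⟨s, hs, a, ha, i, hi, τ, hτ, rfl⟩ := G.mem_discs.1 hp
    exact G.disc_rad.1
  box_pos n q hq := by
    obtain ⟨s, hs, a, ha, rfl⟩ := G.mem_boxes.1 hq
    exact ⟨G.ρ_pos n, half_pos (G.ℓ_pos n)⟩
  box_zero q hq := by
    obtain ⟨s, hs, a, ha, rfl⟩ := G.mem_boxes.1 hq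
    rw [G.S_zero, Finset.mem_singleton] at hs
    rw [G.A_zero, Finset.mem_singleton] at ha
    subst hs ha
    have hb : ∀ z ∈ box (⟨5, -2 + G.ℓ 0 / 2⟩, G.ρ 0, G.ℓ 0 / 2), (4 ≤ z.re ∧ z.re ≤ 6) ∧
        |z.im| ≤ 2 := by
      rintro z ⟨h1, h2⟩
      simp only [G.ρ_zero, G.ℓ_zero, abs_le] at h1 h2 ⊢
      refine ⟨⟨?_, ?_⟩, ?_, ?_⟩ <;> linarith
    refine ⟨fun z hz => ?_, disjoint_right.2 fun z hz hz1 => ?_⟩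
    · obtain ⟨⟨h1, h2⟩, h3⟩ := hb z hz
      rw [mem_ball_zero_iff]
      have := norm_le_abs_re_add_abs_im z
      rw [abs_of_nonneg (by linarith : 0 ≤ z.re)] at this
      linarith
    · obtain ⟨⟨h1, h2⟩, h3⟩ := hb z hz
      rw [mem_ball_zero_iff] at hz1
      linarith [re_le_norm z]
  disc_sub n p hp := by
    obtain ⟨s, hs, a, ha, i, hi, τ, hτ, rfl⟩ := G.mem_discs.1 hp
    obtain ⟨s₀, hs₀, hss⟩ := (G.S_succ n s).1 hs
    obtain ⟨h1, h2, h3, h4, h5, h6, h7, -⟩ := G.sizes n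
    have hy := G.y_mem n a hi
    refine ⟨_, G.mem_boxes.2 ⟨s₀, hs₀, a, ha, rfl⟩, fun z hz => ?_⟩
    obtain ⟨-, hz1, hz2⟩ := G.disc_bounds hτ hz
    have hz3 := hz2.trans G.disc_rad.2.2
    simp only [openBox, mem_ofPred_eq, abs_lt]
    rw [abs_le] at hz1 hz3
    refine ⟨?_, ?_, ?_⟩
    · rcases hss with rfl | rfl <;> constructor <;> linarith
    · linarith
    · linarith
  box_sub n q hq := by
    obtain ⟨s, hs, a', ha', rfl⟩ := G.mem_boxes.1 hq
    obtain ⟨s₀, hs₀, hss⟩ := (G.S_succ n s).1 hs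
    obtain ⟨a, ha, i, hi, hai⟩ := (G.A_succ n a').1 ha'
    change a' = G.y n a i + 2 * G.ρ (n + 1) at hai
    obtain ⟨h1, h2, h3, h4, h5, h6, h7, h8⟩ := G.sizes n
    have hy := G.y_mem n a hi
    rw [G.y_succ] at hy
    have hy' := G.y_mem n a ((Nat.lt_succ_self i).trans hi)
    refine ⟨_, G.mem_boxes.2 ⟨s₀, hs₀, a, ha, rfl⟩, fun z hz => ?_⟩
    simp only [box, mem_ofPred_eq, abs_le] at hz
    obtain ⟨⟨z1, z2⟩, z3, z4⟩ := hz
    simp only [openBox, mem_ofPred_eq, abs_lt]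
    refine ⟨?_, ?_, ?_⟩
    · rcases hss with rfl | rfl <;> constructor <;> linarith
    · linarith
    · linarith
  box_disj n q hq q' hq' hne := by
    obtain ⟨s, hs, a, ha, rfl⟩ := G.mem_boxes.1 hq
    obtain ⟨s', hs', a', ha', rfl⟩ := G.mem_boxes.1 hq'
    have hρ := G.ρ_pos n
    rw [disjoint_left]
    rintro z hz hz'
    simp only [box, mem_ofPred_eq, abs_le] at hz hz'
    by_cases hss : s = s'
    · have haa : a ≠ a' := by rintro rfl; exact hne (by rw [hss])
      have := G.A_sep n a ha a' ha' haa
      rw [le_abs] at this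
      rcases this with this | this <;> linarith
    · have := G.S_sep n s hs s' hs' hss
      rw [le_abs] at this
      rcases this with this | this <;> linarith
  disc_disj n p hp p' hp' hne := by
    obtain ⟨s, hs, a, ha, i, hi, τ, hτ, rfl⟩ := G.mem_discs.1 hp
    obtain ⟨s', hs', a', ha', i', hi', τ', hτ', rfl⟩ := G.mem_discs.1 hp'
    obtain ⟨h1, h2, h3, h4, h5, h6, h7, -⟩ := G.sizes n
    rw [disjoint_left]
    rintro z hz hz'
    obtain ⟨z1, z2, z3⟩ := G.disc_bounds hτ hz
    obtain ⟨w1, w2, w3⟩ := G.disc_bounds hτ' hz'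
    by_cases hss : s = s'
    · subst hss
      by_cases hai : a = a' → i ≠ i'
      · have := G.level_sep ha ha' hi hi' hai
        have z4 := abs_le.1 (z3.trans G.disc_rad.2.2)
        have w4 := abs_le.1 (w3.trans G.disc_rad.2.2)
        rw [le_abs] at this
        rcases this with this | this <;> linarith
      · push Not at hai
        obtain ⟨rfl, rfl⟩ := hai
        simp only [disc] at z1 w1
        rw [abs_le] at z1 w1
        rcases hτ with rfl | rfl | rfl <;> rcases hτ' with rfl | rfl | rfl <;>
          first
          | exact hne rfl
          | (norm_num at z1 w1; linarith)
    · have := G.S_succ_sep hs hs' hss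
      rw [abs_le] at z2 w2
      rw [le_abs] at this
      rcases this with this | this <;> linarith
  disc_box_disj n p hp q hq := by
    obtain ⟨s, hs, a, ha, i, hi, τ, hτ, rfl⟩ := G.mem_discs.1 hp
    obtain ⟨s', hs', b, hb, rfl⟩ := G.mem_boxes.1 hq
    obtain ⟨a', ha', i', hi', hai⟩ := (G.A_succ n b).1 hb
    change b = G.y n a' i' + 2 * G.ρ (n + 1) at hai
    obtain ⟨h1, h2, h3, h4, h5, h6, h7, h8⟩ := G.sizes n
    rw [disjoint_left]
    rintro z hz hz'
    obtain ⟨z1, z2, z3⟩ := G.disc_bounds hτ hz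
    simp only [box, mem_ofPred_eq, abs_le] at hz'
    obtain ⟨⟨w1, w2⟩, w3, w4⟩ := hz'
    rw [abs_le] at z2
    by_cases hss : s = s'
    · subst hss
      simp only [disc] at z1 z3
      rw [abs_le] at z1 z3
      rcases hτ with rfl | rfl | rfl <;> norm_num at z1 z3 <;> try linarith
      rcases G.level_cases ha' ha hi' hi with ⟨rfl, rfl⟩ | ⟨rfl, rfl⟩ | hy | hy
      · linarith
      · have := G.y_succ n a i'
        linarith
      · linarith
      · linarith
    · have := G.S_succ_sep hs hs' hss
      rw [le_abs] at this
      rcases this with this | this <;> linarith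
  small η hη := by
    obtain ⟨n, hn⟩ := exists_pow_lt_of_lt_one hη (by norm_num : (1 / 2 : ℝ) < 1)
    refine ⟨n + 1, fun q hq => ?_⟩
    obtain ⟨s, hs, a, ha, rfl⟩ := G.mem_boxes.1 hq
    obtain ⟨h1, h2, h3, h4, h5, h6, h7, h8⟩ := G.sizes n
    have := G.ρ_le_pow n
    simp only
    constructor <;> linarith

end Grid

lemma dist_sq_eq (z c : ℂ) : dist z c ^ 2 = (z.re - c.re) ^ 2 + (z.im - c.im) ^ 2 := by
  rw [dist_eq_norm, Complex.sq_norm, normSq_apply, sub_re, sub_im]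
  ring

/-- A line at distance `t` from the centre meets a disc in a segment of half length `q`. -/
lemma mem_closedBall_iff_chord {z c : ℂ} {R q t : ℝ} (hR : 0 ≤ R) (hq : 0 ≤ q)
    (hqt : q ^ 2 + t ^ 2 = R ^ 2) : (z.im = c.im + t → (z ∈ closedBall c R ↔ |z.re - c.re| ≤ q)) ∧
    (z.re = c.re + t → (z ∈ closedBall c R ↔ |z.im - c.im| ≤ q)) := by
  have key : ∀ u : ℝ, u ^ 2 + t ^ 2 ≤ R ^ 2 ↔ |u| ≤ q := fun u => by
    rw [← hqt, add_le_add_iff_right, sq_le_sq, abs_of_nonneg hq]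
  rw [mem_closedBall, ← sq_le_sq₀ dist_nonneg hR, dist_sq_eq]
  refine ⟨fun h => ?_, fun h => ?_⟩
  · rw [h, add_sub_cancel_left, key]
  · rw [h, add_sub_cancel_left, add_comm, key]

lemma mem_sphere_of_chord {z c : ℂ} {R q t : ℝ} (hR : 0 ≤ R) (hqt : q ^ 2 + t ^ 2 = R ^ 2) :
    (z.im = c.im + t → (z.re = c.re + q ∨ z.re = c.re - q) → z ∈ sphere c R) ∧
    (z.re = c.re + t → (z.im = c.im + q ∨ z.im = c.im - q) → z ∈ sphere c R) := by
  have key : (z.re - c.re) ^ 2 + (z.im - c.im) ^ 2 = R ^ 2 → z ∈ sphere c R := fun h => by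
    rw [mem_sphere, ← sq_eq_sq₀ dist_nonneg hR, dist_sq_eq, h]
  constructor <;> rintro h1 (h2 | h2) <;> refine key ?_ <;> rw [h1, h2, ← hqt] <;> ring

/-- Horizontal positions of the six discs around a cell. -/
def hexPos : Fin 6 → ℤ := ![-1, 0, 1, 1, 0, -1]
/-- Levels of the six discs around a cell. -/
def hexLev : Fin 6 → ℕ := ![0, 0, 0, 1, 1, 1]
/-- The lower or left disc at a gap. -/
def hexLower : Fin 6 → Fin 6 := ![0, 1, 2, 4, 5, 0]
/-- The upper or right disc at a gap. -/
def hexUpper : Fin 6 → Fin 6 := ![1, 2, 3, 3, 4, 5]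
/-- Whether the two discs at a gap are on top of each other. -/
def hexVert : Fin 6 → Bool := ![false, false, true, false, false, true]

lemma hexPos_mem (l : Fin 6) : hexPos l = -1 ∨ hexPos l = 0 ∨ hexPos l = 1 := by
  fin_cases l <;> simp [hexPos]

lemma exists_hexPos {τ : ℤ} (hτ : τ = -1 ∨ τ = 0 ∨ τ = 1) {e : ℕ} (he : e = 0 ∨ e = 1) :
    ∃ l, hexPos l = τ ∧ hexLev l = e := by
  rcases hτ with rfl | rfl | rfl <;> rcases he with rfl | rfl
  exacts [⟨0, rfl, rfl⟩, ⟨5, rfl, rfl⟩, ⟨1, rfl, rfl⟩, ⟨4, rfl, rfl⟩, ⟨2, rfl, rfl⟩, ⟨3, rfl, rfl⟩]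

lemma hexLev_le (l : Fin 6) : hexLev l = 0 ∨ hexLev l = 1 := by
  fin_cases l <;> simp [hexLev]

namespace Grid

variable (G : Grid) (n : ℕ)

def pieces : Finset (ℝ × ℝ × ℕ) := G.S (n + 1) ×ˢ G.A n ×ˢ Finset.range (G.k n - 1)

lemma mem_pieces {p : ℝ × ℝ × ℕ} :
    p ∈ G.pieces n ↔ p.1 ∈ G.S (n + 1) ∧ p.2.1 ∈ G.A n ∧ p.2.2 + 1 < G.k n := by
  simp only [pieces, Finset.mem_product, Finset.mem_range, Nat.lt_sub_iff_add_lt]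

def hexDisc (l : Fin 6) (p : ℝ × ℝ × ℕ) : ℂ × ℝ :=
  G.disc n p.1 (G.y n p.2.1 (p.2.2 + hexLev l)) (hexPos l)

/-- The rectangular cells. -/
def cell (t : ℝ) (p : ℝ × ℝ × ℕ) : ℂ × ℝ × ℝ :=
  (⟨p.1 + t, G.y n p.2.1 p.2.2 + G.d n / 2 + t⟩, G.g n, G.d n / 2)

def gapBase (l : Fin 6) (p : ℝ × ℝ × ℕ) : ℂ :=
  if hexVert l then (G.hexDisc n (hexLower l) p).1 + ((G.hexDisc n (hexLower l) p).2 - G.δ n : ℝ) * I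
  else (G.hexDisc n (hexLower l) p).1 + ((G.hexDisc n (hexLower l) p).2 - G.δ n : ℝ)

variable {n}

lemma mem_cell {t : ℝ} {p : ℝ × ℝ × ℕ} {z : ℂ} : z ∈ box (G.cell n t p) ↔
    (p.1 + t - G.g n ≤ z.re ∧ z.re ≤ p.1 + t + G.g n) ∧
    G.y n p.2.1 p.2.2 + t ≤ z.im ∧ z.im ≤ G.y n p.2.1 p.2.2 + G.d n + t := by
  simp only [box, cell, mem_ofPred_eq, abs_le]
  constructor <;> rintro ⟨⟨h1, h2⟩, h3, h4⟩ <;> refine ⟨⟨?_, ?_⟩, ?_, ?_⟩ <;> linarith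

lemma mem_openCell {t : ℝ} {p : ℝ × ℝ × ℕ} {z : ℂ} : z ∈ openBox (G.cell n t p) ↔
    (p.1 + t - G.g n < z.re ∧ z.re < p.1 + t + G.g n) ∧
    G.y n p.2.1 p.2.2 + t < z.im ∧ z.im < G.y n p.2.1 p.2.2 + G.d n + t := by
  simp only [openBox, cell, mem_ofPred_eq, abs_lt]
  constructor <;> rintro ⟨⟨h1, h2⟩, h3, h4⟩ <;> refine ⟨⟨?_, ?_⟩, ?_, ?_⟩ <;> linarith

lemma hexDisc_mem (l : Fin 6) {p : ℝ × ℝ × ℕ} (hp : p ∈ G.pieces n) :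
    G.hexDisc n l p ∈ G.discs n := by
  obtain ⟨h1, h2, h3⟩ := (G.mem_pieces n).1 hp
  exact G.mem_discs.2 ⟨_, h1, _, h2, _, by rcases hexLev_le l with h | h <;> omega, _, hexPos_mem l, rfl⟩

lemma hexDisc_injOn (l : Fin 6) : InjOn (G.hexDisc n l) (G.pieces n) := by
  intro p hp q hq he
  obtain ⟨h1, h2, h3⟩ := (G.mem_pieces n).1 hp
  obtain ⟨h1', h2', h3'⟩ := (G.mem_pieces n).1 hq
  have hl : p.2.2 + hexLev l < G.k n ∧ q.2.2 + hexLev l < G.k n := by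
    rcases hexLev_le l with h | h <;> omega
  have hre : p.1 = q.1 := add_right_cancel (congrArg (fun w : ℂ × ℝ => w.1.re) he)
  have him : G.y n p.2.1 (p.2.2 + hexLev l) = G.y n q.2.1 (q.2.2 + hexLev l) :=
    congrArg (fun w : ℂ × ℝ => w.1.im) he
  by_cases hne : p.2.1 = q.2.1 → p.2.2 + hexLev l ≠ q.2.2 + hexLev l
  · have := G.level_sep h2 h2' hl.1 hl.2 hne
    obtain ⟨a1, a2, -⟩ := G.sizes n
    rw [him, sub_self, abs_zero] at this
    linarith
  · push Not at hne
    exact Prod.ext hre (Prod.ext hne.1 (by omega))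

lemma exists_hexDisc {j : ℂ × ℝ} (hj : j ∈ G.discs n) : ∃ l, ∃ p ∈ G.pieces n, G.hexDisc n l p = j := by
  obtain ⟨s, hs, a, ha, i, hi, τ, hτ, rfl⟩ := G.mem_discs.1 hj
  have hk := G.two_le_k n
  by_cases h : i + 1 < G.k n
  · obtain ⟨l, h1, h2⟩ := exists_hexPos hτ (e := 0) (Or.inl rfl)
    exact ⟨l, (s, a, i), (G.mem_pieces n).2 ⟨hs, ha, h⟩, by simp only [hexDisc, h1, h2, add_zero]⟩
  · obtain ⟨l, h1, h2⟩ := exists_hexPos hτ (e := 1) (Or.inr rfl)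
    refine ⟨l, (s, a, i - 1), (G.mem_pieces n).2 ⟨hs, ha, by simp only; omega⟩, ?_⟩
    have : i - 1 + 1 = i := by omega
    simp only [hexDisc, h1, h2, this]

variable {t : ℝ} (ht : t ∈ Ioo 0 (G.ε n * G.ρ (n + 1)))

include ht in
/-- The admissible shifts are small. -/
lemma shift_bounds :
    4 * t ≤ G.ρ (n + 1) ∧ t ^ 2 ≤ G.δ n * G.ρ (n + 1) := by
  have h1 := G.ρ_pos (n + 1)
  have h2 := G.ε_le n
  obtain ⟨h3, h4⟩ := ht
  refine ⟨by nlinarith, ?_⟩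
  calc t ^ 2 ≤ (G.ε n * G.ρ (n + 1)) ^ 2 := pow_le_pow_left₀ h3.le h4.le 2
    _ = G.δ n * G.ρ (n + 1) := by unfold δ; ring

include ht in
lemma cell_subset {p : ℝ × ℝ × ℕ}
    (hp : p ∈ G.pieces n) : box (G.cell n t p) ⊆ cellSet G.boxes n := by
  intro z hz
  obtain ⟨⟨z1, z2⟩, z3, z4⟩ := G.mem_cell.1 hz
  obtain ⟨hs, ha, hi⟩ := (G.mem_pieces n).1 hp
  obtain ⟨s₀, hs₀, hss⟩ := (G.S_succ n _).1 hs
  obtain ⟨h1, h2, h3, h4, h5, h6, h7, h8⟩ := G.sizes n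
  obtain ⟨h9, -⟩ := G.shift_bounds ht
  have hy := G.y_mem n p.2.1 hi
  have hy' := G.y_mem n p.2.1 ((Nat.lt_succ_self _).trans hi)
  rw [G.y_succ] at hy
  have ht0 := ht.1
  refine G.mem_cellSet.2 ⟨s₀, hs₀, _, ha, abs_le.2 ?_, abs_le.2 ?_⟩
  · rcases hss with hss | hss <;> constructor <;> linarith
  · constructor <;> linarith

include ht in
lemma cell_cover {z : ℂ}
    (hz : z ∈ cellSet G.boxes (n + 1)) : ∃ p ∈ G.pieces n, z ∈ openBox (G.cell n t p) := by
  obtain ⟨s, hs, b, hb, z1, z2⟩ := G.mem_cellSet.1 hz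
  obtain ⟨a, ha, i, hi, hai⟩ := (G.A_succ n b).1 hb
  change b = G.y n a i + 2 * G.ρ (n + 1) at hai
  obtain ⟨h1, h2, h3, h4, h5, h6, h7, h8⟩ := G.sizes n
  obtain ⟨h9, -⟩ := G.shift_bounds ht
  rw [abs_le] at z1 z2
  have ht0 := ht.1
  refine ⟨(s, a, i), (G.mem_pieces n).2 ⟨hs, ha, hi⟩, G.mem_openCell.2 ⟨⟨?_, ?_⟩, ?_, ?_⟩⟩ <;>
    simp only <;> linarith

lemma cell_disj {t : ℝ} {p q : ℝ × ℝ × ℕ}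
    (hp : p ∈ G.pieces n) (hq : q ∈ G.pieces n) (hpq : p ≠ q) :
    Disjoint (openBox (G.cell n t p)) (box (G.cell n t q)) := by
  obtain ⟨hs, ha, hi⟩ := (G.mem_pieces n).1 hp
  obtain ⟨hs', ha', hi'⟩ := (G.mem_pieces n).1 hq
  obtain ⟨h1, h2, h3, h4, h5, h6, h7, h8⟩ := G.sizes n
  rw [disjoint_left]
  intro z hz hz'
  obtain ⟨⟨z1, z2⟩, z3, z4⟩ := G.mem_openCell.1 hz
  obtain ⟨⟨w1, w2⟩, w3, w4⟩ := G.mem_cell.1 hz'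
  by_cases hss : p.1 = q.1
  · have := G.level_sep ha ha' ((Nat.lt_succ_self _).trans hi) ((Nat.lt_succ_self _).trans hi')
      fun h h' => hpq (Prod.ext hss (Prod.ext h h'))
    rw [le_abs] at this
    rcases this with this | this <;> linarith
  · have := G.S_succ_sep hs hs' hss
    rw [le_abs] at this
    rcases this with this | this <;> linarith

include ht in
lemma cell_near {p : ℝ × ℝ × ℕ}
    (hp : p ∈ G.pieces n) {j : ℂ × ℝ} (hj : j ∈ G.discs n) {z : ℂ} (hz : z ∈ box (G.cell n t p))
    (hzj : z ∈ closedBall j.1 j.2) : ∃ l, G.hexDisc n l p = j := by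
  obtain ⟨s, hs, a, ha, i, hi, τ, hτ, rfl⟩ := G.mem_discs.1 hj
  obtain ⟨hs', ha', hi'⟩ := (G.mem_pieces n).1 hp
  obtain ⟨h1, h2, h3, h4, h5, h6, h7, h8⟩ := G.sizes n
  obtain ⟨h9, -⟩ := G.shift_bounds ht
  have ht0 := ht.1
  obtain ⟨⟨z1, z2⟩, z3, z4⟩ := G.mem_cell.1 hz
  obtain ⟨-, w1, w2⟩ := G.disc_bounds hτ hzj
  have w3 := abs_le.1 (w2.trans G.disc_rad.2.2)
  rw [abs_le] at w1
  by_cases hss : s = p.1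
  · subst hss
    rcases G.level_cases ha' ha hi' hi with ⟨rfl, rfl⟩ | ⟨rfl, rfl⟩ | hy | hy
    · obtain ⟨l, e1, e2⟩ := exists_hexPos hτ (e := 0) (Or.inl rfl)
      exact ⟨l, by simp only [hexDisc, e1, e2, add_zero]⟩
    · obtain ⟨l, e1, e2⟩ := exists_hexPos hτ (e := 1) (Or.inr rfl)
      exact ⟨l, by simp only [hexDisc, e1, e2]⟩
    · linarith
    · linarith
  · have := G.S_succ_sep hs hs' hss
    rw [le_abs] at this
    rcases this with this | this <;> linarith

include ht in
lemma cell_subset_closedBall (p : ℝ × ℝ × ℕ) :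
    box (G.cell n t p) ⊆ closedBall ⟨p.1, G.y n p.2.1 p.2.2 + G.d n / 2⟩ (3 * G.d n) := by
  intro z hz
  obtain ⟨h1, h2, h3, h4, h5, h6, h7, h8⟩ := G.sizes n
  obtain ⟨h9, -⟩ := G.shift_bounds ht
  have ht0 := ht.1
  obtain ⟨⟨z1, z2⟩, z3, z4⟩ := G.mem_cell.1 hz
  rw [mem_closedBall, dist_eq_norm]
  refine (norm_le_abs_re_add_abs_im _).trans ?_
  have e1 : |z.re - p.1| ≤ G.d n := abs_le.2 ⟨by linarith, by linarith⟩
  have e2 : |z.im - (G.y n p.2.1 p.2.2 + G.d n / 2)| ≤ G.d n := abs_le.2 ⟨by linarith, by linarith⟩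
  simp only [sub_re, sub_im]
  linarith

lemma hexDisc_subset_closedBall (p : ℝ × ℝ × ℕ) (l : Fin 6) :
    closedBall (G.hexDisc n l p).1 (G.hexDisc n l p).2 ⊆
      closedBall ⟨p.1, G.y n p.2.1 p.2.2 + G.d n / 2⟩ (3 * G.d n) := by
  intro z hz
  obtain ⟨h1, h2, h3, h4, h5, h6, h7, h8⟩ := G.sizes n
  obtain ⟨-, w1, w2⟩ := G.disc_bounds (hexPos_mem l) hz
  have w3 := abs_le.1 (w2.trans G.disc_rad.2.2)
  rw [mem_closedBall, dist_eq_norm]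
  refine (norm_le_abs_re_add_abs_im _).trans ?_
  have e2 : |z.im - (G.y n p.2.1 p.2.2 + G.d n / 2)| ≤ G.d n := by
    rcases hexLev_le l with hl | hl <;> rw [hl] at w3
    · rw [add_zero] at w3
      exact abs_le.2 ⟨by linarith, by linarith⟩
    · rw [G.y_succ] at w3
      exact abs_le.2 ⟨by linarith, by linarith⟩
  simp only [sub_re, sub_im]
  linarith

lemma hexDisc_im (l : Fin 6) (p : ℝ × ℝ × ℕ) :
    (G.hexDisc n l p).1.im = G.y n p.2.1 p.2.2 + hexLev l * G.d n := by
  simp only [hexDisc, disc, y]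
  push_cast
  ring

lemma hexDisc_gap (l : Fin 6) (p : ℝ × ℝ × ℕ) :
    (hexVert l = true ∧ (G.hexDisc n (hexUpper l) p).1.re = (G.hexDisc n (hexLower l) p).1.re ∧
      (G.hexDisc n (hexUpper l) p).1.im = (G.hexDisc n (hexLower l) p).1.im +
        (G.hexDisc n (hexLower l) p).2 + G.δ n + (G.hexDisc n (hexUpper l) p).2) ∨
    (hexVert l = false ∧ (G.hexDisc n (hexUpper l) p).1.im = (G.hexDisc n (hexLower l) p).1.im ∧
      (G.hexDisc n (hexUpper l) p).1.re = (G.hexDisc n (hexLower l) p).1.re +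
        (G.hexDisc n (hexLower l) p).2 + G.δ n + (G.hexDisc n (hexUpper l) p).2) := by
  obtain ⟨h1, h2, h3, h4, h5, h6, h7, h8⟩ := G.sizes n
  simp only [hexDisc_im]
  fin_cases l <;>
    simp [hexVert, hexUpper, hexLower, hexDisc, disc, hexPos, hexLev] <;> linarith

lemma linePoint_gapBase (l : Fin 6) (p : ℝ × ℝ × ℕ) (x t : ℝ) :
    (hexVert l = true → (linePoint (hexVert l) (G.gapBase n l p) x t).re =
        (G.hexDisc n (hexLower l) p).1.re + t ∧
      (linePoint (hexVert l) (G.gapBase n l p) x t).im = (G.hexDisc n (hexLower l) p).1.im +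
        (G.hexDisc n (hexLower l) p).2 - G.δ n + x) ∧
    (hexVert l = false → (linePoint (hexVert l) (G.gapBase n l p) x t).im =
        (G.hexDisc n (hexLower l) p).1.im + t ∧
      (linePoint (hexVert l) (G.gapBase n l p) x t).re = (G.hexDisc n (hexLower l) p).1.re +
        (G.hexDisc n (hexLower l) p).2 - G.δ n + x) := by
  constructor <;> intro h <;> simp [linePoint, gapBase, h] <;> ring

/-- Half the length of the chord at distance `t` from the centre of a disc. -/
def chord (n : ℕ) (t : ℝ) (l : Fin 6) (p : ℝ × ℝ × ℕ) : ℝ := √((G.hexDisc n l p).2 ^ 2 - t ^ 2)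

include ht in
lemma chord_spec (l : Fin 6) (p : ℝ × ℝ × ℕ) :
    G.chord n t l p ^ 2 + t ^ 2 = (G.hexDisc n l p).2 ^ 2 ∧ t ≤ G.chord n t l p ∧
    (G.hexDisc n l p).2 - G.δ n ≤ G.chord n t l p ∧ G.chord n t l p ≤ (G.hexDisc n l p).2 := by
  obtain ⟨h1, h2, h3, h4, h5, h6, h7, h8⟩ := G.sizes n
  obtain ⟨h9, h10⟩ := G.shift_bounds ht
  have ht0 := ht.1
  obtain ⟨r1, r2, r3⟩ : 0 < (G.hexDisc n l p).2 ∧ G.ρ (n + 1) ≤ (G.hexDisc n l p).2 ∧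
    (G.hexDisc n l p).2 ≤ G.r n := G.disc_rad
  unfold chord
  generalize (G.hexDisc n l p).2 = R at *
  have hδ : (R - G.δ n) ^ 2 ≤ R ^ 2 - t ^ 2 := by nlinarith
  refine ⟨?_, Real.le_sqrt_of_sq_le (by nlinarith), Real.le_sqrt_of_sq_le hδ, ?_⟩
  · rw [Real.sq_sqrt ((sq_nonneg _).trans hδ)]
    ring
  · rw [Real.sqrt_le_left r1.le]
    nlinarith

def gapStart (n : ℕ) (t : ℝ) (p : ℝ × ℝ × ℕ) (l : Fin 6) : ℝ :=
  G.chord n t (hexLower l) p - (G.hexDisc n (hexLower l) p).2 + G.δ n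

def gapEnd (n : ℕ) (t : ℝ) (p : ℝ × ℝ × ℕ) (l : Fin 6) : ℝ :=
  2 * G.δ n + (G.hexDisc n (hexUpper l) p).2 - G.chord n t (hexUpper l) p

lemma hexDisc_rad_cases (l : Fin 6) (p : ℝ × ℝ × ℕ) :
    (G.hexDisc n l p).2 = if hexPos l = 0 then G.ρ (n + 1) else G.r n := rfl

include ht in
lemma mem_hexDisc_iff (l : Fin 6)
    (p : ℝ × ℝ × ℕ) (z : ℂ) : (z.im = (G.hexDisc n l p).1.im + t →
      (z ∈ closedBall (G.hexDisc n l p).1 (G.hexDisc n l p).2 ↔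
        |z.re - (G.hexDisc n l p).1.re| ≤ G.chord n t l p)) ∧
    (z.re = (G.hexDisc n l p).1.re + t →
      (z ∈ closedBall (G.hexDisc n l p).1 (G.hexDisc n l p).2 ↔
        |z.im - (G.hexDisc n l p).1.im| ≤ G.chord n t l p)) := by
  obtain ⟨h1, h2, -, h3⟩ := G.chord_spec ht l p
  have := ht.1
  exact mem_closedBall_iff_chord (by linarith) (by linarith) h1

include ht in
lemma mem_gap {p : ℝ × ℝ × ℕ}
    {l : Fin 6} {z : ℂ} (hz : (hexVert l = true ∧ z.re = (G.hexDisc n (hexLower l) p).1.re + t ∧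
      (G.hexDisc n (hexLower l) p).1.im ≤ z.im ∧ z.im ≤ (G.hexDisc n (hexUpper l) p).1.im + t) ∨
      (hexVert l = false ∧ z.im = (G.hexDisc n (hexLower l) p).1.im + t ∧
      (G.hexDisc n (hexLower l) p).1.re ≤ z.re ∧ z.re ≤ (G.hexDisc n (hexUpper l) p).1.re + t)) :
    (∃ l, z ∈ closedBall (G.hexDisc n l p).1 (G.hexDisc n l p).2) ∨
      ∃ l, ∃ x ∈ Ioo (G.gapStart n t p l) (G.gapEnd n t p l),
        z = linePoint (hexVert l) (G.gapBase n l p) x t := by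
  obtain ⟨a1, a2, a3, a4⟩ := G.chord_spec ht (hexLower l) p
  obtain ⟨b1, b2, b3, b4⟩ := G.chord_spec ht (hexUpper l) p
  have ht0 := ht.1
  have A := G.mem_hexDisc_iff ht (hexLower l) p z
  have B := G.mem_hexDisc_iff ht (hexUpper l) p z
  by_contra! hcon
  obtain ⟨hc1, hc2⟩ := hcon
  have hA := hc1 (hexLower l)
  have hB := hc1 (hexUpper l)
  have hg := G.hexDisc_gap (n := n) l p
  have hL := G.linePoint_gapBase (n := n) l p
  rcases hz with ⟨hv, z1, z2, z3⟩ | ⟨hv, z1, z2, z3⟩ <;> simp only [hv, true_and, reduceCtorEq,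
    false_and, or_false, false_or] at hg
  · rw [A.2 z1, not_le, lt_abs] at hA
    rw [B.2 (by rw [z1, hg.1]), not_le, lt_abs] at hB
    refine hc2 l (z.im - ((G.hexDisc n (hexLower l) p).1.im + (G.hexDisc n (hexLower l) p).2 -
      G.δ n)) ⟨?_, ?_⟩ (Complex.ext (by rw [((hL _ t).1 hv).1, z1])
        (by rw [((hL _ t).1 hv).2]; ring))
    · unfold gapStart
      rcases hA with hA | hA <;> linarith
    · unfold gapEnd
      rcases hB with hB | hB <;> linarith
  · rw [A.1 z1, not_le, lt_abs] at hA
    rw [B.1 (by rw [z1, hg.1]), not_le, lt_abs] at hB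
    refine hc2 l (z.re - ((G.hexDisc n (hexLower l) p).1.re + (G.hexDisc n (hexLower l) p).2 -
      G.δ n)) ⟨?_, ?_⟩ (Complex.ext (by rw [((hL _ t).2 hv).2]; ring)
        (by rw [((hL _ t).2 hv).1, z1]))
    · unfold gapStart
      rcases hA with hA | hA <;> linarith
    · unfold gapEnd
      rcases hB with hB | hB <;> linarith

include ht in
lemma cell_frontier {p : ℝ × ℝ × ℕ} {z : ℂ}
    (hz : z ∈ box (G.cell n t p)) (hz' : z ∉ openBox (G.cell n t p)) :
    (∃ l, z ∈ closedBall (G.hexDisc n l p).1 (G.hexDisc n l p).2) ∨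
      ∃ l, ∃ x ∈ Ioo (G.gapStart n t p l) (G.gapEnd n t p l),
        z = linePoint (hexVert l) (G.gapBase n l p) x t := by
  have ht0 := ht.1
  rw [mem_cell] at hz
  rw [mem_openCell] at hz'
  obtain ⟨⟨z1, z2⟩, z3, z4⟩ := hz
  have key : ∀ l : Fin 6, ((hexVert l = true ∧ z.re = p.1 + hexPos (hexLower l) * G.g n + t ∧
      G.y n p.2.1 p.2.2 + hexLev (hexLower l) * G.d n ≤ z.im ∧
      z.im ≤ G.y n p.2.1 p.2.2 + hexLev (hexUpper l) * G.d n + t) ∨ (hexVert l = false ∧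
      z.im = G.y n p.2.1 p.2.2 + hexLev (hexLower l) * G.d n + t ∧
      p.1 + hexPos (hexLower l) * G.g n ≤ z.re ∧ z.re ≤ p.1 + hexPos (hexUpper l) * G.g n + t)) → _ :=
    fun l hl => G.mem_gap (l := l) ht (by simp only [hexDisc_im]; exact hl)
  by_cases c1 : z.im = G.y n p.2.1 p.2.2 + t
  · rcases le_total z.re p.1 with h | h
    on_goal 1 => refine key 0 (.inr ?_)
    on_goal 2 => refine key 1 (.inr ?_)
    all_goals simp [hexVert, hexUpper, hexLower, hexPos, hexLev]; refine ⟨?_, ?_, ?_⟩ <;> linarith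
  by_cases c2 : z.im = G.y n p.2.1 p.2.2 + G.d n + t
  · rcases le_total z.re p.1 with h | h
    on_goal 1 => refine key 4 (.inr ?_)
    on_goal 2 => refine key 3 (.inr ?_)
    all_goals simp [hexVert, hexUpper, hexLower, hexPos, hexLev]; refine ⟨?_, ?_, ?_⟩ <;> linarith
  by_cases c3 : z.re = p.1 + t - G.g n
  · refine key 5 (.inl ?_)
    simp [hexVert, hexUpper, hexLower, hexPos, hexLev]; refine ⟨?_, ?_, ?_⟩ <;> linarith
  by_cases c4 : z.re = p.1 + t + G.g n
  · refine key 2 (.inl ?_)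
    simp [hexVert, hexUpper, hexLower, hexPos, hexLev]; refine ⟨?_, ?_, ?_⟩ <;> linarith
  exact absurd ⟨⟨lt_of_le_of_ne z1 (Ne.symm c3), lt_of_le_of_ne z2 c4⟩,
    lt_of_le_of_ne z3 (Ne.symm c1), lt_of_le_of_ne z4 c2⟩ hz'

include ht in
lemma gap_spec (p : ℝ × ℝ × ℕ)
    (l : Fin 6) {x : ℝ} (hx : x ∈ Ioo (G.gapStart n t p l) (G.gapEnd n t p l)) {z : ℂ}
    (hz : z = linePoint (hexVert l) (G.gapBase n l p) x t) :
    z ∈ box (G.cell n t p) ∧ z ∉ openBox (G.cell n t p) ∧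
      ∀ m, z ∉ closedBall (G.hexDisc n m p).1 (G.hexDisc n m p).2 := by
  obtain ⟨h1, h2, h3, h4, h5, h6, h7, h8⟩ := G.sizes n
  obtain ⟨h9, -⟩ := G.shift_bounds ht
  have ht0 := ht.1
  obtain ⟨a1, a2, a3, a4⟩ := G.chord_spec ht (hexLower l) p
  obtain ⟨b1, b2, b3, b4⟩ := G.chord_spec ht (hexUpper l) p
  have A := G.mem_hexDisc_iff ht (hexLower l) p z
  have B := G.mem_hexDisc_iff ht (hexUpper l) p z
  have hg := G.hexDisc_gap (n := n) l p
  have hL := G.linePoint_gapBase (n := n) l p x t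
  rw [← hz] at hL
  obtain ⟨x1, x2⟩ := hx
  unfold gapStart at x1
  unfold gapEnd at x2
  have hlow : z ∉ closedBall (G.hexDisc n (hexLower l) p).1 (G.hexDisc n (hexLower l) p).2 := by
    rcases hg with ⟨hv, g1, g2⟩ | ⟨hv, g1, g2⟩
    · rw [A.2 (hL.1 hv).1, (hL.1 hv).2, not_le, lt_abs]
      left; linarith
    · rw [A.1 (hL.2 hv).1, (hL.2 hv).2, not_le, lt_abs]
      left; linarith
  have hup : z ∉ closedBall (G.hexDisc n (hexUpper l) p).1 (G.hexDisc n (hexUpper l) p).2 := by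
    rcases hg with ⟨hv, g1, g2⟩ | ⟨hv, g1, g2⟩
    · rw [B.2 ((hL.1 hv).1.trans (by rw [g1])), (hL.1 hv).2, g2, not_le, lt_abs]
      right; linarith
    · rw [B.1 ((hL.2 hv).1.trans (by rw [g1])), (hL.2 hv).2, g2, not_le, lt_abs]
      right; linarith
  clear A B
  simp only [hexDisc_im] at hL
  simp only [hexDisc_rad_cases] at hL a3 a4 b3 b4 x1 x2
  change ((_ → z.re = p.1 + hexPos _ * G.g n + t ∧ _) ∧ (_ → _ ∧ z.re = p.1 + hexPos _ * G.g n + _ - _ + _)) at hL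
  have hD : ∀ m, m ≠ hexLower l → m ≠ hexUpper l →
      z ∉ closedBall (G.hexDisc n m p).1 (G.hexDisc n m p).2 := by
    intro m m1 m2 hm
    obtain ⟨w1, -, w2⟩ := G.disc_bounds (hexPos_mem m) hm
    change _ ≤ if hexPos m = 0 then G.ρ (n + 1) else G.r n at w1
    change |_ - (G.hexDisc n m p).1.im| ≤ if hexPos m = 0 then G.ρ (n + 1) else G.r n at w2
    rw [hexDisc_im] at w2
    rw [abs_le] at w1 w2
    clear hlow hup hg a1 b1 hm hz
    fin_cases l <;> fin_cases m <;> first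
      | exact absurd rfl m1
      | exact absurd rfl m2
      | (simp [hexVert, hexUpper, hexLower, hexPos, hexLev] at w1 w2 hL x1 x2 a3 a4 b3 b4
         linarith)
  refine ⟨G.mem_cell.2 ?_, fun h => ?_, fun m => ?_⟩
  · clear hlow hup hg a1 b1 hD hz
    fin_cases l <;> simp [hexVert, hexUpper, hexLower, hexPos, hexLev] at hL x1 x2 a3 a4 b3 b4 <;>
      refine ⟨⟨?_, ?_⟩, ?_, ?_⟩ <;> linarith
  · have h := G.mem_openCell.1 h
    clear hlow hup hg a1 b1 hD hz
    fin_cases l <;> simp [hexVert, hexUpper, hexLower, hexPos, hexLev] at hL x1 x2 a3 a4 b3 b4 <;>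
      linarith
  · by_cases m1 : m = hexLower l
    · rwa [m1]
    by_cases m2 : m = hexUpper l
    · rwa [m2]
    exact hD m m1 m2

include ht in
lemma gap_mem_cellDomain {p : ℝ × ℝ × ℕ}
    (hp : p ∈ G.pieces n) (l : Fin 6) {x : ℝ} (hx : x ∈ Ioo (G.gapStart n t p l) (G.gapEnd n t p l)) :
    linePoint (hexVert l) (G.gapBase n l p) x t ∈ cellDomain G.discs G.boxes := by
  obtain ⟨h1, h2, h3⟩ := G.gap_spec ht p l hx rfl
  have h4 := G.cell_subset ht hp h1
  refine G.cellSystem.mem_cellDomain_of (n := n + 1) (G.cellSystem.cellSet_subset_ball n h4)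
    (fun h => ?_) fun m hm j hj hzj => ?_
  · obtain ⟨q, hq, hzq⟩ := G.cell_cover ht h
    by_cases hpq : q = p
    · exact h2 (hpq ▸ hzq)
    · exact disjoint_left.1 (G.cell_disj hq hp hpq) hzq h1
  · rcases (Nat.lt_succ_iff.1 hm).lt_or_eq with hm | rfl
    · exact disjoint_left.1 (G.cellSystem.disc_cellSet_disj hm hj) hzj h4
    · obtain ⟨l', rfl⟩ := G.cell_near ht hp hj h1 hzj
      exact h3 l' hzj

include ht in
lemma gap_endpoints (p : ℝ × ℝ × ℕ) (l : Fin 6) :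
    linePoint (hexVert l) (G.gapBase n l p) (G.gapStart n t p l) t ∈
      sphere (G.hexDisc n (hexLower l) p).1 (G.hexDisc n (hexLower l) p).2 ∧
    linePoint (hexVert l) (G.gapBase n l p) (G.gapEnd n t p l) t ∈
      sphere (G.hexDisc n (hexUpper l) p).1 (G.hexDisc n (hexUpper l) p).2 := by
  obtain ⟨a1, -, -, -⟩ := G.chord_spec ht (hexLower l) p
  obtain ⟨b1, -, -, -⟩ := G.chord_spec ht (hexUpper l) p
  have hg := G.hexDisc_gap (n := n) l p
  have hL := fun x => G.linePoint_gapBase (n := n) l p x t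
  have hr : ∀ m, 0 ≤ (G.hexDisc n m p).2 := fun m => G.disc_rad.1.le
  rcases hg with ⟨hv, g1, g2⟩ | ⟨hv, g1, g2⟩
  · refine ⟨(mem_sphere_of_chord (hr _) a1).2 ((hL _).1 hv).1 (Or.inl ?_),
      (mem_sphere_of_chord (hr _) b1).2 (((hL _).1 hv).1.trans (by rw [g1])) (Or.inr ?_)⟩ <;>
      rw [((hL _).1 hv).2]
    · unfold gapStart; ring
    · rw [g2]; unfold gapEnd; ring
  · refine ⟨(mem_sphere_of_chord (hr _) a1).1 ((hL _).2 hv).1 (Or.inl ?_),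
      (mem_sphere_of_chord (hr _) b1).1 (((hL _).2 hv).1.trans (by rw [g1])) (Or.inr ?_)⟩ <;>
      rw [((hL _).2 hv).2]
    · unfold gapStart; ring
    · rw [g2]; unfold gapEnd; ring

lemma hex_orient (l : Fin 6) :
    (hexLower l = l ∧ hexUpper l = l + 1) ∨ (hexUpper l = l ∧ hexLower l = l + 1) := by
  fin_cases l <;> decide

variable (n) in
/-- The cells of generation `n` form a mesh. -/
def mesh : Mesh G.discs G.boxes n where
  P := G.pieces n
  disc := G.hexDisc n
  T := G.ε n * G.ρ (n + 1)
  W := 3 * G.δ n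
  d := 3 * G.d n
  ctr p := ⟨p.1, G.y n p.2.1 p.2.2 + G.d n / 2⟩
  U t p := box (G.cell n t p)
  Uo t p := openBox (G.cell n t p)
  vert := hexVert
  base := G.gapBase n
  T_pos := mul_pos (G.ε_pos n) (G.ρ_pos _)
  W_pos := by obtain ⟨h1, h2, h3, h4, -⟩ := G.sizes n; linarith
  d_pos := by obtain ⟨h1, h2, h3, h4, -⟩ := G.sizes n; linarith
  disc_mem l _ hp := G.hexDisc_mem l hp
  disc_inj l := G.hexDisc_injOn l
  exists_disc _ hj := G.exists_hexDisc hj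
  isClosed_U _ _ := isClosed_box _
  isOpen_Uo _ _ := isOpen_openBox _
  Uo_subset _ _ := openBox_subset_box _
  U_subset _ ht _ hp := G.cell_subset ht hp
  cover _ ht _ hz := G.cell_cover ht hz
  disj _ _ _ hp _ hq hpq := G.cell_disj hp hq hpq
  edges t ht p hp := by
    refine ⟨G.gapStart n t p, G.gapEnd n t p, fun l => ?_, fun z hz hz' => G.cell_frontier ht hz hz'⟩
    obtain ⟨-, -, a3, a4⟩ := G.chord_spec ht (hexLower l) p
    obtain ⟨-, -, b3, b4⟩ := G.chord_spec ht (hexUpper l) p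
    obtain ⟨h1, h2, h3, h4, h5, h6, h7, h8⟩ := G.sizes n
    obtain ⟨e1, e2⟩ := G.gap_endpoints ht p l
    refine ⟨?_, ?_, ?_, fun x hx => G.gap_mem_cellDomain ht hp l hx, ?_⟩
    · unfold gapStart; linarith
    · unfold gapStart gapEnd; linarith
    · unfold gapEnd; linarith
    · rcases hex_orient l with ⟨o1, o2⟩ | ⟨o1, o2⟩ <;>
        simp only [o1, o2] at e1 e2
      · exact Or.inl ⟨e1, e2⟩
      · exact Or.inr ⟨e2, e1⟩
  near _ ht _ hp _ hj _ hz hzj := G.cell_near ht hp hj hz hzj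
  U_ctr _ ht p _ := G.cell_subset_closedBall ht p
  disc_ctr p _ l := G.hexDisc_subset_closedBall p l

theorem exists_good_mesh {η : ℝ} (hη : 0 < η) (n₀ : ℕ) : ∃ n ≥ n₀, ∃ M : Mesh G.discs G.boxes n,
    M.P.card * M.d ^ 2 < η ∧ M.P.card * M.W < η * M.T := by
  obtain ⟨N, hN⟩ := exists_nat_one_div_lt hη
  refine ⟨max n₀ N, le_max_left _ _, G.mesh _, ?_⟩
  set n := max n₀ N
  have hn : 1 / ((n : ℝ) + 1) < η := by
    refine lt_of_le_of_lt ?_ hN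
    have : (N : ℝ) ≤ n := by exact_mod_cast le_max_right _ _
    gcongr
  have hc : ((G.pieces n).card : ℝ) ≤ (G.S (n + 1)).card * (G.A n).card * G.k n := by
    rw [pieces, Finset.card_product, Finset.card_product, Finset.card_range, ← mul_assoc]
    push_cast
    gcongr
    exact Nat.sub_le _ _
  have h1 := G.card_mul_area n
  have h2 := G.card_mul_ε n
  have h3 := G.ε_pos n
  have h4 := G.ρ_pos (n + 1)
  change ((G.pieces n).card : ℝ) * (3 * G.d n) ^ 2 < η ∧
    ((G.pieces n).card : ℝ) * (3 * (G.ε n ^ 2 * G.ρ (n + 1))) < η * (G.ε n * G.ρ (n + 1))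
  constructor
  · exact ((mul_le_mul_of_nonneg_right hc (sq_nonneg _)).trans h1).trans_lt hn
  · have h5 := ((mul_le_mul_of_nonneg_right hc (by positivity : 0 ≤ 3 * G.ε n)).trans h2).trans_lt hn
    have := mul_lt_mul_of_pos_right h5 (mul_pos h3 h4)
    linarith

variable (G : Grid)

def reSet (n : ℕ) : Set ℝ := ⋃ s ∈ G.S n, closedBall s (G.ρ n)

def imSet (n : ℕ) : Set ℝ := ⋃ a ∈ G.A n, closedBall (a + G.ℓ n / 2) (G.ℓ n / 2)

lemma isClosed_iInter_reSet : IsClosed (⋂ n, G.reSet n) :=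
  isClosed_iInter fun _ => isClosed_biUnion_finset fun _ _ => isClosed_closedBall

lemma isClosed_iInter_imSet : IsClosed (⋂ n, G.imSet n) :=
  isClosed_iInter fun _ => isClosed_biUnion_finset fun _ _ => isClosed_closedBall

lemma mem_limitSet {z : ℂ} (h1 : z.re ∈ ⋂ n, G.reSet n) (h2 : z.im ∈ ⋂ n, G.imSet n) :
    z ∈ limitSet G.boxes := by
  refine mem_iInter.2 fun n => G.mem_cellSet.2 ?_
  obtain ⟨s, hs, h3⟩ := mem_iUnion₂.1 (mem_iInter.1 h1 n)
  obtain ⟨a, ha, h4⟩ := mem_iUnion₂.1 (mem_iInter.1 h2 n)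
  exact ⟨s, hs, a, ha, h3, h4⟩

lemma reSet_anti : Antitone G.reSet := by
  refine antitone_nat_of_succ_le fun n x hx => ?_
  obtain ⟨s, hs, hx⟩ := mem_iUnion₂.1 hx
  obtain ⟨s₀, hs₀, h⟩ := (G.S_succ n s).1 hs
  obtain ⟨h1, h2, h3, -⟩ := G.sizes n
  refine mem_iUnion₂.2 ⟨s₀, hs₀, ?_⟩
  rw [mem_closedBall, Real.dist_eq, abs_le] at hx ⊢
  rcases h with rfl | rfl <;> constructor <;> linarith

lemma exists_mem_reSet {N : ℕ} {s : ℝ} (hs : s ∈ G.S N) : ∃ x ∈ ⋂ n, G.reSet n, |x - s| ≤ G.ρ N := by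
  have key : ∀ m, ∃ x ∈ G.S (N + m), |x - s| ≤ G.ρ N - G.ρ (N + m) := by
    intro m
    induction m with
    | zero => exact ⟨s, hs, by simp⟩
    | succ m ih =>
      obtain ⟨x, hx, hxs⟩ := ih
      obtain ⟨h1, h2, h3, -⟩ := G.sizes (N + m)
      refine ⟨x + G.ρ (N + m) / 2, (G.S_succ _ _).2 ⟨x, hx, Or.inr rfl⟩, ?_⟩
      rw [abs_le] at hxs ⊢
      constructor <;> rw [← add_assoc N] <;> linarith
  obtain ⟨x, hx⟩ := IsCompact.nonempty_iInter_of_sequence_nonempty_isCompact_isClosed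
    (fun m => closedBall s (G.ρ N) ∩ G.reSet (N + m))
    (fun m => inter_subset_inter_right _ (G.reSet_anti (Nat.le_succ _)))
    (fun m => by
      obtain ⟨x, hx, hxs⟩ := key m
      have := G.ρ_pos (N + m)
      refine ⟨x, ?_, mem_iUnion₂.2 ⟨x, hx, mem_closedBall_self this.le⟩⟩
      rw [mem_closedBall, Real.dist_eq]
      linarith)
    ((isCompact_closedBall _ _).inter_right
      (isClosed_biUnion_finset fun _ _ => isClosed_closedBall))
    (fun m => isClosed_closedBall.inter
      (isClosed_biUnion_finset fun _ _ => isClosed_closedBall))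
  rw [mem_iInter] at hx
  exact ⟨x, mem_iInter.2 fun n => G.reSet_anti (Nat.le_add_left n N) (hx n).2, (hx 0).1⟩

lemma perfect_reSet : Perfect (⋂ n, G.reSet n) := by
  refine ⟨G.isClosed_iInter_reSet, fun x hx => accPt_iff_nhds.2 fun U hU => ?_⟩
  obtain ⟨η, hη, hηU⟩ := Metric.mem_nhds_iff.1 hU
  obtain ⟨N, hN⟩ := exists_pow_lt_of_lt_one (half_pos hη) (by norm_num : (1 / 2 : ℝ) < 1)
  obtain ⟨s, hs, hxs⟩ := mem_iUnion₂.1 (mem_iInter.1 hx N)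
  rw [mem_closedBall, Real.dist_eq, abs_le] at hxs
  obtain ⟨h1, h2, h3, -⟩ := G.sizes N
  have h4 := G.ρ_le_pow N
  obtain ⟨u, hu, hus⟩ := G.exists_mem_reSet ((G.S_succ N _).2 ⟨s, hs, Or.inl rfl⟩)
  obtain ⟨v, hv, hvs⟩ := G.exists_mem_reSet ((G.S_succ N _).2 ⟨s, hs, Or.inr rfl⟩)
  rw [abs_le] at hus hvs
  have hball : ∀ w, |w - s| ≤ G.ρ N → w ∈ U := fun w hw => hηU (by
    rw [abs_le] at hw
    rw [mem_ball, Real.dist_eq, abs_lt]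
    constructor <;> linarith)
  by_cases hux : u = x
  · refine ⟨v, ⟨hball v (abs_le.2 ⟨?_, ?_⟩), hv⟩, fun hvx => ?_⟩ <;> linarith
  · refine ⟨u, ⟨hball u (abs_le.2 ⟨?_, ?_⟩), hu⟩, hux⟩ <;> linarith

lemma isCompact_reSet : IsCompact (⋂ n, G.reSet n) :=
  ((G.S 0).finite_toSet.isCompact_biUnion fun s _ => isCompact_closedBall s (G.ρ 0)).of_isClosed_subset
    G.isClosed_iInter_reSet (iInter_subset _ 0)

lemma exists_level {v : ℝ} (hv : |v| < 1) (hvF : v ∉ ⋂ n, G.imSet n) :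
    ∃ n, ∃ a ∈ G.A n, ∃ i < G.k n, |v - G.y n a i| ≤ 4 * G.ρ (n + 1) := by
  by_contra! hcon
  have key : ∀ n, ∃ a ∈ G.A n, a + G.d n / 2 ≤ v ∧ v ≤ a + G.ℓ n - G.d n / 2 := by
    intro n
    induction n with
    | zero =>
      obtain ⟨h1, h2, h3, -⟩ := G.sizes 0
      rw [G.ρ_zero] at h3
      rw [abs_lt] at hv
      refine ⟨-2, by rw [G.A_zero, Finset.mem_singleton], ?_, ?_⟩ <;>
        linarith [G.ℓ_zero]
    | succ n ih =>
      obtain ⟨a, ha, h1, h2⟩ := ih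
      obtain ⟨s1, s2, s3, -, -, -, -, s8⟩ := G.sizes n
      obtain ⟨-, -, s9, -⟩ := G.sizes (n + 1)
      have hd : 0 < G.d n := by linarith
      have hx : 0 ≤ (v - a) / G.d n - 1 / 2 := by
        rw [sub_nonneg, le_div_iff₀ hd]
        linarith
      set i := ⌊(v - a) / G.d n - 1 / 2⌋₊
      have hi1 := Nat.floor_le hx
      have hi2 := Nat.lt_floor_add_one ((v - a) / G.d n - 1 / 2)
      rw [le_sub_iff_add_le, le_div_iff₀ hd] at hi1
      rw [sub_lt_iff_lt_add, div_lt_iff₀ hd] at hi2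
      change (i + 1 / 2) * G.d n ≤ v - a at hi1
      change v - a < (i + 1 + 1 / 2) * G.d n at hi2
      have hkd := G.k_mul_d n
      have hik : i < G.k n := by
        by_contra! h
        have : (G.k n : ℝ) ≤ i := by exact_mod_cast h
        nlinarith
      have hi3 := hcon n a ha i hik
      unfold y at hi3
      rw [abs_of_nonneg (by linarith)] at hi3
      have hik' : i + 1 < G.k n := by
        by_contra! h
        have : (G.k n : ℝ) ≤ i + 1 := by exact_mod_cast h
        nlinarith
      have hi4 := hcon n a ha _ hik'
      unfold y at hi4
      push_cast at hi4
      rw [abs_of_neg (by linarith)] at hi4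
      refine ⟨_, (G.A_succ n _).2 ⟨a, ha, i, hik', rfl⟩, ?_, ?_⟩ <;>
        unfold d at * <;> linarith
  refine hvF (mem_iInter.2 fun n => ?_)
  obtain ⟨a, ha, h1, h2⟩ := key n
  obtain ⟨s1, s2, -⟩ := G.sizes n
  refine mem_iUnion₂.2 ⟨a, ha, ?_⟩
  rw [mem_closedBall, Real.dist_eq, abs_le]
  constructor <;> linarith

theorem exists_homeomorph : ∃ h : Homeomorph ℂ ℂ,
    (∀ z ∉ limitSet G.boxes, DifferentiableAt ℂ (h : ℂ → ℂ) z) ∧ ¬ IsMobiusOn (h : ℂ → ℂ) univ := by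
  obtain ⟨x, hx, -⟩ := G.exists_mem_reSet (G.S_zero ▸ Finset.mem_singleton_self 5)
  obtain ⟨h, h1, h2⟩ := G.perfect_reSet.exists_nonmobius_homeomorph
    (ι := Σ n, {p : ℝ × ℕ // p ∈ G.A n ×ˢ Finset.range (G.k n)})
    (τ := fun j => 4 * G.ρ (j.1 + 1)) (y := fun j => G.y j.1 j.2.1.1 j.2.1.2)
    (fun j => by
      obtain ⟨h1, h2, h3, -⟩ := G.sizes j.1
      have := (G.ρ_le_pow j.1).trans (pow_le_one₀ (by norm_num) (by norm_num))
      constructor <;> linarith)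
    (by
      rw [ENNReal.tsum_sigma']
      refine (ENNReal.tsum_le_tsum (g := fun n => ENNReal.ofReal ((1 / 2) ^ n / 40))
        fun n => ?_).trans ?_
      · simp only [tsum_fintype]
        rw [Finset.sum_const, Finset.card_univ, Fintype.card_coe,
          Finset.card_product, Finset.card_range, ← ENNReal.ofReal_nsmul, nsmul_eq_mul]
        push_cast
        exact ENNReal.ofReal_le_ofReal (G.log_le n)
      · rw [← ENNReal.ofReal_tsum_of_nonneg (fun n => by positivity)
          (summable_geometric_two.div_const 40), tsum_div_const, tsum_geometric_two]
        norm_num)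
    G.isCompact_reSet ⟨x, hx⟩ G.isClosed_iInter_imSet fun v hv hvF => by
      obtain ⟨n, a, ha, i, hi, h⟩ := G.exists_level hv hvF
      exact ⟨⟨n, (a, i), Finset.mem_product.2 ⟨ha, Finset.mem_range.2 hi⟩⟩, h⟩
  exact ⟨h, fun z hz => h1 z fun h' => hz (G.mem_limitSet h'.1 h'.2), h2⟩

end Grid

lemma exists_grid_constants (n : ℕ) {ρ ℓ : ℝ} (hρ : 0 < ρ) (hℓ : 0 < ℓ) (N M : ℕ) :
    ∃ (k : ℕ) (ρ' ε : ℝ), 0 < ρ' ∧ 0 < ε ∧ ε ≤ 1 / 4 ∧ 2 ≤ k ∧ 16 * (ℓ / k) ≤ ρ ∧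
      16 * ρ' ≤ ℓ / k ∧ (N * M * k : ℝ) * (3 * (ℓ / k)) ^ 2 ≤ 1 / (n + 1) ∧
      (N * M * k : ℝ) * (3 * ε) ≤ 1 / (n + 1) ∧
      (M * k : ℝ) * (1 / Real.log (1 / (4 * ρ'))) ≤ (1 / 2) ^ n / 40 := by
  obtain ⟨k, hk⟩ := exists_nat_ge (2 + 16 * ℓ / ρ + N * M * 9 * ℓ ^ 2 * (n + 1))
  have p1 : 0 ≤ 16 * ℓ / ρ := by positivity
  have p2 : 0 ≤ N * M * 9 * ℓ ^ 2 * (n + 1) := by positivity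
  have hk2 : (2 : ℝ) ≤ k := by linarith
  have hk0 : (0 : ℝ) < k := by linarith
  set L : ℝ := 40 * 2 ^ n * (M * k) + 1 with hL
  have hL0 : 0 < L := by positivity
  set ρ' := min (ℓ / k / 16) (Real.exp (-L) / 4)
  have hρ' : 0 < ρ' := lt_min (by positivity) (by positivity)
  have hlog : L ≤ Real.log (1 / (4 * ρ')) := by
    rw [one_div, Real.log_inv, le_neg, Real.log_le_iff_le_exp (by positivity)]
    linarith [min_le_right (ℓ / k / 16) (Real.exp (-L) / 4)]
  refine ⟨k, ρ', 1 / (3 * (N * M * k) * (n + 1) + 4), hρ', by positivity, ?_, by exact_mod_cast hk2,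
    ?_, by linarith [min_le_left (ℓ / k / 16) (Real.exp (-L) / 4)], ?_, ?_, ?_⟩
  · exact one_div_le_one_div_of_le (by norm_num) (le_add_of_nonneg_left (by positivity))
  · have : 16 * ℓ / ρ ≤ k := by linarith
    rw [div_le_iff₀ hρ] at this
    rw [← mul_div_assoc, div_le_iff₀ hk0]
    linarith
  · have e : (N * M * k : ℝ) * (3 * (ℓ / k)) ^ 2 = N * M * 9 * ℓ ^ 2 / k := by
      field_simp
      ring
    rw [e, div_le_div_iff₀ hk0 (by positivity)]
    linarith
  · rw [← mul_div_assoc, ← mul_div_assoc, div_le_div_iff₀ (by positivity) (by positivity)]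
    linarith
  · rw [← mul_div_assoc, mul_one]
    refine (div_le_div_of_nonneg_left (by positivity) hL0 hlog).trans ?_
    rw [one_div_pow, div_div, div_le_div_iff₀ hL0 (by positivity)]
    linarith

instance : Nonempty Grid := by
  classical
  let X := {s : Finset ℝ × Finset ℝ × ℝ × ℝ // 0 < s.2.2.1 ∧ 0 < s.2.2.2}
  have step : ∀ (n : ℕ) (s : X), ∃ (k : ℕ) (ε : ℝ) (s' : X),
      (∀ x, x ∈ s'.1.1 ↔ ∃ t ∈ s.1.1, x = t - s.1.2.2.1 / 2 ∨ x = t + s.1.2.2.1 / 2) ∧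
      (∀ x, x ∈ s'.1.2.1 ↔ ∃ a ∈ s.1.2.1, ∃ i : ℕ, i + 1 < k ∧
        x = a + (i + 1 / 2) * (s.1.2.2.2 / k) + 2 * s'.1.2.2.1) ∧
      s'.1.2.2.2 = s.1.2.2.2 / k - 4 * s'.1.2.2.1 ∧ 0 < ε ∧ ε ≤ 1 / 4 ∧ 2 ≤ k ∧
      16 * (s.1.2.2.2 / k) ≤ s.1.2.2.1 ∧ 16 * s'.1.2.2.1 ≤ s.1.2.2.2 / k ∧
      (s'.1.1.card * s.1.2.1.card * k : ℝ) * (3 * (s.1.2.2.2 / k)) ^ 2 ≤ 1 / (n + 1) ∧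
      (s'.1.1.card * s.1.2.1.card * k : ℝ) * (3 * ε) ≤ 1 / (n + 1) ∧
      (s.1.2.1.card * k : ℝ) * (1 / Real.log (1 / (4 * s'.1.2.2.1))) ≤ (1 / 2) ^ n / 40 := by
    rintro n ⟨⟨S, A, ρ, ℓ⟩, hρ, hℓ⟩
    set S' := S.image (fun t => t - ρ / 2) ∪ S.image fun t => t + ρ / 2
    obtain ⟨k, ρ', ε, h1, h2, h3, h4, h5, h6, h7⟩ := exists_grid_constants n hρ hℓ S'.card A.card
    refine ⟨k, ε, ⟨(S', (A ×ˢ Finset.range (k - 1)).image fun p =>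
      p.1 + (p.2 + 1 / 2) * (ℓ / k) + 2 * ρ', ρ', ℓ / k - 4 * ρ'), h1, by dsimp only; linarith⟩,
      fun x => ?_, fun x => ?_, rfl, h2, h3, h4, h5, h6, h7⟩
    · simp only [S', Finset.mem_union, Finset.mem_image, ← exists_or, ← and_or_left, eq_comm]
    · simp only [Finset.mem_image, Finset.mem_product, Finset.mem_range, Prod.exists,
        Nat.lt_sub_iff_add_lt, and_assoc, eq_comm, exists_and_left]
  choose k ε N h using step
  let s : ℕ → X := fun n => Nat.rec ⟨({5}, {-2}, 1, 4), by norm_num, by norm_num⟩ N n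
  exact ⟨⟨fun n => (s n).1.1, fun n => (s n).1.2.1, fun n => (s n).1.2.2.1, fun n => (s n).1.2.2.2,
    fun n => ε n (s n), fun n => k n (s n), rfl, rfl, rfl, rfl, fun n => (h n (s n)).1,
    fun n => (h n (s n)).2.1, fun n => (h n (s n)).2.2.1, fun n => (s n).2.1,
    fun n => (h n (s n)).2.2.2.1, fun n => (h n (s n)).2.2.2.2.1,
    fun n => (h n (s n)).2.2.2.2.2.1, fun n => (h n (s n)).2.2.2.2.2.2.1,
    fun n => (h n (s n)).2.2.2.2.2.2.2.1, fun n => (h n (s n)).2.2.2.2.2.2.2.2.1,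
    fun n => (h n (s n)).2.2.2.2.2.2.2.2.2.1, fun n => (h n (s n)).2.2.2.2.2.2.2.2.2.2⟩⟩

/-- **Rajala's counterexample to the rigidity conjecture of He and Schramm.** There is a bounded
normalized circle domain that is conformally rigid but whose frontier is not conformally
removable. -/
theorem rajala_rigid_nonremovable_circle_domain :
    ∃ Ω : Set ℂ, Bornology.IsBounded Ω ∧ IsNormalizedCircleDomain Ω ∧
      (∀ (f : ℂ → ℂ) (D : Set ℂ), IsNormalizedCircleDomain D → ConformalMapOnto f Ω D →
        IsMobiusOn f Ω) ∧
      ∃ h : Homeomorph ℂ ℂ, (∀ z ∉ frontier Ω, DifferentiableAt ℂ (h : ℂ → ℂ) z) ∧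
        ¬ IsMobiusOn (h : ℂ → ℂ) Set.univ := by
  obtain ⟨G⟩ : Nonempty Grid := inferInstance
  obtain ⟨h, h1, h2⟩ := G.exists_homeomorph
  exact ⟨cellDomain G.discs G.boxes, CellSystem.isBounded_cellDomain, G.cellSystem.isNormalizedCircleDomain,
    fun f D hD hf => G.cellSystem.isMobiusOn (fun η hη n₀ => G.exists_good_mesh hη n₀) hD hf, h,
    fun z hz => h1 z fun hz' => hz (G.cellSystem.limitSet_subset_frontier hz'), h2⟩
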